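/- There exist rational functions A, B, C, D, E : ℤ/24ℤ → ℚ(w) such that for every finite field of cardinality q with q coprime to 6 and every natural number b, the denominators of A, B, C, D, E at b mod 24 do not vanish at the real number q^{1/12} and, as real numbers, N_{4,q,b} = (A(b mod 24)(q^{1/12})·b + B(b mod 24)(q^{1/12})) · q^b + C(b mod 24)(q^{1/12}) · q^{5b/6} + (D(b mod 24)(q^{1/12})·b + E(b mod 24)(q^{1/12})) · q^{3b/4}. -/

import Mathlib

/-- The discriminant of the binary cubic form `a·x³ + b·x²y + c·xy² + d·y³`. -/
def disc3 {R : Type*} [CommRing R] (a b c d : R) : R :=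
  b ^ 2 * c ^ 2 - 4 * a * c ^ 3 - 4 * b ^ 3 * d - 27 * a ^ 2 * d ^ 2 + 18 * a * b * c * d

/-- The binary cubic form `4·det(x·A − y·B)` associated to a pair of 3×3 matrices,
as an element of `R[x][y]` (the inner variable is `x`, the outer variable is `y`). -/
noncomputable def pairCubic {R : Type*} [CommRing R] (A B : Matrix (Fin 3) (Fin 3) R) :
    Polynomial (Polynomial R) :=
  4 * Matrix.det (Matrix.of fun i j =>
    (Polynomial.C (Polynomial.C (A i j) * Polynomial.X) -
      Polynomial.X * Polynomial.C (Polynomial.C (B i j)) : Polynomial (Polynomial R)))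

/-- The discriminant `Δ₄(A,B)` of a pair of 3×3 matrices: writing
`4·det(x·A − y·B) = a·x³ + b·x²y + c·xy² + d·y³`, it is `Δ₃(a,b,c,d)`. -/
noncomputable def disc4 {R : Type*} [CommRing R] (A B : Matrix (Fin 3) (Fin 3) R) : R :=
  disc3 (((pairCubic A B).coeff 0).coeff 3) (((pairCubic A B).coeff 1).coeff 2)
    (((pairCubic A B).coeff 2).coeff 1) (((pairCubic A B).coeff 3).coeff 0)

/-- Membership in the group `G₄(R) = {(g₃,g₂) ∈ GL₃(R) × GL₂(R) : det g₃ = det g₂}`. -/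
def g4mem {R : Type*} [CommRing R]
    (g : Matrix.GeneralLinearGroup (Fin 3) R × Matrix.GeneralLinearGroup (Fin 2) R) :
    Prop :=
  Matrix.det (g.1 : Matrix (Fin 3) (Fin 3) R) = Matrix.det (g.2 : Matrix (Fin 2) (Fin 2) R)

/-- The action of `G₄(R)` on pairs of symmetric 3×3 matrices:
`(g₃,g₂)·(A,B) = (g₃(pA + rB)g₃ᵀ, g₃(qA + sB)g₃ᵀ)` where `g₂⁻¹ = [[p,q],[r,s]]`. -/
def g4act {R : Type*} [CommRing R]
    (g : Matrix.GeneralLinearGroup (Fin 3) R × Matrix.GeneralLinearGroup (Fin 2) R)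
    (v : Matrix (Fin 3) (Fin 3) R × Matrix (Fin 3) (Fin 3) R) :
    Matrix (Fin 3) (Fin 3) R × Matrix (Fin 3) (Fin 3) R :=
  let g3 : Matrix (Fin 3) (Fin 3) R := g.1
  let h : Matrix (Fin 2) (Fin 2) R := ↑(g.2⁻¹)
  (g3 * (h 0 0 • v.1 + h 1 0 • v.2) * g3.transpose,
   g3 * (h 0 1 • v.1 + h 1 1 • v.2) * g3.transpose)

/-- `N` is the weighted number of `G₄(R)`-orbits on the set `S` of pairs of 3×3 matrices:
`S` is a finite union of orbits, each with finite stabilizer, and `N` is the sum over the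
orbits of `1/#Stab`. -/
def IsWeightedG4OrbitCount {R : Type*} [CommRing R]
    (S : Set (Matrix (Fin 3) (Fin 3) R × Matrix (Fin 3) (Fin 3) R)) (N : ℚ) : Prop :=
  ∃ (m : ℕ) (reps : Fin m → Matrix (Fin 3) (Fin 3) R × Matrix (Fin 3) (Fin 3) R),
    (∀ i, reps i ∈ S) ∧
    (∀ i j : Fin m, (∃ g, g4mem g ∧ g4act g (reps i) = reps j) → i = j) ∧
    (∀ v ∈ S, ∃ i, ∃ g, g4mem g ∧ g4act g (reps i) = v) ∧
    (∀ i, {g | g4mem g ∧ g4act g (reps i) = reps i}.Finite) ∧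
    N = ∑ i : Fin m, (1 : ℚ) / ({g | g4mem g ∧ g4act g (reps i) = reps i}.ncard)


namespace QC

open Matrix Polynomial

abbrev M3 (R : Type*) := Matrix (Fin 3) (Fin 3) R
abbrev M2 (R : Type*) := Matrix (Fin 2) (Fin 2) R

section alg
variable {R : Type*} [CommRing R]

/-- mixed coefficient: coefficient of `x² y` in `det (x A + y B)` -/
def mixc (A B : M3 R) : R :=
  (A 1 1 * A 2 2 - A 1 2 * A 2 1) * B 0 0 - (A 1 0 * A 2 2 - A 1 2 * A 2 0) * B 0 1
  + (A 1 0 * A 2 1 - A 1 1 * A 2 0) * B 0 2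
  - (A 0 1 * A 2 2 - A 0 2 * A 2 1) * B 1 0 + (A 0 0 * A 2 2 - A 0 2 * A 2 0) * B 1 1
  - (A 0 0 * A 2 1 - A 0 1 * A 2 0) * B 1 2
  + (A 0 1 * A 1 2 - A 0 2 * A 1 1) * B 2 0 - (A 0 0 * A 1 2 - A 0 2 * A 1 0) * B 2 1
  + (A 0 0 * A 1 1 - A 0 1 * A 1 0) * B 2 2

theorem pairCubic_eq (A B : M3 R) : pairCubic A B =
    C (C (4 * A.det) * X ^ 3) - X * C (C (4 * mixc A B) * X ^ 2)
      + X ^ 2 * C (C (4 * mixc B A) * X) - X ^ 3 * C (C (4 * B.det)) := by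
  unfold pairCubic mixc
  simp only [det_fin_three, of_apply]
  simp only [map_mul, map_sub, map_add, map_pow]
  have h4 : (C (C (4:R)) : R[X][X]) = 4 := rfl
  rw [h4]
  ring

theorem cf4 {S : Type*} [CommRing S] (a b c d : S) :
    (C a + C b * X + C c * X ^ 2 + C d * X ^ 3).coeff 0 = a ∧
    (C a + C b * X + C c * X ^ 2 + C d * X ^ 3).coeff 1 = b ∧
    (C a + C b * X + C c * X ^ 2 + C d * X ^ 3).coeff 2 = c ∧
    (C a + C b * X + C c * X ^ 2 + C d * X ^ 3).coeff 3 = d := by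
  refine ⟨?_, ?_, ?_, ?_⟩ <;>
  · simp only [coeff_add, coeff_C_mul, coeff_X_pow, coeff_X, coeff_C]
    simp

/-- discriminant of a pair -/
def D (X : Fin 2 → M3 R) : R :=
  disc3 (4 * (X 0).det) (- (4 * mixc (X 0) (X 1))) (4 * mixc (X 1) (X 0)) (-(4 * (X 1).det))

theorem disc4_eq (A B : M3 R) : disc4 A B = D ![A, B] := by
  have e : pairCubic A B =
    C (C (4 * A.det) * X ^ 3) + C (-(C (4 * mixc A B) * X ^ 2)) * X
      + C (C (4 * mixc B A) * X) * X ^ 2 + C (-(C (4 * B.det))) * X ^ 3 := by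
    rw [pairCubic_eq]; simp only [map_neg]; ring
  unfold disc4 D
  rw [e]
  obtain ⟨h0, h1, h2, h3⟩ := cf4 (C (4 * A.det) * X ^ 3) (-(C (4 * mixc A B) * X ^ 2))
    (C (4 * mixc B A) * X) (-(C (4 * B.det)))
  rw [h0, h1, h2, h3]
  simp only [coeff_C_mul, coeff_neg, coeff_X_pow, coeff_C, coeff_X]
  simp

/-- the action -/
def act (g : M3 R) (h : M2 R) (X : Fin 2 → M3 R) : Fin 2 → M3 R :=
  fun l => g * (h 0 l • X 0 + h 1 l • X 1) * gᵀ

theorem act_apply (g : M3 R) (h : M2 R) (X : Fin 2 → M3 R) (l i j) :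
    act g h X l i j = ∑ i', ∑ j', ∑ k, g i i' * g j j' * h k l * X k i' j' := by
  simp only [act, Matrix.mul_apply, Fin.sum_univ_three, Fin.sum_univ_two, Matrix.transpose_apply,
    Matrix.add_apply, Matrix.smul_apply, smul_eq_mul]
  ring

theorem act_act (g g' : M3 R) (h h' : M2 R) (X : Fin 2 → M3 R) :
    act g h (act g' h' X) = act (g * g') (h' * h) X := by
  funext l
  simp only [act, Matrix.mul_apply, Fin.sum_univ_two, Matrix.transpose_mul]
  simp only [Matrix.mul_add, Matrix.add_mul, Matrix.mul_smul, Matrix.smul_mul, Matrix.mul_assoc,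
    smul_add, smul_smul, add_smul]
  simp only [mul_comm (h 0 l), mul_comm (h 1 l)]
  abel

theorem act_one (X : Fin 2 → M3 R) : act 1 1 X = X := by
  funext l
  fin_cases l <;> simp [act, Matrix.one_apply]

theorem act_symm (g : M3 R) (h : M2 R) (X : Fin 2 → M3 R) (hX : ∀ k, (X k).IsSymm) (l) :
    (act g h X l).IsSymm := by
  have h0 := hX 0
  have h1 := hX 1
  unfold Matrix.IsSymm at *
  simp [act, Matrix.transpose_mul, h0, h1, Matrix.mul_assoc]

theorem det_lin (A B : M3 R) (x y : R) : (x • A + y • B).det =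
    x ^ 3 * A.det + x ^ 2 * y * mixc A B + x * y ^ 2 * mixc B A + y ^ 3 * B.det := by
  simp only [det_fin_three, mixc, Matrix.add_apply, Matrix.smul_apply, smul_eq_mul]
  ring

theorem mixc_conj (g A B : M3 R) : mixc (g * A * gᵀ) (g * B * gᵀ) = g.det ^ 2 * mixc A B := by
  -- compare coefficients of the polynomial `det (A + X B)`
  have key := det_lin (A.map C) (B.map C) (1 : R[X]) X
  have key2 := det_lin ((g * A * gᵀ).map C) ((g * B * gᵀ).map C) (1 : R[X]) X
  have e : ((1 : R[X]) • (g * A * gᵀ).map C + (X : R[X]) • (g * B * gᵀ).map C)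
      = g.map C * ((1 : R[X]) • A.map C + (X : R[X]) • B.map C) * (g.map C)ᵀ := by
    simp only [Matrix.map_mul, Matrix.mul_add, Matrix.add_mul, Matrix.mul_smul, Matrix.smul_mul,
      Matrix.transpose_map]
  rw [e, det_mul, det_mul, key, det_transpose] at key2
  have mc : ∀ A B : M3 R, mixc (A.map C) (B.map C) = C (mixc A B) := by
    intro A B; simp [mixc]
  have dc : ∀ A : M3 R, (A.map C).det = C A.det := by
    intro A
    exact (RingHom.map_det C A).symm
  have := congrArg (fun p => Polynomial.coeff p 1) key2
  have e1 : C g.det * (1 ^ 3 * C A.det + 1 ^ 2 * X * C (mixc A B) + 1 * X ^ 2 * C (mixc B A) +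
    X ^ 3 * C B.det) * C g.det =
     C (g.det ^ 2 * A.det) + C (g.det ^ 2 * mixc A B) * X + C (g.det ^ 2 * mixc B A) * X ^ 2
      + C (g.det ^ 2 * B.det) * X ^ 3 := by
    simp only [map_mul, map_pow]; ring
  have e2 : ∀ a b c d : R, (1 ^ 3 * C a + 1 ^ 2 * X * C b + 1 * X ^ 2 * C c +
    X ^ 3 * C d) =
     C a + C b * X + C c * X ^ 2 + C d * X ^ 3 := by
    intros; ring
  simp only [mc, dc] at this
  rw [e1, e2, (cf4 _ _ _ _).2.1, (cf4 _ _ _ _).2.1] at this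
  exact this.symm

theorem disc3_sub (a b c d p q r s : R) :
    disc3 (a * p ^ 3 + b * p ^ 2 * r + c * p * r ^ 2 + d * r ^ 3)
      (3 * a * p ^ 2 * q + b * (p ^ 2 * s + 2 * p * q * r) + c * (2 * p * r * s + q * r ^ 2)
        + 3 * d * r ^ 2 * s)
      (3 * a * p * q ^ 2 + b * (q ^ 2 * r + 2 * p * q * s) + c * (2 * q * r * s + p * s ^ 2)
        + 3 * d * r * s ^ 2)
      (a * q ^ 3 + b * q ^ 2 * s + c * q * s ^ 2 + d * s ^ 3) =
    (p * s - q * r) ^ 6 * disc3 a b c d := by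
  unfold disc3; ring

theorem D_act (g : M3 R) (h : M2 R) (X : Fin 2 → M3 R) :
    D (act g h X) = g.det ^ 8 * h.det ^ 6 * D X := by
  unfold D
  have d1 : ∀ A : M3 R, (g * A * gᵀ).det = g.det ^ 2 * A.det := by
    intro A; rw [det_mul, det_mul, det_transpose]; ring
  simp only [act, d1, mixc_conj]
  have m : ∀ (A B : M3 R) (p q r s : R), mixc (p • A + r • B) (q • A + s • B) =
      3 * A.det * p ^ 2 * q + mixc A B * (p ^ 2 * s + 2 * p * q * r)
        + mixc B A * (2 * p * r * s + q * r ^ 2)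
        + 3 * B.det * r ^ 2 * s := by
    intros
    simp only [det_fin_three, mixc, Matrix.add_apply, Matrix.smul_apply, smul_eq_mul]
    ring
  rw [m, m, det_lin, det_lin, det_fin_two]
  set A := X 0
  set B := X 1
  have := disc3_sub (4 * A.det) (-(4 * mixc A B)) (4 * mixc B A) (-(4 * B.det)) (h 0 0) (-(h 0 1))
    (-(h 1 0)) (h 1 1)
  unfold disc3 at *
  linear_combination (g.det ^ 8) * this

theorem D_map {S : Type*} [CommRing S] (f : R →+* S) (X : Fin 2 → M3 R) :
    D (fun k => (X k).map f) = f (D X) := by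
  simp only [D, disc3, mixc, det_fin_three, Matrix.map_apply, map_add, map_sub, map_mul, map_neg,
    map_pow, map_ofNat]

end alg
end QC


namespace QC

open Matrix Polynomial

section vf
variable {R : Type*} [CommRing R]

theorem act_perm (σ : Equiv.Perm (Fin 3)) (τ : Equiv.Perm (Fin 2)) (X : Fin 2 → M3 R) :
    act (σ.permMatrix R) (τ.permMatrix R)ᵀ X = fun k => Matrix.of fun i j => X (τ k) (σ i) (σ j) := by
  funext l
  ext i j
  rw [act_apply]
  simp [Equiv.Perm.permMatrix, PEquiv.toMatrix_apply, Equiv.toPEquiv_apply, ite_mul, mul_ite,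
    Finset.sum_ite_eq, Matrix.transpose_apply]

theorem D_perm (σ : Equiv.Perm (Fin 3)) (τ : Equiv.Perm (Fin 2)) (X : Fin 2 → M3 R) :
    D (fun k => Matrix.of fun i j => X (τ k) (σ i) (σ j)) = D X := by
  rw [← act_perm, D_act, det_transpose, det_permutation, det_permutation]
  rcases Int.units_eq_one_or (Equiv.Perm.sign σ) with h | h <;>
  rcases Int.units_eq_one_or (Equiv.Perm.sign τ) with h' | h' <;> simp [h, h'] <;> ring

theorem D_F1 (X : Fin 2 → M3 R) (h : ∀ k, (X k).IsSymm) (h1 : X 1 0 0 = 0) (h2 : X 1 0 1 = 0)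
    (h3 : X 0 0 0 = 0) (h4 : X 0 0 1 = 0) : D X = 0 := by
  have e1 : X 1 1 0 = 0 := by rw [(h 1).apply]; exact h2
  have e2 : X 0 1 0 = 0 := by rw [(h 0).apply]; exact h4
  simp only [D, disc3, mixc, det_fin_three, h1, h2, h3, h4, e1, e2]
  rw [(h 0).apply 0 2, (h 1).apply 0 2]
  ring

theorem D_F2 (X : Fin 2 → M3 R) (h : ∀ k, (X k).IsSymm) (h1 : X 1 0 0 = 0) (h2 : X 1 0 1 = 0)
    (h3 : X 1 0 2 = 0) (h4 : X 1 1 1 = 0) (h5 : X 1 1 2 = 0) : D X = 0 := by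
  have e1 : X 1 1 0 = 0 := by rw [(h 1).apply]; exact h2
  have e2 : X 1 2 0 = 0 := by rw [(h 1).apply]; exact h3
  have e3 : X 1 2 1 = 0 := by rw [(h 1).apply]; exact h5
  simp only [D, disc3, mixc, det_fin_three, h1, h2, h3, h4, h5, e1, e2, e3]
  ring

theorem D_F3 (X : Fin 2 → M3 R) (h : ∀ k, (X k).IsSymm) (h1 : X 1 0 0 = 0) (h2 : X 1 0 1 = 0)
    (h3 : X 1 0 2 = 0) (h4 : X 0 0 0 = 0) : D X = 0 := by
  have e1 : X 1 1 0 = 0 := by rw [(h 1).apply]; exact h2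
  have e2 : X 1 2 0 = 0 := by rw [(h 1).apply]; exact h3
  simp only [D, disc3, mixc, det_fin_three, h1, h2, h3, h4, e1, e2]
  ring

theorem VF_sorted (X : Fin 2 → M3 R) (h : ∀ k, (X k).IsSymm) (hD : D X ≠ 0)
    (a : Fin 3 → ℝ) (b : Fin 2 → ℝ) (hs : a 0 + a 1 + a 2 = b 0 + b 1)
    (a01 : a 0 ≤ a 1) (a12 : a 1 ≤ a 2) (b01 : b 0 ≤ b 1)
    (hX : ∀ k i j, a i + a j - b k < 0 → X k i j = 0) : 0 ≤ a 0 ∧ 0 ≤ b 0 := by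
  by_cases c : a 0 + a 2 - b 1 < 0
  · have l00 : X 1 0 0 = 0 := hX _ _ _ (by linarith)
    have l01 : X 1 0 1 = 0 := hX _ _ _ (by linarith)
    have l02 : X 1 0 2 = 0 := hX _ _ _ (by linarith)
    have c1 : b 0 ≤ 2 * a 0 := by
      by_contra hh
      exact hD (D_F3 X h l00 l01 l02 (hX _ _ _ (by linarith)))
    have c2 : b 1 ≤ a 1 + a 2 := by
      by_contra hh
      exact hD (D_F2 X h l00 l01 l02 (hX _ _ _ (by linarith)) (hX _ _ _ (by linarith)))
    constructor <;> linarith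
  · have c1 : b 0 ≤ a 0 + a 1 := by
      by_contra hh
      exact hD (D_F1 X h (hX _ _ _ (by linarith)) (hX _ _ _ (by linarith)) (hX _ _ _ (by linarith))
        (hX _ _ _ (by linarith)))
    constructor <;> linarith

theorem VF (X : Fin 2 → M3 R) (h : ∀ k, (X k).IsSymm) (hD : D X ≠ 0)
    (a : Fin 3 → ℝ) (b : Fin 2 → ℝ) (hs : ∑ i, a i = ∑ k, b k)
    (hX : ∀ k i j, a i + a j - b k < 0 → X k i j = 0) : (∀ i, 0 ≤ a i) ∧ (∀ k, 0 ≤ b k) := by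
  set σ := Tuple.sort a with hσ
  set τ := Tuple.sort b with hτ
  have ma := Tuple.monotone_sort a
  have mb := Tuple.monotone_sort b
  rw [← hσ] at ma
  rw [← hτ] at mb
  have sa : ∑ i, a (σ i) = ∑ i, a i := Equiv.sum_comp σ a
  have sb : ∑ i, b (τ i) = ∑ i, b i := Equiv.sum_comp τ b
  have key := VF_sorted (fun k => Matrix.of fun i j => X (τ k) (σ i) (σ j))
    (fun k => by ext i j; simp [(h (τ k)).apply]) (by rw [D_perm]; exact hD)
    (a ∘ σ) (b ∘ τ) (by
      rw [← sa, ← sb, Fin.sum_univ_three, Fin.sum_univ_two] at hs; exact hs)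
    (ma (by decide)) (ma (by decide)) (mb (by decide)) (fun k i j hh => hX _ _ _ hh)
  constructor
  · intro i
    have : a (σ 0) ≤ a (σ (σ.symm i)) := ma (Fin.zero_le _)
    simp at this
    exact key.1.trans this
  · intro i
    have : b (τ 0) ≤ b (τ (τ.symm i)) := mb (Fin.zero_le _)
    simp at this
    exact key.2.trans this
end vf
end QC


namespace QC

open Matrix Polynomial

section cartan
variable {K : Type*} [Field K] (O : Subring K)

/-- Cartan decomposition property -/
def HasCartan {ι : Type*} [Fintype ι] [DecidableEq ι] (g : Matrix ι ι K) : Prop :=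
  ∃ u u' v v' : Matrix ι ι O, ∃ d : ι → K, u * u' = 1 ∧ v * v' = 1 ∧
    g = u.map O.subtype * diagonal d * v.map O.subtype

theorem HasCartan.submatrix {ι ι' : Type*} [Fintype ι] [DecidableEq ι] [Fintype ι'] [DecidableEq ι']
    {g : Matrix ι ι K} (hg : HasCartan O g) (σ τ : ι' ≃ ι) : HasCartan O (g.submatrix σ τ) := by
  obtain ⟨u, u', v, v', d, hu, hv, rfl⟩ := hg
  refine ⟨u.submatrix σ σ, u'.submatrix σ σ, v.submatrix σ τ, v'.submatrix τ σ, d ∘ σ, ?_, ?_, ?_⟩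
  · rw [submatrix_mul_equiv, hu, submatrix_one_equiv]
  · rw [submatrix_mul_equiv, hv, submatrix_one_equiv]
  · rw [← submatrix_diagonal_equiv, ← submatrix_map, ← submatrix_map, submatrix_mul_equiv,
      submatrix_mul_equiv]

theorem exists_pivot (hO : ∀ x : K, x ∈ O ∨ x⁻¹ ∈ O) {ι : Type*} (s : Finset ι) (hs : s.Nonempty)
    (f : ι → K) : ∃ i ∈ s, ∀ j ∈ s, ∃ c ∈ O, f j = c * f i := by
  classical
  induction hs using Finset.Nonempty.cons_induction with
  | singleton a => exact ⟨a, by simp, fun j hj => ⟨1, O.one_mem, by simp at hj; simp [hj]⟩⟩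
  | cons a s ha hs ih =>
    obtain ⟨i, hi, h⟩ := ih
    by_cases hia : ∃ c ∈ O, f a = c * f i
    · refine ⟨i, by simp [hi], fun j hj => ?_⟩
      rcases Finset.mem_cons.1 hj with rfl | hj
      · exact hia
      · exact h j hj
    · have fa : f a ≠ 0 := fun h0 => hia ⟨0, O.zero_mem, by simp [h0]⟩
      have key : ∃ c ∈ O, f i = c * f a := by
        by_cases fi : f i = 0
        · exact ⟨0, O.zero_mem, by simp [fi]⟩
        refine ⟨f i / f a, ?_, by field_simp⟩
        rcases hO (f i / f a) with h1 | h1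
        · exact h1
        · exact absurd ⟨f a / f i, by simpa using h1, by field_simp⟩ hia
      refine ⟨a, by simp, fun j hj => ?_⟩
      rcases Finset.mem_cons.1 hj with rfl | hj
      · exact ⟨1, O.one_mem, by simp⟩
      · obtain ⟨c, hc, e⟩ := h j hj
        obtain ⟨c', hc', e'⟩ := key
        exact ⟨c * c', O.mul_mem hc hc', by rw [e, e', mul_assoc]⟩

theorem cartan_step (hO : ∀ x : K, x ∈ O ∨ x⁻¹ ∈ O) {ι : Type*} [Fintype ι] [DecidableEq ι]
    (ih : ∀ g : Matrix ι ι K, HasCartan O g) (g : Matrix (ι ⊕ Fin 1) (ι ⊕ Fin 1) K) :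
    HasCartan O g := by
  classical
  obtain ⟨⟨i0, j0⟩, -, h⟩ := exists_pivot O hO (Finset.univ : Finset ((ι ⊕ Fin 1) × (ι ⊕ Fin 1)))
    ⟨(Sum.inr 0, Sum.inr 0), by simp⟩ (fun p => g p.1 p.2)
  simp only [Finset.mem_univ, forall_const, Prod.forall] at h
  set σ := Equiv.swap i0 (Sum.inr 0 : ι ⊕ Fin 1)
  set τ := Equiv.swap j0 (Sum.inr 0 : ι ⊕ Fin 1)
  suffices hh : HasCartan O (g.submatrix σ τ) by
    have := hh.submatrix O σ τ
    rw [submatrix_submatrix] at this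
    have e1 : (σ : ι ⊕ Fin 1 → ι ⊕ Fin 1) ∘ σ = id := by ext x; simp [σ]
    have e2 : (τ : ι ⊕ Fin 1 → ι ⊕ Fin 1) ∘ τ = id := by ext x; simp [τ]
    rwa [e1, e2, submatrix_id_id] at this
  set g' := g.submatrix σ τ with hg'
  have h' : ∀ i j, ∃ c ∈ O, g' i j = c * g' (Sum.inr 0) (Sum.inr 0) := by
    intro i j
    have := h (σ i) (τ j)
    simpa [hg', σ, τ] using this
  choose c hc e using h'
  clear_value g'
  clear h hg' σ τ
  by_cases hp : g' (Sum.inr 0) (Sum.inr 0) = 0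
  · have : g' = 0 := by ext i j; rw [e, hp]; simp
    rw [this]
    exact ⟨1, 1, 1, 1, 0, by simp, by simp, by simp⟩
  set p := g' (Sum.inr 0) (Sum.inr 0) with hpdef
  obtain ⟨u, u', v, v', d, hu, hv, hd⟩ := ih (Matrix.of fun i j => g' (Sum.inl i) (Sum.inl j) -
    c (Sum.inl i) (Sum.inr 0) * p * c (Sum.inr 0) (Sum.inl j))
  let B : Matrix ι (Fin 1) O := Matrix.of fun i _ => ⟨c (Sum.inl i) (Sum.inr 0), hc _ _⟩
  let C : Matrix (Fin 1) ι O := Matrix.of fun _ j => ⟨c (Sum.inr 0) (Sum.inl j), hc _ _⟩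
  refine ⟨fromBlocks u B 0 1, fromBlocks u' (-(u' * B)) 0 1, fromBlocks v 0 C 1,
    fromBlocks v' 0 (-(C * v')) 1, Sum.elim d (fun _ => p), ?_, ?_, ?_⟩
  · rw [fromBlocks_multiply, ← fromBlocks_one]
    congr 1 <;> simp [← Matrix.mul_assoc, hu]
  · rw [fromBlocks_multiply, ← fromBlocks_one]
    congr 1 <;> simp [← Matrix.mul_assoc, hv]
  · rw [← fromBlocks_diagonal, fromBlocks_map, fromBlocks_map, fromBlocks_multiply,
      fromBlocks_multiply]
    have hp1 : (diagonal (fun _ : Fin 1 => p)) = p • (1 : Matrix (Fin 1) (Fin 1) K) := by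
      ext i j; fin_cases i; fin_cases j; simp
    rw [← fromBlocks_toBlocks g']
    congr 1
    · simp only [Matrix.map_zero _ (map_zero _), Matrix.mul_zero, add_zero, zero_add]
      rw [← hd]
      ext i j
      simp [toBlocks₁₁, B, C, Matrix.mul_apply, diagonal_apply]
    · ext i j
      fin_cases j
      simp [toBlocks₁₂, B, C, Matrix.mul_apply, diagonal_apply, e (Sum.inl i) (Sum.inr 0)]
    · ext i j
      fin_cases i
      simp [toBlocks₂₁, B, C, Matrix.mul_apply, diagonal_apply, e (Sum.inr 0) (Sum.inl j), mul_comm]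
    · ext i j
      fin_cases i; fin_cases j
      simp [toBlocks₂₂, diagonal_apply, Matrix.mul_apply, hpdef]

theorem cartan (hO : ∀ x : K, x ∈ O ∨ x⁻¹ ∈ O) (n : ℕ) (g : Matrix (Fin n) (Fin n) K) :
    HasCartan O g := by
  induction n with
  | zero => exact ⟨1, 1, 1, 1, 0, by simp, by simp, Subsingleton.elim _ _⟩
  | succ n ih =>
    have := (cartan_step O hO ih (g.submatrix finSumFinEquiv finSumFinEquiv)).submatrix O
      finSumFinEquiv.symm finSumFinEquiv.symm
    simpa [submatrix_submatrix] using this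

end cartan
end QC


namespace QC

open Matrix Polynomial

section val
variable (F : Type) [Field F]

abbrev KK := HahnSeries ℝ F

/-- valuation ring -/
noncomputable def OO : Subring (KK F) where
  carrier := {x | 0 ≤ x.orderTop}
  mul_mem' := by
    intro x y hx hy
    simp only [Set.mem_ofPred_eq, HahnSeries.orderTop_mul] at *
    exact add_nonneg hx hy
  one_mem' := by simp
  add_mem' := by
    intro x y hx hy
    refine le_trans ?_ (HahnSeries.min_orderTop_le_orderTop_add (x := x) (y := y))
    simp only [Set.mem_ofPred_eq] at hx hy
    simp [hx, hy]
  zero_mem' := by simp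
  neg_mem' := by intro x hx; simpa using hx

variable {F}

theorem mem_OO (x : KK F) : x ∈ OO F ↔ 0 ≤ x.orderTop := Iff.rfl

theorem mem_OO' (x : KK F) : x ∈ OO F ↔ ∀ r : ℝ, r < 0 → x.coeff r = 0 := by
  rw [mem_OO, HahnSeries.le_orderTop_iff_forall]
  simp only [← WithTop.coe_zero, WithTop.coe_lt_coe]

theorem OO_val (x : KK F) : x ∈ OO F ∨ x⁻¹ ∈ OO F := by
  by_cases hx : x = 0
  · left; simp [hx]
  by_contra! h
  rw [mem_OO, mem_OO, not_le, not_le] at h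
  have h1 : (x * x⁻¹).orderTop = x.orderTop + x⁻¹.orderTop := HahnSeries.orderTop_mul _ _
  rw [mul_inv_cancel₀ hx, HahnSeries.orderTop_one] at h1
  obtain ⟨r, hr⟩ := WithTop.ne_top_iff_exists.1 h.1.ne_top
  obtain ⟨s, hs⟩ := WithTop.ne_top_iff_exists.1 h.2.ne_top
  rw [← hr, ← hs, ← WithTop.coe_add, ← WithTop.coe_zero, WithTop.coe_eq_coe] at h1
  rw [← hr, ← hs, ← WithTop.coe_zero, WithTop.coe_lt_coe, WithTop.coe_lt_coe] at h
  linarith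

theorem res_mul (x y : KK F) (hx : x ∈ OO F) (hy : y ∈ OO F) :
    (x * y).coeff 0 = x.coeff 0 * y.coeff 0 := by
  have e : x * y = HahnSeries.single 0 (x.coeff 0) * y + (x - HahnSeries.single 0 (x.coeff 0)) * y := by
    ring
  have h2 : ((x - HahnSeries.single 0 (x.coeff 0)) * y).coeff 0 = 0 := by
    apply HahnSeries.coeff_eq_zero_of_lt_orderTop
    rw [HahnSeries.orderTop_mul]
    have : (0 : WithTop ℝ) < (x - HahnSeries.single 0 (x.coeff 0)).orderTop := by
      apply lt_of_le_of_ne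
      · rw [← mem_OO, mem_OO']
        intro r hr
        rw [mem_OO'] at hx
        simp [hx r hr, HahnSeries.coeff_single_of_ne hr.ne]
      · intro h0
        have := HahnSeries.coeff_orderTop_ne (x := (x - HahnSeries.single 0 (x.coeff 0))) (g := 0)
          h0.symm
        simp at this
    exact lt_of_lt_of_le this (le_add_of_nonneg_right hy)
  rw [e, HahnSeries.coeff_add, h2, HahnSeries.coeff_single_mul]
  simp

/-- residue map -/
noncomputable def res : OO F →+* F where
  toFun x := (x : KK F).coeff 0
  map_one' := by simp
  map_mul' x y := res_mul _ _ x.2 y.2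
  map_zero' := by simp
  map_add' x y := by simp

theorem res_apply (x : OO F) : res x = (x : KK F).coeff 0 := rfl

theorem orderTop_of_res (x : OO F) (h : res x ≠ 0) : (x : KK F).orderTop = 0 := by
  apply le_antisymm _ x.2
  exact HahnSeries.orderTop_le_of_coeff_ne_zero h

/-- monomial of degree `-r` -/
noncomputable def sp (r : ℝ) : KK F := HahnSeries.single r 1

theorem sp_add (r s : ℝ) : (sp (r + s) : KK F) = sp r * sp s := by simp [sp]
theorem sp_zero : (sp 0 : KK F) = 1 := rfl
theorem sp_ne (r : ℝ) : (sp r : KK F) ≠ 0 := by simp [sp]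
theorem sp_mul_neg (r : ℝ) : (sp r * sp (-r) : KK F) = 1 := by rw [← sp_add]; simp [sp_zero]
theorem sp_pow (r : ℝ) (n : ℕ) : (sp r ^ n : KK F) = sp (n * r) := by
  induction n with
  | zero => simp [sp_zero]
  | succ n ih => rw [pow_succ, ih, ← sp_add]; congr 1; push_cast; ring

noncomputable def iota : F[X] →+* KK F := eval₂RingHom HahnSeries.C (sp (-1) : KK F)

/-- coefficient at a real exponent -/
noncomputable def lc (d : ℝ) (f : F[X]) : F := if (⌊d⌋₊ : ℝ) = d then f.coeff ⌊d⌋₊ else 0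
/-- degree bound by a real -/
def bd (d : ℝ) (f : F[X]) : Prop := ∀ m : ℕ, d < m → f.coeff m = 0

theorem lc_nat (m : ℕ) (f : F[X]) : lc (m : ℝ) f = f.coeff m := by simp [lc]
theorem lc_of_ne (d : ℝ) (h : ∀ m : ℕ, (m : ℝ) ≠ d) (f : F[X]) : lc d f = 0 := by
  simp [lc, h]

theorem bd_iff (d : ℝ) (f : F[X]) : bd d f ↔ ∀ r, d < r → lc r f = 0 := by
  constructor
  · intro h r hr
    unfold lc
    split_ifs with h1
    · exact h _ (by rw [h1]; exact hr)
    · rfl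
  · intro h m hm
    rw [← lc_nat]; exact h _ hm

theorem iota_coeff (f : F[X]) (r : ℝ) : (iota f).coeff r = lc (-r) f := by
  induction f using Polynomial.induction_on' with
  | add p q hp hq =>
    rw [map_add, HahnSeries.coeff_add, hp, hq]
    unfold lc; split_ifs <;> simp
  | monomial n a =>
    have : (iota (monomial n a) : KK F) = HahnSeries.single (-(n : ℝ)) a := by
      simp only [iota, coe_eval₂RingHom, eval₂_monomial, sp_pow]
      simp [sp, HahnSeries.C_apply, HahnSeries.single_mul_single]
    rw [this]
    by_cases h : r = -(n : ℝ)
    · subst h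
      rw [HahnSeries.coeff_single_same]
      simp [lc_nat]
    · rw [HahnSeries.coeff_single_of_ne h]
      unfold lc
      split_ifs with h1
      · rw [coeff_monomial, if_neg]
        rintro rfl
        apply h; rw [h1]; ring
      · rfl

theorem sp_iota_coeff (f : F[X]) (d r : ℝ) : (sp d * iota f).coeff r = lc (d - r) f := by
  rw [sp, HahnSeries.coeff_single_mul, iota_coeff]; simp

theorem sp_iota_mem (f : F[X]) (d : ℝ) : sp d * iota f ∈ OO F ↔ bd d f := by
  rw [mem_OO', bd_iff]
  constructor
  · intro h r hr
    have := h (d - r) (by linarith)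
    rwa [sp_iota_coeff, sub_sub_cancel] at this
  · intro h r hr
    rw [sp_iota_coeff]; exact h _ (by linarith)

theorem iota_inj : Function.Injective (iota : F[X] → KK F) := by
  intro f g h
  ext m
  have := congrArg (fun x : KK F => x.coeff (-(m : ℝ))) h
  simpa [iota_coeff, lc_nat] using this

theorem iota_map_det {n : ℕ} (A : Matrix (Fin n) (Fin n) F[X]) : (A.map iota).det = iota A.det :=
  (RingHom.map_det iota A).symm

/-- twisted pair -/
noncomputable def tw (a : Fin 3 → ℝ) (b : Fin 2 → ℝ) (X : Fin 2 → M3 F[X]) : Fin 2 → M3 (KK F) :=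
  fun k => Matrix.of fun i j => sp (a i + a j - b k) * iota (X k i j)

theorem act_diag {K : Type*} [CommRing K] (d : Fin 3 → K) (e : Fin 2 → K) (X : Fin 2 → M3 K) (k i j) :
    act (diagonal d) (diagonal e) X k i j = d i * d j * e k * X k i j := by
  simp only [act, Matrix.mul_diagonal, Matrix.diagonal_transpose, Matrix.diagonal_mul,
    Matrix.add_apply, Matrix.smul_apply, smul_eq_mul]
  fin_cases k <;> simp <;> ring

theorem tw_eq (a b) (X : Fin 2 → M3 F[X]) : tw a b X = act (diagonal fun i => sp (a i))
    (diagonal fun k => sp (-b k)) (fun k => (X k).map iota) := by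
  funext k; ext i j
  rw [act_diag]
  simp [tw, sub_eq_add_neg, sp_add]

/-- degree bounds for a pair -/
def Bd (a : Fin 3 → ℝ) (b : Fin 2 → ℝ) (X : Fin 2 → M3 F[X]) : Prop :=
  ∀ k i j, bd (a i + a j - b k) (X k i j)

/-- leading part -/
noncomputable def lead (a : Fin 3 → ℝ) (b : Fin 2 → ℝ) (X : Fin 2 → M3 F[X]) : Fin 2 → M3 F :=
  fun k => Matrix.of fun i j => lc (a i + a j - b k) (X k i j)

/-- lift of the twisted pair to the valuation ring -/
noncomputable def twO (a : Fin 3 → ℝ) (b : Fin 2 → ℝ) (X : Fin 2 → M3 F[X]) (h : Bd a b X) :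
    Fin 2 → M3 (OO F) :=
  fun k => Matrix.of fun i j => ⟨tw a b X k i j, (sp_iota_mem _ _).2 (h k i j)⟩

theorem twO_map (a b) (X : Fin 2 → M3 F[X]) (h : Bd a b X) :
    (fun k => (twO a b X h k).map (OO F).subtype) = tw a b X := rfl

theorem twO_res (a b) (X : Fin 2 → M3 F[X]) (h : Bd a b X) :
    (fun k => (twO a b X h k).map res) = lead a b X := by
  funext k; ext i j
  simp [twO, tw, lead, res_apply, sp_iota_coeff]

theorem D_tw (a b) (X : Fin 2 → M3 F[X]) (hs : ∑ i, a i = ∑ k, b k) :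
    D (tw a b X) = sp (2 * ∑ i, a i) * iota (D X) := by
  rw [tw_eq, D_act, D_map, det_diagonal, det_diagonal]
  congr 1
  rw [Fin.sum_univ_three, Fin.sum_univ_two] at *
  rw [Fin.prod_univ_three, Fin.prod_univ_two]
  simp only [← sp_add, sp_pow]
  congr 1
  push_cast
  linarith

theorem Bd_disc (a b) (X : Fin 2 → M3 F[X]) (hs : ∑ i, a i = ∑ k, b k) (h : Bd a b X) :
    bd (2 * ∑ i, a i) (D X) ∧ lc (2 * ∑ i, a i) (D X) = D (lead a b X) := by
  have h1 : ((OO F).subtype (D (twO a b X h))) = D (tw a b X) := by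
    rw [← D_map, twO_map]
  have h2 : res (D (twO a b X h)) = D (lead a b X) := by
    rw [← D_map, twO_res]
  rw [D_tw _ _ _ hs] at h1
  constructor
  · rw [← sp_iota_mem, ← h1]; exact (D (twO a b X h)).2
  · rw [← h2, res_apply]
    have : ((D (twO a b X h) : OO F) : KK F) = sp (2 * ∑ i, a i) * iota (D X) := h1
    rw [this, sp_iota_coeff]; simp

/-- reduced pairs -/
def Red (a : Fin 3 → ℝ) (b : Fin 2 → ℝ) (X : Fin 2 → M3 F[X]) : Prop :=
  Bd a b X ∧ D (lead a b X) ≠ 0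

theorem Red.natDegree {a b} {X : Fin 2 → M3 F[X]} (hs : ∑ i, a i = ∑ k, b k) (h : Red a b X) :
    D X ≠ 0 ∧ ((D X).natDegree : ℝ) = 2 * ∑ i, a i := by
  obtain ⟨h1, h2⟩ := Bd_disc a b X hs h.1
  have h3 := h.2
  rw [← h2] at h3
  have h0 : D X ≠ 0 := by
    intro h0; apply h3; rw [h0]; simp [lc]
  refine ⟨h0, ?_⟩
  have h4 : (⌊2 * ∑ i, a i⌋₊ : ℝ) = 2 * ∑ i, a i := by
    by_contra hh
    apply h3; unfold lc; rw [if_neg hh]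
  rw [← h4, lc_nat] at h3
  rw [← h4] at h1
  rw [← h4]
  norm_cast
  apply le_antisymm
  · rw [natDegree_le_iff_coeff_eq_zero]
    intro m hm
    exact h1 m (by exact_mod_cast hm)
  · exact le_natDegree_of_ne_zero h3

theorem act_map {R S : Type*} [CommRing R] [CommRing S] (φ : R →+* S) (g : M3 R) (h : M2 R)
    (X : Fin 2 → M3 R) : act (g.map φ) (h.map φ) (fun k => (X k).map φ) =
      fun k => (act g h X k).map φ := by
  funext k; ext i j
  simp only [act_apply, Matrix.map_apply, map_sum, map_mul]

theorem mem_OO_order (x : KK F) : x ∈ OO F ↔ 0 ≤ x.order := by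
  by_cases h : x = 0
  · simp [h]
  · rw [mem_OO, ← HahnSeries.order_eq_orderTop_of_ne_zero h, ← WithTop.coe_zero, WithTop.coe_le_coe]

theorem order_of_res (x : OO F) (h : res x ≠ 0) : (x : KK F).order = 0 := by
  have h1 := orderTop_of_res x h
  have h0 : (x : KK F) ≠ 0 := by
    intro h0; apply h; rw [res_apply, h0]; simp
  rw [← HahnSeries.order_eq_orderTop_of_ne_zero h0, ← WithTop.coe_zero, WithTop.coe_eq_coe] at h1
  exact h1

theorem order_pow' (x : KK F) (n : ℕ) : (x ^ n).order = n * x.order := by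
  rw [HahnSeries.order_pow]; simp

set_option maxHeartbeats 1000000 in
/-- Part II core -/
theorem integral_of_act (Y Z : Fin 2 → M3 (OO F)) (hY : ∀ k, (Y k).IsSymm)
    (hDY : res (D Y) ≠ 0) (hDZ : res (D Z) ≠ 0) (g : M3 (KK F)) (h : M2 (KK F))
    (hd : g.det * h.det = 1)
    (e : act g h (fun k => (Y k).map (OO F).subtype) = fun k => (Z k).map (OO F).subtype) :
    (∀ i j, g i j ∈ OO F) ∧ (∀ i j, h i j ∈ OO F) := by
  obtain ⟨u, u', v, v', d, hu, hv, rfl⟩ := cartan (OO F) OO_val 3 g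
  obtain ⟨u2, u2', v2, v2', f, hu2, hv2, rfl⟩ := cartan (OO F) OO_val 2 h
  have hu' : u' * u = 1 := mul_eq_one_comm.1 hu
  have hdet : ∀ {n : ℕ} (x y : Matrix (Fin n) (Fin n) (OO F)), x * y = 1 → res x.det ≠ 0 := by
    intro n x y hxy h0
    have := congrArg (fun z => res z.det) hxy
    simp [det_mul, h0] at this
  have mapdet : ∀ {n : ℕ} (x : Matrix (Fin n) (Fin n) (OO F)), (x.map (OO F).subtype).det =
    (x.det : KK F) := fun x => (RingHom.map_det (OO F).subtype x).symm
  have rne : ∀ x : OO F, res x ≠ 0 → (x : KK F) ≠ 0 := by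
    intro x hx h0; apply hx; rw [res_apply, h0]; simp
  set Y' := act v u2 Y with hY'
  set Z' := act u' v2' Z with hZ'
  have key : act (diagonal d) (diagonal f) (fun k => (Y' k).map (OO F).subtype) =
      fun k => (Z' k).map (OO F).subtype := by
    rw [hZ', ← act_map (OO F).subtype u' v2' Z, ← e, hY', ← act_map, act_act, act_act]
    congr 1
    · rw [← Matrix.mul_assoc, ← Matrix.mul_assoc, ← Matrix.map_mul, hu']
      simp
    · rw [Matrix.mul_assoc, ← Matrix.map_mul, hv2]
      simp
  have hDY' : res (D Y') ≠ 0 := by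
    rw [hY', D_act]
    simp only [map_mul, map_pow]
    exact mul_ne_zero (mul_ne_zero (pow_ne_zero _ (hdet v v' hv)) (pow_ne_zero _ (hdet u2 u2' hu2)))
      hDY
  have hDZ' : res (D Z') ≠ 0 := by
    rw [hZ', D_act]
    simp only [map_mul, map_pow]
    exact mul_ne_zero (mul_ne_zero (pow_ne_zero _ (hdet u' u hu'))
      (pow_ne_zero _ (hdet v2' v2 (mul_eq_one_comm.1 hv2)))) hDZ
  simp only [det_mul, mapdet, det_diagonal] at hd
  have hpd : ∏ i, d i ≠ 0 := by intro h0; simp [h0] at hd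
  have hpf : ∏ i, f i ≠ 0 := by intro h0; simp [h0] at hd
  have hdi : ∀ i, d i ≠ 0 := fun i => by
    intro h0; exact hpd (Finset.prod_eq_zero (Finset.mem_univ i) h0)
  have hfi : ∀ i, f i ≠ 0 := fun i => by
    intro h0; exact hpf (Finset.prod_eq_zero (Finset.mem_univ i) h0)
  have op1 : (∏ i, d i).order = ∑ i, (d i).order := by
    rw [Fin.prod_univ_three, Fin.sum_univ_three, HahnSeries.order_mul (mul_ne_zero (hdi _) (hdi _))
      (hdi _), HahnSeries.order_mul (hdi _) (hdi _)]
  have op2 : (∏ i, f i).order = ∑ i, (f i).order := by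
    rw [Fin.prod_univ_two, Fin.sum_univ_two, HahnSeries.order_mul (hfi _) (hfi _)]
  have s0 : ∑ i, (d i).order + ∑ i, (f i).order = 0 := by
    have := congrArg HahnSeries.order hd
    have n1 := rne _ (hdet u u' hu)
    have n2 := rne _ (hdet v v' hv)
    have n3 := rne _ (hdet u2 u2' hu2)
    have n4 := rne _ (hdet v2 v2' hv2)
    have m1 := mul_ne_zero n1 hpd
    have m2 := mul_ne_zero n3 hpf
    rw [HahnSeries.order_mul (mul_ne_zero m1 n2) (mul_ne_zero m2 n4), HahnSeries.order_mul m1 n2,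
      HahnSeries.order_mul n1 hpd, HahnSeries.order_mul m2 n4, HahnSeries.order_mul n3 hpf,
      order_of_res _ (hdet u u' hu), order_of_res _ (hdet v v' hv), order_of_res _ (hdet u2 u2' hu2),
      order_of_res _ (hdet v2 v2' hv2), op1, op2, HahnSeries.order_one] at this
    linarith
  have s1 : ∑ i, (d i).order = 0 := by
    have h1 := congrArg D key
    rw [D_act, D_map, D_map, det_diagonal, det_diagonal] at h1
    have := congrArg HahnSeries.order h1
    have n1 : (OO F).subtype (D Y') ≠ 0 := rne _ hDY'
    rw [HahnSeries.order_mul (mul_ne_zero (pow_ne_zero _ hpd) (pow_ne_zero _ hpf)) n1,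
      HahnSeries.order_mul (pow_ne_zero _ hpd) (pow_ne_zero _ hpf),
      order_pow', order_pow', op1, op2] at this
    have o1 : ((OO F).subtype (D Y')).order = 0 := order_of_res _ hDY'
    have o2 : ((OO F).subtype (D Z')).order = 0 := order_of_res _ hDZ'
    rw [o1, o2] at this
    push_cast at this
    linarith
  have vf := VF (fun k => (Y' k).map res) (by
      intro k
      have := act_symm v u2 Y hY k
      ext i j
      simp only [Matrix.transpose_apply, Matrix.map_apply]
      exact congrArg res (this.apply i j)) (by rw [D_map]; exact hDY')
    (fun i => (d i).order) (fun k => -(f k).order) (by rw [Finset.sum_neg_distrib]; linarith) (by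
      intro k i j hneg
      by_contra h0
      have h1 : (Y' k i j : KK F).order = 0 := order_of_res _ h0
      have h2 := congrFun (congrFun (congrFun key k) i) j
      rw [act_diag] at h2
      have h3 := (mem_OO_order _).1 (Z' k i j).2
      simp only [Matrix.map_apply, Subring.subtype_apply] at h2
      rw [← h2, HahnSeries.order_mul (mul_ne_zero (mul_ne_zero (hdi i) (hdi j)) (hfi k)) (rne _ h0),
        HahnSeries.order_mul (mul_ne_zero (hdi i) (hdi j)) (hfi k), HahnSeries.order_mul (hdi i) (hdi j)] at h3
      linarith)
  obtain ⟨v1, w1⟩ := vf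
  have dm : ∀ i, d i ∈ OO F := fun i => (mem_OO_order _).2 (v1 i)
  have fm : ∀ i, f i ∈ OO F := by
    intro k
    rw [mem_OO_order]
    have a0 := w1 0
    have a1 := w1 1
    rw [Fin.sum_univ_three, Fin.sum_univ_two] at *
    fin_cases k <;> simp only [Fin.isValue, Fin.zero_eta, Fin.mk_one] <;> linarith
  have lift : ∀ {n : ℕ} (x y : Matrix (Fin n) (Fin n) (OO F)) (c : Fin n → KK F) (hc : ∀ i, c i ∈ OO F)
      (i j), (x.map (OO F).subtype * diagonal c * y.map (OO F).subtype) i j ∈ OO F := by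
    intro n x y c hc i j
    have : diagonal c = (diagonal (fun i => (⟨c i, hc i⟩ : OO F))).map (OO F).subtype := by
      rw [Matrix.diagonal_map (map_zero _)]; rfl
    rw [this, ← Matrix.map_mul, ← Matrix.map_mul]
    exact ((x * diagonal (fun i => (⟨c i, hc i⟩ : OO F)) * y) i j).2
  exact ⟨lift u v d dm, lift u2 v2 f fm⟩
end val
end QC


namespace QC

open Matrix Polynomial

section grp
variable {F : Type} [Field F]

/-- degree bounds for a square matrix -/
def BdM {n : ℕ} (p q : Fin n → ℝ) (g : Matrix (Fin n) (Fin n) F[X]) : Prop :=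
  ∀ i j, bd (p i - q j) (g i j)
/-- leading part of a square matrix -/
noncomputable def ldM {n : ℕ} (p q : Fin n → ℝ) (g : Matrix (Fin n) (Fin n) F[X]) :
    Matrix (Fin n) (Fin n) F := Matrix.of fun i j => lc (p i - q j) (g i j)
noncomputable def twM {n : ℕ} (p q : Fin n → ℝ) (g : Matrix (Fin n) (Fin n) F[X]) :
    Matrix (Fin n) (Fin n) (KK F) := Matrix.of fun i j => sp (p i - q j) * iota (g i j)
noncomputable def twMO {n : ℕ} (p q : Fin n → ℝ) (g : Matrix (Fin n) (Fin n) F[X])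
    (h : BdM p q g) : Matrix (Fin n) (Fin n) (OO F) :=
  Matrix.of fun i j => ⟨twM p q g i j, (sp_iota_mem _ _).2 (h i j)⟩

theorem twMO_map {n : ℕ} (p q : Fin n → ℝ) (g : Matrix (Fin n) (Fin n) F[X])
    (h : BdM p q g) : (twMO p q g h).map (OO F).subtype = twM p q g := rfl
theorem twMO_res {n : ℕ} (p q : Fin n → ℝ) (g : Matrix (Fin n) (Fin n) F[X])
    (h : BdM p q g) : (twMO p q g h).map res = ldM p q g := by
  ext i j
  simp [twMO, twM, ldM, res_apply, sp_iota_coeff]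

theorem twM_eq {n : ℕ} (p q : Fin n → ℝ) (g : Matrix (Fin n) (Fin n) F[X]) : twM p q g =
    diagonal (fun i => sp (p i)) * g.map iota * diagonal (fun i => sp (-q i)) := by
  refine Matrix.ext fun i j => ?_
  rw [Matrix.mul_diagonal, Matrix.diagonal_mul, twM, of_apply, sub_eq_add_neg, sp_add]
  simp only [Matrix.map_apply]
  ring

theorem prod_sp {n : ℕ} (p : Fin n → ℝ) : ∏ i, (sp (p i) : KK F) = sp (∑ i, p i) := by
  induction n with
  | zero => simp [sp_zero]
  | succ n ih => rw [Fin.prod_univ_succ, Fin.sum_univ_succ, sp_add, ih]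

theorem det_twM {n : ℕ} (p q : Fin n → ℝ) (g : Matrix (Fin n) (Fin n) F[X]) :
    (twM p q g).det = sp (∑ i, p i - ∑ i, q i) * iota g.det := by
  rw [twM_eq, det_mul, det_mul, det_diagonal, det_diagonal, prod_sp, prod_sp, iota_map_det,
    sub_eq_add_neg, sp_add, Finset.sum_neg_distrib]
  ring

theorem BdM_det {n : ℕ} (p q : Fin n → ℝ) (g : Matrix (Fin n) (Fin n) F[X]) (h : BdM p q g) :
    bd (∑ i, p i - ∑ i, q i) g.det ∧ lc (∑ i, p i - ∑ i, q i) g.det = (ldM p q g).det := by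
  have h1 : ((twMO p q g h).det : KK F) = (twM p q g).det := by
    rw [← twMO_map p q g h]; exact RingHom.map_det (OO F).subtype _
  have h2 : res (twMO p q g h).det = (ldM p q g).det := by
    rw [← twMO_res p q g h]; exact RingHom.map_det res _
  rw [det_twM] at h1
  constructor
  · rw [← sp_iota_mem, ← h1]; exact (twMO p q g h).det.2
  · rw [← h2, res_apply, h1, sp_iota_coeff]; simp

theorem tw_act (a a' : Fin 3 → ℝ) (b b' : Fin 2 → ℝ) (g : M3 F[X]) (h : M2 F[X])
    (X : Fin 2 → M3 F[X]) :
    act (twM a' a g) (twM b b' h) (tw a b X) = tw a' b' (act g h X) := by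
  rw [tw_eq, tw_eq, ← act_map, act_act, act_act, twM_eq, twM_eq]
  have e1 : ∀ {n : ℕ} (p : Fin n → ℝ), diagonal (fun i => (sp (-p i) : KK F)) *
      diagonal (fun i => (sp (p i) : KK F)) = 1 := by
    intro n p
    rw [diagonal_mul_diagonal]
    simp [← sp_add, sp_zero]
  congr 1
  · rw [Matrix.mul_assoc, e1, Matrix.mul_one]
  · rw [Matrix.mul_assoc, ← Matrix.mul_assoc, e1, Matrix.one_mul]

theorem lead_act (a a' : Fin 3 → ℝ) (b b' : Fin 2 → ℝ) (g : M3 F[X]) (h : M2 F[X])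
    (X : Fin 2 → M3 F[X]) (hX : Bd a b X) (hg : BdM a' a g) (hh : BdM b b' h) :
    Bd a' b' (act g h X) ∧ lead a' b' (act g h X) = act (ldM a' a g) (ldM b b' h) (lead a b X) := by
  have e := tw_act a a' b b' g h X
  rw [← twMO_map a' a g hg, ← twMO_map b b' h hh, ← twO_map a b X hX, act_map] at e
  have hB : Bd a' b' (act g h X) := by
    intro k i j
    rw [← sp_iota_mem]
    have : sp (a' i + a' j - b' k) * iota (act g h X k i j) = tw a' b' (act g h X) k i j := rfl
    rw [this, ← e]
    exact (act (twMO a' a g hg) (twMO b b' h hh) (twO a b X hX) k i j).2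
  refine ⟨hB, ?_⟩
  rw [← twO_res a' b' _ hB, ← twO_res a b X hX, ← twMO_res _ _ _ hg, ← twMO_res _ _ _ hh, act_map]
  funext k
  congr 1
  ext i j
  have := congrFun (congrFun (congrFun e k) i) j
  exact congrArg (fun z : KK F => z.coeff _) this.symm

/-- the group pairs -/
def GG (g : M3 F[X]) (h : M2 F[X]) : Prop := g.det * h.det = 1

theorem D_GG {g : M3 F[X]} {h : M2 F[X]} (hh : GG g h) (X : Fin 2 → M3 F[X]) :
    D (act g h X) = g.det ^ 2 * D X := by
  rw [D_act]
  have : g.det ^ 8 * h.det ^ 6 = g.det ^ 2 * (g.det * h.det) ^ 6 := by ring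
  rw [this, hh]; ring

theorem GG_unit {g : M3 F[X]} {h : M2 F[X]} (hh : GG g h) : g.det.natDegree = 0 ∧ g.det ≠ 0 := by
  have : IsUnit g.det := IsUnit.of_mul_eq_one _ hh
  exact ⟨natDegree_eq_zero_of_isUnit this, this.ne_zero⟩

theorem D_GG_deg {g : M3 F[X]} {h : M2 F[X]} (hh : GG g h) (X : Fin 2 → M3 F[X]) (h0 : D X ≠ 0) :
    D (act g h X) ≠ 0 ∧ (D (act g h X)).natDegree = (D X).natDegree := by
  obtain ⟨h1, h2⟩ := GG_unit hh
  rw [D_GG hh]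
  refine ⟨mul_ne_zero (pow_ne_zero _ h2) h0, ?_⟩
  rw [natDegree_mul (pow_ne_zero _ h2) h0, natDegree_pow, h1]; simp

theorem exists_perm_of_det {n : ℕ} (A : Matrix (Fin n) (Fin n) F) (h : A.det ≠ 0) :
    ∃ σ : Equiv.Perm (Fin n), ∀ i, A (σ i) i ≠ 0 := by
  by_contra! hh
  apply h
  rw [det_apply]
  apply Finset.sum_eq_zero
  intro σ _
  obtain ⟨i, hi⟩ := hh σ
  have : ∏ i, A (σ i) i = 0 := Finset.prod_eq_zero (Finset.mem_univ i) hi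
  rw [this, smul_zero]

theorem type_eq {n : ℕ} (p q : Fin n → ℝ) (hp : Monotone p) (hq : Monotone q)
    (hs : ∑ i, p i = ∑ i, q i) (g : Matrix (Fin n) (Fin n) F[X]) (h : (ldM p q g).det ≠ 0) :
    p = q := by
  obtain ⟨σ, hσ⟩ := exists_perm_of_det _ h
  have h1 : ∀ i, q i ≤ p (σ i) := by
    intro i
    by_contra hh
    apply hσ i
    simp only [ldM, of_apply]
    apply lc_of_ne
    intro m hm
    have : (0 : ℝ) ≤ m := Nat.cast_nonneg m
    linarith
  have h2 : ∑ i, p (σ i) = ∑ i, q i := by rw [Equiv.sum_comp σ p, hs]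
  have h3 : ∀ i, q i = p (σ i) := by
    intro i
    exact (Finset.sum_eq_sum_iff_of_le (fun i _ => h1 i)).1 h2.symm i (Finset.mem_univ i)
  have h4 : q = p ∘ σ := funext h3
  have := Tuple.unique_monotone (f := p) (σ := 1) (τ := σ) (by simpa using hp) (by rw [← h4]; exact hq)
  rw [h4, ← this]; rfl

theorem uniq_core (a a' : Fin 3 → ℝ) (b b' : Fin 2 → ℝ) (X : Fin 2 → M3 F[X])
    (hs : ∑ i, a i = ∑ k, b k) (hs' : ∑ i, a' i = ∑ k, b' k)
    (hsym : ∀ k, (X k).IsSymm)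
    (g : M3 F[X]) (h : M2 F[X]) (hgh : GG g h) (hX : Red a b X) (hY : Red a' b' (act g h X)) :
    BdM a' a g ∧ BdM b b' h ∧ (ldM a' a g).det * (ldM b b' h).det = 1 ∧
      ∑ i, a' i = ∑ i, a i := by
  have hss : ∑ i, a' i = ∑ i, a i := by
    obtain ⟨h1, h2⟩ := hX.natDegree hs
    obtain ⟨h3, h4⟩ := hY.natDegree hs'
    rw [(D_GG_deg hgh X h1).2, h2] at h4
    linarith
  have hss' : ∑ i, b i = ∑ i, b' i := by rw [← hs, ← hs', hss]
  have hdet : (twM a' a g).det * (twM b b' h).det = 1 := by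
    rw [det_twM, det_twM, hss, hss', sub_self, sub_self, sp_zero, one_mul, one_mul, ← map_mul, hgh,
      map_one]
  have key := integral_of_act (twO a b X hX.1) (twO a' b' _ hY.1) (by
      intro k; ext i j
      have := (hsym k).apply i j
      simp [twO, tw, this, add_comm (a j)])
    (by rw [← D_map, twO_res]; exact hX.2) (by rw [← D_map, twO_res]; exact hY.2)
    (twM a' a g) (twM b b' h) hdet (by rw [twO_map, twO_map]; exact tw_act _ _ _ _ _ _ _)
  have k1 : BdM a' a g := fun i j => (sp_iota_mem _ _).1 (key.1 i j)
  have k2 : BdM b b' h := fun i j => (sp_iota_mem _ _).1 (key.2 i j)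
  refine ⟨k1, k2, ?_, hss⟩
  rw [← (BdM_det _ _ _ k1).2, ← (BdM_det _ _ _ k2).2, hss, hss', sub_self, sub_self]
  have l0 : ∀ f : F[X], lc 0 f = f.coeff 0 := fun f => by
    have := lc_nat 0 f; simpa using this
  rw [l0, l0, ← mul_coeff_zero, hgh]; simp

/-- automorphisms of a type -/
def AutT (a : Fin 3 → ℝ) (b : Fin 2 → ℝ) : Set (M3 F[X] × M2 F[X]) :=
  {γ | BdM a a γ.1 ∧ BdM b b γ.2 ∧ (ldM a a γ.1).det * (ldM b b γ.2).det = 1}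

theorem bd_zero_eq (f : F[X]) (h : bd 0 f) : f = C (lc 0 f) := by
  have := lc_nat 0 f
  rw [Nat.cast_zero] at this
  rw [this]
  ext m
  rw [coeff_C]
  split_ifs with hm
  · rw [hm]
  · exact h m (by positivity)

theorem AutT.GG {a b} {g : M3 F[X]} {h : M2 F[X]} (hh : (g, h) ∈ AutT a b) : GG g h := by
  obtain ⟨h1, h2, h3⟩ := hh
  have d1 := BdM_det _ _ _ h1
  have d2 := BdM_det _ _ _ h2
  simp only [sub_self] at d1 d2
  unfold QC.GG
  dsimp only at *
  rw [bd_zero_eq _ d1.1, bd_zero_eq _ d2.1, d1.2, d2.2, ← C_mul, h3, C_1]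

theorem AutT.red {a b} {g : M3 F[X]} {h : M2 F[X]} (hh : (g, h) ∈ AutT a b) {X : Fin 2 → M3 F[X]}
    (hX : Red a b X) : Red a b (act g h X) := by
  obtain ⟨h1, h2, h3⟩ := hh
  obtain ⟨l1, l2⟩ := lead_act a a b b g h X hX.1 h1 h2
  refine ⟨l1, ?_⟩
  rw [l2, D_act]
  exact mul_ne_zero (mul_ne_zero (pow_ne_zero _ (left_ne_zero_of_mul_eq_one h3))
    (pow_ne_zero _ (right_ne_zero_of_mul_eq_one h3))) hX.2

theorem mem_AutT {a b} {g : M3 F[X]} {h : M2 F[X]} (hgh : QC.GG g h) {X : Fin 2 → M3 F[X]}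
    (hsym : ∀ k, (X k).IsSymm) (hs : ∑ i, a i = ∑ k, b k)
    (hX : Red a b X) (hY : Red a b (act g h X)) : (g, h) ∈ AutT a b := by
  obtain ⟨h1, h2, h3, -⟩ := uniq_core a a b b X hs hs hsym g h hgh hX hY
  exact ⟨h1, h2, h3⟩

theorem type_uniq {a a' : Fin 3 → ℝ} {b b' : Fin 2 → ℝ} {X : Fin 2 → M3 F[X]}
    (hs : ∑ i, a i = ∑ k, b k) (hs' : ∑ i, a' i = ∑ k, b' k)
    (hsym : ∀ k, (X k).IsSymm) (ma : Monotone a) (ma' : Monotone a') (mb : Monotone b)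
    (mb' : Monotone b')
    {g : M3 F[X]} {h : M2 F[X]} (hgh : GG g h) (hX : Red a b X) (hY : Red a' b' (act g h X)) :
    a = a' ∧ b = b' := by
  obtain ⟨h1, h2, h3, h4⟩ := uniq_core a a' b b' X hs hs' hsym g h hgh hX hY
  constructor
  · exact (type_eq a' a ma' ma h4 g (left_ne_zero_of_mul_eq_one h3)).symm
  · exact type_eq b b' mb mb' (by rw [← hs, ← hs', h4]) h (right_ne_zero_of_mul_eq_one h3)

end grp
end QC


namespace QC

open Matrix Polynomial

section exist
variable {F : Type} [Field F]

/-- homogeneous square matrices -/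
def HomM {n : ℕ} (p : Fin n → ℝ) (g : Matrix (Fin n) (Fin n) F) : Prop :=
  ∀ i j, g i j ≠ 0 → ∃ m : ℕ, p i - p j = m
/-- homogeneous pairs -/
def Hom (a : Fin 3 → ℝ) (b : Fin 2 → ℝ) (x : Fin 2 → M3 F) : Prop :=
  ∀ k i j, x k i j ≠ 0 → ∃ m : ℕ, a i + a j - b k = m

theorem lc_ne {d : ℝ} {f : F[X]} (h : lc d f ≠ 0) : ∃ m : ℕ, d = m := by
  by_contra! hh
  exact h (lc_of_ne d (fun m hm => hh m hm.symm) f)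

theorem lead_hom (a b) (X : Fin 2 → M3 F[X]) : Hom a b (lead a b X) := fun _ _ _ h => lc_ne h

theorem ldM_hom {n : ℕ} (p : Fin n → ℝ) (g : Matrix (Fin n) (Fin n) F[X]) : HomM p (ldM p p g) :=
  fun _ _ h => lc_ne h

/-- monomial lift -/
noncomputable def mono (d : ℝ) (c : F) : F[X] := if (⌊d⌋₊ : ℝ) = d then monomial ⌊d⌋₊ c else 0

theorem mono_bd (d : ℝ) (c : F) : bd d (mono d c) := by
  intro m hm
  unfold mono
  split_ifs with h
  · rw [coeff_monomial, if_neg]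
    rintro rfl
    linarith
  · simp

theorem mono_lc (d : ℝ) (c : F) (h : c ≠ 0 → ∃ m : ℕ, d = m) : lc d (mono d c) = c := by
  by_cases hc : c = 0
  · subst hc; simp [mono, lc]
  · obtain ⟨m, rfl⟩ := h hc
    simp [mono, lc]

theorem lift_exists {n : ℕ} (p : Fin n → ℝ) (g : Matrix (Fin n) (Fin n) F) (h : HomM p g) :
    ∃ G : Matrix (Fin n) (Fin n) F[X], BdM p p G ∧ ldM p p G = g := by
  refine ⟨Matrix.of fun i j => mono (p i - p j) (g i j), fun i j => mono_bd _ _, ?_⟩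
  ext i j
  exact mono_lc _ _ (h i j)

theorem HomM_one {n : ℕ} (p : Fin n → ℝ) : HomM p (1 : Matrix (Fin n) (Fin n) F) := by
  intro i j h
  have : i = j := by
    by_contra hh; exact h (Matrix.one_apply_ne hh)
  subst this
  exact ⟨0, by simp⟩

theorem HomM_mul {n : ℕ} (p : Fin n → ℝ) (g g' : Matrix (Fin n) (Fin n) F) (h : HomM p g)
    (h' : HomM p g') : HomM p (g * g') := by
  intro i j hij
  rw [Matrix.mul_apply] at hij
  obtain ⟨k, -, hk⟩ := Finset.exists_ne_zero_of_sum_ne_zero hij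
  obtain ⟨m, hm⟩ := h i k (left_ne_zero_of_mul hk)
  obtain ⟨m', hm'⟩ := h' k j (right_ne_zero_of_mul hk)
  exact ⟨m + m', by push_cast; linarith⟩

theorem Hom_act (a b) (g : M3 F) (h : M2 F) (x : Fin 2 → M3 F) (hg : HomM a g) (hh : HomM b h)
    (hx : Hom a b x) : Hom a b (act g h x) := by
  intro l i j hne
  rw [act_apply] at hne
  obtain ⟨i', -, h1⟩ := Finset.exists_ne_zero_of_sum_ne_zero hne
  obtain ⟨j', -, h2⟩ := Finset.exists_ne_zero_of_sum_ne_zero h1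
  obtain ⟨k, -, h3⟩ := Finset.exists_ne_zero_of_sum_ne_zero h2
  obtain ⟨m1, e1⟩ := hx k i' j' (right_ne_zero_of_mul h3)
  have h4 := left_ne_zero_of_mul h3
  obtain ⟨m2, e2⟩ := hh k l (right_ne_zero_of_mul h4)
  have h5 := left_ne_zero_of_mul h4
  obtain ⟨m3, e3⟩ := hg i i' (left_ne_zero_of_mul h5)
  obtain ⟨m4, e4⟩ := hg j j' (right_ne_zero_of_mul h5)
  exact ⟨m1 + m2 + m3 + m4, by push_cast; linarith⟩

/-- destabilising shift exists -/
def Unst (a : Fin 3 → ℝ) (b : Fin 2 → ℝ) (x : Fin 2 → M3 F) : Prop :=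
  ∃ (g : M3 F) (h : M2 F) (l : Fin 3 → ℝ) (m : Fin 2 → ℝ), HomM a g ∧ HomM b h ∧ g.det * h.det = 1 ∧
    ∑ i, l i = ∑ k, m k ∧ ∑ i, l i < 0 ∧
    ∀ k i j, l i + l j - m k < 0 → act g h x k i j = 0

theorem Unst_act (a b) (g : M3 F) (h : M2 F) (x : Fin 2 → M3 F) (hg : HomM a g) (hh : HomM b h)
    (hd : g.det * h.det = 1) (H : Unst a b (act g h x)) : Unst a b x := by
  obtain ⟨g', h', l, m, h1, h2, h3, h4, h5, h6⟩ := H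
  refine ⟨g' * g, h * h', l, m, HomM_mul _ _ _ h1 hg, HomM_mul _ _ _ hh h2, ?_, h4, h5, ?_⟩
  · rw [det_mul, det_mul]
    linear_combination (g'.det * h'.det) * hd + h3
  · rwa [act_act] at h6

/-- kernel vector normal form -/
theorem kernel_row (a : Fin 3 → ℝ) (β : ℝ) (M : M3 F)
    (hM : ∀ i j, M i j ≠ 0 → ∃ m : ℤ, a i + a j - β = m)
    (p : Fin 3 → F) (hp : p ≠ 0) (hMp : ∀ i, ∑ j, M i j * p j = 0) :
    ∃ i, ∃ r : Fin 3 → F, r i = 1 ∧ (∀ j, p j = 0 → r j = 0) ∧ (∀ j, r j ≠ 0 → ∃ m : ℕ, a i - a j = m) ∧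
      ∀ i', ∑ j, M i' j * r j = 0 := by
  classical
  obtain ⟨i0, hi0⟩ := Function.ne_iff.1 hp
  simp only [Pi.zero_apply] at hi0
  let S : Finset (Fin 3) := Finset.univ.filter fun j => p j ≠ 0 ∧ ∃ m : ℤ, a j - a i0 = m
  obtain ⟨i, hi, hmax⟩ := Finset.exists_max_image S a ⟨i0, by
    simp only [S, Finset.mem_filter, Finset.mem_univ, true_and]; exact ⟨hi0, 0, by simp⟩⟩
  simp only [S, Finset.mem_filter, Finset.mem_univ, true_and] at hi hmax
  obtain ⟨hpi, mi, hmi⟩ := hi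
  refine ⟨i, fun j => if j ∈ S then p j / p i else 0, ?_, ?_, ?_, ?_⟩
  · have : i ∈ S := by
      simp only [S, Finset.mem_filter, Finset.mem_univ, true_and]; exact ⟨hpi, mi, hmi⟩
    simp only [this, if_true]; field_simp
  · intro j hj; simp [hj]
  · intro j hj
    have hS : j ∈ S := by by_contra hh; simp [hh] at hj
    simp only [S, Finset.mem_filter, Finset.mem_univ, true_and] at hS
    obtain ⟨m, hm⟩ := hS.2
    have hle := hmax j hS
    have : (0 : ℤ) ≤ mi - m := by
      have : (0 : ℝ) ≤ ((mi - m : ℤ) : ℝ) := by push_cast; linarith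
      exact_mod_cast this
    refine ⟨(mi - m).toNat, ?_⟩
    have e : (((mi - m).toNat : ℤ) : ℝ) = ((mi - m : ℤ) : ℝ) := by rw [Int.toNat_of_nonneg this]
    rw [← Int.cast_natCast, e]; push_cast; linarith
  · intro i'
    by_cases hc : ∃ m : ℤ, a i' + a i0 - β = m
    · obtain ⟨m, hm⟩ := hc
      have : ∀ j, M i' j * (if j ∈ S then p j / p i else 0) = M i' j * p j * (p i)⁻¹ := by
        intro j
        by_cases hS : j ∈ S
        · simp only [hS, if_true]; ring
        · simp only [hS, if_false]
          by_cases h0 : M i' j * p j = 0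
          · rw [h0]; simp
          · exfalso
            apply hS
            simp only [S, Finset.mem_filter, Finset.mem_univ, true_and]
            refine ⟨right_ne_zero_of_mul h0, ?_⟩
            obtain ⟨m', hm'⟩ := hM i' j (left_ne_zero_of_mul h0)
            exact ⟨m' - m, by push_cast; linarith⟩
      rw [Finset.sum_congr rfl fun j _ => this j, ← Finset.sum_mul, hMp, zero_mul]
    · apply Finset.sum_eq_zero
      intro j _
      by_cases hS : j ∈ S
      · simp only [S, Finset.mem_filter, Finset.mem_univ, true_and] at hS
        have : M i' j = 0 := by
          by_contra h0
          obtain ⟨m', hm'⟩ := hM i' j h0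
          obtain ⟨m, hm⟩ := hS.2
          exact hc ⟨m' - m, by push_cast; linarith⟩
        rw [this, zero_mul]
      · simp [hS]

/-- the elementary matrix with prescribed row -/
def rowM (i : Fin 3) (r : Fin 3 → F) : M3 F := Matrix.updateRow 1 i r

theorem rowM_det (i : Fin 3) (r : Fin 3 → F) (h : r i = 1) : (rowM i r).det = 1 := by
  fin_cases i <;> simp_all [rowM, det_fin_three, Matrix.updateRow_apply]

theorem rowM_hom (a : Fin 3 → ℝ) (i : Fin 3) (r : Fin 3 → F)
    (h : ∀ j, r j ≠ 0 → ∃ m : ℕ, a i - a j = m) : HomM a (rowM i r) := by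
  intro i' j hne
  rw [rowM, Matrix.updateRow_apply] at hne
  split_ifs at hne with hh
  · subst hh; exact h j hne
  · exact HomM_one a i' j hne

theorem rowM_conj_row (i : Fin 3) (r : Fin 3 → F) (M : M3 F) (hs : M.IsSymm)
    (hr : ∀ i', ∑ j, M i' j * r j = 0) (j) : (rowM i r * M * (rowM i r)ᵀ) i j = 0 := by
  have : ∀ j, (rowM i r * M) i j = 0 := by
    intro j
    rw [Matrix.mul_apply]
    simp only [rowM, Matrix.updateRow_self]
    rw [← hr j]
    apply Finset.sum_congr rfl
    intro k _
    rw [hs.apply]; ring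
  rw [Matrix.mul_apply]
  simp [this]

theorem rowM_conj_row' (i i0 : Fin 3) (hi : i0 ≠ i) (r : Fin 3 → F) (M : M3 F)
    (h0 : ∀ j, M i0 j = 0) (j) : (rowM i r * M * (rowM i r)ᵀ) i0 j = 0 := by
  have : ∀ j, (rowM i r * M) i0 j = 0 := by
    intro j
    rw [Matrix.mul_apply]
    apply Finset.sum_eq_zero
    intro k _
    rw [rowM, Matrix.updateRow_ne hi]
    by_cases hk : i0 = k
    · rw [← hk, h0]; simp
    · rw [Matrix.one_apply_ne hk]; simp
  rw [Matrix.mul_apply]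
  simp [this]

theorem act_g_one (g : M3 F) (x : Fin 2 → M3 F) (k) : act g 1 x k = g * x k * gᵀ := by
  fin_cases k <;> simp [act, Matrix.one_apply]

/-- kernel step: given det = 0 and vanishing mixed coefficient -/
theorem Unst_of_double (a b) (x : Fin 2 → M3 F) (hs : ∀ k, (x k).IsSymm) (hx : Hom a b x)
    (m m' : Fin 2) (hmm : m ≠ m') (h0 : (x m).det = 0) (h1 : mixc (x m) (x m') = 0) :
    Unst a b x := by
  classical
  have hnt : ∀ (y : Fin 2 → M3 F), Hom a b y → ∀ i j, y m i j ≠ 0 → ∃ z : ℤ, a i + a j - b m = z := by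
    intro y hy i j hne
    obtain ⟨z, hz⟩ := hy m i j hne
    exact ⟨z, by rw [hz]; simp⟩
  have hm2 : ∀ k : Fin 2, k = m ∨ k = m' := by
    intro k; revert hmm; fin_cases k <;> fin_cases m <;> fin_cases m' <;> simp
  obtain ⟨p, hp, hMp⟩ := Matrix.exists_mulVec_eq_zero_iff.2 h0
  obtain ⟨i, r, r1, -, r3, r4⟩ := kernel_row a (b m) (x m) (hnt x hx) p hp
    (fun i => congrFun hMp i)
  apply Unst_act a b (rowM i r) 1 x (rowM_hom _ _ _ r3) (HomM_one b) (by simp [rowM_det _ _ r1])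
  set y := act (rowM i r) 1 x with hy
  have ys : ∀ k, (y k).IsSymm := fun k => act_symm _ _ _ hs k
  have yh : Hom a b y := Hom_act _ _ _ _ _ (rowM_hom _ _ _ r3) (HomM_one b) hx
  have y0 : ∀ j, y m i j = 0 := by
    intro j; rw [hy, act_g_one]; exact rowM_conj_row i r _ (hs m) r4 j
  have y0' : ∀ j, y m j i = 0 := fun j => by rw [(ys m).apply]; exact y0 j
  have y1 : mixc (y m) (y m') = 0 := by
    rw [hy, act_g_one, act_g_one, mixc_conj, h1, mul_zero]
  clear_value y
  clear hMp hp p r1 r3 r4 hx h0 h1 hs hy x r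
  by_cases hii : y m' i i = 0
  · refine ⟨1, 1, fun j => if j = i then -1 else 0, fun k => if k = m' then -1 else 0, HomM_one a,
      HomM_one b, by simp, by simp, by simp, ?_⟩
    intro k j j' hlt
    rw [act_one]
    rcases hm2 k with rfl | rfl
    · by_cases hj : j = i
      · subst hj; exact y0 _
      · by_cases hj' : j' = i
        · subst hj'; exact y0' _
        · simp [hj, hj', hmm] at hlt
    · by_cases hj : j = i
      · by_cases hj' : j' = i
        · subst hj; subst hj'; exact hii
        · simp [hj, hj'] at hlt
      · by_cases hj' : j' = i
        · simp [hj, hj'] at hlt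
        · simp [hj, hj'] at hlt
          linarith
  · -- the complementary block is singular
    have hker : ∃ p : Fin 3 → F, p ≠ 0 ∧ p i = 0 ∧ ∀ j, ∑ j', y m j j' * p j' = 0 := by
      have hb : (y m (i+1) (i+1) * y m (i+2) (i+2) - y m (i+1) (i+2) * y m (i+1) (i+2)) = 0 := by
        have e : y m' i i * (y m (i+1) (i+1) * y m (i+2) (i+2) - y m (i+1) (i+2) * y m (i+1) (i+2)) = 0 := by
          rw [← y1]
          have s1 := (ys m).apply
          fin_cases i <;>
          · simp only [mixc]
            simp at y0 y0'
            simp [y0, y0']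
            first
            | (rw [s1 1 2]; ring1)
            | (rw [s1 0 2]; ring1)
            | (rw [s1 0 1]; ring1)
        exact (mul_eq_zero.1 e).resolve_left hii
      have s1 := (ys m).apply
      by_cases hA : y m (i+1) (i+1) = 0 ∧ y m (i+1) (i+2) = 0
      · obtain ⟨hA, hB⟩ := hA
        refine ⟨fun j => if j = i + 1 then 1 else 0, ?_, ?_, ?_⟩
        · exact Function.ne_iff.2 ⟨i + 1, by simp⟩
        · fin_cases i <;> simp
        · intro j
          simp only [mul_ite, mul_one, mul_zero, Finset.sum_ite_eq', Finset.mem_univ, if_true]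
          have hj : j = i ∨ j = i + 1 ∨ j = i + 2 := by
            clear * -; fin_cases i <;> fin_cases j <;> simp
          rcases hj with rfl | rfl | rfl
          · exact y0 _
          · exact hA
          · rw [s1]; exact hB
      · refine ⟨fun j => if j = i + 1 then - y m (i+1) (i+2) else if j = i + 2 then y m (i+1) (i+1)
          else 0, ?_, ?_, ?_⟩
        · intro h0
          apply hA
          have e1 := congrFun h0 (i+1)
          have e2 := congrFun h0 (i+2)
          simp at e1 e2
          exact ⟨e2, e1⟩
        · fin_cases i <;> simp
        · intro j
          have hj : j = i ∨ j = i + 1 ∨ j = i + 2 := by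
            clear * -; fin_cases i <;> fin_cases j <;> simp
          have hsum : ∀ f : Fin 3 → F, ∑ j', f j' = f i + f (i+1) + f (i+2) := by
            intro f; rw [Fin.sum_univ_three]; fin_cases i <;> simp <;> ring
          have n1 : i ≠ i + 1 := by clear * -; fin_cases i <;> simp
          have n2 : i ≠ i + 2 := by clear * -; fin_cases i <;> simp
          rw [hsum]
          simp only [n1, n2, if_false, if_true, add_right_inj, show ¬ ((2 : Fin 3) = 1) by decide]
          have sy := s1 (i+1) (i+2)
          rcases hj with rfl | rfl | rfl
          · rw [y0, y0, y0]; ring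
          · ring
          · rw [sy]; linear_combination hb
    obtain ⟨p, hp, hpi, hMp⟩ := hker
    obtain ⟨i2, r, r1, r2, r3, r4⟩ := kernel_row a (b m) (y m) (hnt y yh) p hp hMp
    have hne : i ≠ i2 := by
      rintro rfl
      rw [r2 _ hpi] at r1
      exact zero_ne_one r1
    refine ⟨rowM i2 r, 1, fun j => if j = i ∨ j = i2 then -1 else 0, fun k => if k = m' then -2 else 0,
      rowM_hom _ _ _ r3, HomM_one b, by simp [rowM_det _ _ r1], ?_, ?_, ?_⟩
    · revert hne; clear * -; intro hne
      rw [Finset.sum_ite_eq' Finset.univ m']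
      fin_cases i <;> fin_cases i2 <;> simp [Fin.sum_univ_three] at hne ⊢ <;> norm_num
    · revert hne; clear * -; intro hne
      fin_cases i <;> fin_cases i2 <;> simp [Fin.sum_univ_three] at hne ⊢ <;> norm_num
    · intro k j j' hlt
      have zs := act_symm (rowM i2 r) 1 y ys
      have z1 : ∀ j, act (rowM i2 r) 1 y m i j = 0 := fun j => by
        rw [act_g_one]; exact rowM_conj_row' i2 i hne r _ y0 j
      have z2 : ∀ j, act (rowM i2 r) 1 y m i2 j = 0 := fun j => by
        rw [act_g_one]; exact rowM_conj_row i2 r _ (ys m) r4 j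
      have z3 : ∀ j, (j = i ∨ j = i2) → ∀ j', act (rowM i2 r) 1 y m j j' = 0 := by
        rintro j (rfl | rfl)
        · exact z1
        · exact z2
      rcases hm2 k with rfl | rfl
      · by_cases hj : j = i ∨ j = i2
        · exact z3 j hj j'
        · by_cases hj' : j' = i ∨ j' = i2
          · rw [(zs _).apply]; exact z3 j' hj' j
          · simp [hj, hj', hmm] at hlt
      · exfalso
        simp only [if_true] at hlt
        split_ifs at hlt <;> linarith

theorem double_root (f0 f1 f2 f3 : F) (h2 : (2 : F) ≠ 0) (h3 : (3 : F) ≠ 0) (hd : disc3 f0 f1 f2 f3 = 0) :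
    (f0 = 0 ∧ f1 = 0) ∨ ∃ c, f0 * c ^ 3 + f1 * c ^ 2 + f2 * c + f3 = 0 ∧
      3 * f0 * c ^ 2 + 2 * f1 * c + f2 = 0 := by
  unfold disc3 at hd
  by_cases hP : f1 ^ 2 - 3 * f0 * f2 = 0
  · by_cases h0 : f0 = 0
    · left
      subst h0
      refine ⟨rfl, ?_⟩
      simpa using hP
    · right
      have hQ : f1 * f2 - 9 * f0 * f3 = 0 := by
        have : (f1 * f2 - 9 * f0 * f3) ^ 2 = 0 := by
          linear_combination 4 * (f2 ^ 2 - 3 * f1 * f3) * hP - 3 * hd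
        exact pow_eq_zero_iff (two_ne_zero) |>.1 this
      refine ⟨-f1 / (3 * f0), ?_, ?_⟩
      · have : f0 * (-f1 / (3 * f0)) ^ 3 + f1 * (-f1 / (3 * f0)) ^ 2 + f2 * (-f1 / (3 * f0)) + f3 =
          (2 * f1 * (f1 ^ 2 - 3 * f0 * f2) - 3 * f0 * (f1 * f2 - 9 * f0 * f3)) / (27 * f0 ^ 2) := by
          have h27 : (27 : F) = 3 ^ 3 := by norm_num
          rw [h27]
          field_simp
          ring
        rw [this, hP, hQ]; simp
      · have : 3 * f0 * (-f1 / (3 * f0)) ^ 2 + 2 * f1 * (-f1 / (3 * f0)) + f2 =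
          -(f1 ^ 2 - 3 * f0 * f2) / (3 * f0) := by
          field_simp
          ring
        rw [this, hP]; simp
  · right
    refine ⟨-(f1 * f2 - 9 * f0 * f3) / (2 * (f1 ^ 2 - 3 * f0 * f2)), ?_, ?_⟩
    · have : ∀ P Q : F, P ≠ 0 → f0 * (-Q / (2 * P)) ^ 3 + f1 * (-Q / (2 * P)) ^ 2 + f2 * (-Q / (2 * P)) + f3 =
          (-f0 * Q ^ 3 + 2 * f1 * Q ^ 2 * P - 4 * f2 * Q * P ^ 2 + 8 * f3 * P ^ 3) / (2 ^ 3 * P ^ 3) := by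
        intro P Q hP; field_simp; ring
      rw [this _ _ hP, div_eq_zero_iff]; left
      linear_combination (3 * f0 * (f1 * f2 - 9 * f0 * f3) - 2 * f1 * (f1 ^ 2 - 3 * f0 * f2)) * hd
    · have : ∀ P Q : F, P ≠ 0 → 3 * f0 * (-Q / (2 * P)) ^ 2 + 2 * f1 * (-Q / (2 * P)) + f2 =
          (3 * f0 * Q ^ 2 - 4 * f1 * Q * P + 4 * f2 * P ^ 2) / (2 ^ 2 * P ^ 2) := by
        intro P Q hP; field_simp; ring
      rw [this _ _ hP, div_eq_zero_iff]; left
      linear_combination (-9 * f0) * hd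

end exist
end QC


namespace QC

open Matrix Polynomial

section exist2
variable {F : Type} [Field F]

theorem mixc_int (a : Fin 3 → ℝ) (α β : ℝ) (A B : M3 F)
    (hA : ∀ i j, A i j ≠ 0 → ∃ m : ℕ, a i + a j - α = m)
    (hB : ∀ i j, B i j ≠ 0 → ∃ m : ℕ, a i + a j - β = m) (h : mixc A B ≠ 0) :
    ∃ z : ℤ, 2 * ∑ i, a i - 2 * α - β = z := by
  by_contra hh
  apply h
  have key : ∀ i j k l p r : Fin 3, a i + a k + a p = ∑ i, a i → a j + a l + a r = ∑ i, a i →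
      A i j * A k l * B p r = 0 := by
    intro i j k l p r e1 e2
    by_contra h0
    obtain ⟨m1, h1⟩ := hB p r (right_ne_zero_of_mul h0)
    obtain ⟨m2, h2⟩ := hA k l (right_ne_zero_of_mul (left_ne_zero_of_mul h0))
    obtain ⟨m3, h3⟩ := hA i j (left_ne_zero_of_mul (left_ne_zero_of_mul h0))
    exact hh ⟨m1 + m2 + m3, by push_cast; linarith⟩
  rw [Fin.sum_univ_three] at key
  unfold mixc
  linear_combination key 1 1 2 2 0 0 (by ring) (by ring) - key 1 2 2 1 0 0 (by ring) (by ring)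
    - key 1 0 2 2 0 1 (by ring) (by ring) + key 1 2 2 0 0 1 (by ring) (by ring)
    + key 1 0 2 1 0 2 (by ring) (by ring) - key 1 1 2 0 0 2 (by ring) (by ring)
    - key 0 1 2 2 1 0 (by ring) (by ring) + key 0 2 2 1 1 0 (by ring) (by ring)
    + key 0 0 2 2 1 1 (by ring) (by ring) - key 0 2 2 0 1 1 (by ring) (by ring)
    - key 0 0 2 1 1 2 (by ring) (by ring) + key 0 1 2 0 1 2 (by ring) (by ring)
    + key 0 1 1 2 2 0 (by ring) (by ring) - key 0 2 1 1 2 0 (by ring) (by ring)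
    - key 0 0 1 2 2 1 (by ring) (by ring) + key 0 2 1 0 2 1 (by ring) (by ring)
    + key 0 0 1 1 2 2 (by ring) (by ring) - key 0 1 1 0 2 2 (by ring) (by ring)

theorem det_int (a : Fin 3 → ℝ) (α : ℝ) (A : M3 F)
    (hA : ∀ i j, A i j ≠ 0 → ∃ m : ℕ, a i + a j - α = m) (h : A.det ≠ 0) :
    ∃ z : ℤ, 2 * ∑ i, a i - 3 * α = z := by
  obtain ⟨σ, hσ⟩ := exists_perm_of_det A h
  choose m hm using fun i => hA _ _ (hσ i)
  refine ⟨∑ i, (m i : ℤ), ?_⟩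
  push_cast
  simp only [← hm, Finset.sum_sub_distrib, Finset.sum_add_distrib, Equiv.sum_comp σ a]
  simp; ring

theorem D_eq (x : Fin 2 → M3 F) : D x = 256 * disc3 (x 0).det (mixc (x 0) (x 1)) (mixc (x 1) (x 0))
    (x 1).det := by
  unfold D disc3; ring

theorem mixc_shift (A B : M3 F) (c : F) : mixc (c • A + B) A =
    3 * A.det * c ^ 2 + 2 * mixc A B * c + mixc B A := by
  simp only [det_fin_three, mixc, Matrix.add_apply, Matrix.smul_apply, smul_eq_mul]
  ring

theorem Unst_of_D (a b) (x : Fin 2 → M3 F) (hs : ∀ k, (x k).IsSymm) (hx : Hom a b x)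
    (hab : ∑ i, a i = ∑ k, b k) (h2 : (2 : F) ≠ 0) (h3 : (3 : F) ≠ 0) (hD : D x = 0) :
    Unst a b x := by
  rw [D_eq] at hD
  have hd : disc3 (x 0).det (mixc (x 0) (x 1)) (mixc (x 1) (x 0)) (x 1).det = 0 := by
    have : (256 : F) = 2 ^ 8 := by norm_num
    rw [this] at hD
    exact (mul_eq_zero.1 hD).resolve_left (pow_ne_zero _ h2)
  have hab' := hab
  rw [Fin.sum_univ_two] at hab
  have i0 := det_int a (b 0) (x 0) (hx 0)
  have i1 := mixc_int a (b 0) (b 1) (x 0) (x 1) (hx 0) (hx 1)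
  have i2 := mixc_int a (b 1) (b 0) (x 1) (x 0) (hx 1) (hx 0)
  have i3 := det_int a (b 1) (x 1) (hx 1)
  rw [hab] at i0 i1 i2 i3
  have fin0 : (x 0).det = 0 → mixc (x 0) (x 1) = 0 → Unst a b x :=
    fun h h' => Unst_of_double a b x hs hx 0 1 (by decide) h h'
  have fin1 : (x 1).det = 0 → mixc (x 1) (x 0) = 0 → Unst a b x :=
    fun h h' => Unst_of_double a b x hs hx 1 0 (by decide) h h'
  by_cases hz : ∃ z : ℤ, b 0 - b 1 = z
  · obtain ⟨z, hz⟩ := hz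
    rcases le_total 0 z with hz0 | hz0
    · rcases double_root _ _ _ _ h2 h3 hd with ⟨h, h'⟩ | ⟨c, h, h'⟩
      · exact fin0 h h'
      · have hh : HomM b (!![1, c; 0, 1] : M2 F) := by
          intro k l hne
          fin_cases k <;> fin_cases l <;> simp at hne ⊢
          · exact ⟨0, by simp⟩
          · exact ⟨z.toNat, by rw [hz, ← Int.cast_natCast, Int.toNat_of_nonneg hz0]⟩
          · exact ⟨0, by simp⟩
        have e0 : act 1 !![1, c; 0, 1] x 0 = x 0 := by simp [act]
        have e1 : act 1 !![1, c; 0, 1] x 1 = c • x 0 + x 1 := by simp [act]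
        apply Unst_act a b 1 !![1, c; 0, 1] x (HomM_one a) hh (by simp)
        apply Unst_of_double a b _ (act_symm _ _ _ hs) (Hom_act _ _ _ _ _ (HomM_one a) hh hx) 1 0
          (by decide)
        · rw [e1]
          have := det_lin (x 0) (x 1) c 1
          rw [one_smul] at this
          rw [this, ← h]; ring
        · rw [e1, e0, mixc_shift, ← h']
    · have hd' : disc3 (x 1).det (mixc (x 1) (x 0)) (mixc (x 0) (x 1)) (x 0).det = 0 := by
        rw [← hd]; unfold disc3; ring
      rcases double_root _ _ _ _ h2 h3 hd' with ⟨h, h'⟩ | ⟨c, h, h'⟩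
      · exact fin1 h h'
      · have hh : HomM b (!![1, 0; c, 1] : M2 F) := by
          intro k l hne
          fin_cases k <;> fin_cases l <;> simp at hne ⊢
          · exact ⟨0, by simp⟩
          · refine ⟨(-z).toNat, ?_⟩
            rw [← Int.cast_natCast, Int.toNat_of_nonneg (by omega)]
            push_cast; linarith
          · exact ⟨0, by simp⟩
        have e0 : act 1 !![1, 0; c, 1] x 1 = x 1 := by simp [act]
        have e1 : act 1 !![1, 0; c, 1] x 0 = c • x 1 + x 0 := by simp [act, add_comm]
        apply Unst_act a b 1 !![1, 0; c, 1] x (HomM_one a) hh (by simp)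
        apply Unst_of_double a b _ (act_symm _ _ _ hs) (Hom_act _ _ _ _ _ (HomM_one a) hh hx) 0 1
          (by decide)
        · rw [e1]
          have := det_lin (x 1) (x 0) c 1
          rw [one_smul] at this
          rw [this, ← h]; ring
        · rw [e1, e0, mixc_shift, ← h']
  · generalize (x 0).det = f0 at *
    generalize (x 1).det = f3 at *
    generalize mixc (x 0) (x 1) = f1 at *
    generalize mixc (x 1) (x 0) = f2 at *
    have m01 : f0 * f1 = 0 := by
      by_contra hh
      obtain ⟨z, hz1⟩ := i0 (left_ne_zero_of_mul hh)
      obtain ⟨w, hw⟩ := i1 (right_ne_zero_of_mul hh)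
      exact hz ⟨w - z, by push_cast; linarith⟩
    have m12 : f1 * f2 = 0 := by
      by_contra hh
      obtain ⟨z, hz1⟩ := i1 (left_ne_zero_of_mul hh)
      obtain ⟨w, hw⟩ := i2 (right_ne_zero_of_mul hh)
      exact hz ⟨w - z, by push_cast; linarith⟩
    have m23 : f2 * f3 = 0 := by
      by_contra hh
      obtain ⟨z, hz1⟩ := i2 (left_ne_zero_of_mul hh)
      obtain ⟨w, hw⟩ := i3 (right_ne_zero_of_mul hh)
      exact hz ⟨w - z, by push_cast; linarith⟩
    unfold disc3 at hd
    have h27 : (27 : F) ≠ 0 := by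
      have : (27 : F) = 3 ^ 3 := by norm_num
      rw [this]; exact pow_ne_zero _ h3
    have h4 : (4 : F) ≠ 0 := by
      have : (4 : F) = 2 ^ 2 := by norm_num
      rw [this]; exact pow_ne_zero _ h2
    by_cases c0 : f0 = 0
    · by_cases c1 : f1 = 0
      · exact fin0 c0 c1
      · have c2 : f2 = 0 := (mul_eq_zero.1 m12).resolve_left c1
        have : 4 * f1 ^ 3 * f3 = 0 := by
          rw [c0, c2] at hd; linear_combination -hd
        have c3 : f3 = 0 := (mul_eq_zero.1 this).resolve_left (mul_ne_zero h4 (pow_ne_zero _ c1))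
        exact fin1 c3 c2
    · have c1 : f1 = 0 := (mul_eq_zero.1 m01).resolve_left c0
      rcases mul_eq_zero.1 m23 with c2 | c3
      · have : 27 * f0 ^ 2 * f3 ^ 2 = 0 := by
          rw [c1, c2] at hd; linear_combination -hd
        have c3 := (mul_eq_zero.1 this).resolve_left (mul_ne_zero h27 (pow_ne_zero _ c0))
        exact fin1 (pow_eq_zero_iff two_ne_zero |>.1 c3) c2
      · have : 4 * f0 * f2 ^ 3 = 0 := by
          rw [c1, c3] at hd; linear_combination -hd
        have c2 := (mul_eq_zero.1 this).resolve_left (mul_ne_zero h4 c0)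
        exact fin1 c3 (pow_eq_zero_iff three_ne_zero |>.1 c2)

open Filter Topology

theorem bd_mono {d d' : ℝ} (h : d ≤ d') {f : F[X]} (hf : bd d f) : bd d' f :=
  fun m hm => hf m (lt_of_le_of_lt h hm)

theorem bd_eventually (d w : ℝ) (f : F[X]) (hf : bd d f) (hw : w < 0 → lc d f = 0) :
    ∀ᶠ ε in 𝓝[>] (0 : ℝ), bd (d + ε * w) f := by
  rcases le_or_gt 0 w with h | h
  · filter_upwards [self_mem_nhdsWithin] with ε hε
    have : (0 : ℝ) < ε := hε
    exact bd_mono (by nlinarith) hf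
  · have h1 : ∀ᶠ ε in 𝓝 (0 : ℝ), (⌈d⌉ - 1 : ℝ) < d + ε * w := by
      have : Tendsto (fun ε : ℝ => d + ε * w) (𝓝 0) (𝓝 (d + 0 * w)) :=
        Continuous.tendsto (by fun_prop) 0
      apply this.eventually_const_lt
      have := Int.ceil_lt_add_one d
      linarith
    filter_upwards [mem_nhdsWithin_of_mem_nhds h1] with ε hε
    intro m hm
    rcases lt_trichotomy d m with h2 | h2 | h2
    · exact hf m h2
    · rw [← lc_nat, ← h2]; exact hw h
    · exfalso
      have h3 : (⌈d⌉ - 1 : ℝ) < m := lt_trans hε hm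
      have h4 : ⌈d⌉ - 1 < (m : ℤ) := by exact_mod_cast h3
      have h5 : (m : ℤ) < ⌈d⌉ := Int.lt_ceil.2 (by exact_mod_cast h2)
      omega

theorem improve (a b) (Y : Fin 2 → M3 F[X]) (hs : ∀ k, (Y k).IsSymm)
    (hab : ∑ i, a i = ∑ k, b k) (h2 : (2 : F) ≠ 0) (h3 : (3 : F) ≠ 0) (hB : Bd a b Y)
    (hD : D (lead a b Y) = 0) : ∃ g h a' b', GG g h ∧ ∑ i, a' i = ∑ k, b' k ∧
      ∑ i, a' i < ∑ i, a i ∧ Bd a' b' (act g h Y) := by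
  obtain ⟨g, h, l, m, hg, hh, hdet, hlm, hneg, hv⟩ := Unst_of_D a b (lead a b Y) (by
    intro k; ext i j
    have := (hs k).apply i j
    simp [lead, this, add_comm (a j)]) (lead_hom a b Y) hab h2 h3 hD
  obtain ⟨G, hG1, hG2⟩ := lift_exists a g hg
  obtain ⟨H, hH1, hH2⟩ := lift_exists b h hh
  obtain ⟨l1, l2⟩ := lead_act a a b b G H Y hB hG1 hH1
  rw [hG2, hH2] at l2
  have hA : (G, H) ∈ AutT a b := ⟨hG1, hH1, by dsimp only; rw [hG2, hH2]; exact hdet⟩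
  have ev : ∀ᶠ ε in 𝓝[>] (0 : ℝ), ∀ k i j,
      bd (a i + a j - b k + ε * (l i + l j - m k)) (act G H Y k i j) := by
    rw [eventually_all]; intro k
    rw [eventually_all]; intro i
    rw [eventually_all]; intro j
    apply bd_eventually _ _ _ (l1 k i j)
    intro hlt
    have := hv k i j hlt
    rw [← l2] at this
    exact this
  obtain ⟨ε, hε, hpos⟩ := (ev.and self_mem_nhdsWithin).exists
  have hpos : (0 : ℝ) < ε := hpos
  refine ⟨G, H, fun i => a i + ε * l i, fun k => b k + ε * m k, AutT.GG hA, ?_, ?_, ?_⟩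
  · simp only [Finset.sum_add_distrib, ← Finset.mul_sum, hab, hlm]
  · simp only [Finset.sum_add_distrib, ← Finset.mul_sum]
    nlinarith
  · intro k i j
    have := hε k i j
    convert this using 1
    ring

theorem Bd_nonneg (a b) (Y : Fin 2 → M3 F[X]) (hs : ∀ k, (Y k).IsSymm)
    (hab : ∑ i, a i = ∑ k, b k) (hB : Bd a b Y) (hD : D Y ≠ 0) :
    (∀ i, 0 ≤ a i) ∧ (∀ k, 0 ≤ b k) := by
  apply VF Y hs hD a b hab
  intro k i j hlt
  ext m
  rw [coeff_zero]
  apply hB k i j m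
  have : (0 : ℝ) ≤ m := Nat.cast_nonneg m
  linarith

theorem GG_mul {g g' : M3 F[X]} {h h' : M2 F[X]} (h1 : GG g h) (h2 : GG g' h') :
    GG (g * g') (h' * h) := by
  unfold GG at *
  rw [det_mul, det_mul]
  linear_combination (g'.det * h'.det) * h1 + h2

end exist2
end QC

namespace QC
open Matrix Polynomial
variable {F : Type} [Field F]

theorem closed_aux (P : Prop) (p : Fin 2 → Fin 3 → Fin 3 → ℕ) :
    IsClosed {z : (Fin 3 → ℝ) × (Fin 2 → ℝ) | P ∧ (∑ i, z.1 i = ∑ k, z.2 k) ∧ ∀ k i j, 1 ≤ p k i j →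
      (p k i j : ℝ) - 1 ≤ z.1 i + z.1 j - z.2 k} := by
  refine IsClosed.inter isClosed_const (IsClosed.inter (isClosed_eq (by fun_prop) (by fun_prop)) ?_)
  have : {z : (Fin 3 → ℝ) × (Fin 2 → ℝ) | ∀ k i j, 1 ≤ p k i j →
      (p k i j : ℝ) - 1 ≤ z.1 i + z.1 j - z.2 k} = ⋂ k, ⋂ i, ⋂ j,
          {z | 1 ≤ p k i j → (p k i j : ℝ) - 1 ≤ z.1 i + z.1 j - z.2 k} := by
    ext z; simp only [Set.mem_ofPred_eq, Set.mem_iInter]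
  show IsClosed {z : (Fin 3 → ℝ) × (Fin 2 → ℝ) | ∀ k i j, 1 ≤ p k i j →
      (p k i j : ℝ) - 1 ≤ z.1 i + z.1 j - z.2 k}
  rw [this]
  refine isClosed_iInter fun k => isClosed_iInter fun i => isClosed_iInter fun j => ?_
  by_cases h : 1 ≤ p k i j
  · simp only [h, true_imp_iff]
    exact isClosed_le (by fun_prop) (by fun_prop)
  · simp only [h, false_imp_iff]
    exact isClosed_const

theorem exists_min (X : Fin 2 → M3 F[X]) (hs : ∀ k, (X k).IsSymm) (hD : D X ≠ 0) :
    ∃ a b, (∑ i, a i = ∑ k, b k) ∧ (∃ g h, GG g h ∧ Bd a b (act g h X)) ∧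
      ∀ a' b', (∑ i, a' i = ∑ k, b' k) → (∃ g h, GG g h ∧ Bd a' b' (act g h X)) →
        ∑ i, a i ≤ ∑ i, a' i := by
  classical
  obtain ⟨N, hN⟩ : ∃ N : ℕ, ∀ k i j, (X k i j).natDegree ≤ N := by
    refine ⟨∑ k, ∑ i, ∑ j, (X k i j).natDegree, fun k i j => ?_⟩
    calc (X k i j).natDegree ≤ ∑ j, (X k i j).natDegree :=
          Finset.single_le_sum (f := fun j => (X k i j).natDegree) (fun _ _ => Nat.zero_le _) (Finset.mem_univ j)
      _ ≤ ∑ i, ∑ j, (X k i j).natDegree :=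
          Finset.single_le_sum (f := fun i => ∑ j, (X k i j).natDegree) (fun _ _ => Nat.zero_le _) (Finset.mem_univ i)
      _ ≤ _ := Finset.single_le_sum (f := fun k => ∑ i, ∑ j, (X k i j).natDegree) (fun _ _ => Nat.zero_le _) (Finset.mem_univ k)
  let n : ℝ := 6 * N
  let box : Set ((Fin 3 → ℝ) × (Fin 2 → ℝ)) := Set.Icc 0 (fun _ => n, fun _ => n)
  let Rz : (Fin 2 → Fin 3 → Fin 3 → Fin (12 * N + 2)) → Prop := fun p =>
    ∃ g h, GG g h ∧ ∀ k i j m, (p k i j : ℕ) ≤ m → (act g h X k i j).coeff m = 0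
  let C : (Fin 2 → Fin 3 → Fin 3 → Fin (12 * N + 2)) → Set ((Fin 3 → ℝ) × (Fin 2 → ℝ)) := fun p =>
    {z | Rz p ∧ (∑ i, z.1 i = ∑ k, z.2 k) ∧ ∀ k i j, 1 ≤ (p k i j : ℕ) →
      ((p k i j : ℕ) : ℝ) - 1 ≤ z.1 i + z.1 j - z.2 k}
  have hCc : ∀ p, IsClosed (C p) := fun p => closed_aux (Rz p) (fun k i j => (p k i j : ℕ))
  have hS1 : ∀ z : (Fin 3 → ℝ) × (Fin 2 → ℝ), (∑ i, z.1 i = ∑ k, z.2 k) →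
      (∑ i, z.1 i ≤ n) → (∃ g h, GG g h ∧ Bd z.1 z.2 (act g h X)) → z ∈ box ∩ ⋃ p, C p := by
    rintro ⟨a, b⟩ hab hle ⟨g, h, hgh, hB⟩
    simp only at hab hle hB
    obtain ⟨ha, hb⟩ := Bd_nonneg a b _ (act_symm g h X hs) hab hB (D_GG_deg hgh X hD).1
    have ha' : ∀ i, a i ≤ n := fun i => le_trans
      (Finset.single_le_sum (f := a) (fun i _ => ha i) (Finset.mem_univ i)) hle
    have hb' : ∀ i, b i ≤ n := fun i => le_trans
      (Finset.single_le_sum (f := b) (fun i _ => hb i) (Finset.mem_univ i)) (hab ▸ hle)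
    refine ⟨⟨⟨ha, hb⟩, ⟨ha', hb'⟩⟩, ?_⟩
    rw [Set.mem_iUnion]
    have hlt : ∀ k i j, ⌊a i + a j - b k + 1⌋₊ < 12 * N + 2 := by
      intro k i j
      rw [Nat.floor_lt' (by omega)]
      push_cast
      have := ha' i; have := ha' j; have := hb k
      simp only [n] at *
      linarith
    refine ⟨fun k i j => ⟨_, hlt k i j⟩, ⟨g, h, hgh, ?_⟩, hab, ?_⟩
    · intro k i j m hm
      apply hB k i j m
      have := Nat.lt_floor_add_one (a i + a j - b k + 1)
      have hm' : ((⌊a i + a j - b k + 1⌋₊ : ℕ) : ℝ) ≤ m := by exact_mod_cast hm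
      linarith
    · intro k i j hp
      have := Nat.floor_le (Nat.pos_of_floor_pos hp).le
      simp only
      linarith
  have hS2 : ∀ z ∈ box ∩ ⋃ p, C p, (∑ i, z.1 i = ∑ k, z.2 k) ∧
      (∃ g h, GG g h ∧ Bd z.1 z.2 (act g h X)) := by
    rintro z ⟨-, hz⟩
    rw [Set.mem_iUnion] at hz
    obtain ⟨p, ⟨g, h, hgh, hp⟩, hz1, hz2⟩ := hz
    refine ⟨hz1, g, h, hgh, fun k i j m hm => ?_⟩
    by_cases hpm : (p k i j : ℕ) ≤ m
    · exact hp k i j m hpm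
    · exfalso
      have := hz2 k i j (by omega)
      have h3 : (m : ℝ) + 1 ≤ ((p k i j : ℕ) : ℝ) := by exact_mod_cast (by omega : m + 1 ≤ (p k i j : ℕ))
      linarith
  have hcomp : IsCompact (box ∩ ⋃ p, C p) :=
    isCompact_Icc.inter_right (isClosed_iUnion_of_finite hCc)
  have hstart : ((fun _ => 2 * N, fun _ => 3 * N) : (Fin 3 → ℝ) × (Fin 2 → ℝ)) ∈ box ∩ ⋃ p, C p := by
    apply hS1
    · simp; ring
    · simp [n]; linarith
    · refine ⟨1, 1, by simp [GG], ?_⟩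
      rw [act_one]
      intro k i j m hm
      apply coeff_eq_zero_of_natDegree_lt
      have := hN k i j
      simp only at hm
      have h2 : (N : ℝ) < m := by linarith
      have h3 : N < m := by exact_mod_cast h2
      omega
  obtain ⟨z, hz, hmin⟩ := hcomp.exists_isMinOn ⟨_, hstart⟩
    (f := fun z : (Fin 3 → ℝ) × (Fin 2 → ℝ) => ∑ i, z.1 i) (by fun_prop)
  obtain ⟨h1, h2⟩ := hS2 z hz
  refine ⟨z.1, z.2, h1, h2, fun a' b' hab' hB' => ?_⟩
  by_cases hle : ∑ i, a' i ≤ n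
  · exact hmin (hS1 (a', b') hab' hle hB')
  · have h3 := hmin hstart
    simp only [Set.mem_ofPred_eq, Finset.sum_const, Finset.card_univ, Fintype.card_fin, nsmul_eq_mul] at h3
    push_cast at h3
    simp only [n] at hle
    linarith

theorem exists_red0 (X : Fin 2 → M3 F[X]) (hs : ∀ k, (X k).IsSymm) (hD : D X ≠ 0)
    (h2 : (2 : F) ≠ 0) (h3 : (3 : F) ≠ 0) :
    ∃ a b, (∑ i, a i = ∑ k, b k) ∧ ∃ g h, GG g h ∧ Red a b (act g h X) := by
  obtain ⟨a, b, hab, ⟨g, h, hgh, hB⟩, hmin⟩ := exists_min X hs hD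
  refine ⟨a, b, hab, g, h, hgh, hB, fun h0 => ?_⟩
  obtain ⟨g', h', a', b', hg', hab', hlt, hB'⟩ := improve a b _ (act_symm g h X hs) hab h2 h3 hB h0
  rw [act_act] at hB'
  exact absurd (hmin a' b' hab' ⟨_, _, GG_mul hg' hgh, hB'⟩) (not_le.mpr hlt)

theorem exists_red (X : Fin 2 → M3 F[X]) (hs : ∀ k, (X k).IsSymm) (hD : D X ≠ 0)
    (h2 : (2 : F) ≠ 0) (h3 : (3 : F) ≠ 0) :
    ∃ a b, Monotone a ∧ Monotone b ∧ (∑ i, a i = ∑ k, b k) ∧ ∃ g h, GG g h ∧ Red a b (act g h X) := by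
  obtain ⟨a, b, hab, g, h, hgh, hB, hl⟩ := exists_red0 X hs hD h2 h3
  set Y := act g h X with hY
  let σ := Tuple.sort a
  let τ := Tuple.sort b
  refine ⟨a ∘ σ, b ∘ τ, Tuple.monotone_sort a, Tuple.monotone_sort b, ?_, ?_⟩
  · simp only [Function.comp]
    rw [Equiv.sum_comp σ a, Equiv.sum_comp τ b, hab]
  have key : ∀ Z : Fin 2 → M3 F[X], (Z = fun k => of fun i j => Y (τ k) (σ i) (σ j)) → Red (a ∘ σ) (b ∘ τ) Z := by
    rintro Z rfl
    refine ⟨fun k i j => hB (τ k) (σ i) (σ j), ?_⟩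
    have : lead (a ∘ σ) (b ∘ τ) (fun k => of fun i j => Y (τ k) (σ i) (σ j))
        = fun k => of fun i j => lead a b Y (τ k) (σ i) (σ j) := rfl
    rw [this, D_perm]
    exact hl
  have e1 : act (σ.permMatrix F[X]) (τ.permMatrix F[X])ᵀ Y = _ := act_perm σ τ Y
  have d1 : (σ.permMatrix F[X]).det * ((τ.permMatrix F[X])ᵀ).det = 1 ∨
     (-(σ.permMatrix F[X])).det * ((τ.permMatrix F[X])ᵀ).det = 1 := by
    rw [det_neg, det_transpose, det_permutation, det_permutation]
    rcases Int.units_eq_one_or (Equiv.Perm.sign σ) with h | h <;>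
    rcases Int.units_eq_one_or (Equiv.Perm.sign τ) with h' | h' <;> simp [h, h', pow_succ]
  rcases d1 with d1 | d1
  · refine ⟨σ.permMatrix F[X] * g, h * (τ.permMatrix F[X])ᵀ, GG_mul d1 hgh, ?_⟩
    rw [← act_act]
    exact key _ e1
  · refine ⟨-(σ.permMatrix F[X]) * g, h * (τ.permMatrix F[X])ᵀ, GG_mul d1 hgh, ?_⟩
    rw [← act_act]
    apply key
    rw [← e1, ← hY]
    funext k
    simp only [act, neg_mul, transpose_neg, mul_neg, neg_neg]

end QC

namespace QC
open Matrix Polynomial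

theorem orbit_count {G V : Type*} [Group G] [MulAction G V] (R : Set V) (A : Set G)
    (hA : ∀ x ∈ R, ∀ γ : G, γ • x ∈ R ↔ γ ∈ A) (x0 : V) (γ0 : G) (h0 : γ0 • x0 ∈ R) :
    (MulAction.orbit G x0 ∩ R).ncard * {g : G | g • x0 = x0}.ncard = A.ncard := by
  classical
  have hch : ∀ y : ↥(MulAction.orbit G x0 ∩ R), ∃ g : G, g • x0 = y := fun y => y.2.1
  choose c hc using hch
  have key : Nat.card (↥(MulAction.orbit G x0 ∩ R) × {g : G | g • x0 = x0}) = Nat.card A := by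
    let f : ↥(MulAction.orbit G x0 ∩ R) × {g : G | g • x0 = x0} → A := fun p =>
      ⟨c p.1 * p.2.1 * γ0⁻¹, (hA _ h0 _).1 (by
        rw [smul_smul, inv_mul_cancel_right, mul_smul, p.2.2, hc]
        exact p.1.2.2)⟩
    apply Nat.card_congr (Equiv.ofBijective f ⟨?_, ?_⟩)
    · rintro ⟨y, s, hs⟩ ⟨y', s', hs'⟩ h
      have h1 : c y * s * γ0⁻¹ = c y' * s' * γ0⁻¹ := congrArg Subtype.val h
      have h2 : c y * s = c y' * s' := mul_right_cancel h1
      have h3 : (y : V) = y' := by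
        have e := congrArg (fun g : G => g • x0) h2
        simp only [mul_smul] at e
        have e1 : s • x0 = x0 := hs
        have e2 : s' • x0 = x0 := hs'
        rw [e1, e2, hc, hc] at e
        exact e
      have h4 : y = y' := Subtype.ext h3
      subst h4
      have h5 : s = s' := mul_left_cancel h2
      subst h5
      rfl
    · rintro ⟨γ, hγ⟩
      have hm := (hA _ h0 γ).2 hγ
      let y : ↥(MulAction.orbit G x0 ∩ R) := ⟨γ • γ0 • x0, ⟨γ * γ0, by simp [mul_smul]⟩, hm⟩
      have e3 : c y • x0 = γ • γ0 • x0 := hc y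
      refine ⟨⟨y, (c y)⁻¹ * (γ * γ0), ?_⟩, ?_⟩
      · show ((c y)⁻¹ * (γ * γ0)) • x0 = x0
        rw [mul_smul, mul_smul, ← e3, inv_smul_smul]
      · apply Subtype.ext
        show c y * ((c y)⁻¹ * (γ * γ0)) * γ0⁻¹ = γ
        group
  rw [Nat.card_prod] at key
  exact key

theorem count_abstract {G V τ : Type*} [Group G] [MulAction G V] (m : ℕ) (reps : Fin m → V)
    (T : Finset τ) (R : τ → Set V) (A : τ → Set G)
    (h1 : ∀ i j, (∃ g : G, g • reps i = reps j) → i = j)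
    (hR : ∀ i, ∃ t ∈ T, ∃ g : G, g • reps i ∈ R t)
    (hu : ∀ i, ∀ t ∈ T, ∀ t' ∈ T, ∀ g g' : G, g • reps i ∈ R t → g' • reps i ∈ R t' → t = t')
    (hcov : ∀ t ∈ T, ∀ x ∈ R t, ∃ i, ∃ g : G, g • reps i = x)
    (hA : ∀ t ∈ T, ∀ x ∈ R t, ∀ γ : G, γ • x ∈ R t ↔ γ ∈ A t)
    (hfA : ∀ t ∈ T, (A t).Finite) (hfR : ∀ t ∈ T, (R t).Finite)
    (hst : ∀ i, {g : G | g • reps i = reps i}.Finite) :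
    ∑ i : Fin m, (1 : ℚ) / ({g : G | g • reps i = reps i}.ncard)
      = ∑ t ∈ T, ((R t).ncard : ℚ) / (A t).ncard := by
  classical
  choose ty hty γ hγ using hR
  rw [← Finset.sum_fiberwise_of_maps_to (s := Finset.univ) (t := T) (g := ty) (fun i _ => hty i)]
  refine Finset.sum_congr rfl fun t ht => ?_
  have hfin : ∀ i, (MulAction.orbit G (reps i) ∩ R t).Finite := fun i => (hfR t ht).inter_of_right _
  have e1 : (R t).ncard = ∑ i ∈ Finset.univ.filter (fun i => ty i = t), (MulAction.orbit G (reps i) ∩ R t).ncard := by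
    rw [Set.ncard_eq_toFinset_card _ (hfR t ht)]
    have : (hfR t ht).toFinset = (Finset.univ.filter (fun i => ty i = t)).biUnion fun i => (hfin i).toFinset := by
      ext x
      simp only [Set.Finite.mem_toFinset, Finset.mem_biUnion, Finset.mem_filter, Finset.mem_univ, true_and,
        Set.mem_inter_iff]
      constructor
      · intro hx
        obtain ⟨i, g, rfl⟩ := hcov t ht x hx
        exact ⟨i, hu i _ (hty i) _ ht _ _ (hγ i) hx, ⟨g, rfl⟩, hx⟩
      · rintro ⟨i, -, -, h⟩
        exact h
    rw [this, Finset.card_biUnion]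
    · exact Finset.sum_congr rfl fun i _ => (Set.ncard_eq_toFinset_card _ (hfin i)).symm
    · intro i _ j _ hij
      show Disjoint _ _
      rw [Finset.disjoint_left]
      intro x hx hx'
      simp only [Set.Finite.mem_toFinset, Set.mem_inter_iff] at hx hx'
      obtain ⟨⟨g, hg⟩, -⟩ := hx
      obtain ⟨⟨g', hg'⟩, -⟩ := hx'
      apply hij
      apply h1
      refine ⟨g'⁻¹ * g, ?_⟩
      simp only at hg hg'
      rw [mul_smul, hg, ← hg', inv_smul_smul]
  rw [e1, Nat.cast_sum, Finset.sum_div]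
  refine Finset.sum_congr rfl fun i hi => ?_
  have hi' : ty i = t := (Finset.mem_filter.1 hi).2
  have h3 := hγ i
  rw [hi'] at h3
  have h4 := orbit_count (R t) (A t) (hA t ht) (reps i) (γ i) h3
  have h5 : {g : G | g • reps i = reps i}.ncard ≠ 0 := by
    exact Set.ncard_ne_zero_of_mem (one_smul _ _ : (1 : G) • reps i = reps i) (hst i)
  have h6 : (A t).ncard ≠ 0 := by
    exact Set.ncard_ne_zero_of_mem ((hA t ht _ h3 1).1 (by rw [one_smul]; exact h3)) (hfA t ht)
  rw [div_eq_div_iff (by exact_mod_cast h5) (by exact_mod_cast h6), one_mul]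
  exact_mod_cast h4.symm

variable {F : Type} [Field F]

/-- the group G₄ -/
def G4 (R : Type) [CommRing R] : Subgroup (GL (Fin 3) R × GL (Fin 2) R) where
  carrier := {g | g4mem g}
  one_mem' := by simp [g4mem]
  mul_mem' := by
    intro g h hg hh
    simp only [g4mem, Set.mem_ofPred_eq, Prod.fst_mul, Prod.snd_mul, Units.val_mul, det_mul] at *
    rw [hg, hh]
  inv_mem' := by
    intro g hg
    have hg : GeneralLinearGroup.det g.1 = GeneralLinearGroup.det g.2 := Units.ext hg
    have : GeneralLinearGroup.det g.1⁻¹ = GeneralLinearGroup.det g.2⁻¹ := by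
      rw [map_inv, map_inv, hg]
    exact congrArg Units.val this

/-- vector form of a pair -/
def vec {R : Type} (v : M3 R × M3 R) : Fin 2 → M3 R := ![v.1, v.2]
/-- pair form -/
def pr {R : Type} (X : Fin 2 → M3 R) : M3 R × M3 R := (X 0, X 1)
theorem vec_pr {R : Type} (X : Fin 2 → M3 R) : vec (pr X) = X := by
  funext k; fin_cases k <;> rfl
theorem pr_vec {R : Type} (X : M3 R × M3 R) : pr (vec X) = X := rfl

/-- second matrix -/
def hm {R : Type} [CommRing R] (g : GL (Fin 3) R × GL (Fin 2) R) : M2 R := ↑(g.2⁻¹)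
/-- first matrix -/
def gm {R : Type} [CommRing R] (g : GL (Fin 3) R × GL (Fin 2) R) : M3 R := ↑(g.1)

theorem g4act_eq {R : Type} [CommRing R] (g : GL (Fin 3) R × GL (Fin 2) R) (v : M3 R × M3 R) :
    g4act g v = pr (act (gm g) (hm g) (vec v)) := rfl

instance instAct (R : Type) [CommRing R] : MulAction (G4 R) (M3 R × M3 R) where
  smul g v := g4act g.1 v
  one_smul v := by
    show g4act _ _ = _
    rw [g4act_eq]
    have : act (gm (1 : GL (Fin 3) R × GL (Fin 2) R)) (hm 1) (vec v) = vec v := by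
      have h1 : gm (1 : GL (Fin 3) R × GL (Fin 2) R) = 1 := rfl
      have h2 : hm (1 : GL (Fin 3) R × GL (Fin 2) R) = 1 := by simp [hm]
      rw [h1, h2, act_one]
    exact congrArg pr this
  mul_smul g h v := by
    show g4act _ _ = g4act _ (g4act _ _)
    rw [g4act_eq, g4act_eq, g4act_eq, vec_pr, act_act]
    have h1 : gm ((g * h : G4 R) : GL (Fin 3) R × GL (Fin 2) R) = gm g.1 * gm h.1 := rfl
    have h2 : hm ((g * h : G4 R) : GL (Fin 3) R × GL (Fin 2) R) = hm h.1 * hm g.1 := by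
      simp [hm]
    rw [h1, h2]

theorem smul_def (g : G4 F[X]) (v : M3 F[X] × M3 F[X]) : g • v = pr (act (gm g.1) (hm g.1) (vec v)) := rfl
theorem vec_smul (g : G4 F[X]) (v : M3 F[X] × M3 F[X]) : vec (g • v) = act (gm g.1) (hm g.1) (vec v) := by
  rw [smul_def, vec_pr]

theorem GG_of (g : G4 F[X]) : GG (gm g.1) (hm g.1) := by
  have h1 : g4mem g.1 := g.2
  unfold g4mem at h1
  unfold GG gm hm
  rw [h1, ← det_mul, ← Units.val_mul, mul_inv_cancel, Units.val_one, det_one]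

theorem exists_G4 {g : M3 F[X]} {h : M2 F[X]} (hh : GG g h) : ∃ γ : G4 F[X], gm γ.1 = g ∧ hm γ.1 = h := by
  have hg : IsUnit g.det := IsUnit.of_mul_eq_one _ hh
  have hu : IsUnit h.det := IsUnit.of_mul_eq_one g.det (by rw [mul_comm]; exact hh)
  let γ1 := GeneralLinearGroup.mk'' g hg
  let γ2 := GeneralLinearGroup.mk'' h hu
  have e : g4mem (γ1, γ2⁻¹) := by
    have h1 : γ1.det * γ2.det = 1 := Units.ext hh
    have : γ1.det = (γ2⁻¹).det := by rw [map_inv]; exact eq_inv_of_mul_eq_one_left h1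
    exact congrArg Units.val this
  refine ⟨⟨(γ1, γ2⁻¹), e⟩, rfl, ?_⟩
  simp only [hm, inv_inv]
  rfl

theorem gm_hm_inj {γ γ' : G4 F[X]} (h1 : gm γ.1 = gm γ'.1) (h2 : hm γ.1 = hm γ'.1) : γ = γ' := by
  apply Subtype.ext
  apply Prod.ext
  · exact Units.ext h1
  · exact inv_injective (Units.ext h2)

/-- symmetric reduced pairs -/
def RedS (a : Fin 3 → ℝ) (b : Fin 2 → ℝ) : Set (Fin 2 → M3 F[X]) := {X | (∀ k, (X k).IsSymm) ∧ Red a b X}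

/-- types -/
abbrev TY := (Fin 3 → ℝ) × (Fin 2 → ℝ)

/-- sorted types -/
def OKT (n : ℕ) (t : TY) : Prop := Monotone t.1 ∧ Monotone t.2 ∧ ∑ i, t.1 i = ∑ k, t.2 k ∧ 2 * ∑ i, t.1 i = n

theorem main_count (h2 : (2 : F) ≠ 0) (h3 : (3 : F) ≠ 0) (n : ℕ) (N : ℚ)
    (hN : IsWeightedG4OrbitCount {v : Matrix (Fin 3) (Fin 3) (Polynomial F) ×
                Matrix (Fin 3) (Fin 3) (Polynomial F) |
              v.1.IsSymm ∧ v.2.IsSymm ∧ disc4 v.1 v.2 ≠ 0 ∧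
                (disc4 v.1 v.2).natDegree = n} N)
    (T : Finset TY) (hT : ∀ t ∈ T, OKT n t)
    (hT' : ∀ t, OKT n t → (RedS (F := F) t.1 t.2).Nonempty → t ∈ T)
    (hfA : ∀ t ∈ T, (AutT (F := F) t.1 t.2).Finite) (hfR : ∀ t ∈ T, (RedS (F := F) t.1 t.2).Finite) :
    N = ∑ t ∈ T, ((RedS (F := F) t.1 t.2).ncard : ℚ) / (AutT (F := F) t.1 t.2).ncard := by
  obtain ⟨m, reps, hr1, hr2, hr3, hr4, rfl⟩ := hN
  have key := count_abstract (G := G4 F[X]) m reps T (fun t => {v | vec v ∈ RedS t.1 t.2})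
    (fun t => {γ | (gm γ.1, hm γ.1) ∈ AutT t.1 t.2}) ?_ ?_ ?_ ?_ ?_ ?_ ?_ ?_
  · have e1 : ∀ i, {g : G4 F[X] | g • reps i = reps i}.ncard = {g | g4mem g ∧ g4act g (reps i) = reps i}.ncard := by
      intro i
      have : {g | g4mem g ∧ g4act g (reps i) = reps i} = Subtype.val '' {g : G4 F[X] | g • reps i = reps i} := by
        ext g
        constructor
        · rintro ⟨h1, h2⟩; exact ⟨⟨g, h1⟩, h2, rfl⟩
        · rintro ⟨g, h, rfl⟩; exact ⟨g.2, h⟩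
      rw [this, Set.ncard_image_of_injective _ Subtype.val_injective]
    simp only [e1] at key
    rw [key]
    refine Finset.sum_congr rfl fun t ht => ?_
    congr 2
    · rw [← Set.ncard_image_of_injective (f := vec)]
      · congr 1
        ext X
        constructor
        · rintro ⟨v, hv, rfl⟩; exact hv
        · intro hX; exact ⟨pr X, by rw [Set.mem_ofPred_eq, vec_pr]; exact hX, vec_pr X⟩
      · intro v w hvw
        rw [← pr_vec v, ← pr_vec w, hvw]
    · rw [← Set.ncard_image_of_injective (f := fun γ : G4 F[X] => (gm γ.1, hm γ.1))]
      · congr 1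
        ext ⟨g, h⟩
        constructor
        · rintro ⟨v, hv, hv'⟩; rw [← hv']; exact hv
        · intro hX
          obtain ⟨γ, e1, e2⟩ := exists_G4 (AutT.GG hX)
          refine ⟨γ, ?_, ?_⟩
          · rw [Set.mem_ofPred_eq, e1, e2]; exact hX
          · simp only [e1, e2]
      · intro v w hvw
        exact gm_hm_inj (congrArg Prod.fst hvw) (congrArg Prod.snd hvw)
  · rintro i j ⟨g, hg⟩
    exact hr2 i j ⟨g.1, g.2, hg⟩
  · intro i
    obtain ⟨s1, s2, s3, s4⟩ := hr1 i
    have hs : ∀ k, (vec (reps i) k).IsSymm := by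
      intro k; fin_cases k
      · exact s1
      · exact s2
    rw [disc4_eq] at s3 s4
    obtain ⟨a, b, ma, mb, hab, g, h, hgh, hred⟩ := exists_red (vec (reps i)) hs s3 h2 h3
    obtain ⟨γ, e1, e2⟩ := exists_G4 hgh
    have hmem : vec (γ • reps i) ∈ RedS a b := by
      rw [vec_smul, e1, e2]
      exact ⟨act_symm g h _ hs, hred⟩
    refine ⟨(a, b), hT' _ ⟨ma, mb, hab, ?_⟩ ⟨_, hmem⟩, γ, hmem⟩
    have d1 := (Red.natDegree hab hred).2
    rw [(D_GG_deg hgh (vec (reps i)) s3).2] at d1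
    rw [← d1]
    exact_mod_cast s4
  · intro i t ht t' ht' g g' hg hg'
    obtain ⟨m1, m2, m3, m4⟩ := hT t ht
    obtain ⟨m1', m2', m3', m4'⟩ := hT t' ht'
    have e : g' • reps i = (g' * g⁻¹) • (g • reps i) := by rw [smul_smul, inv_mul_cancel_right]
    rw [Set.mem_ofPred_eq, e, vec_smul] at hg'
    obtain ⟨q1, q2⟩ := type_uniq m3 m3' hg.1 m1 m1' m2 m2' (GG_of _) hg.2 hg'.2
    exact Prod.ext q1 q2
  · intro t ht x hx
    obtain ⟨m1, m2, m3, m4⟩ := hT t ht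
    obtain ⟨d0, d1⟩ := Red.natDegree m3 hx.2
    rw [m4] at d1
    obtain ⟨i, g, hg, hgx⟩ := hr3 x ⟨hx.1 0, hx.1 1, by rw [disc4_eq]; exact d0, by
      rw [disc4_eq]; exact_mod_cast d1⟩
    exact ⟨i, ⟨g, hg⟩, hgx⟩
  · intro t ht x hx γ
    obtain ⟨m1, m2, m3, m4⟩ := hT t ht
    simp only [Set.mem_ofPred_eq, vec_smul]
    constructor
    · intro h; exact mem_AutT (GG_of γ) hx.1 m3 hx.2 h.2
    · intro h; exact ⟨act_symm _ _ _ hx.1, AutT.red h hx.2⟩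
  · intro t ht
    refine Set.Finite.of_injOn (f := fun γ : G4 F[X] => (gm γ.1, hm γ.1)) (fun γ hγ => hγ) ?_ (hfA t ht)
    intro v _ w _ hvw
    exact gm_hm_inj (congrArg Prod.fst hvw) (congrArg Prod.snd hvw)
  · intro t ht
    refine Set.Finite.of_injOn (f := vec) (fun γ hγ => hγ) ?_ (hfR t ht)
    intro v _ w _ hvw
    rw [← pr_vec v, ← pr_vec w, hvw]
  · intro i
    refine Set.Finite.of_injOn (f := Subtype.val) (t := {g | g4mem g ∧ g4act g (reps i) = reps i})
      (fun γ hγ => ⟨γ.2, hγ⟩) ?_ (hr4 i)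
    exact Subtype.val_injective.injOn

end QC

namespace QC
open Matrix Polynomial
section cnt
variable {F : Type} [Field F] [Fintype F]

theorem count_bd {ι : Type} [Fintype ι] (d : ι → ℝ) (P : (ι → F) → Prop) :
    {f : ι → F[X] | (∀ i, bd (d i) (f i)) ∧ P (fun i => lc (d i) (f i))}.ncard =
      Fintype.card F ^ (∑ i, ⌈d i⌉₊) *
        {c : ι → F | (∀ i, c i ≠ 0 → ∃ m : ℕ, d i = m) ∧ P c}.ncard ∧
    {f : ι → F[X] | (∀ i, bd (d i) (f i)) ∧ P (fun i => lc (d i) (f i))}.Finite := by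
  classical
  let A := {f : ι → F[X] | (∀ i, bd (d i) (f i)) ∧ P (fun i => lc (d i) (f i))}
  let B := {c : ι → F | (∀ i, c i ≠ 0 → ∃ m : ℕ, d i = m) ∧ P c}
  let Φ : A → (∀ i, Fin ⌈d i⌉₊ → F) × B := fun f =>
    (fun i m => (f.1 i).coeff m, ⟨fun i => lc (d i) (f.1 i), fun i h => lc_ne h, f.2.2⟩)
  have hΦ : Function.Bijective Φ := by
    constructor
    · rintro ⟨f, hf⟩ ⟨g, hg⟩ h
      apply Subtype.ext
      funext i
      have h1 := congrFun (congrArg Prod.fst h) i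
      have h2 : lc (d i) (f i) = lc (d i) (g i) := congrFun (congrArg Subtype.val (congrArg Prod.snd h)) i
      ext m
      rcases lt_trichotomy (m : ℝ) (d i) with hm | hm | hm
      · exact congrFun h1 ⟨m, Nat.lt_ceil.2 hm⟩
      · rw [← hm, lc_nat, lc_nat] at h2
        exact h2
      · exact (hf.1 i m hm).trans (hg.1 i m hm).symm
    · rintro ⟨e, c, hc, hP⟩
      have low : ∀ i, (∑ m : Fin ⌈d i⌉₊, monomial (m : ℕ) (e i m)) |> fun p : F[X] =>
          (∀ m : Fin ⌈d i⌉₊, p.coeff m = e i m) ∧ (∀ m : ℕ, d i ≤ m → p.coeff m = 0) := by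
        intro i
        constructor
        · intro m
          simp only [finsetSum_coeff, coeff_monomial]
          rw [Finset.sum_eq_single m]
          · simp
          · intro m' _ hm'
            rw [if_neg]
            intro h; exact hm' (Fin.ext h)
          · simp
        · intro m hm
          simp only [finsetSum_coeff, coeff_monomial]
          apply Finset.sum_eq_zero
          intro m' _
          rw [if_neg]
          intro h
          have := Nat.lt_ceil.1 m'.2
          rw [h] at this
          linarith
      let f : ι → F[X] := fun i => (∑ m : Fin ⌈d i⌉₊, monomial (m : ℕ) (e i m)) + mono (d i) (c i)
      have hlc : ∀ i, lc (d i) (f i) = c i := by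
        intro i
        have h1 := mono_lc (d i) (c i) (hc i)
        rw [← h1]
        unfold lc
        split_ifs with hd
        · rw [coeff_add, (low i).2 _ hd.ge, zero_add]
        · rfl
      have hbd : ∀ i, bd (d i) (f i) := by
        intro i m hm
        rw [coeff_add, (low i).2 _ hm.le, mono_bd _ _ m hm, add_zero]
      have hf : f ∈ A := ⟨hbd, by simp only [hlc]; exact hP⟩
      refine ⟨⟨f, hf⟩, ?_⟩
      apply Prod.ext
      · funext i m
        show (f i).coeff m = e i m
        rw [coeff_add, (low i).1, mono]
        have := Nat.lt_ceil.1 m.2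
        split_ifs with hd
        · rw [coeff_monomial, if_neg, add_zero]
          intro h
          rw [← h, hd] at this
          exact lt_irrefl _ this
        · simp
      · apply Subtype.ext
        funext i
        exact hlc i
  have e := Equiv.ofBijective Φ hΦ
  constructor
  · have := Nat.card_congr e
    rw [Nat.card_prod, Nat.card_pi] at this
    have h3 : ∀ i, Nat.card (Fin ⌈d i⌉₊ → F) = Fintype.card F ^ ⌈d i⌉₊ := fun i => by simp
    simp only [h3] at this
    rw [Finset.prod_pow_eq_pow_sum] at this
    exact this
  · have : Finite A := Finite.of_equiv _ e.symm
    exact Set.toFinite A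

/-- row index of the upper triangular entry -/
def ii : Fin 6 → Fin 3 := ![0, 0, 0, 1, 1, 2]
/-- column index of the upper triangular entry -/
def jj : Fin 6 → Fin 3 := ![0, 1, 2, 1, 2, 2]
/-- symmetric matrix from its six entries -/
def sy {R : Type} (c : Fin 6 → R) : M3 R := !![c 0, c 1, c 2; c 1, c 3, c 4; c 2, c 4, c 5]
/-- entries of a symmetric matrix -/
def ys {R : Type} (A : M3 R) : Fin 6 → R := fun s => A (ii s) (jj s)

theorem sy_ys {R : Type} (A : M3 R) (h : A.IsSymm) : sy (ys A) = A := by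
  refine Matrix.ext fun i j => ?_
  have h10 : A 1 0 = A 0 1 := h.apply 0 1
  have h20 : A 2 0 = A 0 2 := h.apply 0 2
  have h21 : A 2 1 = A 1 2 := h.apply 1 2
  fin_cases i <;> fin_cases j <;> simp [sy, ys, ii, jj, h10, h20, h21]
theorem ys_sy {R : Type} (c : Fin 6 → R) : ys (sy c) = c := by
  funext s; fin_cases s <;> rfl
theorem sy_symm {R : Type} (c : Fin 6 → R) : (sy c).IsSymm := by
  refine Matrix.ext fun i j => ?_
  fin_cases i <;> fin_cases j <;> rfl

/-- number of nondegenerate homogeneous pairs -/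
noncomputable def Mc (F : Type) [Field F] (a : Fin 3 → ℝ) (b : Fin 2 → ℝ) : ℕ :=
  {c : Fin 2 × Fin 6 → F | (∀ p, c p ≠ 0 → ∃ m : ℕ, a (ii p.2) + a (jj p.2) - b p.1 = m) ∧
    D (fun k => sy (fun s => c (k, s))) ≠ 0}.ncard

theorem card_RedS (a b) : (RedS (F := F) a b).ncard =
    Fintype.card F ^ (∑ p : Fin 2 × Fin 6, ⌈a (ii p.2) + a (jj p.2) - b p.1⌉₊) * Mc F a b ∧
    (RedS (F := F) a b).Finite := by
  have c1 := add_comm (a 1) (a 0)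
  have c2 := add_comm (a 2) (a 0)
  have c3 := add_comm (a 2) (a 1)
  have key := count_bd (F := F) (fun p : Fin 2 × Fin 6 => a (ii p.2) + a (jj p.2) - b p.1)
    (fun c => D (fun k => sy (fun s => c (k, s))) ≠ 0)
  let f : (Fin 2 → M3 F[X]) → (Fin 2 × Fin 6 → F[X]) := fun X p => ys (X p.1) p.2
  let g : (Fin 2 × Fin 6 → F[X]) → (Fin 2 → M3 F[X]) := fun c k => sy (fun s => c (k, s))
  have him : RedS a b = g '' {f | (∀ p : Fin 2 × Fin 6, bd (a (ii p.2) + a (jj p.2) - b p.1) (f p)) ∧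
      D (fun k => sy (fun s => lc (a (ii s) + a (jj s) - b k) (f (k, s)))) ≠ 0} := by
    ext X
    constructor
    · rintro ⟨hs, hX, hD⟩
      have hgf : g (f X) = X := by funext k; exact sy_ys _ (hs k)
      refine ⟨f X, ⟨fun p => hX _ _ _, ?_⟩, hgf⟩
      have : (fun k => sy (fun s => lc (a (ii s) + a (jj s) - b k) (f X (k, s)))) = lead a b X := by
        funext k
        have : (lead a b X k).IsSymm := by
          refine Matrix.ext fun i j => ?_
          show lc (a j + a i - b k) (X k j i) = lc (a i + a j - b k) (X k i j)
          rw [(hs k).apply, add_comm (a j)]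
        rw [← sy_ys _ this]
        rfl
      rw [this]; exact hD
    · rintro ⟨c, ⟨h1, h2⟩, rfl⟩
      refine ⟨fun k => sy_symm _, ?_, ?_⟩
      · intro k i j
        have := fun s => h1 (k, s)
        have e0 := this 0; have e1 := this 1; have e2 := this 2
        have e3 := this 3; have e4 := this 4; have e5 := this 5
        simp only [ii, jj] at e0 e1 e2 e3 e4 e5
        fin_cases i <;> fin_cases j
        · exact e0
        · exact e1
        · exact e2
        · simpa [g, sy, c1, c2, c3] using e1
        · exact e3
        · exact e4
        · simpa [g, sy, c1, c2, c3] using e2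
        · simpa [g, sy, c1, c2, c3] using e4
        · exact e5
      · have : lead a b (g c) = (fun k => sy (fun s => lc (a (ii s) + a (jj s) - b k) (c (k, s)))) := by
          funext k
          refine Matrix.ext fun i j => ?_
          fin_cases i <;> fin_cases j <;> simp [lead, g, sy, ii, jj, c1, c2, c3]
        rw [this]; exact h2
  have ginj : Function.Injective g := by
    intro c c' h
    funext ⟨k, s⟩
    have := congrArg (fun X => ys (X k) s) h
    simp only [g, ys_sy] at this
    exact this
  rw [him, Set.ncard_image_of_injective _ ginj]
  exact ⟨key.1, key.2.image _⟩

/-- number of homogeneous automorphisms -/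
noncomputable def Pc (F : Type) [Field F] (a : Fin 3 → ℝ) (b : Fin 2 → ℝ) : ℕ :=
  {γ : M3 F × M2 F | HomM a γ.1 ∧ HomM b γ.2 ∧ γ.1.det * γ.2.det = 1}.ncard

theorem card_AutT (a b) : (AutT (F := F) a b).ncard =
    Fintype.card F ^ ((∑ p : Fin 3 × Fin 3, ⌈a p.1 - a p.2⌉₊) + ∑ p : Fin 2 × Fin 2, ⌈b p.1 - b p.2⌉₊)
      * Pc F a b ∧
    (AutT (F := F) a b).Finite := by
  let gg (R : Type) : ((Fin 3 × Fin 3) ⊕ (Fin 2 × Fin 2) → R) → M3 R × M2 R := fun c =>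
    (Matrix.of fun i j => c (Sum.inl (i, j)), Matrix.of fun i j => c (Sum.inr (i, j)))
  have ginj : ∀ R, Function.Injective (gg R) := by
    intro R c c' h
    have h1 := congrArg Prod.fst h
    have h2 := congrArg Prod.snd h
    funext p
    rcases p with ⟨i, j⟩ | ⟨i, j⟩
    · exact congrFun (congrFun h1 i) j
    · exact congrFun (congrFun h2 i) j
  have gsurj : ∀ R, Function.Surjective (gg R) := by
    rintro R ⟨g, h⟩
    exact ⟨fun p => p.elim (fun p => g p.1 p.2) (fun p => h p.1 p.2), rfl⟩
  let dd : (Fin 3 × Fin 3) ⊕ (Fin 2 × Fin 2) → ℝ := fun p =>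
    p.elim (fun p => a p.1 - a p.2) (fun p => b p.1 - b p.2)
  have key := count_bd (F := F) dd (fun c => (gg F c).1.det * (gg F c).2.det = 1)
  have him : AutT a b = gg F[X] '' {f | (∀ p, bd (dd p) (f p)) ∧
      (gg F (fun p => lc (dd p) (f p))).1.det * (gg F (fun p => lc (dd p) (f p))).2.det = 1} := by
    ext γ
    constructor
    · rintro ⟨h1, h2, h3⟩
      obtain ⟨c, rfl⟩ := gsurj _ γ
      refine ⟨c, ⟨?_, h3⟩, rfl⟩
      rintro (⟨i, j⟩ | ⟨i, j⟩)
      · exact h1 i j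
      · exact h2 i j
    · rintro ⟨c, ⟨h1, h3⟩, rfl⟩
      exact ⟨fun i j => h1 (Sum.inl (i, j)), fun i j => h1 (Sum.inr (i, j)), h3⟩
  have him2 : {γ : M3 F × M2 F | HomM a γ.1 ∧ HomM b γ.2 ∧ γ.1.det * γ.2.det = 1} = gg F ''
      {c | (∀ i, c i ≠ 0 → ∃ m : ℕ, dd i = m) ∧ (gg F c).1.det * (gg F c).2.det = 1} := by
    ext γ
    constructor
    · rintro ⟨h1, h2, h3⟩
      obtain ⟨c, rfl⟩ := gsurj _ γ
      refine ⟨c, ⟨?_, h3⟩, rfl⟩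
      rintro (⟨i, j⟩ | ⟨i, j⟩)
      · exact h1 i j
      · exact h2 i j
    · rintro ⟨c, ⟨h1, h3⟩, rfl⟩
      exact ⟨fun i j => h1 (Sum.inl (i, j)), fun i j => h1 (Sum.inr (i, j)), h3⟩
  unfold Pc
  rw [him, him2, Set.ncard_image_of_injective _ (ginj _), Set.ncard_image_of_injective _ (ginj _)]
  refine ⟨?_, key.2.image _⟩
  rw [key.1, Fintype.sum_sum_type]
  rfl

end cnt
end QC

namespace QC
open Matrix Polynomial
section cnt
variable {F : Type} [Field F] [Fintype F]

theorem shear_count {α : Type} [Finite α] (S : Set α) (v w : α → F) (s : F → α → α)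
    (hs : ∀ t, ∀ x ∈ S, s t x ∈ S) (hv : ∀ t, ∀ x ∈ S, v (s t x) = v x + t * w x)
    (hw : ∀ t, ∀ x ∈ S, w (s t x) = w x) (hw0 : ∀ x ∈ S, w x ≠ 0) (hinv : ∀ t, ∀ x, s (-t) (s t x) = x) :
    S.ncard = Fintype.card F * {x ∈ S | v x = 0}.ncard := by
  classical
  have e : S ≃ F × {x ∈ S | v x = 0} :=
    { toFun := fun x => (v x.1 / w x.1, ⟨s (-(v x.1 / w x.1)) x.1, hs _ _ x.2, by
        rw [hv _ _ x.2]; field_simp [hw0 _ x.2]; ring⟩)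
      invFun := fun p => ⟨s p.1 p.2.1, hs _ _ p.2.2.1⟩
      left_inv := by
        rintro ⟨x, hx⟩
        apply Subtype.ext
        have := hinv (-(v x / w x)) x
        rw [neg_neg] at this
        exact this
      right_inv := by
        rintro ⟨t, x, hx, hx0⟩
        have h1 : v (s t x) / w (s t x) = t := by
          rw [hv _ _ hx, hw _ _ hx, hx0, zero_add, mul_div_cancel_right₀ _ (hw0 _ hx)]
        simp only [h1, hinv] }
  have := Nat.card_congr e
  rw [Nat.card_prod, Nat.card_eq_fintype_card (α := F)] at this
  exact this

theorem line_count {α : Type} [Finite α] (S : Set α) (v w : α → F) (s : F → α → α) (p : α → α)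
    (hs : ∀ t, ∀ x ∈ S, s t x ∈ S) (hv : ∀ t, ∀ x ∈ S, v (s t x) = v x + t * w x)
    (hw : ∀ t, ∀ x ∈ S, w (s t x) = w x) (hinv : ∀ t, ∀ x, s (-t) (s t x) = x)
    (hp : ∀ x ∈ S, p x ∈ S) (hpp : ∀ x, p (p x) = x) (hpv : ∀ x ∈ S, v (p x) = w x)
    (hne : ∀ x ∈ S, ¬ (v x = 0 ∧ w x = 0)) :
    S.ncard = (Fintype.card F + 1) * {x ∈ S | v x = 0}.ncard := by
  have hpw : ∀ x ∈ S, w (p x) = v x := by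
    intro x hx; rw [← hpv _ (hp x hx), hpp]
  have h1 := shear_count {x ∈ S | w x ≠ 0} v w s
    (fun t x hx => ⟨hs t x hx.1, by rw [hw t x hx.1]; exact hx.2⟩) (fun t x hx => hv t x hx.1)
    (fun t x hx => hw t x hx.1) (fun x hx => hx.2) hinv
  have h2 : {x ∈ {x ∈ S | w x ≠ 0} | v x = 0} = {x ∈ S | v x = 0} := by
    ext x
    constructor
    · rintro ⟨⟨a, b⟩, c⟩; exact ⟨a, c⟩
    · rintro ⟨a, c⟩; exact ⟨⟨a, fun h => hne x a ⟨c, h⟩⟩, c⟩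
  have h3 : {x ∈ S | w x = 0}.ncard = {x ∈ S | v x = 0}.ncard := by
    have : {x ∈ S | v x = 0} = p '' {x ∈ S | w x = 0} := by
      ext x
      constructor
      · rintro ⟨a, c⟩; exact ⟨p x, ⟨hp x a, by rw [hpw x a, c]⟩, hpp x⟩
      · rintro ⟨y, ⟨a, c⟩, rfl⟩; exact ⟨hp y a, by rw [hpv y a, c]⟩
    rw [this, Set.ncard_image_of_injective]
    intro x y h
    rw [← hpp x, h, hpp]
  have h4 : S = {x ∈ S | w x ≠ 0} ∪ {x ∈ S | w x = 0} := by
    ext x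
    constructor
    · intro h
      by_cases hx : w x = 0
      · exact Or.inr ⟨h, hx⟩
      · exact Or.inl ⟨h, hx⟩
    · rintro (h | h) <;> exact h.1
  have h5 : S.ncard = {x ∈ S | w x ≠ 0}.ncard + {x ∈ S | w x = 0}.ncard := by
    conv_lhs => rw [h4]
    apply Set.ncard_union_eq _ (Set.toFinite _) (Set.toFinite _)
    rw [Set.disjoint_left]
    rintro x ⟨_, a⟩ ⟨_, b⟩
    exact a b
  rw [h5, h1, h2, h3]; ring

theorem split_count {α : Type} [Finite α] (P Q : α → Prop) :
    {x | P x}.ncard = {x | P x ∧ Q x}.ncard + {x | P x ∧ ¬ Q x}.ncard := by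
  classical
  rw [← Set.ncard_union_eq _ (Set.toFinite _) (Set.toFinite _)]
  · congr 1
    ext x
    simp only [Set.mem_union, Set.mem_ofPred_eq]
    tauto
  · rw [Set.disjoint_left]
    rintro x ⟨_, a⟩ ⟨_, b⟩
    exact b a

theorem fib_count {α β : Type} [Finite α] [Finite β] (P : α → Prop) (Q : α → β → Prop) (n : ℕ)
    (h : ∀ a, P a → {b | Q a b}.ncard = n) :
    {p : α × β | P p.1 ∧ Q p.1 p.2}.ncard = {a | P a}.ncard * n := by
  classical
  have e : {p : α × β | P p.1 ∧ Q p.1 p.2} ≃ Σ a : {a | P a}, {b | Q a.1 b} :=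
    { toFun := fun p => ⟨⟨p.1.1, p.2.1⟩, ⟨p.1.2, p.2.2⟩⟩
      invFun := fun x => ⟨(x.1.1, x.2.1), x.1.2, x.2.2⟩
      left_inv := fun p => rfl
      right_inv := fun x => rfl }
  have h1 := Nat.card_congr e
  haveI : Fintype {a | P a} := Fintype.ofFinite _
  rw [Nat.card_sigma] at h1
  have h2 : ∀ a : {a | P a}, Nat.card {b | Q a.1 b} = n := fun a => h a.1 a.2
  simp only [h2, Finset.sum_const, Finset.card_univ, smul_eq_mul] at h1
  rw [← Nat.card_eq_fintype_card] at h1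
  exact h1

theorem cnt_ne (c : F) : {x : F | x ≠ c}.ncard = Fintype.card F - 1 := by
  classical
  have : {x : F | x ≠ c} = {c}ᶜ := rfl
  rw [this, Set.ncard_compl, Set.ncard_singleton, Nat.card_eq_fintype_card]

theorem cnt_univ : {_x : F | True}.ncard = Fintype.card F := by
  have : {_x : F | True} = Set.univ := Set.ofPred_true
  rw [this, Set.ncard_univ, Nat.card_eq_fintype_card]

/-- pairs of symmetric matrices with nonzero discriminant and a condition -/
def NS (Q : (Fin 2 → M3 F) → Prop) : Set (Fin 2 → M3 F) := {X | (∀ k, (X k).IsSymm) ∧ D X ≠ 0 ∧ Q X}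

/-- row operation: row i += t * row j -/
def rop (i j : Fin 3) (t : F) (X : Fin 2 → M3 F) : Fin 2 → M3 F := act (transvection i j t) 1 X

omit [Fintype F] in
theorem rop_apply (i j : Fin 3) (t : F) (X : Fin 2 → M3 F) (k a b) : rop i j t X k a b =
    X k a b + (if a = i then t * X k j b else 0) + (if b = i then t * X k a j else 0) +
      (if a = i then if b = i then t * t * X k j j else 0 else 0) := by
  have h1 : rop i j t X k = transvection i j t * X k * (transvection i j t)ᵀ := by
    have h0 : ∀ k : Fin 2, (1 : M2 F) 0 k • X 0 + (1 : M2 F) 1 k • X 1 = X k :=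
      Fin.forall_fin_two.2 ⟨by simp, by simp⟩
    unfold rop act
    simp only [h0]
  have h2 : (transvection i j t)ᵀ = transvection j i t := by
    simp [transvection]
  rw [h1, h2]
  have h3 : ∀ (M : M3 F) a b, (transvection i j t * M) a b = M a b + if a = i then t * M j b else 0 := by
    intro M a b
    split_ifs with h
    · subst h; rw [transvection_mul_apply_same]
    · rw [transvection_mul_apply_of_ne _ _ _ _ h, add_zero]
  have h4 : ∀ (M : M3 F) a b, (M * transvection j i t) a b = M a b + if b = i then t * M a j else 0 := by
    intro M a b
    split_ifs with h
    · subst h; rw [mul_transvection_apply_same]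
    · rw [mul_transvection_apply_of_ne _ _ _ _ h, add_zero]
  rw [h4, h3, h3]
  split_ifs <;> ring

omit [Fintype F] in
theorem rop_mem {Q : (Fin 2 → M3 F) → Prop} {i j : Fin 3} (hij : i ≠ j) (t : F) (X : Fin 2 → M3 F)
    (hQ : (∀ k, (X k).IsSymm) → Q X → Q (rop i j t X)) (hX : X ∈ NS Q) : rop i j t X ∈ NS Q := by
  refine ⟨act_symm _ _ _ hX.1, ?_, hQ hX.1 hX.2.2⟩
  unfold rop
  rw [D_act, det_transvection_of_ne _ _ hij, det_one]
  simpa using hX.2.1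

omit [Fintype F] in
theorem rop_inv {i j : Fin 3} (hij : i ≠ j) (t : F) (X : Fin 2 → M3 F) : rop i j (-t) (rop i j t X) = X := by
  unfold rop
  rw [act_act, transvection_mul_transvection_same _ _ hij, neg_add_cancel, transvection_zero, mul_one, act_one]

/-- pencil operation X k += t X l -/
def pop (k l : Fin 2) (t : F) (X : Fin 2 → M3 F) : Fin 2 → M3 F := act 1 (transvection l k t) X

omit [Fintype F] in
theorem pop_apply (k l : Fin 2) (t : F) (X : Fin 2 → M3 F) (m a b) : pop k l t X m a b =
    X m a b + if m = k then t * X l a b else 0 := by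
  unfold pop act
  fin_cases m <;> fin_cases k <;> fin_cases l <;> simp [transvection, Matrix.single] <;> ring

omit [Fintype F] in
theorem pop_mem {Q : (Fin 2 → M3 F) → Prop} {i j : Fin 2} (hij : i ≠ j) (t : F) (X : Fin 2 → M3 F)
    (hQ : Q X → Q (pop i j t X)) (hX : X ∈ NS Q) : pop i j t X ∈ NS Q := by
  refine ⟨act_symm _ _ _ hX.1, ?_, hQ hX.2.2⟩
  unfold pop
  rw [D_act, det_transvection_of_ne _ _ hij.symm, det_one]
  simpa using hX.2.1

omit [Fintype F] in
theorem pop_inv {i j : Fin 2} (hij : i ≠ j) (t : F) (X : Fin 2 → M3 F) : pop i j (-t) (pop i j t X) = X := by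
  unfold pop
  rw [act_act, transvection_mul_transvection_same _ _ hij.symm, add_neg_cancel, transvection_zero, mul_one, act_one]

/-- permutation operation -/
def perm (σ : Equiv.Perm (Fin 3)) (τ : Equiv.Perm (Fin 2)) (X : Fin 2 → M3 F) : Fin 2 → M3 F :=
  fun k => Matrix.of fun i j => X (τ k) (σ i) (σ j)

omit [Fintype F] in
theorem perm_mem {Q : (Fin 2 → M3 F) → Prop} (σ τ) (X : Fin 2 → M3 F)
    (hQ : Q X → Q (perm σ τ X)) (hX : X ∈ NS Q) : perm σ τ X ∈ NS Q := by
  refine ⟨fun k => Matrix.ext fun i j => (hX.1 (τ k)).apply _ _, ?_, hQ hX.2.2⟩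
  unfold perm
  rw [D_perm]
  exact hX.2.1

theorem NS_sep (Q : (Fin 2 → M3 F) → Prop) (v : (Fin 2 → M3 F) → F) :
    {x ∈ NS Q | v x = 0} = NS (fun X => Q X ∧ v X = 0) := by
  ext X
  simp only [NS, Set.mem_ofPred_eq]
  tauto

theorem rop_count (Q : (Fin 2 → M3 F) → Prop) (i j : Fin 3) (hij : i ≠ j) (v w : (Fin 2 → M3 F) → F)
    (hQ : ∀ t X, (∀ k, (X k).IsSymm) → Q X → Q (rop i j t X) ∧ v (rop i j t X) = v X + t * w X ∧
      w (rop i j t X) = w X)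
    (hw : ∀ X, X ∈ NS Q → w X ≠ 0) :
    (NS Q).ncard = Fintype.card F * (NS (fun X => Q X ∧ v X = 0)).ncard := by
  rw [← NS_sep]
  exact shear_count (NS Q) v w (rop i j) (fun t x hx => rop_mem hij t x (fun h1 h2 => (hQ t x h1 h2).1) hx)
    (fun t x hx => (hQ t x hx.1 hx.2.2).2.1) (fun t x hx => (hQ t x hx.1 hx.2.2).2.2) hw (rop_inv hij)

theorem pop_count (Q : (Fin 2 → M3 F) → Prop) (i j : Fin 2) (hij : i ≠ j) (v w : (Fin 2 → M3 F) → F)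
    (hQ : ∀ t X, Q X → Q (pop i j t X) ∧ v (pop i j t X) = v X + t * w X ∧
      w (pop i j t X) = w X)
    (hw : ∀ X, X ∈ NS Q → w X ≠ 0) :
    (NS Q).ncard = Fintype.card F * (NS (fun X => Q X ∧ v X = 0)).ncard := by
  rw [← NS_sep]
  exact shear_count (NS Q) v w (pop i j) (fun t x hx => pop_mem hij t x (fun h2 => (hQ t x h2).1) hx)
    (fun t x hx => (hQ t x hx.2.2).2.1) (fun t x hx => (hQ t x hx.2.2).2.2) hw (pop_inv hij)

theorem rop_lines (Q : (Fin 2 → M3 F) → Prop) (i j : Fin 3) (hij : i ≠ j) (v w : (Fin 2 → M3 F) → F)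
    (hQ : ∀ t X, (∀ k, (X k).IsSymm) → Q X → Q (rop i j t X) ∧ v (rop i j t X) = v X + t * w X ∧
      w (rop i j t X) = w X)
    (hp : ∀ X, (∀ k, (X k).IsSymm) → Q X → Q (perm (Equiv.swap i j) 1 X) ∧ v (perm (Equiv.swap i j) 1 X) = w X)
    (hne : ∀ X, X ∈ NS Q → ¬ (v X = 0 ∧ w X = 0)) :
    (NS Q).ncard = (Fintype.card F + 1) * (NS (fun X => Q X ∧ v X = 0)).ncard := by
  rw [← NS_sep]
  exact line_count (NS Q) v w (rop i j) (perm (Equiv.swap i j) 1)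
    (fun t x hx => rop_mem hij t x (fun h1 h2 => (hQ t x h1 h2).1) hx)
    (fun t x hx => (hQ t x hx.1 hx.2.2).2.1) (fun t x hx => (hQ t x hx.1 hx.2.2).2.2) (rop_inv hij)
    (fun x hx => perm_mem _ _ x (fun h => (hp x hx.1 h).1) hx)
    (fun x => by funext k; refine Matrix.ext fun a b => ?_; simp [perm])
    (fun x hx => (hp x hx.1 hx.2.2).2) hne

theorem pop_lines (Q : (Fin 2 → M3 F) → Prop) (i j : Fin 2) (hij : i ≠ j) (v w : (Fin 2 → M3 F) → F)
    (hQ : ∀ t X, Q X → Q (pop i j t X) ∧ v (pop i j t X) = v X + t * w X ∧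
      w (pop i j t X) = w X)
    (hp : ∀ X, Q X → Q (perm 1 (Equiv.swap i j) X) ∧ v (perm 1 (Equiv.swap i j) X) = w X)
    (hne : ∀ X, X ∈ NS Q → ¬ (v X = 0 ∧ w X = 0)) :
    (NS Q).ncard = (Fintype.card F + 1) * (NS (fun X => Q X ∧ v X = 0)).ncard := by
  rw [← NS_sep]
  exact line_count (NS Q) v w (pop i j) (perm 1 (Equiv.swap i j))
    (fun t x hx => pop_mem hij t x (fun h2 => (hQ t x h2).1) hx)
    (fun t x hx => (hQ t x hx.2.2).2.1) (fun t x hx => (hQ t x hx.2.2).2.2) (pop_inv hij)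
    (fun x hx => perm_mem _ _ x (fun h => (hp x h).1) hx)
    (fun x => by funext k; refine Matrix.ext fun a b => ?_; simp [perm])
    (fun x hx => (hp x hx.2.2).2) hne

theorem NS_split (Q : (Fin 2 → M3 F) → Prop) (P : (Fin 2 → M3 F) → Prop) :
    (NS Q).ncard = (NS (fun X => Q X ∧ P X)).ncard + (NS (fun X => Q X ∧ ¬ P X)).ncard := by
  have := split_count (fun X => (∀ k, (X k).IsSymm) ∧ D X ≠ 0 ∧ Q X) P
  unfold NS
  rw [this]
  congr 2 <;> (ext X; simp only [Set.mem_ofPred_eq]; tauto)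

theorem NS_congr {Q Q' : (Fin 2 → M3 F) → Prop} (h : ∀ X, (∀ k, (X k).IsSymm) → D X ≠ 0 → (Q X ↔ Q' X)) :
    (NS Q).ncard = (NS Q').ncard := by
  congr 1
  ext X
  unfold NS
  simp only [Set.mem_ofPred_eq]
  constructor
  · rintro ⟨a, b, c⟩; exact ⟨a, b, (h X a b).1 c⟩
  · rintro ⟨a, b, c⟩; exact ⟨a, b, (h X a b).2 c⟩

end cnt
end QC

namespace QC
open Matrix Polynomial
section cnt
variable {F : Type} [Field F] [Fintype F]

/-- explicit pair -/
def mk (a b c d e f a' b' c' d' e' f' : F) : Fin 2 → M3 F :=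
  ![!![a, b, c; b, d, e; c, e, f], !![a', b', c'; b', d', e'; c', e', f']]

theorem mk_symm (a b c d e f a' b' c' d' e' f' : F) (k) : (mk a b c d e f a' b' c' d' e' f' k).IsSymm := by
  refine Matrix.ext fun i j => ?_
  fin_cases k <;> fin_cases i <;> fin_cases j <;> rfl

theorem mk_eta (X : Fin 2 → M3 F) (h : ∀ k, (X k).IsSymm) : X = mk (X 0 0 0) (X 0 0 1) (X 0 0 2) (X 0 1 1)
    (X 0 1 2) (X 0 2 2) (X 1 0 0) (X 1 0 1) (X 1 0 2) (X 1 1 1) (X 1 1 2) (X 1 2 2) := by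
  have h1 := (h 0).apply
  have h2 := (h 1).apply
  funext k
  refine Matrix.ext fun i j => ?_
  fin_cases k <;> fin_cases i <;> fin_cases j <;> first | rfl | exact h1 _ _ | exact h2 _ _

theorem D_mk (a b c d e f a' b' c' d' e' f' : F) : D (mk a b c d e f a' b' c' d' e' f') =
    256 * disc3 (a * (d * f - e * e) - b * (b * f - c * e) + c * (b * e - c * d))
      (a' * (d * f - e * e) - 2 * b' * (b * f - c * e) + 2 * c' * (b * e - c * d) + d' * (a * f - c * c)
        - 2 * e' * (a * e - b * c) + f' * (a * d - b * b))
      (a * (d' * f' - e' * e') - 2 * b * (b' * f' - c' * e') + 2 * c * (b' * e' - c' * d') + d * (a' * f' - c' * c')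
        - 2 * e * (a' * e' - b' * c') + f * (a' * d' - b' * b'))
      (a' * (d' * f' - e' * e') - b' * (b' * f' - c' * e') + c' * (b' * e' - c' * d')) := by
  rw [D_eq]
  congr 1
  unfold mk mixc
  congr 1
  all_goals
    simp [det_fin_three]
    try ring

theorem NS_param {β : Type} [Finite β] (Q : (Fin 2 → M3 F) → Prop) (P : β → Prop) (f : β → Fin 2 → M3 F)
    (g : (Fin 2 → M3 F) → β)
    (h1 : ∀ y, P y → f y ∈ NS Q) (h2 : ∀ X ∈ NS Q, P (g X) ∧ f (g X) = X) (h3 : ∀ y, P y → g (f y) = y) :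
    (NS Q).ncard = {y | P y}.ncard := by
  have : NS Q = f '' {y | P y} := by
    ext X
    constructor
    · intro h; exact ⟨g X, (h2 X h).1, (h2 X h).2⟩
    · rintro ⟨y, hy, rfl⟩; exact h1 y hy
  rw [this, Set.ncard_image_of_injOn]
  intro x hx y hy h
  rw [← h3 x hx, ← h3 y hy, h]

variable {s : ℕ} (hq : Fintype.card F = s + 2)
include hq

theorem c_ne (c : F) : {x : F | x ≠ c}.ncard = s + 1 := by
  rw [cnt_ne, hq]; rfl

theorem c_ne2 (c : F) (hc : c ≠ 0) : {x : F | x ≠ 0 ∧ x ≠ c}.ncard = s := by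
  classical
  have h := split_count (fun x : F => x ≠ 0) (fun x => x ≠ c)
  rw [c_ne hq] at h
  have : {x : F | x ≠ 0 ∧ ¬ x ≠ c} = {c} := by
    ext x
    simp only [Set.mem_ofPred_eq, Set.mem_singleton_iff, not_not]
    constructor
    · exact fun h => h.2
    · rintro rfl; exact ⟨hc, rfl⟩
  rw [this, Set.ncard_singleton] at h
  omega

/-- the basic affine count -/
theorem c_two (u v : F → F) (hu : ∀ x, u x = 0 ↔ x = 0) (hv : ∀ x, v x = 0 ↔ x = 0) :
    {p : (F × F) × F | p.2 ≠ 0 ∧ u p.1.1 + p.2 * v p.1.2 ≠ 0}.ncard = (s + 1) ^ 2 * (s + 2) := by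
  classical
  have e1 := split_count (fun p : (F × F) × F => p.2 ≠ 0 ∧ u p.1.1 + p.2 * v p.1.2 ≠ 0) (fun p => p.1.2 = 0)
  have e2 := split_count (fun p : (F × F) × F => (p.2 ≠ 0 ∧ u p.1.1 + p.2 * v p.1.2 ≠ 0) ∧ ¬ p.1.2 = 0) (fun p => p.1.1 = 0)
  have u0 := (hu 0).2 rfl
  have v0 := (hv 0).2 rfl
  have a1 : {p : (F × F) × F | (p.2 ≠ 0 ∧ u p.1.1 + p.2 * v p.1.2 ≠ 0) ∧ p.1.2 = 0}.ncard = (s + 1) * (s + 1) := by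
    have := fib_count (fun p : F × F => p.1 ≠ 0 ∧ p.2 = 0) (fun _ (x : F) => x ≠ 0) (s + 1) (fun _ _ => c_ne hq 0)
    have h2 := fib_count (fun p : F => p ≠ 0) (fun _ (x : F) => x = 0) 1 (fun _ _ => Set.ncard_singleton _)
    rw [c_ne hq] at h2
    rw [h2, mul_one] at this
    rw [← this]
    congr 1
    ext ⟨⟨x, y⟩, z⟩
    simp only [Set.mem_ofPred_eq, ne_eq]
    constructor
    · rintro ⟨⟨b, c⟩, rfl⟩; rw [v0, mul_zero, add_zero, hu] at c; tauto
    · rintro ⟨⟨a, rfl⟩, c⟩; rw [v0, mul_zero, add_zero, hu]; tauto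
  have a2 : {p : (F × F) × F | ((p.2 ≠ 0 ∧ u p.1.1 + p.2 * v p.1.2 ≠ 0) ∧ ¬ p.1.2 = 0) ∧ p.1.1 = 0}.ncard = (s + 1) * (s + 1) := by
    have := fib_count (fun p : F × F => p.1 = 0 ∧ p.2 ≠ 0) (fun _ (x : F) => x ≠ 0) (s + 1) (fun _ _ => c_ne hq 0)
    have h2 := fib_count (fun p : F => p = 0) (fun _ (x : F) => x ≠ 0) (s+1) (fun _ _ => c_ne hq 0)
    have h3 : {p : F | p = 0}.ncard = 1 := Set.ncard_singleton _
    rw [h3, one_mul] at h2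
    rw [h2] at this
    rw [← this]
    congr 1
    ext ⟨⟨x, y⟩, z⟩
    simp only [Set.mem_ofPred_eq, ne_eq]
    constructor
    · rintro ⟨⟨⟨b, c⟩, d⟩, rfl⟩; tauto
    · rintro ⟨⟨rfl, a⟩, c⟩; rw [u0, zero_add, mul_eq_zero, hv]; tauto
  have a3 : {p : (F × F) × F | ((p.2 ≠ 0 ∧ u p.1.1 + p.2 * v p.1.2 ≠ 0) ∧ ¬ p.1.2 = 0) ∧ ¬ p.1.1 = 0}.ncard = (s + 1) * (s + 1) * s := by
    have := fib_count (fun p : F × F => p.1 ≠ 0 ∧ p.2 ≠ 0) (fun p (x : F) => x ≠ 0 ∧ x ≠ - (u p.1 / v p.2)) s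
      (fun p hp => c_ne2 hq _ (neg_ne_zero.2 (div_ne_zero (fun h => hp.1 ((hu _).1 h)) (fun h => hp.2 ((hv _).1 h)))))
    have h2 := fib_count (fun p : F => p ≠ 0) (fun _ (x : F) => x ≠ 0) (s+1) (fun _ _ => c_ne hq 0)
    rw [c_ne hq] at h2
    rw [h2] at this
    rw [← this]
    congr 1
    ext ⟨⟨x, y⟩, z⟩
    simp only [Set.mem_ofPred_eq, ne_eq]
    have key : y ≠ 0 → (u x + z * v y = 0 ↔ z = - (u x / v y)) := by
      intro hy
      have hy' : v y ≠ 0 := fun h => hy ((hv _).1 h)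
      field_simp
      constructor
      · intro h; linear_combination h
      · intro h; linear_combination h
    constructor
    · rintro ⟨⟨⟨b, c⟩, d⟩, e⟩
      exact ⟨⟨e, d⟩, b, fun h => c ((key d).2 h)⟩
    · rintro ⟨⟨a, b⟩, c, d⟩
      exact ⟨⟨⟨c, fun h => d ((key b).1 h)⟩, b⟩, a⟩
  rw [e1, e2, a1, a2, a3]; ring

theorem c_fst (n : ℕ) {α : Type} [Finite α] (P : α → Prop) (h : {a | P a}.ncard = n) :
    {p : α × F | P p.1}.ncard = n * (s + 2) := by
  have := fib_count P (fun _ (x : F) => True) (s + 2) (fun _ _ => by rw [cnt_univ, hq])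
  rw [h] at this
  simpa using this

variable (h2 : (2 : F) ≠ 0) (h3 : (3 : F) ≠ 0)
include h2

theorem cub0 : {p : (F × F) × F | disc3 p.2 p.1.2 p.1.1 0 ≠ 0}.ncard = (s + 1) ^ 2 * (s + 2) := by
  have h1 := fib_count (fun p : F × F => p.1 ≠ 0) (fun p x => x ≠ p.2 ^ 2 / (4 * p.1)) (s + 1) (fun p _ => c_ne hq _)
  rw [c_fst hq (s + 1) (fun x : F => x ≠ 0) (c_ne hq 0)] at h1
  rw [show (s + 1) ^ 2 * (s + 2) = (s + 1) * (s + 2) * (s + 1) by ring, ← h1]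
  congr 1
  ext ⟨⟨c, b⟩, a⟩
  have e : disc3 a b c 0 = c ^ 2 * (b ^ 2 - 4 * a * c) := by unfold disc3; ring
  have h4 : (4 : F) ≠ 0 := by
    have : (4 : F) = 2 * 2 := by norm_num
    rw [this]; exact mul_ne_zero h2 h2
  simp only [Set.mem_ofPred_eq, ne_eq, e, mul_eq_zero, pow_eq_zero_iff (two_ne_zero (α := ℕ)), not_or]
  refine and_congr_right fun hc => not_congr ?_
  field_simp
  constructor
  · intro h; linear_combination -h
  · intro h; linear_combination -h

include h3
theorem cub : {p : ((F × F) × F) × F | disc3 p.2 p.1.2 p.1.1.1 p.1.1.2 ≠ 0}.ncard = (s + 1) ^ 2 * (s + 2) * (s + 3) := by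
  have e0 := split_count (fun p : ((F × F) × F) × F => disc3 p.2 p.1.2 p.1.1.1 p.1.1.2 ≠ 0) (fun p => p.2 ≠ 0)
  -- leading coefficient zero
  have a0 : {p : ((F × F) × F) × F | disc3 p.2 p.1.2 p.1.1.1 p.1.1.2 ≠ 0 ∧ ¬ p.2 ≠ 0}.ncard = (s + 1) ^ 2 * (s + 2) := by
    rw [← cub0 hq h2]
    have : {p : ((F × F) × F) × F | disc3 p.2 p.1.2 p.1.1.1 p.1.1.2 ≠ 0 ∧ ¬ p.2 ≠ 0} =
      (fun p : (F × F) × F => (((p.1.2, p.2), p.1.1), 0)) '' {p : (F × F) × F | disc3 p.2 p.1.2 p.1.1 0 ≠ 0} := by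
      ext ⟨⟨⟨c, d⟩, b⟩, a⟩
      have e : disc3 0 b c d = disc3 d c b 0 := by unfold disc3; ring
      simp only [Set.mem_ofPred_eq, Set.mem_image, Prod.exists, Prod.mk.injEq, not_not]
      constructor
      · rintro ⟨h, rfl⟩
        exact ⟨b, c, d, by rwa [← e], ⟨⟨rfl, rfl⟩, rfl⟩, rfl⟩
      · rintro ⟨b', c', d', h, ⟨⟨rfl, rfl⟩, rfl⟩, rfl⟩
        exact ⟨by rwa [e], rfl⟩
    rw [this, Set.ncard_image_of_injective]
    rintro ⟨⟨x, y⟩, z⟩ ⟨⟨x', y'⟩, z'⟩ h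
    simp only [Prod.mk.injEq] at h ⊢
    tauto
  have a1 : {p : ((F × F) × F) × F | disc3 p.2 p.1.2 p.1.1.1 p.1.1.2 ≠ 0 ∧ p.2 ≠ 0}.ncard = (s + 2) * ((s + 1) ^ 2 * (s + 2)) := by
    rw [shear_count {p : ((F × F) × F) × F | disc3 p.2 p.1.2 p.1.1.1 p.1.1.2 ≠ 0 ∧ p.2 ≠ 0} (fun p => p.1.2) (fun p => 3 * p.2)
      (fun t p => (((p.1.1.1 + 2 * t * p.1.2 + 3 * t ^ 2 * p.2, p.1.1.2 + t * p.1.1.1 + t ^ 2 * p.1.2 + t ^ 3 * p.2), p.1.2 + t * (3 * p.2)), p.2)), hq]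
    · congr 1
      rw [← c_two hq (fun x => 4 * x ^ 3) (fun x => 27 * x ^ 2)]
      · have : {x ∈ {p : ((F × F) × F) × F | disc3 p.2 p.1.2 p.1.1.1 p.1.1.2 ≠ 0 ∧ p.2 ≠ 0} | x.1.2 = 0} =
          (fun p : (F × F) × F => ((p.1, 0), p.2)) '' {p : (F × F) × F | p.2 ≠ 0 ∧ 4 * p.1.1 ^ 3 + p.2 * (27 * p.1.2 ^ 2) ≠ 0} := by
          ext ⟨⟨⟨c, d⟩, b⟩, a⟩
          have e : disc3 a 0 c d = - a * (4 * c ^ 3 + a * (27 * d ^ 2)) := by unfold disc3; ring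
          simp only [Set.mem_ofPred_eq, Set.mem_image, Prod.exists, Prod.mk.injEq]
          constructor
          · rintro ⟨⟨h, h'⟩, rfl⟩
            rw [e] at h
            exact ⟨c, d, a, ⟨h', fun h0 => h (by rw [h0, mul_zero])⟩, ⟨⟨rfl, rfl⟩, rfl⟩, rfl⟩
          · rintro ⟨c', d', a', ⟨h, h'⟩, ⟨⟨rfl, rfl⟩, rfl⟩, rfl⟩
            exact ⟨⟨by rw [e]; exact mul_ne_zero (neg_ne_zero.2 h) h', h⟩, rfl⟩
        rw [this, Set.ncard_image_of_injective]
        rintro ⟨⟨x, y⟩, z⟩ ⟨⟨x', y'⟩, z'⟩ h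
        simp only [Prod.mk.injEq] at h ⊢
        tauto
      · intro x
        have h4 : (4 : F) ≠ 0 := by
          have : (4 : F) = 2 * 2 := by norm_num
          rw [this]; exact mul_ne_zero h2 h2
        simp [h4]
      · intro x
        have h4 : (27 : F) ≠ 0 := by
          have : (27 : F) = 3 * 3 * 3 := by norm_num
          rw [this]; exact mul_ne_zero (mul_ne_zero h3 h3) h3
        simp [h4]
    · rintro t ⟨⟨⟨c, d⟩, b⟩, a⟩ ⟨h, h'⟩
      refine ⟨?_, h'⟩
      convert h using 1
      simp only [disc3]; ring
    · rintro t ⟨⟨⟨c, d⟩, b⟩, a⟩ h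
      rfl
    · rintro t ⟨⟨⟨c, d⟩, b⟩, a⟩ h
      rfl
    · rintro ⟨⟨⟨c, d⟩, b⟩, a⟩ ⟨h, h'⟩
      exact mul_ne_zero h3 h'
    · rintro t ⟨⟨⟨c, d⟩, b⟩, a⟩
      simp only [Prod.mk.injEq, and_true]
      refine ⟨⟨?_, ?_⟩, ?_⟩ <;> ring
  rw [e0, a0, a1]; ring

end cnt
end QC

namespace QC
open Matrix Polynomial
section cnt
variable {F : Type} [Field F] [Fintype F]

theorem ssym {X : Fin 2 → M3 F} (hs : ∀ k, (X k).IsSymm) : (∀ k, X k 1 0 = X k 0 1) ∧ (∀ k, X k 2 0 = X k 0 2) ∧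
    (∀ k, X k 2 1 = X k 1 2) := ⟨fun k => (hs k).apply _ _, fun k => (hs k).apply _ _, fun k => (hs k).apply _ _⟩

theorem F1 {Q : (Fin 2 → M3 F) → Prop} {X : Fin 2 → M3 F} (hX : X ∈ NS Q) (h1 : X 1 0 0 = 0) (h2 : X 1 0 1 = 0)
    (h3 : X 0 0 0 = 0) : X 0 0 1 ≠ 0 := fun h => hX.2.1 (D_F1 X hX.1 h1 h2 h3 h)
theorem F2 {Q : (Fin 2 → M3 F) → Prop} {X : Fin 2 → M3 F} (hX : X ∈ NS Q) (h1 : X 1 0 0 = 0) (h2 : X 1 0 1 = 0)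
    (h3 : X 1 0 2 = 0) (h4 : X 1 1 1 = 0) : X 1 1 2 ≠ 0 := fun h => hX.2.1 (D_F2 X hX.1 h1 h2 h3 h4 h)
theorem F3 {Q : (Fin 2 → M3 F) → Prop} {X : Fin 2 → M3 F} (hX : X ∈ NS Q) (h1 : X 1 0 0 = 0) (h2 : X 1 0 1 = 0)
    (h3 : X 0 0 0 = 0) : X 1 0 2 ≠ 0 := fun h => hX.2.1 (D_F3 X hX.1 h1 h2 h h3)

theorem n256 (h2 : (2 : F) ≠ 0) : (256 : F) ≠ 0 := by
  have : (256 : F) = 2 ^ 8 := by norm_num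
  rw [this]; exact pow_ne_zero _ h2

theorem c_prod {α β : Type} [Finite α] [Finite β] (P : α → Prop) (Q : β → Prop) :
    {p : α × β | P p.1 ∧ Q p.2}.ncard = {a | P a}.ncard * {b | Q b}.ncard :=
  fib_count P (fun _ b => Q b) _ (fun _ _ => rfl)

theorem D78 (h l a b c d : F) : D (mk 0 h 0 c 0 a 0 0 l d 0 b) = 256 * disc3 (a * h ^ 2) (b * h ^ 2) (c * l ^ 2) (d * l ^ 2) := by
  rw [D_mk]
  simp only [mul_zero, zero_mul, sub_zero, zero_sub, add_zero, zero_add]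
  unfold disc3
  ring

variable {s : ℕ} (hq : Fintype.card F = s + 2) (h2 : (2 : F) ≠ 0)
include hq h2

theorem M78 (E : Prop) : (NS (fun X : Fin 2 → M3 F => X 1 0 0 = 0 ∧ X 1 0 1 = 0 ∧ X 0 0 0 = 0 ∧ (E → X 1 1 1 = 0))).ncard =
    (s + 2) ^ 3 * (s + 1) ^ 2 * {p : ((F × F) × F) × F | disc3 p.2 p.1.2 p.1.1.1 p.1.1.2 ≠ 0 ∧ (E → p.1.1.2 = 0)}.ncard := by
  rw [rop_count _ 2 1 (by decide) (fun X => X 0 0 2) (fun X => X 0 0 1) ?_ (fun X hX => F1 hX hX.2.2.1 hX.2.2.2.1 hX.2.2.2.2.1),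
    rop_count _ 1 0 (by decide) (fun X => X 1 1 2) (fun X => X 1 0 2) ?_ (fun X hX => F3 hX hX.2.2.1.1 hX.2.2.1.2.1 hX.2.2.1.2.2.1),
    rop_count _ 2 0 (by decide) (fun X => X 0 1 2) (fun X => X 0 0 1) ?_ (fun X hX => F1 hX hX.2.2.1.1.1 hX.2.2.1.1.2.1 hX.2.2.1.1.2.2.1)]
  rotate_left
  · intro t X hs hQ
    obtain ⟨s1, s2, s3⟩ := ssym hs
    simp [rop_apply, s1, s2, s3, hQ]
    tauto
  · intro t X hs hQ
    obtain ⟨s1, s2, s3⟩ := ssym hs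
    simp [rop_apply, s1, s2, s3, hQ]
    tauto
  · intro t X hs hQ
    obtain ⟨s1, s2, s3⟩ := ssym hs
    simp [rop_apply, s1, s2, s3, hQ]
    tauto
  rw [NS_param (β := (F × F) × (((F × F) × F) × F)) _ (fun p => (p.1.1 ≠ 0 ∧ p.1.2 ≠ 0) ∧ (disc3 p.2.2 p.2.1.2 p.2.1.1.1 p.2.1.1.2 ≠ 0 ∧ (E → p.2.1.1.2 = 0)))
    (fun p => mk 0 p.1.1 0 (p.2.1.1.1 / p.1.2 ^ 2) 0 (p.2.2 / p.1.1 ^ 2) 0 0 p.1.2 (p.2.1.1.2 / p.1.2 ^ 2) 0 (p.2.1.2 / p.1.1 ^ 2))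
    (fun X => ((X 0 0 1, X 1 0 2), (((X 0 1 1 * X 1 0 2 ^ 2, X 1 1 1 * X 1 0 2 ^ 2), X 1 2 2 * X 0 0 1 ^ 2), X 0 2 2 * X 0 0 1 ^ 2)))]
  · rw [c_prod (fun p : F × F => p.1 ≠ 0 ∧ p.2 ≠ 0) (fun p : ((F × F) × F) × F => disc3 p.2 p.1.2 p.1.1.1 p.1.1.2 ≠ 0 ∧ (E → p.1.1.2 = 0)),
      c_prod (fun p : F => p ≠ 0) (fun p : F => p ≠ 0), c_ne hq, hq]
    ring
  · rintro ⟨⟨h, l⟩, ⟨⟨⟨c, d⟩, b⟩, a⟩⟩ ⟨⟨hh, hl⟩, hD, hE⟩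
    dsimp only at *
    refine ⟨mk_symm _ _ _ _ _ _ _ _ _ _ _ _, ?_, ?_⟩
    · rw [D78, div_mul_cancel₀ _ (pow_ne_zero 2 hl), div_mul_cancel₀ _ (pow_ne_zero 2 hl),
        div_mul_cancel₀ _ (pow_ne_zero 2 hh), div_mul_cancel₀ _ (pow_ne_zero 2 hh)]
      exact mul_ne_zero (n256 h2) hD
    · simp only [mk]
      simp
      tauto
  · rintro X ⟨hs, hD, ⟨⟨⟨h1, h2, h3, hE⟩, h4⟩, h5⟩, h6⟩
    have hX : X ∈ NS (fun _ => True) := ⟨hs, hD, trivial⟩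
    have n1 := F1 hX h1 h2 h3
    have n2 := F3 hX h1 h2 h3
    have e := mk_eta X hs
    simp only [h1, h2, h3, h4, h5, h6] at e
    refine ⟨⟨⟨n1, n2⟩, ?_, fun h => by simp [hE h]⟩, ?_⟩
    · intro h0
      apply hD
      rw [e, D78]
      exact mul_eq_zero_of_right _ h0
    · conv_rhs => rw [e]
      simp only [mul_div_cancel_right₀ _ (pow_ne_zero 2 n1), mul_div_cancel_right₀ _ (pow_ne_zero 2 n2)]
  · rintro ⟨⟨h, l⟩, ⟨⟨⟨c, d⟩, b⟩, a⟩⟩ ⟨⟨hh, hl⟩, hD, hE⟩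
    simp only at hh hl
    simp [mk, hh, hl]

end cnt
end QC

namespace QC
open Matrix Polynomial
section cnt
variable {F : Type} [Field F] [Fintype F]

theorem D5 (h l b c d : F) : D (mk h 0 0 b 0 c 0 0 0 0 l d) = 256 * (h ^ 4 * l ^ 4 * b) * (b * d ^ 2 + 4 * l ^ 2 * c) := by
  rw [D_mk]
  simp only [mul_zero, zero_mul, sub_zero, zero_sub, add_zero, zero_add]
  unfold disc3
  ring

theorem D3 (h l c d m : F) : D (mk h 0 0 0 d c 0 0 0 l 0 m) = 256 * (h ^ 4 * l ^ 3 * m ^ 2) * (4 * m * d ^ 2 + l * c ^ 2) := by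
  rw [D_mk]
  simp only [mul_zero, zero_mul, sub_zero, zero_sub, add_zero, zero_add]
  unfold disc3
  ring

theorem D2 (h B C E l m : F) : D (mk h 0 0 B C E 0 0 l m 0 0) = 256 * disc3 (h * (B * E - C ^ 2)) (m * h * E) (- (B * l ^ 2)) (- (m * l ^ 2)) := by
  rw [D_mk]
  simp only [mul_zero, zero_mul, sub_zero, zero_sub, add_zero, zero_add]
  unfold disc3
  ring

variable {s : ℕ} (hq : Fintype.card F = s + 2) (h2 : (2 : F) ≠ 0) (h3 : (3 : F) ≠ 0)
include hq h2

theorem M8 : (NS (fun X : Fin 2 → M3 F => X 1 0 0 = 0 ∧ X 1 0 1 = 0 ∧ X 0 0 0 = 0 ∧ X 1 1 1 = 0)).ncard =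
    (s + 1) ^ 4 * (s + 2) ^ 4 := by
  have := M78 (F := F) hq h2 True
  simp only [true_imp_iff] at this
  rw [this]
  have e : {p : ((F × F) × F) × F | disc3 p.2 p.1.2 p.1.1.1 p.1.1.2 ≠ 0 ∧ p.1.1.2 = 0} =
      (fun p : (F × F) × F => (((p.1.1, 0), p.1.2), p.2)) '' {p : (F × F) × F | disc3 p.2 p.1.2 p.1.1 0 ≠ 0} := by
    ext ⟨⟨⟨c, d⟩, b⟩, a⟩
    simp only [Set.mem_ofPred_eq, Set.mem_image, Prod.exists, Prod.mk.injEq]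
    constructor
    · rintro ⟨h, rfl⟩
      exact ⟨c, b, a, h, ⟨⟨rfl, rfl⟩, rfl⟩, rfl⟩
    · rintro ⟨b', c', d', h, ⟨⟨rfl, rfl⟩, rfl⟩, rfl⟩
      exact ⟨h, rfl⟩
  rw [e, Set.ncard_image_of_injective, cub0 hq h2]
  · ring
  · rintro ⟨⟨x, y⟩, z⟩ ⟨⟨x', y'⟩, z'⟩ h
    simp only [Prod.mk.injEq] at h ⊢
    tauto

theorem M5 : (NS (fun X : Fin 2 → M3 F => X 1 0 0 = 0 ∧ X 1 0 1 = 0 ∧ X 1 0 2 = 0 ∧ X 1 1 1 = 0)).ncard =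
    (s + 1) ^ 4 * (s + 2) ^ 4 := by
  have n0 : ∀ X : Fin 2 → M3 F, (∀ k, (X k).IsSymm) → D X ≠ 0 → X 1 0 0 = 0 → X 1 0 1 = 0 → X 1 0 2 = 0 → X 0 0 0 ≠ 0 :=
    fun X hs hD a b c d => hD (D_F3 X hs a b c d)
  have n1 : ∀ X : Fin 2 → M3 F, (∀ k, (X k).IsSymm) → D X ≠ 0 → X 1 0 0 = 0 → X 1 0 1 = 0 → X 1 0 2 = 0 → X 1 1 1 = 0 →
    X 0 0 1 = 0 → X 0 0 2 = 0 → X 0 1 1 ≠ 0 := by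
    intro X hs hD a b c d e f g
    apply hD
    rw [mk_eta X hs, D_mk]
    simp only [a, b, c, d, e, f, g, mul_zero, zero_mul, sub_zero, zero_sub, add_zero, zero_add, disc3]
    ring
  rw [rop_count _ 1 0 (by decide) (fun X => X 0 0 1) (fun X => X 0 0 0) ?_ (fun X hX => n0 X hX.1 hX.2.1 hX.2.2.1 hX.2.2.2.1 hX.2.2.2.2.1),
    rop_count _ 2 0 (by decide) (fun X => X 0 0 2) (fun X => X 0 0 0) ?_ (fun X hX => n0 X hX.1 hX.2.1 hX.2.2.1.1 hX.2.2.1.2.1 hX.2.2.1.2.2.1),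
    rop_count _ 2 1 (by decide) (fun X => X 0 1 2) (fun X => X 0 1 1) ?_ (fun X hX => n1 X hX.1 hX.2.1 hX.2.2.1.1.1 hX.2.2.1.1.2.1 hX.2.2.1.1.2.2.1 hX.2.2.1.1.2.2.2 hX.2.2.1.2 hX.2.2.2)]
  rotate_left
  iterate 3
    · intro t X hs hQ
      obtain ⟨s1, s2, s3⟩ := ssym hs
      simp [rop_apply, s1, s2, s3, hQ]
  rw [NS_param (β := ((F × F) × F) × F × F) _ (fun p => ((p.1.1.1 ≠ 0 ∧ p.1.1.2 ≠ 0) ∧ p.1.2 ≠ 0) ∧ (p.2.1 * 0 = 0 ∧ p.2.2 ≠ - p.1.2 * p.2.1 ^ 2 / (4 * p.1.1.2 ^ 2)))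
    (fun p => mk p.1.1.1 0 0 p.1.2 0 p.2.2 0 0 0 0 p.1.1.2 p.2.1)
    (fun X => (((X 0 0 0, X 1 1 2), X 0 1 1), (X 1 2 2, X 0 2 2)))]
  · rw [fib_count (fun p : (F × F) × F => (p.1.1 ≠ 0 ∧ p.1.2 ≠ 0) ∧ p.2 ≠ 0)
      (fun (q : (F × F) × F) (p : F × F) => p.1 * 0 = 0 ∧ p.2 ≠ - q.2 * p.1 ^ 2 / (4 * q.1.2 ^ 2)) ((s + 2) * (s + 1)),
      c_prod (fun p : F × F => p.1 ≠ 0 ∧ p.2 ≠ 0) (fun p : F => p ≠ 0),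
      c_prod (fun p : F => p ≠ 0) (fun p : F => p ≠ 0), c_ne hq, hq]
    · ring
    · intro q _
      rw [fib_count (fun p : F => p * 0 = 0) (fun p x => x ≠ - q.2 * p ^ 2 / (4 * q.1.2 ^ 2)) (s + 1) (fun p _ => c_ne hq _)]
      simp only [mul_zero]
      rw [cnt_univ, hq]
  · rintro ⟨⟨⟨h, l⟩, b⟩, d, c⟩ ⟨⟨⟨hh, hl⟩, hb⟩, -, hc⟩
    dsimp only at *
    refine ⟨mk_symm _ _ _ _ _ _ _ _ _ _ _ _, ?_, ?_⟩
    · rw [D5]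
      refine mul_ne_zero (mul_ne_zero (n256 h2) (mul_ne_zero (mul_ne_zero (pow_ne_zero _ hh) (pow_ne_zero _ hl)) hb)) ?_
      intro h0
      apply hc
      have h4 : (4 : F) ≠ 0 := by
        have : (4 : F) = 2 * 2 := by norm_num
        rw [this]; exact mul_ne_zero h2 h2
      field_simp
      linear_combination h0
    · simp [mk]
  · rintro X ⟨hs, hD, ⟨⟨⟨g1, g2, g3, g4⟩, g5⟩, g6⟩, g7⟩
    have hX : X ∈ NS (fun _ => True) := ⟨hs, hD, trivial⟩
    have e := mk_eta X hs
    simp only [g1, g2, g3, g4, g5, g6, g7] at e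
    have h4 : (4 : F) ≠ 0 := by
      have : (4 : F) = 2 * 2 := by norm_num
      rw [this]; exact mul_ne_zero h2 h2
    have hl := F2 hX g1 g2 g3 g4
    refine ⟨⟨⟨⟨n0 X hs hD g1 g2 g3, hl⟩, n1 X hs hD g1 g2 g3 g4 g5 g6⟩, mul_zero _, ?_⟩, e.symm⟩
    intro h0
    apply hD
    dsimp only at h0
    rw [e, D5, h0]
    field_simp
    ring
  · rintro ⟨⟨⟨h, l⟩, b⟩, d, c⟩ -
    simp [mk]

theorem M3a : (NS (fun X : Fin 2 → M3 F => (X 1 0 0 = 0 ∧ X 1 0 1 = 0 ∧ X 1 0 2 = 0) ∧ ¬ X 1 1 1 = 0)).ncard =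
    (s + 1) ^ 4 * (s + 2) ^ 5 := by
  have n0 : ∀ X : Fin 2 → M3 F, (∀ k, (X k).IsSymm) → D X ≠ 0 → X 1 0 0 = 0 → X 1 0 1 = 0 → X 1 0 2 = 0 → X 0 0 0 ≠ 0 :=
    fun X hs hD a b c d => hD (D_F3 X hs a b c d)
  rw [rop_count _ 1 0 (by decide) (fun X => X 0 0 1) (fun X => X 0 0 0) ?_ (fun X hX => n0 X hX.1 hX.2.1 hX.2.2.1.1 hX.2.2.1.2.1 hX.2.2.1.2.2),
    rop_count _ 2 0 (by decide) (fun X => X 0 0 2) (fun X => X 0 0 0) ?_ (fun X hX => n0 X hX.1 hX.2.1 hX.2.2.1.1.1 hX.2.2.1.1.2.1 hX.2.2.1.1.2.2),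
    rop_count _ 2 1 (by decide) (fun X => X 1 1 2) (fun X => X 1 1 1) ?_ (fun X hX => hX.2.2.1.1.2),
    pop_count _ 0 1 (by decide) (fun X => X 0 1 1) (fun X => X 1 1 1) ?_ (fun X hX => hX.2.2.1.1.1.2)]
  rotate_left
  · intro t X hQ
    simp [pop_apply, hQ]
  iterate 3
    · intro t X hs hQ
      obtain ⟨s1, s2, s3⟩ := ssym hs
      simp [rop_apply, s1, s2, s3, hQ]
  have h4 : (4 : F) ≠ 0 := by
    have : (4 : F) = 2 * 2 := by norm_num
    rw [this]; exact mul_ne_zero h2 h2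
  rw [NS_param (β := (F × F) × ((F × F) × F)) _ (fun p => (p.1.1 ≠ 0 ∧ p.1.2 ≠ 0) ∧ (p.2.2 ≠ 0 ∧ 4 * p.1.2 * p.2.1.1 ^ 2 + p.2.2 * p.2.1.2 ^ 2 ≠ 0))
    (fun p => mk p.1.1 0 0 0 p.2.1.1 p.2.1.2 0 0 0 p.2.2 0 p.1.2)
    (fun X => ((X 0 0 0, X 1 2 2), ((X 0 1 2, X 0 2 2), X 1 1 1)))]
  · rw [fib_count (fun p : F × F => p.1 ≠ 0 ∧ p.2 ≠ 0)
      (fun (q : F × F) (p : (F × F) × F) => p.2 ≠ 0 ∧ 4 * q.2 * p.1.1 ^ 2 + p.2 * p.1.2 ^ 2 ≠ 0) ((s + 1) ^ 2 * (s + 2)),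
      c_prod (fun p : F => p ≠ 0) (fun p : F => p ≠ 0), c_ne hq, hq]
    · ring
    · rintro q ⟨_, hq2⟩
      exact c_two hq (fun x => 4 * q.2 * x ^ 2) (fun x => x ^ 2) (by intro x; simp [h4, hq2]) (by intro x; simp)
  · rintro ⟨⟨h, m⟩, ⟨d, c⟩, l⟩ ⟨⟨hh, hm⟩, hl, hc⟩
    dsimp only at *
    refine ⟨mk_symm _ _ _ _ _ _ _ _ _ _ _ _, ?_, ?_⟩
    · rw [D3]
      exact mul_ne_zero (mul_ne_zero (n256 h2) (mul_ne_zero (mul_ne_zero (pow_ne_zero _ hh) (pow_ne_zero _ hl)) (pow_ne_zero _ hm))) hc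
    · simp [mk, hl]
  · rintro X ⟨hs, hD, ⟨⟨⟨⟨⟨g1, g2, g3⟩, g4⟩, g5⟩, g6⟩, g7⟩, g8⟩
    have hX : X ∈ NS (fun _ => True) := ⟨hs, hD, trivial⟩
    have e := mk_eta X hs
    simp only [g1, g2, g3, g5, g6, g7, g8] at e
    rw [e, D3] at hD
    refine ⟨⟨⟨?_, ?_⟩, g4, ?_⟩, e.symm⟩ <;> (intro h0; apply hD; dsimp only at h0; rw [h0]; ring)
  · rintro ⟨⟨h, m⟩, ⟨d, c⟩, l⟩ -
    simp [mk]

theorem M3_ : (NS (fun X : Fin 2 → M3 F => X 1 0 0 = 0 ∧ X 1 0 1 = 0 ∧ X 1 0 2 = 0)).ncard =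
    (s + 1) ^ 4 * (s + 2) ^ 4 * (s + 3) := by
  rw [NS_split _ (fun X => X 1 1 1 = 0), M3a hq h2, NS_congr (Q' := fun X => X 1 0 0 = 0 ∧ X 1 0 1 = 0 ∧ X 1 0 2 = 0 ∧ X 1 1 1 = 0)
    (fun X _ _ => by tauto), M5 hq h2]
  ring

theorem M4 : (NS (fun X : Fin 2 → M3 F => X 1 0 0 = 0 ∧ X 1 0 1 = 0 ∧ X 1 1 1 = 0)).ncard =
    (s + 1) ^ 4 * (s + 2) ^ 4 * (s + 3) := by
  rw [rop_lines _ 0 1 (by decide) (fun X => X 1 0 2) (fun X => X 1 1 2), hq, NS_congr (Q' := fun X => X 1 0 0 = 0 ∧ X 1 0 1 = 0 ∧ X 1 0 2 = 0 ∧ X 1 1 1 = 0)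
    (fun X _ _ => by tauto), M5 hq h2]
  · ring
  · intro t X hs hQ
    obtain ⟨s1, s2, s3⟩ := ssym hs
    simp [rop_apply, s1, s2, s3, hQ]
  · intro X hs hQ
    obtain ⟨s1, s2, s3⟩ := ssym hs
    simp [perm, Equiv.swap_apply_def, s1, s2, s3, hQ]
  · rintro X hX ⟨a, b⟩
    exact F2 hX hX.2.2.1 hX.2.2.2.1 a hX.2.2.2.2 b

include h3
theorem M7 : (NS (fun X : Fin 2 → M3 F => X 1 0 0 = 0 ∧ X 1 0 1 = 0 ∧ X 0 0 0 = 0)).ncard =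
    (s + 1) ^ 4 * (s + 2) ^ 4 * (s + 3) := by
  have := M78 (F := F) hq h2 False
  simp only [false_imp_iff, and_true] at this
  rw [this, cub hq h2 h3]
  ring

end cnt
end QC

namespace QC
open Matrix Polynomial
section cnt
variable {F : Type} [Field F] [Fintype F]
variable {s : ℕ} (hq : Fintype.card F = s + 2) (h2 : (2 : F) ≠ 0) (h3 : (3 : F) ≠ 0)
include hq h2 h3

theorem cub1 : {p : ((F × F) × F) × F | disc3 p.2 p.1.2 p.1.1.1 p.1.1.2 ≠ 0 ∧ ¬ p.1.1.2 = 0}.ncard = (s + 1) ^ 2 * (s + 2) ^ 2 := by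
  have e0 := split_count (fun p : ((F × F) × F) × F => disc3 p.2 p.1.2 p.1.1.1 p.1.1.2 ≠ 0) (fun p => p.1.1.2 = 0)
  have e : {p : ((F × F) × F) × F | disc3 p.2 p.1.2 p.1.1.1 p.1.1.2 ≠ 0 ∧ p.1.1.2 = 0} =
      (fun p : (F × F) × F => (((p.1.1, 0), p.1.2), p.2)) '' {p : (F × F) × F | disc3 p.2 p.1.2 p.1.1 0 ≠ 0} := by
    ext ⟨⟨⟨c, d⟩, b⟩, a⟩
    simp only [Set.mem_ofPred_eq, Set.mem_image, Prod.exists, Prod.mk.injEq]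
    constructor
    · rintro ⟨h, rfl⟩
      exact ⟨c, b, a, h, ⟨⟨rfl, rfl⟩, rfl⟩, rfl⟩
    · rintro ⟨b', c', d', h, ⟨⟨rfl, rfl⟩, rfl⟩, rfl⟩
      exact ⟨h, rfl⟩
  rw [e, Set.ncard_image_of_injective, cub0 hq h2, cub hq h2 h3] at e0
  · have : (s + 1) ^ 2 * (s + 2) * (s + 3) = (s + 1) ^ 2 * (s + 2) + (s + 1) ^ 2 * (s + 2) ^ 2 := by ring
    omega
  · rintro ⟨⟨x, y⟩, z⟩ ⟨⟨x', y'⟩, z'⟩ h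
    simp only [Prod.mk.injEq] at h ⊢
    tauto

theorem M2p : (NS (fun X : Fin 2 → M3 F => (((X 1 0 0 = 0 ∧ X 1 0 1 = 0) ∧ ¬ X 0 0 0 = 0) ∧ ¬ X 1 0 2 = 0) ∧ ¬ X 1 1 1 = 0)).ncard =
    (s + 1) ^ 4 * (s + 2) ^ 6 := by
  classical
  rw [rop_count _ 1 0 (by decide) (fun X => X 0 0 1) (fun X => X 0 0 0) ?_ (fun X hX => hX.2.2.1.1.2),
    rop_count _ 2 1 (by decide) (fun X => X 1 1 2) (fun X => X 1 1 1) ?_ (fun X hX => hX.2.2.1.2),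
    rop_count _ 2 0 (by decide) (fun X => X 1 2 2) (fun X => 2 * X 1 0 2) ?_ (fun X hX => mul_ne_zero h2 hX.2.2.1.1.1.2),
    pop_count _ 0 1 (by decide) (fun X => X 0 0 2) (fun X => X 1 0 2) ?_ (fun X hX => hX.2.2.1.1.1.1.2)]
  rotate_left
  · intro t X hQ
    simp [pop_apply, hQ]
  iterate 3
    · intro t X hs hQ
      obtain ⟨s1, s2, s3⟩ := ssym hs
      simp [rop_apply, s1, s2, s3, hQ]
      try ring
  rw [NS_param (β := (F × F) × (((F × F) × F) × F)) _ (fun p => (p.1.1 ≠ 0 ∧ p.1.2 ≠ 0) ∧ (disc3 p.2.2 p.2.1.2 p.2.1.1.1 p.2.1.1.2 ≠ 0 ∧ ¬ p.2.1.1.2 = 0))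
    (fun p => mk (if p.2.1.2 * p.2.1.1.1 / p.2.1.1.2 - p.2.2 = 0 then p.1.2 else (p.2.1.2 * p.2.1.1.1 / p.2.1.1.2 - p.2.2) / p.1.2 ^ 2)
      0 0 (- p.2.1.1.1 / p.1.1 ^ 2) (if p.2.1.2 * p.2.1.1.1 / p.2.1.1.2 - p.2.2 = 0 then 0 else p.1.2)
      (p.2.1.2 / (- p.2.1.1.2 / p.1.1 ^ 2 * (if p.2.1.2 * p.2.1.1.1 / p.2.1.1.2 - p.2.2 = 0 then p.1.2 else (p.2.1.2 * p.2.1.1.1 / p.2.1.1.2 - p.2.2) / p.1.2 ^ 2))) 0 0 p.1.1 (- p.2.1.1.2 / p.1.1 ^ 2) 0 0)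
    (fun X => ((X 1 0 2, if X 0 1 2 = 0 then X 0 0 0 else X 0 1 2), (((-(X 0 1 1 * X 1 0 2 ^ 2), -(X 1 1 1 * X 1 0 2 ^ 2)), X 1 1 1 * X 0 0 0 * X 0 2 2),
      X 0 0 0 * (X 0 1 1 * X 0 2 2 - X 0 1 2 ^ 2))))]
  · rw [c_prod (fun p : F × F => p.1 ≠ 0 ∧ p.2 ≠ 0) (fun p : ((F × F) × F) × F => disc3 p.2 p.1.2 p.1.1.1 p.1.1.2 ≠ 0 ∧ ¬ p.1.1.2 = 0),
      c_prod (fun p : F => p ≠ 0) (fun p : F => p ≠ 0), c_ne hq, hq, cub1 hq h2 h3]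
    ring
  · rintro ⟨⟨l, r⟩, ⟨⟨⟨c, d⟩, b⟩, a⟩⟩ ⟨⟨hl, hr⟩, hD, hd⟩
    dsimp only at *
    split_ifs with hk
    · refine ⟨mk_symm _ _ _ _ _ _ _ _ _ _ _ _, ?_, ?_⟩
      · rw [D2]
        refine mul_ne_zero (n256 h2) ?_
        convert hD using 2
        · field_simp
          field_simp at hk
          linear_combination hk
        · field_simp
        · field_simp
        · field_simp
      · simp [mk, hl, hr, hd]
    · refine ⟨mk_symm _ _ _ _ _ _ _ _ _ _ _ _, ?_, ?_⟩
      · have ha : a = b * c / d - (b * c / d - a) := by ring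
        generalize b * c / d - a = κ at *
        rw [D2]
        refine mul_ne_zero (n256 h2) ?_
        convert hD using 2
        · rw [ha]
          field_simp
        · field_simp
        · field_simp
        · field_simp
      · simp [mk, hl, hr, hd, hk]
  · rintro X ⟨hs, hD, ⟨⟨⟨⟨⟨⟨⟨g1, g2⟩, g3⟩, g4⟩, g5⟩, g6⟩, g7⟩, g8⟩, g9⟩
    have e := mk_eta X hs
    simp only [g1, g2, g6, g7, g8, g9] at e
    have hD' := hD
    rw [e, D2] at hD
    refine ⟨⟨⟨g4, ?_⟩, ?_, neg_ne_zero.2 (mul_ne_zero g5 (pow_ne_zero 2 g4))⟩, ?_⟩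
    · dsimp only
      split_ifs with h
      · exact g3
      · exact h
    · intro h0; apply hD; dsimp only at h0; rw [h0]; ring
    · have k1 : X 1 1 1 * X 0 0 0 * X 0 2 2 * -(X 0 1 1 * X 1 0 2 ^ 2) / -(X 1 1 1 * X 1 0 2 ^ 2) -
        X 0 0 0 * (X 0 1 1 * X 0 2 2 - X 0 1 2 ^ 2) = X 0 0 0 * X 0 1 2 ^ 2 := by
        field_simp; ring
      dsimp only
      rw [k1]
      conv_rhs => rw [e]
      by_cases h : X 0 1 2 = 0
      · simp only [h]
        simp
        congr 1 <;> field_simp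
      · simp only [h, mul_eq_zero, pow_eq_zero_iff (two_ne_zero (α := ℕ)), g3, or_self, if_false]
        congr 1 <;> field_simp
  · rintro ⟨⟨l, r⟩, ⟨⟨⟨c, d⟩, b⟩, a⟩⟩ ⟨⟨hl, hr⟩, hD, hd⟩
    dsimp only at hl hr hd
    have ha : a = b * c / d - (b * c / d - a) := by ring
    generalize b * c / d - a = κ at *
    by_cases hk : κ = 0
    · simp [mk, hk, hl, hr]
      rw [ha, hk]
      first | (refine ⟨⟨?_, ?_⟩, ?_⟩ <;> field_simp) | (refine ⟨?_, ?_⟩ <;> field_simp) | field_simp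
      ring
    · simp [mk, hk, hl, hr]
      rw [ha]
      first | (refine ⟨⟨?_, ?_⟩, ?_⟩ <;> field_simp) | (refine ⟨?_, ?_⟩ <;> field_simp) | field_simp

theorem M2_ : (NS (fun X : Fin 2 → M3 F => X 1 0 0 = 0 ∧ X 1 0 1 = 0)).ncard =
    (s + 1) ^ 4 * (s + 2) ^ 4 * ((s + 2) ^ 2 + 3 * (s + 2) + 1) := by
  have e1 := NS_split (fun X : Fin 2 → M3 F => X 1 0 0 = 0 ∧ X 1 0 1 = 0) (fun X => X 0 0 0 = 0)
  have e2 := NS_split (fun X : Fin 2 → M3 F => (X 1 0 0 = 0 ∧ X 1 0 1 = 0) ∧ ¬ X 0 0 0 = 0) (fun X => X 1 0 2 = 0)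
  have e3 := NS_split (fun X : Fin 2 → M3 F => ((X 1 0 0 = 0 ∧ X 1 0 1 = 0) ∧ ¬ X 0 0 0 = 0) ∧ ¬ X 1 0 2 = 0) (fun X => X 1 1 1 = 0)
  have a1 := M7 hq h2 h3
  have a2 := M3_ hq h2
  have a3 := M2p hq h2 h3
  have f1 := NS_split (fun X : Fin 2 → M3 F => X 1 0 0 = 0 ∧ X 1 0 1 = 0 ∧ X 1 1 1 = 0) (fun X => X 0 0 0 = 0)
  have f2 := NS_split (fun X : Fin 2 → M3 F => (X 1 0 0 = 0 ∧ X 1 0 1 = 0 ∧ X 1 1 1 = 0) ∧ ¬ X 0 0 0 = 0) (fun X => X 1 0 2 = 0)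
  rw [M4 hq h2, NS_congr (Q := fun X => (X 1 0 0 = 0 ∧ X 1 0 1 = 0 ∧ X 1 1 1 = 0) ∧ X 0 0 0 = 0) (Q' := fun X => X 1 0 0 = 0 ∧ X 1 0 1 = 0 ∧ X 0 0 0 = 0 ∧ X 1 1 1 = 0) (fun X _ _ => by tauto), M8 hq h2] at f1
  rw [NS_congr (Q := fun X => ((X 1 0 0 = 0 ∧ X 1 0 1 = 0 ∧ X 1 1 1 = 0) ∧ ¬ X 0 0 0 = 0) ∧ X 1 0 2 = 0)
    (Q' := fun X => X 1 0 0 = 0 ∧ X 1 0 1 = 0 ∧ X 1 0 2 = 0 ∧ X 1 1 1 = 0) (fun X hs hD => by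
      have := D_F3 X hs
      tauto), M5 hq h2] at f2
  rw [NS_congr (Q := fun X => (X 1 0 0 = 0 ∧ X 1 0 1 = 0) ∧ X 0 0 0 = 0) (Q' := fun X => X 1 0 0 = 0 ∧ X 1 0 1 = 0 ∧ X 0 0 0 = 0) (fun X _ _ => by tauto), a1] at e1
  rw [NS_congr (Q := fun X => ((X 1 0 0 = 0 ∧ X 1 0 1 = 0) ∧ ¬ X 0 0 0 = 0) ∧ X 1 0 2 = 0)
    (Q' := fun X => X 1 0 0 = 0 ∧ X 1 0 1 = 0 ∧ X 1 0 2 = 0) (fun X hs hD => by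
      have := D_F3 X hs
      tauto), a2] at e2
  rw [NS_congr (Q := fun X => (((X 1 0 0 = 0 ∧ X 1 0 1 = 0) ∧ ¬ X 0 0 0 = 0) ∧ ¬ X 1 0 2 = 0) ∧ X 1 1 1 = 0)
    (Q' := fun X => ((X 1 0 0 = 0 ∧ X 1 0 1 = 0 ∧ X 1 1 1 = 0) ∧ ¬ X 0 0 0 = 0) ∧ ¬ X 1 0 2 = 0) (fun X hs hD => by
      tauto), a3] at e3
  zify at *
  linear_combination e1 + e2 + e3 - f1 - f2

theorem M6 : (NS (fun X : Fin 2 → M3 F => X 1 0 0 = 0 ∧ X 0 0 0 = 0)).ncard =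
    (s + 1) ^ 4 * (s + 2) ^ 4 * (s + 3) ^ 2 := by
  rw [rop_lines _ 1 2 (by decide) (fun X => X 1 0 1) (fun X => X 1 0 2), hq, NS_congr (Q' := fun X => X 1 0 0 = 0 ∧ X 1 0 1 = 0 ∧ X 0 0 0 = 0)
    (fun X _ _ => by tauto), M7 hq h2 h3]
  · ring
  · intro t X hs hQ
    obtain ⟨s1, s2, s3⟩ := ssym hs
    simp [rop_apply, s1, s2, s3, hQ]
  · intro X hs hQ
    obtain ⟨s1, s2, s3⟩ := ssym hs
    simp [perm, Equiv.swap_apply_def, s1, s2, s3, hQ]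
  · rintro X hX ⟨a, b⟩
    exact F3 hX hX.2.2.1 a hX.2.2.2 b

theorem M1 : (NS (fun X : Fin 2 → M3 F => X 1 0 0 = 0)).ncard =
    (s + 1) ^ 4 * (s + 2) ^ 4 * (s + 3) ^ 3 := by
  have e1 := NS_split (fun X : Fin 2 → M3 F => X 1 0 0 = 0) (fun X => X 0 0 0 = 0)
  have e2 := NS_split (fun X : Fin 2 → M3 F => X 1 0 0 = 0 ∧ ¬ X 0 0 0 = 0) (fun X => X 1 0 1 = 0 ∧ X 1 0 2 = 0)
  have e3 := rop_lines (fun X : Fin 2 → M3 F => (X 1 0 0 = 0 ∧ ¬ X 0 0 0 = 0) ∧ ¬ (X 1 0 1 = 0 ∧ X 1 0 2 = 0)) 1 2 (by decide)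
    (fun X => X 1 0 1) (fun X => X 1 0 2) (by
      intro t X hs hQ
      obtain ⟨s1, s2, s3⟩ := ssym hs
      obtain ⟨⟨c1, c2⟩, c3⟩ := hQ
      simp [rop_apply, s1, s2, s3, c1, c2]
      intro h h'
      apply c3
      rw [h', mul_zero, add_zero] at h
      exact ⟨h, h'⟩) (by
      intro X hs hQ
      obtain ⟨s1, s2, s3⟩ := ssym hs
      obtain ⟨⟨c1, c2⟩, c3⟩ := hQ
      simp [perm, Equiv.swap_apply_def, s1, s2, s3, c1, c2]
      tauto) (fun X hX => hX.2.2.2)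
  have e4 := NS_split (fun X : Fin 2 → M3 F => X 1 0 0 = 0 ∧ X 1 0 1 = 0) (fun X => X 0 0 0 = 0)
  have e5 := NS_split (fun X : Fin 2 → M3 F => (X 1 0 0 = 0 ∧ X 1 0 1 = 0) ∧ ¬ X 0 0 0 = 0) (fun X => X 1 0 2 = 0)
  rw [M6 hq h2 h3] at e1
  rw [NS_congr (Q := fun X => (X 1 0 0 = 0 ∧ ¬ X 0 0 0 = 0) ∧ X 1 0 1 = 0 ∧ X 1 0 2 = 0)
    (Q' := fun X => X 1 0 0 = 0 ∧ X 1 0 1 = 0 ∧ X 1 0 2 = 0) (fun X hs hD => by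
      have := D_F3 X hs
      tauto), M3_ hq h2] at e2
  rw [M2_ hq h2 h3, NS_congr (Q := fun X => (X 1 0 0 = 0 ∧ X 1 0 1 = 0) ∧ X 0 0 0 = 0) (Q' := fun X => X 1 0 0 = 0 ∧ X 1 0 1 = 0 ∧ X 0 0 0 = 0) (fun X _ _ => by tauto), M7 hq h2 h3] at e4
  rw [NS_congr (Q := fun X => ((X 1 0 0 = 0 ∧ X 1 0 1 = 0) ∧ ¬ X 0 0 0 = 0) ∧ X 1 0 2 = 0)
    (Q' := fun X => X 1 0 0 = 0 ∧ X 1 0 1 = 0 ∧ X 1 0 2 = 0) (fun X hs hD => by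
      have := D_F3 X hs
      tauto), M3_ hq h2] at e5
  rw [NS_congr (Q := fun X => ((X 1 0 0 = 0 ∧ ¬ X 0 0 0 = 0) ∧ ¬ (X 1 0 1 = 0 ∧ X 1 0 2 = 0)) ∧ X 1 0 1 = 0)
    (Q' := fun X => ((X 1 0 0 = 0 ∧ X 1 0 1 = 0) ∧ ¬ X 0 0 0 = 0) ∧ ¬ X 1 0 2 = 0) (fun X hs hD => by tauto), hq] at e3
  zify at *
  linear_combination e1 + e2 + e3 - (s + 3) * (e4 + e5)

theorem M0 : (NS (fun _ : Fin 2 → M3 F => True)).ncard =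
    (s + 1) ^ 4 * (s + 2) ^ 4 * ((s + 3) ^ 2 * ((s + 2) ^ 2 + (s + 2) + 1)) := by
  have e1 := NS_split (fun _ : Fin 2 → M3 F => True) (fun X => X 1 0 0 = 0 ∧ X 0 0 0 = 0)
  have e3 := pop_lines (fun X : Fin 2 → M3 F => True ∧ ¬ (X 1 0 0 = 0 ∧ X 0 0 0 = 0)) 1 0 (by decide)
    (fun X => X 1 0 0) (fun X => X 0 0 0) (by
      intro t X hQ
      simp [pop_apply]
      intro h h'
      apply hQ.2
      rw [h', mul_zero, add_zero] at h
      exact ⟨h, h'⟩) (by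
      intro X hQ
      simp [perm]
      tauto) (fun X hX => hX.2.2.2)
  have e4 := NS_split (fun X : Fin 2 → M3 F => X 1 0 0 = 0) (fun X => X 0 0 0 = 0)
  rw [M1 hq h2 h3, M6 hq h2 h3] at e4
  rw [NS_congr (Q := fun X => True ∧ X 1 0 0 = 0 ∧ X 0 0 0 = 0)
    (Q' := fun X => X 1 0 0 = 0 ∧ X 0 0 0 = 0) (fun X hs hD => by tauto), M6 hq h2 h3] at e1
  rw [NS_congr (Q := fun X => (True ∧ ¬ (X 1 0 0 = 0 ∧ X 0 0 0 = 0)) ∧ X 1 0 0 = 0)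
    (Q' := fun X => X 1 0 0 = 0 ∧ ¬ X 0 0 0 = 0) (fun X hs hD => by tauto), hq] at e3
  zify at *
  linear_combination e1 + e3 - (s + 3) * e4

end cnt
end QC

namespace QC
open Matrix Polynomial
section cnt
variable {F : Type} [Field F] [Fintype F]

theorem n4 (h2 : (2 : F) ≠ 0) : (4 : F) ≠ 0 := by
  have : (4 : F) = 2 * 2 := by norm_num
  rw [this]; exact mul_ne_zero h2 h2

/-- support of the (12) family -/
def S12 (X : Fin 2 → M3 F) : Prop := X 0 0 2 = 0 ∧ X 0 1 2 = 0 ∧ X 1 0 0 = 0 ∧ X 1 0 1 = 0 ∧ X 1 1 1 = 0 ∧ X 1 2 2 = 0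
/-- support of the (22) family -/
def S22 (X : Fin 2 → M3 F) : Prop := X 0 0 1 = 0 ∧ X 0 0 2 = 0 ∧ X 1 0 1 = 0 ∧ X 1 0 2 = 0
/-- support of the (123) family -/
def S123 (X : Fin 2 → M3 F) : Prop := X 0 0 0 = 0 ∧ X 0 0 2 = 0 ∧ X 0 1 1 = 0 ∧ X 0 1 2 = 0 ∧
  X 1 0 0 = 0 ∧ X 1 0 1 = 0 ∧ X 1 1 2 = 0 ∧ X 1 2 2 = 0
/-- support of the (1234) family -/
def S1234 (X : Fin 2 → M3 F) : Prop := X 0 0 0 = 0 ∧ X 0 0 1 = 0 ∧ X 0 1 2 = 0 ∧ X 0 2 2 = 0 ∧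
  X 1 0 1 = 0 ∧ X 1 0 2 = 0 ∧ X 1 1 1 = 0 ∧ X 1 1 2 = 0

theorem DS12 (X : Fin 2 → M3 F) (hs : ∀ k, (X k).IsSymm) (h : S12 X) : D X = 256 * (4 * (X 0 2 2 * (X 0 0 0 * X 0 1 1 - X 0 0 1 ^ 2)) *
    (X 0 0 0 * X 1 1 2 ^ 2 - 2 * X 0 0 1 * X 1 0 2 * X 1 1 2 + X 0 1 1 * X 1 0 2 ^ 2) ^ 3) := by
  obtain ⟨g1, g2, g3, g4, g5, g6⟩ := h
  conv_lhs => rw [mk_eta X hs]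
  simp only [g1, g2, g3, g4, g5, g6, D_mk]
  simp only [mul_zero, zero_mul, sub_zero, zero_sub, add_zero, zero_add]
  unfold disc3
  ring

theorem DS123 (X : Fin 2 → M3 F) (hs : ∀ k, (X k).IsSymm) (h : S123 X) : D X = - 256 * 27 * (X 0 0 1 ^ 2 * X 0 2 2 * X 1 0 2 ^ 2 * X 1 1 1) ^ 2 := by
  obtain ⟨g1, g2, g3, g4, g5, g6, g7, g8⟩ := h
  conv_lhs => rw [mk_eta X hs]
  simp only [g1, g2, g3, g4, g5, g6, g7, g8, D_mk]
  simp only [mul_zero, zero_mul, sub_zero, zero_sub, add_zero, zero_add]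
  unfold disc3
  ring

theorem DS1234 (X : Fin 2 → M3 F) (hs : ∀ k, (X k).IsSymm) (h : S1234 X) : D X = 256 * 4 * (X 0 1 1 * X 0 0 2 ^ 2) * (X 1 0 0 * X 0 1 1 * X 1 2 2) ^ 3 := by
  obtain ⟨g1, g2, g3, g4, g5, g6, g7, g8⟩ := h
  conv_lhs => rw [mk_eta X hs]
  simp only [g1, g2, g3, g4, g5, g6, g7, g8, D_mk]
  simp only [mul_zero, zero_mul, sub_zero, zero_sub, add_zero, zero_add]
  unfold disc3
  ring

theorem DS22 (X : Fin 2 → M3 F) (hs : ∀ k, (X k).IsSymm) (h : S22 X) (h5 : X 1 1 1 = 0) (h0 : X 0 0 0 = 0) (h1 : X 0 1 2 = 0) :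
    D X = 256 * (X 1 0 0 ^ 4 * (X 0 1 1 ^ 3 * X 0 2 2 ^ 2)) * (4 * X 0 2 2 * X 1 1 2 ^ 2 + X 0 1 1 * X 1 2 2 ^ 2) := by
  obtain ⟨g1, g2, g3, g4⟩ := h
  conv_lhs => rw [mk_eta X hs]
  simp only [g1, g2, g3, g4, h5, h0, h1, D_mk]
  simp only [mul_zero, zero_mul, sub_zero, zero_sub, add_zero, zero_add]
  unfold disc3
  ring

theorem DS22' (X : Fin 2 → M3 F) (hs : ∀ k, (X k).IsSymm) (h : S22 X) (h5 : X 1 1 1 = 0) (h0 : X 0 1 1 = 0) :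
    D X = 0 := by
  obtain ⟨g1, g2, g3, g4⟩ := h
  conv_lhs => rw [mk_eta X hs]
  simp only [g1, g2, g3, g4, h5, h0, D_mk]
  simp only [mul_zero, zero_mul, sub_zero, zero_sub, add_zero, zero_add]
  unfold disc3
  ring

theorem c_ne4 {s : ℕ} (hq : Fintype.card F = s + 2) :
   {p : (F × F) × (F × F) | (p.1.1 ≠ 0 ∧ p.1.2 ≠ 0) ∧ (p.2.1 ≠ 0 ∧ p.2.2 ≠ 0)}.ncard = (s + 1) ^ 4 := by
  rw [c_prod (fun p : F × F => p.1 ≠ 0 ∧ p.2 ≠ 0) (fun p : F × F => p.1 ≠ 0 ∧ p.2 ≠ 0), c_prod (fun p : F => p ≠ 0) (fun p : F => p ≠ 0), c_ne hq]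
  ring

variable {s : ℕ} (hq : Fintype.card F = s + 2) (h2 : (2 : F) ≠ 0) (h3 : (3 : F) ≠ 0)
include hq h2

theorem M12a : (NS (fun X : Fin 2 → M3 F => S12 X ∧ X 1 0 2 = 0)).ncard = (s + 1) ^ 4 * (s + 2) := by
  have key : ∀ X : Fin 2 → M3 F, X ∈ NS (fun X : Fin 2 → M3 F => S12 X ∧ X 1 0 2 = 0) → X 0 0 0 ≠ 0 := by
    rintro X ⟨hs, hD, h, h'⟩ h0
    apply hD
    rw [DS12 X hs h, h', h0]; ring
  rw [rop_count _ 1 0 (by decide) (fun X => X 0 0 1) (fun X => X 0 0 0) ?_ key]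
  rotate_left
  · intro t X hs hQ
    obtain ⟨s1, s2, s3⟩ := ssym hs
    simp only [S12] at *
    simp [rop_apply, s1, s2, s3, hQ]
  rw [NS_param (β := (F × F) × (F × F)) _ (fun p => (p.1.1 ≠ 0 ∧ p.1.2 ≠ 0) ∧ (p.2.1 ≠ 0 ∧ p.2.2 ≠ 0))
    (fun p => mk p.1.1 0 0 p.1.2 0 p.2.1 0 0 0 0 p.2.2 0) (fun X => ((X 0 0 0, X 0 1 1), (X 0 2 2, X 1 1 2))), c_ne4 hq, hq]
  · ring
  · rintro ⟨⟨a, c⟩, z, v⟩ ⟨⟨ha, hc⟩, hz, hv⟩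
    dsimp only at *
    have hS : S12 (mk a 0 0 c 0 z 0 0 0 0 v 0) := by simp [S12, mk]
    refine ⟨mk_symm _ _ _ _ _ _ _ _ _ _ _ _, ?_, ⟨hS, by simp [mk]⟩, by simp [mk]⟩
    rw [DS12 _ (mk_symm _ _ _ _ _ _ _ _ _ _ _ _) hS]
    simp [mk, ha, hc, hz, hv, n256 h2, n4 h2]
  · rintro X ⟨hs, hD, ⟨g1, g2⟩, g3⟩
    have e := mk_eta X hs
    rw [DS12 X hs g1, g2, g3] at hD
    obtain ⟨f1, f2, f3, f4, f5, f6⟩ := g1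
    simp only [f1, f2, f3, f4, f5, f6, g2, g3] at e
    refine ⟨⟨⟨?_, ?_⟩, ?_, ?_⟩, e.symm⟩ <;> (intro h0; apply hD; dsimp only at h0; rw [h0]; ring)
  · rintro ⟨⟨a, c⟩, z, v⟩ -
    simp [mk]

theorem M12b : (NS (fun X : Fin 2 → M3 F => S12 X ∧ X 0 0 0 = 0)).ncard = (s + 1) ^ 4 * (s + 2) := by
  have key : ∀ X : Fin 2 → M3 F, X ∈ NS (fun X : Fin 2 → M3 F => S12 X ∧ X 0 0 0 = 0) → X 1 0 2 ≠ 0 := by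
    rintro X ⟨hs, hD, h, h'⟩ h0
    apply hD
    rw [DS12 X hs h, h', h0]; ring
  rw [rop_count _ 1 0 (by decide) (fun X => X 1 1 2) (fun X => X 1 0 2) ?_ key]
  rotate_left
  · intro t X hs hQ
    obtain ⟨s1, s2, s3⟩ := ssym hs
    simp only [S12] at *
    simp [rop_apply, s1, s2, s3, hQ]
  rw [NS_param (β := (F × F) × (F × F)) _ (fun p => (p.1.1 ≠ 0 ∧ p.1.2 ≠ 0) ∧ (p.2.1 ≠ 0 ∧ p.2.2 ≠ 0))
    (fun p => mk 0 p.1.1 0 p.1.2 0 p.2.1 0 0 p.2.2 0 0 0) (fun X => ((X 0 0 1, X 0 1 1), (X 0 2 2, X 1 0 2))), c_ne4 hq, hq]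
  · ring
  · rintro ⟨⟨a, c⟩, z, v⟩ ⟨⟨ha, hc⟩, hz, hv⟩
    dsimp only at *
    have hS : S12 (mk 0 a 0 c 0 z 0 0 v 0 0 0) := by simp [S12, mk]
    refine ⟨mk_symm _ _ _ _ _ _ _ _ _ _ _ _, ?_, ⟨hS, by simp [mk]⟩, by simp [mk]⟩
    rw [DS12 _ (mk_symm _ _ _ _ _ _ _ _ _ _ _ _) hS]
    simp [mk, ha, hc, hz, hv, n256 h2, n4 h2]
  · rintro X ⟨hs, hD, ⟨g1, g2⟩, g3⟩
    have e := mk_eta X hs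
    rw [DS12 X hs g1, g2, g3] at hD
    obtain ⟨f1, f2, f3, f4, f5, f6⟩ := g1
    simp only [f1, f2, f3, f4, f5, f6, g2, g3] at e
    refine ⟨⟨⟨?_, ?_⟩, ?_, ?_⟩, e.symm⟩ <;> (intro h0; apply hD; dsimp only at h0; rw [h0]; ring)
  · rintro ⟨⟨a, c⟩, z, v⟩ -
    simp [mk]

theorem M12 : (NS (fun X : Fin 2 → M3 F => S12 X)).ncard = (s + 1) ^ 4 * (s + 2) * (s + 3) := by
  rw [rop_lines _ 0 1 (by decide) (fun X => X 1 0 2) (fun X => X 1 1 2), hq, M12a hq h2]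
  · ring
  · intro t X hs hQ
    obtain ⟨s1, s2, s3⟩ := ssym hs
    simp only [S12] at *
    simp [rop_apply, s1, s2, s3, hQ]
  · intro X hs hQ
    obtain ⟨s1, s2, s3⟩ := ssym hs
    simp only [S12] at *
    simp [perm, Equiv.swap_apply_def, s1, s2, s3, hQ]
  · rintro X hX ⟨a, b⟩
    apply hX.2.1
    rw [DS12 X hX.1 hX.2.2, a, b]; ring

theorem M123 (h3 : (3 : F) ≠ 0) : (NS (fun X : Fin 2 → M3 F => S123 X)).ncard = (s + 1) ^ 4 := by
  have h27 : (27 : F) ≠ 0 := by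
    have : (27 : F) = 3 * 3 * 3 := by norm_num
    rw [this]; exact mul_ne_zero (mul_ne_zero h3 h3) h3
  rw [NS_param (β := (F × F) × (F × F)) _ (fun p => (p.1.1 ≠ 0 ∧ p.1.2 ≠ 0) ∧ (p.2.1 ≠ 0 ∧ p.2.2 ≠ 0))
    (fun p => mk 0 p.1.1 0 0 0 p.1.2 0 0 p.2.1 p.2.2 0 0) (fun X => ((X 0 0 1, X 0 2 2), (X 1 0 2, X 1 1 1))), c_ne4 hq]
  · rintro ⟨⟨a, c⟩, z, v⟩ ⟨⟨ha, hc⟩, hz, hv⟩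
    dsimp only at *
    have hS : S123 (mk 0 a 0 0 0 c 0 0 z v 0 0) := by simp [S123, mk]
    refine ⟨mk_symm _ _ _ _ _ _ _ _ _ _ _ _, ?_, hS⟩
    rw [DS123 _ (mk_symm _ _ _ _ _ _ _ _ _ _ _ _) hS]
    simp [mk, ha, hc, hz, hv, n256 h2, h27]
  · rintro X ⟨hs, hD, g1⟩
    have e := mk_eta X hs
    rw [DS123 X hs g1] at hD
    obtain ⟨f1, f2, f3, f4, f5, f6, f7, f8⟩ := g1
    simp only [f1, f2, f3, f4, f5, f6, f7, f8] at e
    refine ⟨⟨⟨?_, ?_⟩, ?_, ?_⟩, e.symm⟩ <;> (intro h0; apply hD; dsimp only at h0; rw [h0]; ring)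
  · rintro ⟨⟨a, c⟩, z, v⟩ -
    simp [mk]

theorem M1234 : (NS (fun X : Fin 2 → M3 F => S1234 X)).ncard = (s + 1) ^ 4 := by
  rw [NS_param (β := (F × F) × (F × F)) _ (fun p => (p.1.1 ≠ 0 ∧ p.1.2 ≠ 0) ∧ (p.2.1 ≠ 0 ∧ p.2.2 ≠ 0))
    (fun p => mk 0 0 p.1.1 p.1.2 0 0 p.2.1 0 0 0 0 p.2.2) (fun X => ((X 0 0 2, X 0 1 1), (X 1 0 0, X 1 2 2))), c_ne4 hq]
  · rintro ⟨⟨a, c⟩, z, v⟩ ⟨⟨ha, hc⟩, hz, hv⟩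
    dsimp only at *
    have hS : S1234 (mk 0 0 a c 0 0 z 0 0 0 0 v) := by simp [S1234, mk]
    refine ⟨mk_symm _ _ _ _ _ _ _ _ _ _ _ _, ?_, hS⟩
    rw [DS1234 _ (mk_symm _ _ _ _ _ _ _ _ _ _ _ _) hS]
    simp [mk, ha, hc, hz, hv, n256 h2, n4 h2]
  · rintro X ⟨hs, hD, g1⟩
    have e := mk_eta X hs
    rw [DS1234 X hs g1] at hD
    obtain ⟨f1, f2, f3, f4, f5, f6, f7, f8⟩ := g1
    simp only [f1, f2, f3, f4, f5, f6, f7, f8] at e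
    refine ⟨⟨⟨?_, ?_⟩, ?_, ?_⟩, e.symm⟩ <;> (intro h0; apply hD; dsimp only at h0; rw [h0]; ring)
  · rintro ⟨⟨a, c⟩, z, v⟩ -
    simp [mk]

theorem M22red (E : Prop) : (NS (fun X : Fin 2 → M3 F => X 1 0 0 = 0 ∧ X 1 0 1 = 0 ∧ X 1 0 2 = 0 ∧ (E → X 1 1 1 = 0))).ncard =
    (s + 2) ^ 2 * (NS (fun X : Fin 2 → M3 F => S22 X ∧ X 1 0 0 = 0 ∧ (E → X 1 1 1 = 0))).ncard := by
  have n0 : ∀ X : Fin 2 → M3 F, (∀ k, (X k).IsSymm) → D X ≠ 0 → X 1 0 0 = 0 → X 1 0 1 = 0 → X 1 0 2 = 0 → X 0 0 0 ≠ 0 :=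
    fun X hs hD a b c d => hD (D_F3 X hs a b c d)
  rw [rop_count _ 1 0 (by decide) (fun X => X 0 0 1) (fun X => X 0 0 0) ?_ (fun X hX => n0 X hX.1 hX.2.1 hX.2.2.1 hX.2.2.2.1 hX.2.2.2.2.1),
    rop_count _ 2 0 (by decide) (fun X => X 0 0 2) (fun X => X 0 0 0) ?_ (fun X hX => n0 X hX.1 hX.2.1 hX.2.2.1.1 hX.2.2.1.2.1 hX.2.2.1.2.2.1)]
  rotate_left
  iterate 2
    · intro t X hs hQ
      obtain ⟨s1, s2, s3⟩ := ssym hs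
      simp [rop_apply, s1, s2, s3, hQ]
      try tauto
  rw [hq, NS_congr (Q' := fun X : Fin 2 → M3 F => S22 X ∧ X 1 0 0 = 0 ∧ (E → X 1 1 1 = 0)) (fun X _ _ => by unfold S22; tauto)]
  ring

/-- L00 = 0 -/
theorem M22a : (NS (fun X : Fin 2 → M3 F => S22 X ∧ X 1 0 0 = 0)).ncard = (s + 1) ^ 4 * (s + 2) ^ 2 * (s + 3) := by
  have := M22red hq h2 False
  simp only [false_imp_iff, and_true] at this
  rw [M3_ hq h2] at this
  have h0 : 0 < (s + 2) ^ 2 := by positivity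
  apply Nat.eq_of_mul_eq_mul_left h0
  rw [← this]; ring

/-- L00 = 0, L11 = 0 -/
theorem M22b : (NS (fun X : Fin 2 → M3 F => S22 X ∧ X 1 0 0 = 0 ∧ X 1 1 1 = 0)).ncard = (s + 1) ^ 4 * (s + 2) ^ 2 := by
  have := M22red hq h2 True
  simp only [true_imp_iff] at this
  rw [M5 hq h2] at this
  have h0 : 0 < (s + 2) ^ 2 := by positivity
  apply Nat.eq_of_mul_eq_mul_left h0
  rw [← this]; ring

theorem M22 : (NS (fun X : Fin 2 → M3 F => S22 X)).ncard = (s + 1) ^ 4 * (s + 2) ^ 2 * (s + 3) ^ 2 := by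
  rw [pop_lines _ 1 0 (by decide) (fun X => X 1 0 0) (fun X => X 0 0 0), hq, M22a hq h2]
  · ring
  · intro t X hQ
    simp only [S22] at *
    simp [pop_apply, hQ]
  · intro X hQ
    simp only [S22] at *
    simp [perm, hQ]
  · rintro X hX ⟨a, b⟩
    exact hX.2.1 (D_F3 X hX.1 a hX.2.2.2.2.1 hX.2.2.2.2.2 b)

theorem M22c' (E : Prop) : (NS (fun X : Fin 2 → M3 F => (S22 X ∧ X 1 1 1 = 0 ∧ (E → X 1 1 2 = 0)) ∧ ¬ X 1 0 0 = 0)).ncard = (s + 2) ^ 2 * (s + 1) ^ 2 *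
    {p : (F × F) × F | (p.2 ≠ 0 ∧ 4 * p.1.1 ^ 2 + p.2 * p.1.2 ^ 2 ≠ 0) ∧ (E → p.1.1 = 0)}.ncard := by
  rw [pop_count _ 0 1 (by decide) (fun X => X 0 0 0) (fun X => X 1 0 0) ?_ (fun X hX => hX.2.2.2),
    rop_count _ 2 1 (by decide) (fun X => X 0 1 2) (fun X => X 0 1 1) ?_ (fun X hX h0 => hX.2.1 (DS22' X hX.1 hX.2.2.1.1.1 hX.2.2.1.1.2.1 h0))]
  rotate_left
  · intro t X hs hQ
    obtain ⟨s1, s2, s3⟩ := ssym hs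
    simp only [S22] at *
    simp [rop_apply, s1, s2, s3, hQ]
    tauto
  · intro t X hQ
    simp only [S22] at *
    simp [pop_apply, hQ]
    tauto
  rw [NS_param (β := (F × F) × ((F × F) × F)) _ (fun p => (p.1.1 ≠ 0 ∧ p.1.2 ≠ 0) ∧ ((p.2.2 ≠ 0 ∧ 4 * p.2.1.1 ^ 2 + p.2.2 * p.2.1.2 ^ 2 ≠ 0) ∧ (E → p.2.1.1 = 0)))
    (fun p => mk 0 0 0 (p.1.2 * p.2.2) 0 p.1.2 p.1.1 0 0 0 p.2.1.1 p.2.1.2)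
    (fun X => ((X 1 0 0, X 0 2 2), ((X 1 1 2, X 1 2 2), X 0 1 1 / X 0 2 2)))]
  · rw [c_prod (fun p : F × F => p.1 ≠ 0 ∧ p.2 ≠ 0)
      (fun p : (F × F) × F => (p.2 ≠ 0 ∧ 4 * p.1.1 ^ 2 + p.2 * p.1.2 ^ 2 ≠ 0) ∧ (E → p.1.1 = 0)),
      c_prod (fun p : F => p ≠ 0) (fun p : F => p ≠ 0), c_ne hq, hq]
    ring
  · rintro ⟨⟨l, z⟩, ⟨u, v⟩, w⟩ ⟨⟨hl, hz⟩, ⟨hw, hD⟩, hE⟩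
    dsimp only at *
    have hS : S22 (mk 0 0 0 (z * w) 0 z l 0 0 0 u v) := by simp [S22, mk]
    refine ⟨mk_symm _ _ _ _ _ _ _ _ _ _ _ _, ?_, ?_⟩
    · rw [DS22 _ (mk_symm _ _ _ _ _ _ _ _ _ _ _ _) hS (by simp [mk]) (by simp [mk]) (by simp [mk])]
      have : 4 * z * u ^ 2 + z * w * v ^ 2 = z * (4 * u ^ 2 + w * v ^ 2) := by ring
      simp [mk, hl, hz, hw, n256 h2, this]
      exact hD
    · simp [hS]
      simp [mk, hl]
      exact hE
  · rintro X ⟨hs, hD, ⟨⟨⟨g1, g2, gE⟩, g3⟩, g4⟩, g5⟩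
    have e := mk_eta X hs
    rw [DS22 X hs g1 g2 g4 g5] at hD
    obtain ⟨f1, f2, f3, f4⟩ := g1
    simp only [f1, f2, f3, f4, g2, g4, g5] at e
    have hz : X 0 2 2 ≠ 0 := by intro h0; apply hD; rw [h0]; ring
    refine ⟨⟨⟨g3, hz⟩, ⟨div_ne_zero ?_ hz, ?_⟩, gE⟩, ?_⟩
    · intro h0; apply hD; rw [h0]; ring
    · intro h0; apply hD; dsimp only at h0; field_simp at h0
      rw [show 4 * X 0 2 2 * X 1 1 2 ^ 2 + X 0 1 1 * X 1 2 2 ^ 2 = 0 by linear_combination h0]; ring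
    · conv_rhs => rw [e]
      simp only [mul_div_cancel₀ _ hz]
  · rintro ⟨⟨l, z⟩, ⟨u, v⟩, w⟩ ⟨⟨hl, hz⟩, ⟨hw, hD⟩, hE⟩
    dsimp only at hz
    simp [mk, hz]

/-- L11 = 0 -/
theorem M22c : (NS (fun X : Fin 2 → M3 F => S22 X ∧ X 1 1 1 = 0)).ncard = (s + 1) ^ 4 * (s + 2) ^ 2 * (s + 3) := by
  have := M22c' (F := F) hq h2 False
  simp only [false_imp_iff, and_true] at this
  rw [NS_split _ (fun X => X 1 0 0 = 0), this, NS_congr (Q' := fun X : Fin 2 → M3 F => S22 X ∧ X 1 0 0 = 0 ∧ X 1 1 1 = 0) (fun X _ _ => by tauto), M22b hq h2,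
    c_two hq (fun x => 4 * x ^ 2) (fun x => x ^ 2) (by intro x; simp [n4 h2]) (by intro x; simp)]
  ring

/-- L11 = L12 = 0 -/
theorem M22d : (NS (fun X : Fin 2 → M3 F => S22 X ∧ X 1 1 1 = 0 ∧ X 1 1 2 = 0)).ncard = (s + 1) ^ 4 * (s + 2) ^ 2 := by
  have := M22c' (F := F) hq h2 True
  simp only [true_imp_iff] at this
  rw [NS_split _ (fun X => X 1 0 0 = 0), this]
  have e0 : (NS (fun X : Fin 2 → M3 F => (S22 X ∧ X 1 1 1 = 0 ∧ X 1 1 2 = 0) ∧ X 1 0 0 = 0)).ncard = 0 := by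
    refine (congrArg Set.ncard ?_).trans (Set.ncard_empty _)
    rw [Set.eq_empty_iff_forall_notMem]
    rintro X ⟨hs, hD, ⟨g1, g2, g3⟩, g4⟩
    exact hD (D_F2 X hs g4 g1.2.2.1 g1.2.2.2 g2 g3)
  have e1 : {p : (F × F) × F | (p.2 ≠ 0 ∧ 4 * p.1.1 ^ 2 + p.2 * p.1.2 ^ 2 ≠ 0) ∧ p.1.1 = 0} =
      {p : (F × F) × F | (p.1.1 = 0 ∧ p.1.2 ≠ 0) ∧ p.2 ≠ 0} := by
    ext ⟨⟨x, y⟩, z⟩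
    simp only [Set.mem_ofPred_eq]
    constructor
    · rintro ⟨⟨a, b⟩, rfl⟩
      refine ⟨⟨rfl, ?_⟩, a⟩
      rintro rfl
      exact b (by ring)
    · rintro ⟨⟨rfl, b⟩, c⟩
      exact ⟨⟨c, by simp [b, c]⟩, rfl⟩
  rw [e0, e1, c_prod (fun p : F × F => p.1 = 0 ∧ p.2 ≠ 0) (fun p : F => p ≠ 0), c_prod (fun p : F => p = 0) (fun p : F => p ≠ 0), c_ne hq]
  have : {p : F | p = 0}.ncard = 1 := Set.ncard_singleton _
  rw [this]
  ring

end cnt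
end QC

namespace QC
open Matrix Polynomial
section cnt

/-- rescaled integral weights -/
noncomputable def ra {n : ℕ} (A : Fin n → ℤ) : Fin n → ℝ := fun i => (A i : ℝ) / 12
/-- nonnegative and divisible by twelve -/
def nd (n : ℤ) : Prop := 0 ≤ n ∧ n % 12 = 0

theorem ex_nat (n : ℤ) (r : ℝ) (h : r = (n : ℝ) / 12) : (∃ m : ℕ, r = m) ↔ nd n := by
  subst h
  constructor
  · rintro ⟨m, hm⟩
    have : (n : ℝ) = ((12 * m : ℤ) : ℝ) := by push_cast; linarith
    have := Int.cast_injective this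
    unfold nd; omega
  · rintro ⟨h1, h2⟩
    refine ⟨(n / 12).toNat, ?_⟩
    have e : n = 12 * ((n / 12).toNat : ℤ) := by omega
    rw [div_eq_iff (by norm_num)]
    have : (n : ℝ) = ((12 * ((n / 12).toNat : ℤ) : ℤ) : ℝ) := by rw [← e]
    rw [this]; push_cast; ring

theorem ex_nat2 {n : ℕ} (A : Fin n → ℤ) (i j) : (∃ m : ℕ, ra A i - ra A j = m) ↔ nd (A i - A j) :=
  ex_nat _ _ (by simp only [ra]; push_cast; ring)
theorem ex_nat3 (A : Fin 3 → ℤ) (B : Fin 2 → ℤ) (i j k) : (∃ m : ℕ, ra A i + ra A j - ra B k = m) ↔ nd (A i + A j - B k) :=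
  ex_nat _ _ (by simp only [ra]; push_cast; ring)

variable {F : Type} [Field F] [Fintype F]

/-- support condition -/
def Sup (A : Fin 3 → ℤ) (B : Fin 2 → ℤ) (X : Fin 2 → M3 F) : Prop := ∀ k i j, X k i j ≠ 0 → nd (A i + A j - B k)

theorem Mc_eq (A : Fin 3 → ℤ) (B : Fin 2 → ℤ) : Mc F (ra A) (ra B) = (NS (F := F) (Sup A B)).ncard := by
  unfold Mc
  simp only [ex_nat3]
  symm
  have : NS (F := F) (Sup A B) = (fun c : Fin 2 × Fin 6 → F => fun k => sy (fun s => c (k, s))) ''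
    {c | (∀ p, c p ≠ 0 → nd (A (ii p.2) + A (jj p.2) - B p.1)) ∧ D (fun k => sy (fun s => c (k, s))) ≠ 0} := by
    ext X
    constructor
    · rintro ⟨hs, hD, hS⟩
      have e : (fun k => sy (fun s => ys (X k) s)) = X := by funext k; exact sy_ys _ (hs k)
      refine ⟨fun p => ys (X p.1) p.2, ⟨fun p hp => hS _ _ _ hp, ?_⟩, e⟩
      dsimp only
      rw [e]; exact hD
    · rintro ⟨c, ⟨h1, h2⟩, rfl⟩
      refine ⟨fun k => sy_symm _, h2, ?_⟩
      intro k i j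
      have := fun s => h1 (k, s)
      have e0 := this 0; have e1 := this 1; have e2 := this 2
      have e3 := this 3; have e4 := this 4; have e5 := this 5
      simp only [ii, jj] at e0 e1 e2 e3 e4 e5
      fin_cases i <;> fin_cases j
      · exact e0
      · exact e1
      · exact e2
      · rw [add_comm]; exact e1
      · exact e3
      · exact e4
      · rw [add_comm]; exact e2
      · rw [add_comm]; exact e4
      · exact e5
  rw [this, Set.ncard_image_of_injective]
  intro c c' h
  funext ⟨k, s⟩
  have := congrArg (fun X => ys (X k) s) h
  simp only [ys_sy] at this
  exact this

theorem NS_perm (A : Fin 3 → ℤ) (B : Fin 2 → ℤ) (σ : Equiv.Perm (Fin 3)) (τ : Equiv.Perm (Fin 2)) :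
    (NS (F := F) (Sup (A ∘ σ) (B ∘ τ))).ncard = (NS (F := F) (Sup A B)).ncard := by
  have pm : ∀ (σ : Equiv.Perm (Fin 3)) (τ : Equiv.Perm (Fin 2)) (A : Fin 3 → ℤ) (B : Fin 2 → ℤ) (X : Fin 2 → M3 F), X ∈ NS (Sup A B) → perm σ τ X ∈ NS (Sup (A ∘ σ) (B ∘ τ)) := by
    rintro σ τ A B X ⟨hs, hD, hS⟩
    refine ⟨fun k => Matrix.ext fun i j => (hs (τ k)).apply _ _, ?_, fun k i j h => hS _ _ _ h⟩
    unfold perm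
    rw [D_perm]
    exact hD
  have pp : ∀ (σ τ) (X : Fin 2 → M3 F), perm σ τ (perm σ⁻¹ τ⁻¹ X) = X := by
    intro σ τ X; funext k; refine Matrix.ext fun i j => ?_
    simp [perm]
  symm
  have e : NS (F := F) (Sup (A ∘ σ) (B ∘ τ)) = perm σ τ '' NS (Sup A B) := by
    ext X
    constructor
    · intro h
      refine ⟨perm σ⁻¹ τ⁻¹ X, ?_, pp _ _ _⟩
      have := pm σ⁻¹ τ⁻¹ _ _ X h
      convert this using 2
      congr 1 <;> (funext i; simp)
    · rintro ⟨Y, hY, rfl⟩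
      exact pm _ _ _ _ _ hY
  rw [e, Set.ncard_image_of_injective]
  intro X Y h
  have := congrArg (perm σ⁻¹ τ⁻¹) h
  have q := pp σ⁻¹ τ⁻¹
  simp only [inv_inv] at q
  rwa [q, q] at this

theorem Sup_iff (A : Fin 3 → ℤ) (B : Fin 2 → ℤ) (X : Fin 2 → M3 F) (hs : ∀ k, (X k).IsSymm) : Sup A B X ↔
    ((X 0 0 0 = 0 ∨ nd (A 0 + A 0 - B 0)) ∧ (X 0 0 1 = 0 ∨ nd (A 0 + A 1 - B 0)) ∧ (X 0 0 2 = 0 ∨ nd (A 0 + A 2 - B 0)) ∧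
     (X 0 1 1 = 0 ∨ nd (A 1 + A 1 - B 0)) ∧ (X 0 1 2 = 0 ∨ nd (A 1 + A 2 - B 0)) ∧ (X 0 2 2 = 0 ∨ nd (A 2 + A 2 - B 0)) ∧
     (X 1 0 0 = 0 ∨ nd (A 0 + A 0 - B 1)) ∧ (X 1 0 1 = 0 ∨ nd (A 0 + A 1 - B 1)) ∧ (X 1 0 2 = 0 ∨ nd (A 0 + A 2 - B 1)) ∧
     (X 1 1 1 = 0 ∨ nd (A 1 + A 1 - B 1)) ∧ (X 1 1 2 = 0 ∨ nd (A 1 + A 2 - B 1)) ∧ (X 1 2 2 = 0 ∨ nd (A 2 + A 2 - B 1))) := by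
  obtain ⟨s1, s2, s3⟩ := ssym hs
  constructor
  · intro h
    have h' := fun k i j => or_iff_not_imp_left.2 (h k i j)
    exact ⟨h' _ _ _, h' _ _ _, h' _ _ _, h' _ _ _, h' _ _ _, h' _ _ _, h' _ _ _, h' _ _ _, h' _ _ _, h' _ _ _, h' _ _ _, h' _ _ _⟩
  · rintro ⟨e0, e1, e2, e3, e4, e5, f0, f1, f2, f3, f4, f5⟩ k i j
    rw [ne_eq, ← or_iff_not_imp_left]
    have c1 := add_comm (A 1) (A 0)
    have c2 := add_comm (A 2) (A 0)
    have c3 := add_comm (A 2) (A 1)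
    have g1 := e1; have g2 := e2; have g4 := e4; have k1 := f1; have k2 := f2; have k4 := f4
    rw [← s1, ← c1] at g1 k1
    rw [← s2, ← c2] at g2 k2
    rw [← s3, ← c3] at g4 k4
    fin_cases k <;> fin_cases i <;> fin_cases j <;> assumption
end cnt
end QC

namespace QC
open Matrix Polynomial
section cnt

/-- evaluation of a coefficient list -/
def evl (q : ℕ) : List ℕ → ℕ
  | [] => 0
  | c :: l => c + q * evl q l

/-- multiplicity, generic family -/
def me (X Y Z P Q : ℤ) : List ℕ :=
  if Q ≤ 2 * X then [1, 3, 4, 3, 1]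
  else if P ≤ 2 * X then
    if Q ≤ X + Y then [1, 3, 3, 1]
    else if Q ≤ 2 * Y then (if Q ≤ X + Z then [1, 3, 1] else [1, 1])
    else (if Q ≤ X + Z then [1, 1] else [1])
  else if Q ≤ X + Y then [1, 2, 1]
  else if Q ≤ 2 * Y then [1, 1] else [1]
/-- multiplicity, (12) family -/
def m12 (X Y Z P Q : ℤ) : List ℕ :=
  if X + Y < P ∨ 2 * Y < P ∨ 2 * Z < P ∨ Y + Z < Q then []
  else if P ≤ 2 * X then (if Q ≤ X + Z then [1, 1] else [1])
  else if Q ≤ X + Z then [1] else []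
/-- multiplicity, (22) family -/
def m22 (X Y Z P Q : ℤ) : List ℕ :=
  if 2 * X < P ∨ 2 * Y < P ∨ 2 * Z < Q then []
  else if Q ≤ 2 * Y then (if Q ≤ 2 * X then [1, 2, 1] else [1, 1])
  else if Q ≤ Y + Z then (if Q ≤ 2 * X then [1, 1] else [1])
  else if Q ≤ 2 * X then [1] else []
/-- multiplicity, (123) family -/
def m123 (X Y Z P Q : ℤ) : List ℕ :=
  if P ≤ X + Y ∧ P ≤ 2 * Z ∧ Q ≤ X + Z ∧ Q ≤ 2 * Y then [1] else []
/-- multiplicity, (1234) family -/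
def m1234 (X Y Z P Q : ℤ) : List ℕ :=
  if P ≤ 2 * Y ∧ P ≤ X + Z ∧ Q ≤ 2 * X ∧ Q ≤ 2 * Z then [1] else []

variable {F : Type} [Field F] [Fintype F] {s : ℕ} (hq : Fintype.card F = s + 2) (h2 : (2 : F) ≠ 0) (h3 : (3 : F) ≠ 0)

omit [Fintype F] in
theorem NS_zero {Q : (Fin 2 → M3 F) → Prop} (h : ∀ X, (∀ k, (X k).IsSymm) → Q X → D X = 0) : (NS Q).ncard = 0 := by
  refine (congrArg Set.ncard ?_).trans (Set.ncard_empty _)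
  rw [Set.eq_empty_iff_forall_notMem]
  rintro X ⟨hs, hD, hQ⟩
  exact hD (h X hs hQ)

theorem D22z (X : Fin 2 → M3 F) (hs : ∀ k, (X k).IsSymm) (h : S22 X) (h5 : X 1 1 1 = 0) (h0 : X 1 1 2 = 0) (h6 : X 1 2 2 = 0) :
    D X = 0 := by
  obtain ⟨g1, g2, g3, g4⟩ := h
  conv_lhs => rw [mk_eta X hs]
  simp only [g1, g2, g3, g4, h5, h0, h6, D_mk]
  simp only [mul_zero, zero_mul, sub_zero, zero_sub, add_zero, zero_add]
  unfold disc3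
  ring

include hq h2 h3
theorem Me (A : Fin 3 → ℤ) (B : Fin 2 → ℤ) (rA : A 0 % 12 = 0 ∧ A 1 % 12 = 0 ∧ A 2 % 12 = 0) (rB : B 0 % 12 = 0 ∧ B 1 % 12 = 0)
    (sA : A 0 ≤ A 1 ∧ A 1 ≤ A 2) (sB : B 0 ≤ B 1) (g : B 0 ≤ A 0 + A 1 ∧ B 1 ≤ A 1 + A 2 ∧ (B 1 ≤ A 0 + A 2 ∨ B 0 ≤ 2 * A 0)) :
    (NS (F := F) (Sup A B)).ncard = (s + 1) ^ 4 * (s + 2) ^ 4 * evl (s + 2) (me (A 0) (A 1) (A 2) (B 0) (B 1)) := by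
  unfold me
  split_ifs
  · rw [NS_congr (Q' := fun X : Fin 2 → M3 F => True) (fun X hs _ => by
      rw [Sup_iff A B X hs]
      constructor
      · rintro ⟨e000, e001, e002, e011, e012, e022, e100, e101, e102, e111, e112, e122⟩
        exact trivial
      · rintro -
        exact ⟨Or.inr (by unfold nd; omega), Or.inr (by unfold nd; omega), Or.inr (by unfold nd; omega), Or.inr (by unfold nd; omega), Or.inr (by unfold nd; omega), Or.inr (by unfold nd; omega), Or.inr (by unfold nd; omega), Or.inr (by unfold nd; omega), Or.inr (by unfold nd; omega), Or.inr (by unfold nd; omega), Or.inr (by unfold nd; omega), Or.inr (by unfold nd; omega)⟩)]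
    rw [M0 hq h2 h3]; simp only [evl]; ring
  · rw [NS_congr (Q' := fun X : Fin 2 → M3 F => X 1 0 0 = 0) (fun X hs _ => by
      rw [Sup_iff A B X hs]
      constructor
      · rintro ⟨e000, e001, e002, e011, e012, e022, e100, e101, e102, e111, e112, e122⟩
        exact e100.resolve_right (by unfold nd; omega)
      · rintro f100
        exact ⟨Or.inr (by unfold nd; omega), Or.inr (by unfold nd; omega), Or.inr (by unfold nd; omega), Or.inr (by unfold nd; omega), Or.inr (by unfold nd; omega), Or.inr (by unfold nd; omega), Or.inl f100, Or.inr (by unfold nd; omega), Or.inr (by unfold nd; omega), Or.inr (by unfold nd; omega), Or.inr (by unfold nd; omega), Or.inr (by unfold nd; omega)⟩)]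
    rw [M1 hq h2 h3]; simp only [evl]; ring
  · rw [NS_congr (Q' := fun X : Fin 2 → M3 F => X 1 0 0 = 0 ∧ X 1 0 1 = 0) (fun X hs _ => by
      rw [Sup_iff A B X hs]
      constructor
      · rintro ⟨e000, e001, e002, e011, e012, e022, e100, e101, e102, e111, e112, e122⟩
        exact ⟨e100.resolve_right (by unfold nd; omega), e101.resolve_right (by unfold nd; omega)⟩
      · rintro ⟨f100, f101⟩
        exact ⟨Or.inr (by unfold nd; omega), Or.inr (by unfold nd; omega), Or.inr (by unfold nd; omega), Or.inr (by unfold nd; omega), Or.inr (by unfold nd; omega), Or.inr (by unfold nd; omega), Or.inl f100, Or.inl f101, Or.inr (by unfold nd; omega), Or.inr (by unfold nd; omega), Or.inr (by unfold nd; omega), Or.inr (by unfold nd; omega)⟩)]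
    rw [M2_ hq h2 h3]; simp only [evl]; ring
  · rw [NS_congr (Q' := fun X : Fin 2 → M3 F => X 1 0 0 = 0 ∧ X 1 0 1 = 0 ∧ X 1 0 2 = 0) (fun X hs _ => by
      rw [Sup_iff A B X hs]
      constructor
      · rintro ⟨e000, e001, e002, e011, e012, e022, e100, e101, e102, e111, e112, e122⟩
        exact ⟨e100.resolve_right (by unfold nd; omega), e101.resolve_right (by unfold nd; omega), e102.resolve_right (by unfold nd; omega)⟩
      · rintro ⟨f100, f101, f102⟩
        exact ⟨Or.inr (by unfold nd; omega), Or.inr (by unfold nd; omega), Or.inr (by unfold nd; omega), Or.inr (by unfold nd; omega), Or.inr (by unfold nd; omega), Or.inr (by unfold nd; omega), Or.inl f100, Or.inl f101, Or.inl f102, Or.inr (by unfold nd; omega), Or.inr (by unfold nd; omega), Or.inr (by unfold nd; omega)⟩)]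
    rw [M3_ hq h2]; simp only [evl]; ring
  · rw [NS_congr (Q' := fun X : Fin 2 → M3 F => X 1 0 0 = 0 ∧ X 1 0 1 = 0 ∧ X 1 1 1 = 0) (fun X hs _ => by
      rw [Sup_iff A B X hs]
      constructor
      · rintro ⟨e000, e001, e002, e011, e012, e022, e100, e101, e102, e111, e112, e122⟩
        exact ⟨e100.resolve_right (by unfold nd; omega), e101.resolve_right (by unfold nd; omega), e111.resolve_right (by unfold nd; omega)⟩
      · rintro ⟨f100, f101, f111⟩
        exact ⟨Or.inr (by unfold nd; omega), Or.inr (by unfold nd; omega), Or.inr (by unfold nd; omega), Or.inr (by unfold nd; omega), Or.inr (by unfold nd; omega), Or.inr (by unfold nd; omega), Or.inl f100, Or.inl f101, Or.inr (by unfold nd; omega), Or.inl f111, Or.inr (by unfold nd; omega), Or.inr (by unfold nd; omega)⟩)]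
    rw [M4 hq h2]; simp only [evl]; ring
  · rw [NS_congr (Q' := fun X : Fin 2 → M3 F => X 1 0 0 = 0 ∧ X 1 0 1 = 0 ∧ X 1 0 2 = 0 ∧ X 1 1 1 = 0) (fun X hs _ => by
      rw [Sup_iff A B X hs]
      constructor
      · rintro ⟨e000, e001, e002, e011, e012, e022, e100, e101, e102, e111, e112, e122⟩
        exact ⟨e100.resolve_right (by unfold nd; omega), e101.resolve_right (by unfold nd; omega), e102.resolve_right (by unfold nd; omega), e111.resolve_right (by unfold nd; omega)⟩
      · rintro ⟨f100, f101, f102, f111⟩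
        exact ⟨Or.inr (by unfold nd; omega), Or.inr (by unfold nd; omega), Or.inr (by unfold nd; omega), Or.inr (by unfold nd; omega), Or.inr (by unfold nd; omega), Or.inr (by unfold nd; omega), Or.inl f100, Or.inl f101, Or.inl f102, Or.inl f111, Or.inr (by unfold nd; omega), Or.inr (by unfold nd; omega)⟩)]
    rw [M5 hq h2]; simp only [evl]; ring
  · rw [NS_congr (Q' := fun X : Fin 2 → M3 F => X 1 0 0 = 0 ∧ X 0 0 0 = 0) (fun X hs _ => by
      rw [Sup_iff A B X hs]
      constructor
      · rintro ⟨e000, e001, e002, e011, e012, e022, e100, e101, e102, e111, e112, e122⟩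
        exact ⟨e100.resolve_right (by unfold nd; omega), e000.resolve_right (by unfold nd; omega)⟩
      · rintro ⟨f100, f000⟩
        exact ⟨Or.inl f000, Or.inr (by unfold nd; omega), Or.inr (by unfold nd; omega), Or.inr (by unfold nd; omega), Or.inr (by unfold nd; omega), Or.inr (by unfold nd; omega), Or.inl f100, Or.inr (by unfold nd; omega), Or.inr (by unfold nd; omega), Or.inr (by unfold nd; omega), Or.inr (by unfold nd; omega), Or.inr (by unfold nd; omega)⟩)]
    rw [M6 hq h2 h3]; simp only [evl]; ring
  · rw [NS_congr (Q' := fun X : Fin 2 → M3 F => X 1 0 0 = 0 ∧ X 1 0 1 = 0 ∧ X 0 0 0 = 0) (fun X hs _ => by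
      rw [Sup_iff A B X hs]
      constructor
      · rintro ⟨e000, e001, e002, e011, e012, e022, e100, e101, e102, e111, e112, e122⟩
        exact ⟨e100.resolve_right (by unfold nd; omega), e101.resolve_right (by unfold nd; omega), e000.resolve_right (by unfold nd; omega)⟩
      · rintro ⟨f100, f101, f000⟩
        exact ⟨Or.inl f000, Or.inr (by unfold nd; omega), Or.inr (by unfold nd; omega), Or.inr (by unfold nd; omega), Or.inr (by unfold nd; omega), Or.inr (by unfold nd; omega), Or.inl f100, Or.inl f101, Or.inr (by unfold nd; omega), Or.inr (by unfold nd; omega), Or.inr (by unfold nd; omega), Or.inr (by unfold nd; omega)⟩)]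
    rw [M7 hq h2 h3]; simp only [evl]; ring
  · rw [NS_congr (Q' := fun X : Fin 2 → M3 F => X 1 0 0 = 0 ∧ X 1 0 1 = 0 ∧ X 0 0 0 = 0 ∧ X 1 1 1 = 0) (fun X hs _ => by
      rw [Sup_iff A B X hs]
      constructor
      · rintro ⟨e000, e001, e002, e011, e012, e022, e100, e101, e102, e111, e112, e122⟩
        exact ⟨e100.resolve_right (by unfold nd; omega), e101.resolve_right (by unfold nd; omega), e000.resolve_right (by unfold nd; omega), e111.resolve_right (by unfold nd; omega)⟩
      · rintro ⟨f100, f101, f000, f111⟩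
        exact ⟨Or.inl f000, Or.inr (by unfold nd; omega), Or.inr (by unfold nd; omega), Or.inr (by unfold nd; omega), Or.inr (by unfold nd; omega), Or.inr (by unfold nd; omega), Or.inl f100, Or.inl f101, Or.inr (by unfold nd; omega), Or.inl f111, Or.inr (by unfold nd; omega), Or.inr (by unfold nd; omega)⟩)]
    rw [M8 hq h2]; simp only [evl]; ring

theorem Mf12 (A : Fin 3 → ℤ) (B : Fin 2 → ℤ) (rA : A 0 % 12 = 0 ∧ A 1 % 12 = 0 ∧ A 2 % 12 = 6) (rB : B 0 % 12 = 0 ∧ B 1 % 12 = 6)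
    (sA : A 0 ≤ A 1) :
    (NS (F := F) (Sup A B)).ncard = (s + 1) ^ 4 * (s + 2) * evl (s + 2) (m12 (A 0) (A 1) (A 2) (B 0) (B 1)) := by
  unfold m12
  split_ifs with c
  · rcases c with c | c | c | c
    · refine (NS_zero (fun X hs hS => ?_)).trans (by simp [evl])
      rw [Sup_iff A B X hs] at hS
      obtain ⟨e000, e001, e002, e011, e012, e022, e100, e101, e102, e111, e112, e122⟩ := hS
      have hS : S12 X := ⟨e002.resolve_right (by unfold nd; omega), e012.resolve_right (by unfold nd; omega), e100.resolve_right (by unfold nd; omega), e101.resolve_right (by unfold nd; omega), e111.resolve_right (by unfold nd; omega), e122.resolve_right (by unfold nd; omega)⟩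
      have z001 := e001.resolve_right (by unfold nd; omega)
      have z000 := e000.resolve_right (by unfold nd; omega)
      rw [DS12 X hs hS, z001, z000]; ring
    · refine (NS_zero (fun X hs hS => ?_)).trans (by simp [evl])
      rw [Sup_iff A B X hs] at hS
      obtain ⟨e000, e001, e002, e011, e012, e022, e100, e101, e102, e111, e112, e122⟩ := hS
      have hS : S12 X := ⟨e002.resolve_right (by unfold nd; omega), e012.resolve_right (by unfold nd; omega), e100.resolve_right (by unfold nd; omega), e101.resolve_right (by unfold nd; omega), e111.resolve_right (by unfold nd; omega), e122.resolve_right (by unfold nd; omega)⟩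
      have z011 := e011.resolve_right (by unfold nd; omega)
      have z001 := e001.resolve_right (by unfold nd; omega)
      have z000 := e000.resolve_right (by unfold nd; omega)
      rw [DS12 X hs hS, z011, z001]; ring
    · refine (NS_zero (fun X hs hS => ?_)).trans (by simp [evl])
      rw [Sup_iff A B X hs] at hS
      obtain ⟨e000, e001, e002, e011, e012, e022, e100, e101, e102, e111, e112, e122⟩ := hS
      have hS : S12 X := ⟨e002.resolve_right (by unfold nd; omega), e012.resolve_right (by unfold nd; omega), e100.resolve_right (by unfold nd; omega), e101.resolve_right (by unfold nd; omega), e111.resolve_right (by unfold nd; omega), e122.resolve_right (by unfold nd; omega)⟩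
      have z022 := e022.resolve_right (by unfold nd; omega)
      rw [DS12 X hs hS, z022]; ring
    · refine (NS_zero (fun X hs hS => ?_)).trans (by simp [evl])
      rw [Sup_iff A B X hs] at hS
      obtain ⟨e000, e001, e002, e011, e012, e022, e100, e101, e102, e111, e112, e122⟩ := hS
      have hS : S12 X := ⟨e002.resolve_right (by unfold nd; omega), e012.resolve_right (by unfold nd; omega), e100.resolve_right (by unfold nd; omega), e101.resolve_right (by unfold nd; omega), e111.resolve_right (by unfold nd; omega), e122.resolve_right (by unfold nd; omega)⟩
      have z112 := e112.resolve_right (by unfold nd; omega)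
      have z102 := e102.resolve_right (by unfold nd; omega)
      rw [DS12 X hs hS, z112, z102]; ring
  · rw [NS_congr (Q' := fun X : Fin 2 → M3 F => X 0 0 2 = 0 ∧ X 0 1 2 = 0 ∧ X 1 0 0 = 0 ∧ X 1 0 1 = 0 ∧ X 1 1 1 = 0 ∧ X 1 2 2 = 0) (fun X hs _ => by
      rw [Sup_iff A B X hs]
      constructor
      · rintro ⟨e000, e001, e002, e011, e012, e022, e100, e101, e102, e111, e112, e122⟩
        exact ⟨e002.resolve_right (by unfold nd; omega), e012.resolve_right (by unfold nd; omega), e100.resolve_right (by unfold nd; omega), e101.resolve_right (by unfold nd; omega), e111.resolve_right (by unfold nd; omega), e122.resolve_right (by unfold nd; omega)⟩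
      · rintro ⟨f002, f012, f100, f101, f111, f122⟩
        exact ⟨Or.inr (by unfold nd; omega), Or.inr (by unfold nd; omega), Or.inl f002, Or.inr (by unfold nd; omega), Or.inl f012, Or.inr (by unfold nd; omega), Or.inl f100, Or.inl f101, Or.inr (by unfold nd; omega), Or.inl f111, Or.inr (by unfold nd; omega), Or.inl f122⟩)]
    rw [NS_congr (Q' := fun X : Fin 2 → M3 F => S12 X) (fun X _ _ => by unfold S12; tauto), M12 hq h2]; simp only [evl]; ring
  · rw [NS_congr (Q' := fun X : Fin 2 → M3 F => X 0 0 2 = 0 ∧ X 0 1 2 = 0 ∧ X 1 0 0 = 0 ∧ X 1 0 1 = 0 ∧ X 1 1 1 = 0 ∧ X 1 2 2 = 0 ∧ X 1 0 2 = 0) (fun X hs _ => by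
      rw [Sup_iff A B X hs]
      constructor
      · rintro ⟨e000, e001, e002, e011, e012, e022, e100, e101, e102, e111, e112, e122⟩
        exact ⟨e002.resolve_right (by unfold nd; omega), e012.resolve_right (by unfold nd; omega), e100.resolve_right (by unfold nd; omega), e101.resolve_right (by unfold nd; omega), e111.resolve_right (by unfold nd; omega), e122.resolve_right (by unfold nd; omega), e102.resolve_right (by unfold nd; omega)⟩
      · rintro ⟨f002, f012, f100, f101, f111, f122, f102⟩
        exact ⟨Or.inr (by unfold nd; omega), Or.inr (by unfold nd; omega), Or.inl f002, Or.inr (by unfold nd; omega), Or.inl f012, Or.inr (by unfold nd; omega), Or.inl f100, Or.inl f101, Or.inl f102, Or.inl f111, Or.inr (by unfold nd; omega), Or.inl f122⟩)]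
    rw [NS_congr (Q' := fun X : Fin 2 → M3 F => S12 X ∧ X 1 0 2 = 0) (fun X _ _ => by unfold S12; tauto), M12a hq h2]; simp only [evl]; ring
  · rw [NS_congr (Q' := fun X : Fin 2 → M3 F => X 0 0 2 = 0 ∧ X 0 1 2 = 0 ∧ X 1 0 0 = 0 ∧ X 1 0 1 = 0 ∧ X 1 1 1 = 0 ∧ X 1 2 2 = 0 ∧ X 0 0 0 = 0) (fun X hs _ => by
      rw [Sup_iff A B X hs]
      constructor
      · rintro ⟨e000, e001, e002, e011, e012, e022, e100, e101, e102, e111, e112, e122⟩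
        exact ⟨e002.resolve_right (by unfold nd; omega), e012.resolve_right (by unfold nd; omega), e100.resolve_right (by unfold nd; omega), e101.resolve_right (by unfold nd; omega), e111.resolve_right (by unfold nd; omega), e122.resolve_right (by unfold nd; omega), e000.resolve_right (by unfold nd; omega)⟩
      · rintro ⟨f002, f012, f100, f101, f111, f122, f000⟩
        exact ⟨Or.inl f000, Or.inr (by unfold nd; omega), Or.inl f002, Or.inr (by unfold nd; omega), Or.inl f012, Or.inr (by unfold nd; omega), Or.inl f100, Or.inl f101, Or.inr (by unfold nd; omega), Or.inl f111, Or.inr (by unfold nd; omega), Or.inl f122⟩)]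
    rw [NS_congr (Q' := fun X : Fin 2 → M3 F => S12 X ∧ X 0 0 0 = 0) (fun X _ _ => by unfold S12; tauto), M12b hq h2]; simp only [evl]; ring
  · refine (NS_zero (fun X hs hS => ?_)).trans (by simp [evl])
    rw [Sup_iff A B X hs] at hS
    obtain ⟨e000, e001, e002, e011, e012, e022, e100, e101, e102, e111, e112, e122⟩ := hS
    have hS : S12 X := ⟨e002.resolve_right (by unfold nd; omega), e012.resolve_right (by unfold nd; omega), e100.resolve_right (by unfold nd; omega), e101.resolve_right (by unfold nd; omega), e111.resolve_right (by unfold nd; omega), e122.resolve_right (by unfold nd; omega)⟩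
    have z000 := e000.resolve_right (by unfold nd; omega)
    have z102 := e102.resolve_right (by unfold nd; omega)
    rw [DS12 X hs hS, z000, z102]; ring

theorem Mf22 (A : Fin 3 → ℤ) (B : Fin 2 → ℤ) (rA : A 0 % 12 = 0 ∧ A 1 % 12 = 6 ∧ A 2 % 12 = 6) (rB : B 0 % 12 = 0 ∧ B 1 % 12 = 0)
    (sA : A 1 ≤ A 2) (sB : B 0 ≤ B 1) :
    (NS (F := F) (Sup A B)).ncard = (s + 1) ^ 4 * (s + 2) ^ 2 * evl (s + 2) (m22 (A 0) (A 1) (A 2) (B 0) (B 1)) := by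
  unfold m22
  split_ifs with c
  · rcases c with c | c | c
    · refine (NS_zero (fun X hs hS => ?_)).trans (by simp [evl])
      rw [Sup_iff A B X hs] at hS
      obtain ⟨e000, e001, e002, e011, e012, e022, e100, e101, e102, e111, e112, e122⟩ := hS
      have hS : S22 X := ⟨e001.resolve_right (by unfold nd; omega), e002.resolve_right (by unfold nd; omega), e101.resolve_right (by unfold nd; omega), e102.resolve_right (by unfold nd; omega)⟩
      have z000 := e000.resolve_right (by unfold nd; omega)
      have z100 := e100.resolve_right (by unfold nd; omega)
      exact D_F1 X hs z100 hS.2.2.1 z000 hS.1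
    · refine (NS_zero (fun X hs hS => ?_)).trans (by simp [evl])
      rw [Sup_iff A B X hs] at hS
      obtain ⟨e000, e001, e002, e011, e012, e022, e100, e101, e102, e111, e112, e122⟩ := hS
      have hS : S22 X := ⟨e001.resolve_right (by unfold nd; omega), e002.resolve_right (by unfold nd; omega), e101.resolve_right (by unfold nd; omega), e102.resolve_right (by unfold nd; omega)⟩
      have z011 := e011.resolve_right (by unfold nd; omega)
      have z111 := e111.resolve_right (by unfold nd; omega)
      exact DS22' X hs hS z111 z011
    · refine (NS_zero (fun X hs hS => ?_)).trans (by simp [evl])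
      rw [Sup_iff A B X hs] at hS
      obtain ⟨e000, e001, e002, e011, e012, e022, e100, e101, e102, e111, e112, e122⟩ := hS
      have hS : S22 X := ⟨e001.resolve_right (by unfold nd; omega), e002.resolve_right (by unfold nd; omega), e101.resolve_right (by unfold nd; omega), e102.resolve_right (by unfold nd; omega)⟩
      have z111 := e111.resolve_right (by unfold nd; omega)
      have z112 := e112.resolve_right (by unfold nd; omega)
      have z122 := e122.resolve_right (by unfold nd; omega)
      exact D22z X hs hS z111 z112 z122
  · rw [NS_congr (Q' := fun X : Fin 2 → M3 F => X 0 0 1 = 0 ∧ X 0 0 2 = 0 ∧ X 1 0 1 = 0 ∧ X 1 0 2 = 0) (fun X hs _ => by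
      rw [Sup_iff A B X hs]
      constructor
      · rintro ⟨e000, e001, e002, e011, e012, e022, e100, e101, e102, e111, e112, e122⟩
        exact ⟨e001.resolve_right (by unfold nd; omega), e002.resolve_right (by unfold nd; omega), e101.resolve_right (by unfold nd; omega), e102.resolve_right (by unfold nd; omega)⟩
      · rintro ⟨f001, f002, f101, f102⟩
        exact ⟨Or.inr (by unfold nd; omega), Or.inl f001, Or.inl f002, Or.inr (by unfold nd; omega), Or.inr (by unfold nd; omega), Or.inr (by unfold nd; omega), Or.inr (by unfold nd; omega), Or.inl f101, Or.inl f102, Or.inr (by unfold nd; omega), Or.inr (by unfold nd; omega), Or.inr (by unfold nd; omega)⟩)]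
    rw [NS_congr (Q' := fun X : Fin 2 → M3 F => S22 X) (fun X _ _ => by unfold S22; tauto), M22 hq h2]; simp only [evl]; ring
  · rw [NS_congr (Q' := fun X : Fin 2 → M3 F => X 0 0 1 = 0 ∧ X 0 0 2 = 0 ∧ X 1 0 1 = 0 ∧ X 1 0 2 = 0 ∧ X 1 0 0 = 0) (fun X hs _ => by
      rw [Sup_iff A B X hs]
      constructor
      · rintro ⟨e000, e001, e002, e011, e012, e022, e100, e101, e102, e111, e112, e122⟩
        exact ⟨e001.resolve_right (by unfold nd; omega), e002.resolve_right (by unfold nd; omega), e101.resolve_right (by unfold nd; omega), e102.resolve_right (by unfold nd; omega), e100.resolve_right (by unfold nd; omega)⟩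
      · rintro ⟨f001, f002, f101, f102, f100⟩
        exact ⟨Or.inr (by unfold nd; omega), Or.inl f001, Or.inl f002, Or.inr (by unfold nd; omega), Or.inr (by unfold nd; omega), Or.inr (by unfold nd; omega), Or.inl f100, Or.inl f101, Or.inl f102, Or.inr (by unfold nd; omega), Or.inr (by unfold nd; omega), Or.inr (by unfold nd; omega)⟩)]
    rw [NS_congr (Q' := fun X : Fin 2 → M3 F => S22 X ∧ X 1 0 0 = 0) (fun X _ _ => by unfold S22; tauto), M22a hq h2]; simp only [evl]; ring
  · rw [NS_congr (Q' := fun X : Fin 2 → M3 F => X 0 0 1 = 0 ∧ X 0 0 2 = 0 ∧ X 1 0 1 = 0 ∧ X 1 0 2 = 0 ∧ X 1 1 1 = 0) (fun X hs _ => by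
      rw [Sup_iff A B X hs]
      constructor
      · rintro ⟨e000, e001, e002, e011, e012, e022, e100, e101, e102, e111, e112, e122⟩
        exact ⟨e001.resolve_right (by unfold nd; omega), e002.resolve_right (by unfold nd; omega), e101.resolve_right (by unfold nd; omega), e102.resolve_right (by unfold nd; omega), e111.resolve_right (by unfold nd; omega)⟩
      · rintro ⟨f001, f002, f101, f102, f111⟩
        exact ⟨Or.inr (by unfold nd; omega), Or.inl f001, Or.inl f002, Or.inr (by unfold nd; omega), Or.inr (by unfold nd; omega), Or.inr (by unfold nd; omega), Or.inr (by unfold nd; omega), Or.inl f101, Or.inl f102, Or.inl f111, Or.inr (by unfold nd; omega), Or.inr (by unfold nd; omega)⟩)]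
    rw [NS_congr (Q' := fun X : Fin 2 → M3 F => S22 X ∧ X 1 1 1 = 0) (fun X _ _ => by unfold S22; tauto), M22c hq h2]; simp only [evl]; ring
  · rw [NS_congr (Q' := fun X : Fin 2 → M3 F => X 0 0 1 = 0 ∧ X 0 0 2 = 0 ∧ X 1 0 1 = 0 ∧ X 1 0 2 = 0 ∧ X 1 0 0 = 0 ∧ X 1 1 1 = 0) (fun X hs _ => by
      rw [Sup_iff A B X hs]
      constructor
      · rintro ⟨e000, e001, e002, e011, e012, e022, e100, e101, e102, e111, e112, e122⟩
        exact ⟨e001.resolve_right (by unfold nd; omega), e002.resolve_right (by unfold nd; omega), e101.resolve_right (by unfold nd; omega), e102.resolve_right (by unfold nd; omega), e100.resolve_right (by unfold nd; omega), e111.resolve_right (by unfold nd; omega)⟩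
      · rintro ⟨f001, f002, f101, f102, f100, f111⟩
        exact ⟨Or.inr (by unfold nd; omega), Or.inl f001, Or.inl f002, Or.inr (by unfold nd; omega), Or.inr (by unfold nd; omega), Or.inr (by unfold nd; omega), Or.inl f100, Or.inl f101, Or.inl f102, Or.inl f111, Or.inr (by unfold nd; omega), Or.inr (by unfold nd; omega)⟩)]
    rw [NS_congr (Q' := fun X : Fin 2 → M3 F => S22 X ∧ X 1 0 0 = 0 ∧ X 1 1 1 = 0) (fun X _ _ => by unfold S22; tauto), M22b hq h2]; simp only [evl]; ring
  · rw [NS_congr (Q' := fun X : Fin 2 → M3 F => X 0 0 1 = 0 ∧ X 0 0 2 = 0 ∧ X 1 0 1 = 0 ∧ X 1 0 2 = 0 ∧ X 1 1 1 = 0 ∧ X 1 1 2 = 0) (fun X hs _ => by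
      rw [Sup_iff A B X hs]
      constructor
      · rintro ⟨e000, e001, e002, e011, e012, e022, e100, e101, e102, e111, e112, e122⟩
        exact ⟨e001.resolve_right (by unfold nd; omega), e002.resolve_right (by unfold nd; omega), e101.resolve_right (by unfold nd; omega), e102.resolve_right (by unfold nd; omega), e111.resolve_right (by unfold nd; omega), e112.resolve_right (by unfold nd; omega)⟩
      · rintro ⟨f001, f002, f101, f102, f111, f112⟩
        exact ⟨Or.inr (by unfold nd; omega), Or.inl f001, Or.inl f002, Or.inr (by unfold nd; omega), Or.inr (by unfold nd; omega), Or.inr (by unfold nd; omega), Or.inr (by unfold nd; omega), Or.inl f101, Or.inl f102, Or.inl f111, Or.inl f112, Or.inr (by unfold nd; omega)⟩)]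
    rw [NS_congr (Q' := fun X : Fin 2 → M3 F => S22 X ∧ X 1 1 1 = 0 ∧ X 1 1 2 = 0) (fun X _ _ => by unfold S22; tauto), M22d hq h2]; simp only [evl]; ring
  · refine (NS_zero (fun X hs hS => ?_)).trans (by simp [evl])
    rw [Sup_iff A B X hs] at hS
    obtain ⟨e000, e001, e002, e011, e012, e022, e100, e101, e102, e111, e112, e122⟩ := hS
    have hS : S22 X := ⟨e001.resolve_right (by unfold nd; omega), e002.resolve_right (by unfold nd; omega), e101.resolve_right (by unfold nd; omega), e102.resolve_right (by unfold nd; omega)⟩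
    have z100 := e100.resolve_right (by unfold nd; omega)
    have z111 := e111.resolve_right (by unfold nd; omega)
    have z112 := e112.resolve_right (by unfold nd; omega)
    exact D_F2 X hs z100 hS.2.2.1 hS.2.2.2 z111 z112

theorem Mf123 (A : Fin 3 → ℤ) (B : Fin 2 → ℤ) (rA : A 0 % 12 = 0 ∧ A 1 % 12 = 4 ∧ A 2 % 12 = 8) (rB : B 0 % 12 = 4 ∧ B 1 % 12 = 8) :
    (NS (F := F) (Sup A B)).ncard = (s + 1) ^ 4 * evl (s + 2) (m123 (A 0) (A 1) (A 2) (B 0) (B 1)) := by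
  unfold m123
  split_ifs with c
  · rw [NS_congr (Q' := fun X : Fin 2 → M3 F => X 0 0 0 = 0 ∧ X 0 0 2 = 0 ∧ X 0 1 1 = 0 ∧ X 0 1 2 = 0 ∧ X 1 0 0 = 0 ∧ X 1 0 1 = 0 ∧ X 1 1 2 = 0 ∧ X 1 2 2 = 0) (fun X hs _ => by
      rw [Sup_iff A B X hs]
      constructor
      · rintro ⟨e000, e001, e002, e011, e012, e022, e100, e101, e102, e111, e112, e122⟩
        exact ⟨e000.resolve_right (by unfold nd; omega), e002.resolve_right (by unfold nd; omega), e011.resolve_right (by unfold nd; omega), e012.resolve_right (by unfold nd; omega), e100.resolve_right (by unfold nd; omega), e101.resolve_right (by unfold nd; omega), e112.resolve_right (by unfold nd; omega), e122.resolve_right (by unfold nd; omega)⟩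
      · rintro ⟨f000, f002, f011, f012, f100, f101, f112, f122⟩
        exact ⟨Or.inl f000, Or.inr (by unfold nd; omega), Or.inl f002, Or.inl f011, Or.inl f012, Or.inr (by unfold nd; omega), Or.inl f100, Or.inl f101, Or.inr (by unfold nd; omega), Or.inr (by unfold nd; omega), Or.inl f112, Or.inl f122⟩)]
    rw [NS_congr (Q' := fun X : Fin 2 → M3 F => S123 X) (fun X _ _ => by unfold S123; tauto), M123 hq h2 h3]; simp only [evl]; ring
  · have c : ¬ (B 0 ≤ A 0 + A 1) ∨ ¬ (B 0 ≤ 2 * A 2) ∨ ¬ (B 1 ≤ A 0 + A 2) ∨ ¬ (B 1 ≤ 2 * A 1) := by tauto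
    rcases c with c | c | c | c
    · refine (NS_zero (fun X hs hS => ?_)).trans (by simp [evl])
      rw [Sup_iff A B X hs] at hS
      obtain ⟨e000, e001, e002, e011, e012, e022, e100, e101, e102, e111, e112, e122⟩ := hS
      have hS : S123 X := ⟨e000.resolve_right (by unfold nd; omega), e002.resolve_right (by unfold nd; omega), e011.resolve_right (by unfold nd; omega), e012.resolve_right (by unfold nd; omega), e100.resolve_right (by unfold nd; omega), e101.resolve_right (by unfold nd; omega), e112.resolve_right (by unfold nd; omega), e122.resolve_right (by unfold nd; omega)⟩
      have z001 := e001.resolve_right (by unfold nd; omega)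
      rw [DS123 X hs hS, z001]; ring
    · refine (NS_zero (fun X hs hS => ?_)).trans (by simp [evl])
      rw [Sup_iff A B X hs] at hS
      obtain ⟨e000, e001, e002, e011, e012, e022, e100, e101, e102, e111, e112, e122⟩ := hS
      have hS : S123 X := ⟨e000.resolve_right (by unfold nd; omega), e002.resolve_right (by unfold nd; omega), e011.resolve_right (by unfold nd; omega), e012.resolve_right (by unfold nd; omega), e100.resolve_right (by unfold nd; omega), e101.resolve_right (by unfold nd; omega), e112.resolve_right (by unfold nd; omega), e122.resolve_right (by unfold nd; omega)⟩
      have z022 := e022.resolve_right (by unfold nd; omega)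
      rw [DS123 X hs hS, z022]; ring
    · refine (NS_zero (fun X hs hS => ?_)).trans (by simp [evl])
      rw [Sup_iff A B X hs] at hS
      obtain ⟨e000, e001, e002, e011, e012, e022, e100, e101, e102, e111, e112, e122⟩ := hS
      have hS : S123 X := ⟨e000.resolve_right (by unfold nd; omega), e002.resolve_right (by unfold nd; omega), e011.resolve_right (by unfold nd; omega), e012.resolve_right (by unfold nd; omega), e100.resolve_right (by unfold nd; omega), e101.resolve_right (by unfold nd; omega), e112.resolve_right (by unfold nd; omega), e122.resolve_right (by unfold nd; omega)⟩
      have z102 := e102.resolve_right (by unfold nd; omega)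
      rw [DS123 X hs hS, z102]; ring
    · refine (NS_zero (fun X hs hS => ?_)).trans (by simp [evl])
      rw [Sup_iff A B X hs] at hS
      obtain ⟨e000, e001, e002, e011, e012, e022, e100, e101, e102, e111, e112, e122⟩ := hS
      have hS : S123 X := ⟨e000.resolve_right (by unfold nd; omega), e002.resolve_right (by unfold nd; omega), e011.resolve_right (by unfold nd; omega), e012.resolve_right (by unfold nd; omega), e100.resolve_right (by unfold nd; omega), e101.resolve_right (by unfold nd; omega), e112.resolve_right (by unfold nd; omega), e122.resolve_right (by unfold nd; omega)⟩
      have z111 := e111.resolve_right (by unfold nd; omega)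
      rw [DS123 X hs hS, z111]; ring

theorem Mf1234 (A : Fin 3 → ℤ) (B : Fin 2 → ℤ) (rA : A 0 % 12 = 3 ∧ A 1 % 12 = 6 ∧ A 2 % 12 = 9) (rB : B 0 % 12 = 0 ∧ B 1 % 12 = 6) :
    (NS (F := F) (Sup A B)).ncard = (s + 1) ^ 4 * evl (s + 2) (m1234 (A 0) (A 1) (A 2) (B 0) (B 1)) := by
  unfold m1234
  split_ifs with c
  · rw [NS_congr (Q' := fun X : Fin 2 → M3 F => X 0 0 0 = 0 ∧ X 0 0 1 = 0 ∧ X 0 1 2 = 0 ∧ X 0 2 2 = 0 ∧ X 1 0 1 = 0 ∧ X 1 0 2 = 0 ∧ X 1 1 1 = 0 ∧ X 1 1 2 = 0) (fun X hs _ => by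
      rw [Sup_iff A B X hs]
      constructor
      · rintro ⟨e000, e001, e002, e011, e012, e022, e100, e101, e102, e111, e112, e122⟩
        exact ⟨e000.resolve_right (by unfold nd; omega), e001.resolve_right (by unfold nd; omega), e012.resolve_right (by unfold nd; omega), e022.resolve_right (by unfold nd; omega), e101.resolve_right (by unfold nd; omega), e102.resolve_right (by unfold nd; omega), e111.resolve_right (by unfold nd; omega), e112.resolve_right (by unfold nd; omega)⟩
      · rintro ⟨f000, f001, f012, f022, f101, f102, f111, f112⟩
        exact ⟨Or.inl f000, Or.inl f001, Or.inr (by unfold nd; omega), Or.inr (by unfold nd; omega), Or.inl f012, Or.inl f022, Or.inr (by unfold nd; omega), Or.inl f101, Or.inl f102, Or.inl f111, Or.inl f112, Or.inr (by unfold nd; omega)⟩)]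
    rw [NS_congr (Q' := fun X : Fin 2 → M3 F => S1234 X) (fun X _ _ => by unfold S1234; tauto), M1234 hq h2]; simp only [evl]; ring
  · have c : ¬ (B 0 ≤ 2 * A 1) ∨ ¬ (B 0 ≤ A 0 + A 2) ∨ ¬ (B 1 ≤ 2 * A 0) ∨ ¬ (B 1 ≤ 2 * A 2) := by tauto
    rcases c with c | c | c | c
    · refine (NS_zero (fun X hs hS => ?_)).trans (by simp [evl])
      rw [Sup_iff A B X hs] at hS
      obtain ⟨e000, e001, e002, e011, e012, e022, e100, e101, e102, e111, e112, e122⟩ := hS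
      have hS : S1234 X := ⟨e000.resolve_right (by unfold nd; omega), e001.resolve_right (by unfold nd; omega), e012.resolve_right (by unfold nd; omega), e022.resolve_right (by unfold nd; omega), e101.resolve_right (by unfold nd; omega), e102.resolve_right (by unfold nd; omega), e111.resolve_right (by unfold nd; omega), e112.resolve_right (by unfold nd; omega)⟩
      have z011 := e011.resolve_right (by unfold nd; omega)
      rw [DS1234 X hs hS, z011]; ring
    · refine (NS_zero (fun X hs hS => ?_)).trans (by simp [evl])
      rw [Sup_iff A B X hs] at hS
      obtain ⟨e000, e001, e002, e011, e012, e022, e100, e101, e102, e111, e112, e122⟩ := hS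
      have hS : S1234 X := ⟨e000.resolve_right (by unfold nd; omega), e001.resolve_right (by unfold nd; omega), e012.resolve_right (by unfold nd; omega), e022.resolve_right (by unfold nd; omega), e101.resolve_right (by unfold nd; omega), e102.resolve_right (by unfold nd; omega), e111.resolve_right (by unfold nd; omega), e112.resolve_right (by unfold nd; omega)⟩
      have z002 := e002.resolve_right (by unfold nd; omega)
      rw [DS1234 X hs hS, z002]; ring
    · refine (NS_zero (fun X hs hS => ?_)).trans (by simp [evl])
      rw [Sup_iff A B X hs] at hS
      obtain ⟨e000, e001, e002, e011, e012, e022, e100, e101, e102, e111, e112, e122⟩ := hS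
      have hS : S1234 X := ⟨e000.resolve_right (by unfold nd; omega), e001.resolve_right (by unfold nd; omega), e012.resolve_right (by unfold nd; omega), e022.resolve_right (by unfold nd; omega), e101.resolve_right (by unfold nd; omega), e102.resolve_right (by unfold nd; omega), e111.resolve_right (by unfold nd; omega), e112.resolve_right (by unfold nd; omega)⟩
      have z100 := e100.resolve_right (by unfold nd; omega)
      rw [DS1234 X hs hS, z100]; ring
    · refine (NS_zero (fun X hs hS => ?_)).trans (by simp [evl])
      rw [Sup_iff A B X hs] at hS
      obtain ⟨e000, e001, e002, e011, e012, e022, e100, e101, e102, e111, e112, e122⟩ := hS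
      have hS : S1234 X := ⟨e000.resolve_right (by unfold nd; omega), e001.resolve_right (by unfold nd; omega), e012.resolve_right (by unfold nd; omega), e022.resolve_right (by unfold nd; omega), e101.resolve_right (by unfold nd; omega), e102.resolve_right (by unfold nd; omega), e111.resolve_right (by unfold nd; omega), e112.resolve_right (by unfold nd; omega)⟩
      have z122 := e122.resolve_right (by unfold nd; omega)
      rw [DS1234 X hs hS, z122]; ring

end cnt
end QC

namespace QC
open Matrix Polynomial
section cnt
variable {F : Type} [Field F] [Fintype F]

/-- invertible homogeneous matrices -/
def PA (F : Type) [Field F] {n : ℕ} (A : Fin n → ℤ) : Set (Matrix (Fin n) (Fin n) F) :=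
  {g | (∀ i j, g i j ≠ 0 → nd (A i - A j)) ∧ g.det ≠ 0}

theorem PA_perm {n : ℕ} (A : Fin n → ℤ) (σ : Equiv.Perm (Fin n)) : (PA F (A ∘ σ)).ncard = (PA F A).ncard := by
  symm
  have e : PA F (A ∘ σ) = (fun g => g.submatrix σ σ) '' PA F A := by
    ext g
    constructor
    · rintro ⟨h1, h2⟩
      refine ⟨g.submatrix (σ⁻¹ : Equiv.Perm (Fin n)) (σ⁻¹ : Equiv.Perm (Fin n)), ⟨fun i j h => ?_, ?_⟩, ?_⟩
      · have := h1 _ _ h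
        simpa using this
      · change (g.submatrix (σ⁻¹ : Equiv.Perm _) (σ⁻¹ : Equiv.Perm _)).det ≠ 0
        rw [Matrix.det_submatrix_equiv_self]; exact h2
      · refine Matrix.ext fun i j => ?_
        simp
    · rintro ⟨g, ⟨h1, h2⟩, rfl⟩
      refine ⟨fun i j h => h1 _ _ h, ?_⟩
      change (g.submatrix σ σ).det ≠ 0
      rw [Matrix.det_submatrix_equiv_self]; exact h2
  rw [e, Set.ncard_image_of_injective]
  intro g g' h
  refine Matrix.ext fun i j => ?_
  have := congrFun (congrFun h (σ⁻¹ i)) (σ⁻¹ j)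
  simpa using this

theorem Pc_scale {s : ℕ} (hq : Fintype.card F = s + 2) (A : Fin 3 → ℤ) (B : Fin 2 → ℤ) :
    (s + 1) * Pc F (ra A) (ra B) = (PA F A).ncard * (PA F B).ncard := by
  have h1 := c_prod (fun g : M3 F => g ∈ PA F A) (fun g : M2 F => g ∈ PA F B)
  have e1 : (PA F A).ncard * (PA F B).ncard = {p : M3 F × M2 F | p.1 ∈ PA F A ∧ p.2 ∈ PA F B}.ncard := h1.symm
  have h2 := c_prod (fun c : F => c ≠ 0) (fun γ : M3 F × M2 F => HomM (ra A) γ.1 ∧ HomM (ra B) γ.2 ∧ γ.1.det * γ.2.det = 1)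
  rw [c_ne hq] at h2
  unfold Pc
  rw [← h2, e1]
  let Φ : F × (M3 F × M2 F) → M3 F × M2 F := fun p => (p.2.1, Matrix.of fun i j => if i = 0 then p.1 * p.2.2 i j else p.2.2 i j)
  have dΦ : ∀ c (γ : M3 F × M2 F), (Φ (c, γ)).2.det = c * γ.2.det := by
    intro c γ
    simp [Φ, Matrix.det_fin_two]
    ring
  have hh : ∀ {n : ℕ} (A : Fin n → ℤ) (g : Matrix (Fin n) (Fin n) F), HomM (ra A) g ↔ ∀ i j, g i j ≠ 0 → nd (A i - A j) := by
    intro n A g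
    unfold HomM
    simp only [ex_nat2]
  simp only [hh]
  symm
  rw [← Set.InjOn.ncard_image (f := Φ)]
  · congr 1
    ext ⟨g, h⟩
    constructor
    · rintro ⟨⟨a1, a2⟩, ⟨b1, b2⟩⟩
      have hc : g.det * h.det ≠ 0 := mul_ne_zero a2 b2
      have ee : Φ (g.det * h.det, (Φ ((g.det * h.det)⁻¹, (g, h)))) = (g, h) := by
        refine Prod.ext rfl (Matrix.ext fun i j => ?_)
        change (if i = 0 then _ * (if i = 0 then _ else _) else (if i = 0 then _ else _)) = _
        split_ifs
        · exact mul_inv_cancel_left₀ hc _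
        · rfl
      refine ⟨(g.det * h.det, Φ ((g.det * h.det)⁻¹, (g, h))), ⟨hc, a1, ?_, ?_⟩, ee⟩
      · intro i j hij
        apply b1
        intro h0
        apply hij
        change (if i = 0 then _ * h i j else h i j) = 0
        have h0 : h i j = 0 := h0
        rw [h0]; simp
      · rw [dΦ]
        change g.det * _ = 1
        dsimp only at a2 b2 ⊢
        field_simp
    · rintro ⟨⟨c, g', h'⟩, ⟨hc, a1, a2, a3⟩, hp⟩
      rw [← hp]
      dsimp only at a1 a2 a3 hc
      refine ⟨⟨a1, left_ne_zero_of_mul_eq_one a3⟩, ⟨?_, ?_⟩⟩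
      · intro i j hij
        apply a2
        intro h0
        apply hij
        change (if i = 0 then _ * h' i j else h' i j) = 0
        rw [h0]; simp
      · rw [dΦ]
        exact mul_ne_zero hc (right_ne_zero_of_mul_eq_one a3)
  · rintro ⟨c, g, h⟩ ⟨hc, _, _, a3⟩ ⟨c', g', h'⟩ ⟨hc', _, _, a3'⟩ hp
    dsimp only at a3 a3' hc hc'
    have hg : g = g' := congrArg Prod.fst hp
    subst hg
    have hd := congrArg (fun p => p.2.det) hp
    simp only [dΦ] at hd
    have hgd := left_ne_zero_of_mul_eq_one a3
    have hcc : c = c' := by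
      have e : h.det = h'.det := mul_left_cancel₀ hgd (a3.trans a3'.symm)
      rw [e] at hd
      exact mul_right_cancel₀ (right_ne_zero_of_mul_eq_one a3') hd
    subst hcc
    congr 2
    refine Matrix.ext fun i j => ?_
    have := congrFun (congrFun (congrArg Prod.snd hp) i) j
    change (if i = 0 then c * h i j else h i j) = (if i = 0 then c * h' i j else h' i j) at this
    split_ifs at this
    · exact mul_left_cancel₀ hc this
    · exact this

theorem PA_eq {n : ℕ} (A : Fin n → ℤ) (h : ∀ i j, nd (A i - A j)) : (PA F A).ncard = ∏ i : Fin n, (Fintype.card F ^ n - Fintype.card F ^ (i : ℕ)) := by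
  rw [← Matrix.card_GL_field]
  have e : PA F A = Set.range (fun g : GL (Fin n) F => (g : Matrix (Fin n) (Fin n) F)) := by
    ext g
    constructor
    · rintro ⟨_, hd⟩
      exact ⟨Matrix.GeneralLinearGroup.mkOfDetNeZero g hd, rfl⟩
    · rintro ⟨g, rfl⟩
      exact ⟨fun i j _ => h i j, g.det_ne_zero⟩
  rw [e, ← Set.image_univ, Set.ncard_image_of_injective _ Units.val_injective, Set.ncard_univ]

theorem c_cond (p : Prop) [Decidable p] : {x : F | x ≠ 0 → p}.ncard = if p then Fintype.card F else 1 := by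
  split_ifs with h
  · simp only [h, implies_true]; exact cnt_univ
  · simp only [h, imp_false, not_not]
    exact Set.ncard_singleton _

instance (n : ℤ) : Decidable (nd n) := inferInstanceAs (Decidable (_ ∧ _))

theorem PA2 {s : ℕ} (hq : Fintype.card F = s + 2) (B : Fin 2 → ℤ) (h : ¬ nd (B 0 - B 1) ∨ ¬ nd (B 1 - B 0)) :
    (PA F B).ncard = (s + 1) ^ 2 * ((if nd (B 0 - B 1) then (s + 2) else 1) * (if nd (B 1 - B 0) then (s + 2) else 1)) := by
  have e : PA F B = (fun p : (F × F) × (F × F) => !![p.1.1, p.2.1; p.2.2, p.1.2]) ''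
      {p | (p.1.1 ≠ 0 ∧ p.1.2 ≠ 0) ∧ ((p.2.1 ≠ 0 → nd (B 0 - B 1)) ∧ (p.2.2 ≠ 0 → nd (B 1 - B 0)))} := by
    ext g
    constructor
    · rintro ⟨h1, h2⟩
      refine ⟨((g 0 0, g 1 1), (g 0 1, g 1 0)), ⟨?_, h1 _ _, h1 _ _⟩, (Matrix.eta_fin_two g).symm⟩
      have : g 0 1 * g 1 0 = 0 := by
        rcases h with h | h
        · rw [not_not.1 (fun hh => h (h1 _ _ hh)), zero_mul]
        · rw [not_not.1 (fun hh => h (h1 1 0 hh)), mul_zero]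
      rw [Matrix.det_fin_two, this, sub_zero] at h2
      exact mul_ne_zero_iff.1 h2
    · rintro ⟨⟨⟨a, d⟩, b, c⟩, ⟨⟨ha, hd⟩, hb, hc⟩, rfl⟩
      dsimp only at *
      have : b * c = 0 := by
        rcases h with h | h
        · rw [not_not.1 (fun hh => h (hb hh)), zero_mul]
        · rw [not_not.1 (fun hh => h (hc hh)), mul_zero]
      refine ⟨?_, ?_⟩
      · intro i j
        have z : nd 0 := by unfold nd; omega
        fin_cases i <;> fin_cases j
        · simpa using fun _ => z
        · exact hb
        · exact hc
        · simpa using fun _ => z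
      · rw [Matrix.det_fin_two_of, this, sub_zero]
        exact mul_ne_zero ha hd
  rw [e, Set.ncard_image_of_injective, c_prod (fun p : F × F => p.1 ≠ 0 ∧ p.2 ≠ 0) (fun p : F × F => (p.1 ≠ 0 → nd (B 0 - B 1)) ∧ (p.2 ≠ 0 → nd (B 1 - B 0))),
   c_prod (fun p : F => p ≠ 0) (fun p : F => p ≠ 0), c_prod (fun p : F => p ≠ 0 → nd (B 0 - B 1)) (fun p : F => p ≠ 0 → nd (B 1 - B 0)), c_ne hq, c_cond, c_cond, hq, sq]
  rintro ⟨⟨a, d⟩, b, c⟩ ⟨⟨a', d'⟩, b', c'⟩ hp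
  have h00 := congrFun (congrFun hp 0) 0
  have h01 := congrFun (congrFun hp 0) 1
  have h10 := congrFun (congrFun hp 1) 0
  have h11 := congrFun (congrFun hp 1) 1
  simp at h00 h01 h10 h11
  rw [h00, h01, h10, h11]

theorem PA3 {s : ℕ} (hq : Fintype.card F = s + 2) (A : Fin 3 → ℤ)
    (h : (¬ nd (A 0 - A 2) ∧ ¬ nd (A 1 - A 2)) ∨ (¬ nd (A 2 - A 0) ∧ ¬ nd (A 2 - A 1))) :
    (PA F A).ncard = (PA F ![A 0, A 1]).ncard * ((s + 1) * (((if nd (A 0 - A 2) then (s + 2) else 1) * (if nd (A 1 - A 2) then (s + 2) else 1)) *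
      ((if nd (A 2 - A 0) then (s + 2) else 1) * (if nd (A 2 - A 1) then (s + 2) else 1)))) := by
  have z : nd 0 := by unfold nd; omega
  have key : ∀ (m : M2 F) (z u v x y : F), (u ≠ 0 → nd (A 0 - A 2)) → (v ≠ 0 → nd (A 1 - A 2)) → (x ≠ 0 → nd (A 2 - A 0)) → (y ≠ 0 → nd (A 2 - A 1)) →
      (!![m 0 0, m 0 1, u; m 1 0, m 1 1, v; x, y, z] : M3 F).det = m.det * z := by
    intro m z u v x y hu hv hx hy
    rw [Matrix.det_fin_two, Matrix.det_fin_three]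
    rcases h with h | h
    · have e1 := not_not.1 (fun hh => h.1 (hu hh))
      have e2 := not_not.1 (fun hh => h.2 (hv hh))
      simp [e1, e2]; ring
    · have e1 := not_not.1 (fun hh => h.1 (hx hh))
      have e2 := not_not.1 (fun hh => h.2 (hy hh))
      simp [e1, e2]; ring
  have e : PA F A = (fun p : M2 F × F × (F × F) × (F × F) => !![p.1 0 0, p.1 0 1, p.2.2.1.1; p.1 1 0, p.1 1 1, p.2.2.1.2; p.2.2.2.1, p.2.2.2.2, p.2.1]) ''
      {p | p.1 ∈ PA F ![A 0, A 1] ∧ p.2.1 ≠ 0 ∧ ((p.2.2.1.1 ≠ 0 → nd (A 0 - A 2)) ∧ (p.2.2.1.2 ≠ 0 → nd (A 1 - A 2))) ∧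
         ((p.2.2.2.1 ≠ 0 → nd (A 2 - A 0)) ∧ (p.2.2.2.2 ≠ 0 → nd (A 2 - A 1)))} := by
    ext g
    constructor
    · rintro ⟨h1, h2⟩
      have eg : g = !![!![g 0 0, g 0 1; g 1 0, g 1 1] 0 0, !![g 0 0, g 0 1; g 1 0, g 1 1] 0 1, g 0 2; !![g 0 0, g 0 1; g 1 0, g 1 1] 1 0, !![g 0 0, g 0 1; g 1 0, g 1 1] 1 1, g 1 2; g 2 0, g 2 1, g 2 2] := Matrix.eta_fin_three g
      rw [eg, key _ _ _ _ _ _ (h1 _ _) (h1 _ _) (h1 _ _) (h1 _ _)] at h2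
      refine ⟨(!![g 0 0, g 0 1; g 1 0, g 1 1], g 2 2, (g 0 2, g 1 2), (g 2 0, g 2 1)), ⟨⟨?_, left_ne_zero_of_mul h2⟩, right_ne_zero_of_mul h2, ⟨h1 _ _, h1 _ _⟩, ⟨h1 _ _, h1 _ _⟩⟩, eg.symm⟩
      intro i j
      fin_cases i <;> fin_cases j
      · exact h1 0 0
      · exact h1 0 1
      · exact h1 1 0
      · exact h1 1 1
    · rintro ⟨⟨m, w, ⟨u, v⟩, x, y⟩, ⟨hm, hw, ⟨hu, hv⟩, hx, hy⟩, rfl⟩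
      dsimp only at *
      refine ⟨?_, ?_⟩
      · intro i j
        have := hm.1
        fin_cases i <;> fin_cases j
        · exact this 0 0
        · exact this 0 1
        · exact hu
        · exact this 1 0
        · exact this 1 1
        · exact hv
        · exact hx
        · exact hy
        · simpa using fun _ => z
      · rw [key _ _ _ _ _ _ hu hv hx hy]
        exact mul_ne_zero hm.2 hw
  rw [e, Set.ncard_image_of_injective, c_prod (fun m : M2 F => m ∈ PA F ![A 0, A 1]) (fun p : F × (F × F) × (F × F) => p.1 ≠ 0 ∧ ((p.2.1.1 ≠ 0 → nd (A 0 - A 2)) ∧ (p.2.1.2 ≠ 0 → nd (A 1 - A 2))) ∧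
         ((p.2.2.1 ≠ 0 → nd (A 2 - A 0)) ∧ (p.2.2.2 ≠ 0 → nd (A 2 - A 1)))),
   c_prod (fun p : F => p ≠ 0) (fun p : (F × F) × (F × F) => ((p.1.1 ≠ 0 → nd (A 0 - A 2)) ∧ (p.1.2 ≠ 0 → nd (A 1 - A 2))) ∧
         ((p.2.1 ≠ 0 → nd (A 2 - A 0)) ∧ (p.2.2 ≠ 0 → nd (A 2 - A 1)))),
   c_prod (fun p : F × F => (p.1 ≠ 0 → nd (A 0 - A 2)) ∧ (p.2 ≠ 0 → nd (A 1 - A 2))) (fun p : F × F => (p.1 ≠ 0 → nd (A 2 - A 0)) ∧ (p.2 ≠ 0 → nd (A 2 - A 1))),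
   c_prod (fun p : F => p ≠ 0 → nd (A 0 - A 2)) (fun p : F => p ≠ 0 → nd (A 1 - A 2)), c_prod (fun p : F => p ≠ 0 → nd (A 2 - A 0)) (fun p : F => p ≠ 0 → nd (A 2 - A 1)),
   c_ne hq, c_cond, c_cond, c_cond, c_cond, hq]
  · rfl
  rintro ⟨m, w, ⟨u, v⟩, x, y⟩ ⟨m', w', ⟨u', v'⟩, x', y'⟩ hp
  have q := fun i j => congrFun (congrFun hp i) j
  have h00 := q 0 0
  have h01 := q 0 1
  have h02 := q 0 2
  have h10 := q 1 0
  have h11 := q 1 1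
  have h12 := q 1 2
  have h20 := q 2 0
  have h21 := q 2 1
  have h22 := q 2 2
  simp at h00 h01 h02 h10 h11 h12 h20 h21 h22
  rw [h02, h12, h20, h21, h22, Matrix.eta_fin_two m, Matrix.eta_fin_two m', h00, h01, h10, h11]

/-- flag polynomial -/
def da (X Y Z : ℤ) : List ℕ := if X = Y ∧ Y = Z then [1] else if X = Y ∨ Y = Z ∨ X = Z then [1, 1, 1] else [1, 2, 2, 1]
/-- flag polynomial -/
def db (P Q : ℤ) : List ℕ := if P = Q then [1] else [1, 1]
/-- total flag number -/
def CC (q : ℕ) : ℕ := (1 + q) ^ 2 * (1 + q + q ^ 2)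

theorem PA_B {s : ℕ} (hq : Fintype.card F = s + 2) (B : Fin 2 → ℤ) (r : (B 0 - B 1) % 12 = 0) :
    (PA F B).ncard * evl (s + 2) (db (B 0) (B 1)) = (s + 1) ^ 2 * (s + 2) * (s + 3) := by
  unfold db
  split_ifs with c
  · rw [PA_eq]
    · simp only [Fin.prod_univ_two, hq, evl]
      have e1 : (s + 2) ^ 2 - (s + 2) ^ ((0 : Fin 2) : ℕ) = (s + 1) * (s + 3) := by
        rw [Nat.sub_eq_iff_eq_add (by simp; nlinarith)]; simp; ring
      have e2 : (s + 2) ^ 2 - (s + 2) ^ ((1 : Fin 2) : ℕ) = (s + 1) * (s + 2) := by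
        rw [Nat.sub_eq_iff_eq_add (by simp; nlinarith)]; simp; ring
      rw [e1, e2]; ring
    · intro i j; unfold nd; fin_cases i <;> fin_cases j <;> simp <;> omega
  · rw [PA2 hq B (by unfold nd; omega)]
    have : (nd (B 0 - B 1) ∧ ¬ nd (B 1 - B 0)) ∨ (nd (B 1 - B 0) ∧ ¬ nd (B 0 - B 1)) := by unfold nd; omega
    rcases this with ⟨h1, h2⟩ | ⟨h1, h2⟩ <;> simp only [h1, h2, if_true, if_false, evl] <;> ring

theorem PA_B' {s : ℕ} (hq : Fintype.card F = s + 2) (B : Fin 2 → ℤ) (r : (B 0 - B 1) % 12 ≠ 0) :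
    (PA F B).ncard = (s + 1) ^ 2 := by
  rw [PA2 hq B (by unfold nd; omega), if_neg (by unfold nd; omega), if_neg (by unfold nd; omega)]; ring

theorem PA_3e {s : ℕ} (hq : Fintype.card F = s + 2) (A : Fin 3 → ℤ) (r : (A 0 - A 1) % 12 = 0 ∧ (A 1 - A 2) % 12 = 0)
   (o : A 0 ≤ A 1 ∧ A 1 ≤ A 2) :
    (PA F A).ncard * evl (s + 2) (da (A 0) (A 1) (A 2)) = (s + 1) ^ 3 * (s + 2) ^ 3 * (s + 3) * (1 + (s + 2) + (s + 2) ^ 2) := by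
  have hB := PA_B (F := F) hq ![A 0, A 1] (by simpa using r.1)
  simp only [Matrix.cons_val_zero, Matrix.cons_val_one] at hB
  unfold db at hB
  unfold da
  rcases eq_or_lt_of_le o.2 with c2 | c2
  · rcases eq_or_lt_of_le o.1 with c1 | c1
    · rw [if_pos ⟨c1, c2⟩, PA_eq]
      · simp only [Fin.prod_univ_three, hq, evl]
        have e1 : (s + 2) ^ 3 - (s + 2) ^ ((0 : Fin 3) : ℕ) = (s + 1) * (1 + (s + 2) + (s + 2) ^ 2) := by
          rw [Nat.sub_eq_iff_eq_add (by simp; exact Nat.one_le_pow _ _ (by omega))]; simp; ring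
        have e2 : (s + 2) ^ 3 - (s + 2) ^ ((1 : Fin 3) : ℕ) = (s + 1) * (s + 2) * (s + 3) := by
          rw [Nat.sub_eq_iff_eq_add (Nat.pow_le_pow_right (by omega) (by simp))]; simp; ring
        have e3 : (s + 2) ^ 3 - (s + 2) ^ ((2 : Fin 3) : ℕ) = (s + 1) * (s + 2) ^ 2 := by
          rw [Nat.sub_eq_iff_eq_add (Nat.pow_le_pow_right (by omega) (by simp))]; simp; ring
        rw [e1, e2, e3]; ring
      · intro i j; unfold nd; fin_cases i <;> fin_cases j <;> simp <;> omega
    · rw [if_neg (by omega), if_pos (by omega)]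
      have hB := PA_B (F := F) hq ![A 1, A 2] (by simpa using r.2)
      simp only [Matrix.cons_val_zero, Matrix.cons_val_one] at hB
      unfold db at hB
      rw [if_pos c2] at hB
      have e1 : (finRotate 3) 0 = 1 := by decide
      have e2 : (finRotate 3) 1 = 2 := by decide
      have e3 : (finRotate 3) 2 = 0 := by decide
      rw [← PA_perm A (finRotate 3), PA3 hq (A ∘ finRotate 3)]
      · simp only [Function.comp_apply, e1, e2, e3]
        rw [if_pos (by unfold nd; omega), if_pos (by unfold nd; omega), if_neg (by unfold nd; omega), if_neg (by unfold nd; omega)]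
        simp only [evl] at hB ⊢
        linear_combination ((s + 1) * (s + 2) ^ 2 * (1 + (s + 2) + (s + 2) ^ 2)) * hB
      · simp only [Function.comp_apply, e1, e2, e3]
        unfold nd; omega
  · rw [if_neg (by omega)]
    rw [PA3 hq A (by unfold nd; omega), if_neg (by unfold nd; omega), if_neg (by unfold nd; omega), if_pos (by unfold nd; omega), if_pos (by unfold nd; omega)]
    rcases eq_or_lt_of_le o.1 with c1 | c1
    · rw [if_pos c1] at hB
      rw [if_pos (by omega)]
      simp only [evl] at hB ⊢
      linear_combination ((s + 1) * (s + 2) ^ 2 * (1 + (s + 2) + (s + 2) ^ 2)) * hB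
    · rw [if_neg (by omega)] at hB
      rw [if_neg (by omega)]
      simp only [evl] at hB ⊢
      linear_combination ((s + 1) * (s + 2) ^ 2 * (1 + (s + 2) + (s + 2) ^ 2)) * hB

theorem PA_3m {s : ℕ} (hq : Fintype.card F = s + 2) (A : Fin 3 → ℤ) (r : (A 0 - A 1) % 12 = 0 ∧ (A 1 - A 2) % 12 ≠ 0) :
    (PA F A).ncard * evl (s + 2) (da (A 0) (A 1) (A 2)) = (s + 1) ^ 3 * (s + 2) * (s + 3) * (1 + (s + 2) + (s + 2) ^ 2) := by
  have hB := PA_B (F := F) hq ![A 0, A 1] (by simpa using r.1)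
  simp only [Matrix.cons_val_zero, Matrix.cons_val_one] at hB
  unfold db at hB
  unfold da
  rw [if_neg (by omega)]
  rw [PA3 hq A (by unfold nd; omega), if_neg (by unfold nd; omega), if_neg (by unfold nd; omega), if_neg (by unfold nd; omega), if_neg (by unfold nd; omega)]
  by_cases c1 : A 0 = A 1
  · rw [if_pos c1] at hB
    rw [if_pos (by omega)]
    simp only [evl] at hB ⊢
    linear_combination ((s + 1) * (1 + (s + 2) + (s + 2) ^ 2)) * hB
  · rw [if_neg (by omega)] at hB
    rw [if_neg (by omega)]
    simp only [evl] at hB ⊢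
    linear_combination ((s + 1) * (1 + (s + 2) + (s + 2) ^ 2)) * hB

theorem PA_3m' {s : ℕ} (hq : Fintype.card F = s + 2) (A : Fin 3 → ℤ) (r : (A 1 - A 2) % 12 = 0 ∧ (A 0 - A 2) % 12 ≠ 0) :
    (PA F A).ncard * evl (s + 2) (da (A 0) (A 1) (A 2)) = (s + 1) ^ 3 * (s + 2) * (s + 3) * (1 + (s + 2) + (s + 2) ^ 2) := by
  have e1 : (finRotate 3) 0 = 1 := by decide
  have e2 : (finRotate 3) 1 = 2 := by decide
  have e3 : (finRotate 3) 2 = 0 := by decide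
  have := PA_3m (F := F) hq (A ∘ finRotate 3)
  rw [PA_perm] at this
  simp only [Function.comp_apply, e1, e2, e3] at this
  rw [← this (by omega)]
  congr 2
  unfold da
  split_ifs <;> first | rfl | (exfalso; omega)

theorem PA_3d {s : ℕ} (hq : Fintype.card F = s + 2) (A : Fin 3 → ℤ) (r : (A 0 - A 1) % 12 ≠ 0 ∧ (A 1 - A 2) % 12 ≠ 0 ∧ (A 0 - A 2) % 12 ≠ 0) :
    (PA F A).ncard * evl (s + 2) (da (A 0) (A 1) (A 2)) = (s + 1) ^ 3 * (s + 3) * (1 + (s + 2) + (s + 2) ^ 2) := by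
  have hB := PA_B' (F := F) hq ![A 0, A 1] (by simpa using r.1)
  unfold da
  rw [if_neg (by omega), if_neg (by omega)]
  rw [PA3 hq A (by unfold nd; omega), if_neg (by unfold nd; omega), if_neg (by unfold nd; omega), if_neg (by unfold nd; omega), if_neg (by unfold nd; omega), hB]
  simp only [evl]
  ring

/-- combination of the counts -/
theorem ratio {s K L kA kB m p q M P a b : ℕ} (h1 : (s + 1) * P = p * q) (hM : M = (s + 1) ^ 4 * K * m)
    (ha : p * a = (s + 1) ^ 3 * kA * (s + 3) * (1 + (s + 2) + (s + 2) ^ 2)) (hb : q * b = (s + 1) ^ 2 * kB * L) (hK : kA * kB = K) (hL : L = s + 3) :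
    M * CC (s + 2) = m * (a * b) * P := by
  have : (s + 1) * (M * CC (s + 2)) = (s + 1) * (m * (a * b) * P) := by
    rw [hM, ← hK]
    unfold CC
    have : (s + 1) * (m * (a * b) * P) = m * (a * b) * ((s + 1) * P) := by ring
    rw [this, h1]
    have : m * (a * b) * (p * q) = m * (p * a) * (q * b) := by ring
    rw [this, ha, hb, hL]; ring
  exact Nat.eq_of_mul_eq_mul_left (by omega) this

theorem evl_db' {s : ℕ} (P Q : ℤ) (h : P ≠ Q) : evl (s + 2) (db P Q) = s + 3 := by
  unfold db; rw [if_neg h]; simp only [evl]; ring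

end cnt
end QC

namespace QC
open Matrix Polynomial

/-- residue patterns: family, positions of the labels -/
abbrev Pt := ℕ × (Fin 3 × Fin 3 × Fin 3) × (Fin 2 × Fin 2)

/-- all six orders -/
def ord3 : List (Fin 3 × Fin 3 × Fin 3) := [(0, 1, 2), (0, 2, 1), (1, 0, 2), (1, 2, 0), (2, 0, 1), (2, 1, 0)]
/-- both orders -/
def ord2 : List (Fin 2 × Fin 2) := [(0, 1), (1, 0)]
/-- the 34 patterns -/
def pats : List Pt :=
  [(0, (0, 1, 2), (0, 1))] ++
  ([(0, 1, 2), (0, 2, 1), (1, 2, 0)].flatMap fun s => ord2.map fun u => (1, s, u)) ++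
  ([(0, 1, 2), (1, 0, 2), (2, 0, 1)].map fun s => (2, s, (0, 1))) ++
  (ord3.flatMap fun s => ord2.map fun u => (3, s, u)) ++
  (ord3.flatMap fun s => ord2.map fun u => (4, s, u))

/-- label residues of a family -/
def rfA : ℕ → ℤ × ℤ × ℤ
  | 0 => (0, 0, 0)
  | 1 => (0, 0, 6)
  | 2 => (0, 6, 6)
  | 3 => (0, 4, 8)
  | _ => (3, 6, 9)
/-- label residues of a family -/
def rfB : ℕ → ℤ × ℤ
  | 0 => (0, 0)
  | 1 => (0, 6)
  | 2 => (0, 0)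
  | 3 => (4, 8)
  | _ => (0, 6)
/-- main polynomial of a family -/
def mf : ℕ → ℤ → ℤ → ℤ → ℤ → ℤ → List ℕ
  | 0 => me
  | 1 => m12
  | 2 => m22
  | 3 => m123
  | _ => m1234

/-- region of a type -/
def Reg (A : Fin 3 → ℤ) (B : Fin 2 → ℤ) : Prop :=
  (A 0 ≤ A 1 ∧ A 1 ≤ A 2) ∧ B 0 ≤ B 1 ∧ (B 0 ≤ A 0 + A 1 ∧ B 1 ≤ A 1 + A 2 ∧ (B 1 ≤ A 0 + A 2 ∨ B 0 ≤ 2 * A 0))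

/-- a type has a given pattern -/
def HasPat (p : Pt) (A : Fin 3 → ℤ) (B : Fin 2 → ℤ) : Prop :=
  (A p.2.1.1 % 12 = (rfA p.1).1 ∧ A p.2.1.2.1 % 12 = (rfA p.1).2.1 ∧ A p.2.1.2.2 % 12 = (rfA p.1).2.2) ∧
  (B p.2.2.1 % 12 = (rfB p.1).1 ∧ B p.2.2.2 % 12 = (rfB p.1).2)

section cnt
variable {F : Type} [Field F] [Fintype F]

theorem Pc_pos (a b) : 0 < Pc F a b := by
  unfold Pc
  rw [Set.ncard_pos (Set.toFinite _)]
  have h : ∀ {n : ℕ} (p : Fin n → ℝ), HomM (F := F) p 1 := by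
    intro n p i j h
    have : i = j := by
      by_contra hh; exact h (Matrix.one_apply_ne hh)
    subst this
    exact ⟨0, by simp⟩
  exact ⟨(1, 1), h _, h _, by simp⟩

variable {s : ℕ} (hq : Fintype.card F = s + 2) (h2 : (2 : F) ≠ 0) (h3 : (3 : F) ≠ 0)
include hq h2 h3

theorem Wlab (f : ℕ) (A : Fin 3 → ℤ) (B : Fin 2 → ℤ)
    (rA : A 0 % 12 = (rfA f).1 ∧ A 1 % 12 = (rfA f).2.1 ∧ A 2 % 12 = (rfA f).2.2)
    (rB : B 0 % 12 = (rfB f).1 ∧ B 1 % 12 = (rfB f).2)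
    (o0 : f = 0 → Reg A B) (o1 : f = 1 → A 0 ≤ A 1) (o2 : f = 2 → A 1 ≤ A 2 ∧ B 0 ≤ B 1) :
    Mc F (ra A) (ra B) * CC (s + 2) = evl (s + 2) (mf f (A 0) (A 1) (A 2) (B 0) (B 1)) *
      (evl (s + 2) (da (A 0) (A 1) (A 2)) * evl (s + 2) (db (B 0) (B 1))) * Pc F (ra A) (ra B) := by
  have hs := Pc_scale hq A B
  rw [Mc_eq]
  match f with
  | 0 =>
    simp only [rfA, rfB] at rA rB
    obtain ⟨sA, sB, g⟩ := o0 rfl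
    refine ratio (K := (s + 2) ^ 4) (kA := (s + 2) ^ 3) (kB := s + 2) hs (Me hq h2 h3 A B rA rB sA sB g) ?_ (PA_B hq B (by omega)) (by ring) rfl
    rw [PA_3e hq A (by omega) sA]
  | 1 =>
    simp only [rfA, rfB] at rA rB
    refine ratio (K := (s + 2)) (kA := (s + 2)) (kB := 1) (L := s + 3) hs (Mf12 hq h2 h3 A B rA rB (o1 rfl)) ?_ ?_ (by ring) rfl
    · rw [PA_3m hq A (by omega)]
    · rw [PA_B' hq B (by omega), evl_db' _ _ (by omega), mul_one]
  | 2 =>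
    simp only [rfA, rfB] at rA rB
    refine ratio (K := (s + 2) ^ 2) (kA := (s + 2)) (kB := s + 2) hs (Mf22 hq h2 h3 A B rA rB (o2 rfl).1 (o2 rfl).2) ?_ (PA_B hq B (by omega)) (by ring) rfl
    rw [PA_3m' hq A (by omega)]
  | 3 =>
    simp only [rfA, rfB] at rA rB
    refine ratio (K := 1) (kA := 1) (kB := 1) (L := s + 3) hs ?_ ?_ ?_ (by ring) rfl
    · rw [Mf123 hq h2 h3 A B rA rB, mul_one]; rfl
    · rw [PA_3d hq A (by omega), mul_one]
    · rw [PA_B' hq B (by omega), evl_db' _ _ (by omega), mul_one]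
  | (n + 4) =>
    simp only [rfA, rfB] at rA rB
    refine ratio (K := 1) (kA := 1) (kB := 1) (L := s + 3) hs ?_ ?_ ?_ (by ring) rfl
    · rw [Mf1234 hq h2 h3 A B rA rB, mul_one]; rfl
    · rw [PA_3d hq A (by omega), mul_one]
    · rw [PA_B' hq B (by omega), evl_db' _ _ (by omega), mul_one]

theorem pats_ok : ∀ p ∈ pats, (p.1 = 0 → p.2.1 = (0, 1, 2) ∧ p.2.2 = (0, 1)) ∧ (p.1 = 1 → p.2.1.1 < p.2.1.2.1) ∧
    (p.1 = 2 → p.2.1.2.1 < p.2.1.2.2 ∧ p.2.2 = (0, 1)) ∧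
    (∃ σ : Equiv.Perm (Fin 3), σ 0 = p.2.1.1 ∧ σ 1 = p.2.1.2.1 ∧ σ 2 = p.2.1.2.2) ∧
    (∃ σ : Equiv.Perm (Fin 2), σ 0 = p.2.2.1 ∧ σ 1 = p.2.2.2) := by
  decide +kernel

theorem Pc_perm (A : Fin 3 → ℤ) (B : Fin 2 → ℤ) (σ : Equiv.Perm (Fin 3)) (τ : Equiv.Perm (Fin 2)) :
    Pc F (ra (A ∘ σ)) (ra (B ∘ τ)) = Pc F (ra A) (ra B) := by
  have e1 := Pc_scale hq A B
  have e2 := Pc_scale hq (A ∘ σ) (B ∘ τ)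
  rw [PA_perm, PA_perm, ← e1] at e2
  exact Nat.eq_of_mul_eq_mul_left (by omega) e2

theorem da_perm (A : Fin 3 → ℤ) (σ : Equiv.Perm (Fin 3)) : da (A (σ 0)) (A (σ 1)) (A (σ 2)) = da (A 0) (A 1) (A 2) := by
  have : ∀ σ : Equiv.Perm (Fin 3), (σ 0, σ 1, σ 2) ∈ ord3 := by decide
  have h := this σ
  simp only [ord3, List.mem_cons, Prod.mk.injEq, List.not_mem_nil, or_false] at h
  unfold da
  rcases h with h | h | h | h | h | h <;> rw [h.1, h.2.1, h.2.2] <;> split_ifs <;> first | rfl | (exfalso; omega)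

theorem db_perm (B : Fin 2 → ℤ) (σ : Equiv.Perm (Fin 2)) : db (B (σ 0)) (B (σ 1)) = db (B 0) (B 1) := by
  have : ∀ σ : Equiv.Perm (Fin 2), (σ 0, σ 1) ∈ ord2 := by decide
  have h := this σ
  simp only [ord2, List.mem_cons, Prod.mk.injEq, List.not_mem_nil, or_false] at h
  unfold db
  rcases h with h | h <;> rw [h.1, h.2] <;> split_ifs <;> first | rfl | (exfalso; omega)

theorem Wpos (p : Pt) (hp : p ∈ pats) (A : Fin 3 → ℤ) (B : Fin 2 → ℤ) (hr : Reg A B) (hP : HasPat p A B) :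
    Mc F (ra A) (ra B) * CC (s + 2) = evl (s + 2) (mf p.1 (A p.2.1.1) (A p.2.1.2.1) (A p.2.1.2.2) (B p.2.2.1) (B p.2.2.2)) *
      (evl (s + 2) (da (A 0) (A 1) (A 2)) * evl (s + 2) (db (B 0) (B 1))) * Pc F (ra A) (ra B) := by
  obtain ⟨k0, k1, k2, ⟨σ, s0, s1, s2⟩, ⟨τ, t0, t1⟩⟩ := pats_ok hq h2 h3 p hp
  have mA : ∀ i j : Fin 3, i ≤ j → A i ≤ A j := by
    obtain ⟨⟨sA, sA'⟩, _⟩ := hr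
    intro i j hij
    fin_cases i <;> fin_cases j <;> first | exact le_rfl | assumption | exact sA.trans sA' | exact absurd hij (by decide)
  have key := Wlab hq h2 h3 p.1 (A ∘ σ) (B ∘ τ) (by simpa [s0, s1, s2] using hP.1) (by simpa [t0, t1] using hP.2) ?_ ?_ ?_
  · rw [Mc_eq, NS_perm, ← Mc_eq, Pc_perm hq h2 h3] at key
    simp only [Function.comp_apply] at key
    rw [da_perm hq h2 h3, db_perm hq h2 h3, s0, s1, s2, t0, t1] at key
    exact key
  · intro hf
    obtain ⟨a, b⟩ := k0 hf
    have e : A ∘ σ = A := by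
      funext i; fin_cases i
      · change A (σ 0) = A 0; rw [s0, a]
      · change A (σ 1) = A 1; rw [s1, a]
      · change A (σ 2) = A 2; rw [s2, a]
    have e' : B ∘ τ = B := by
      funext i; fin_cases i
      · change B (τ 0) = B 0; rw [t0, b]
      · change B (τ 1) = B 1; rw [t1, b]
    rw [e, e']; exact hr
  · intro hf
    simp only [Function.comp_apply, s0, s1]
    exact mA _ _ (k1 hf).le
  · intro hf
    simp only [Function.comp_apply, s1, s2, t0, t1, (k2 hf).2]
    exact ⟨mA _ _ (k2 hf).1.le, hr.2.1⟩
end cnt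
end QC

namespace QC
open Matrix Polynomial

/-- positive part of the ceiling of `x/12` -/
def cl (x : ℤ) : ℤ := if 0 < x then (x + 11) / 12 else 0

theorem cl_ceil (x : ℤ) (r : ℝ) (h : r = (x : ℝ) / 12) : (⌈r⌉₊ : ℤ) = cl x := by
  subst h
  unfold cl
  split_ifs with hx
  · have e : ((x + 11) / 12).toNat = ⌈(x : ℝ) / 12⌉₊ := by
      apply le_antisymm
      · by_contra! hh
        have h1 := Nat.ceil_lt_add_one (a := (x : ℝ) / 12) (by positivity)
        have h2 := Nat.le_ceil ((x : ℝ) / 12)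
        rw [div_le_iff₀ (by norm_num)] at h2
        have h3 : x ≤ (⌈(x : ℝ) / 12⌉₊ : ℤ) * 12 := by exact_mod_cast h2
        omega
      · rw [Nat.ceil_le, div_le_iff₀ (by norm_num)]
        have : x ≤ (((x + 11) / 12).toNat : ℤ) * 12 := by omega
        exact_mod_cast this
    rw [← e]; omega
  · have : ⌈(x : ℝ) / 12⌉₊ = 0 := by
      rw [Nat.ceil_eq_zero]
      have : (x : ℝ) ≤ 0 := by exact_mod_cast (not_lt.1 hx)
      linarith
    rw [this]; rfl

theorem cl_neg {x : ℤ} (h : x ≤ 0) : cl x = 0 := if_neg (not_lt.2 h)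

/-- exponent of the weight -/
def ex (a b c H L : ℤ) : ℤ :=
  cl (a + a - H) + cl (a + b - H) + cl (a + c - H) + cl (b + b - H) + cl (b + c - H) + cl (c + c - H) +
  (cl (a + a - L) + cl (a + b - L) + cl (a + c - L) + cl (b + b - L) + cl (b + c - L) + cl (c + c - L)) -
  (cl (b - a) + cl (c - a) + cl (c - b)) - cl (L - H)

/-- polynomial part of the weight -/
def wp (q : ℕ) (p : Pt) (A : Fin 3 → ℤ) (B : Fin 2 → ℤ) : ℕ :=
  evl q (mf p.1 (A p.2.1.1) (A p.2.1.2.1) (A p.2.1.2.2) (B p.2.2.1) (B p.2.2.2)) *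
      (evl q (da (A 0) (A 1) (A 2)) * evl q (db (B 0) (B 1)))

/-- weight of a type -/
def wt (q : ℕ) (p : Pt) (A : Fin 3 → ℤ) (B : Fin 2 → ℤ) : ℚ :=
  (q : ℚ) ^ ex (A 0) (A 1) (A 2) (B 0) (B 1) * (wp q p A B : ℚ)

section cnt
variable {F : Type} [Field F] [Fintype F]
variable {s : ℕ} (hq : Fintype.card F = s + 2) (h2 : (2 : F) ≠ 0) (h3 : (3 : F) ≠ 0)
include hq h2 h3

theorem W_thm (p : Pt) (hp : p ∈ pats) (A : Fin 3 → ℤ) (B : Fin 2 → ℤ) (hr : Reg A B) (hP : HasPat p A B) :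
    ((RedS (F := F) (ra A) (ra B)).ncard : ℚ) / ((AutT (F := F) (ra A) (ra B)).ncard : ℚ) * (CC (s + 2) : ℚ) = wt (s + 2) p A B := by
  have key := Wpos hq h2 h3 p hp A B hr hP
  change _ = wp (s + 2) p A B * _ at key
  rw [(card_RedS (ra A) (ra B)).1, (card_AutT (ra A) (ra B)).1, hq]
  have hP0 : (Pc F (ra A) (ra B) : ℚ) ≠ 0 := by exact_mod_cast (Pc_pos _ _).ne'
  have hs0 : ((s : ℚ) + 2) ≠ 0 := by positivity
  unfold wt
  set E1 := (∑ p : Fin 2 × Fin 6, ⌈ra A (ii p.2) + ra A (jj p.2) - ra B p.1⌉₊) with hE1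
  set E2 := ((∑ p : Fin 3 × Fin 3, ⌈ra A p.1 - ra A p.2⌉₊) + ∑ p : Fin 2 × Fin 2, ⌈ra B p.1 - ra B p.2⌉₊) with hE2
  have c3 : ∀ i j k, ((⌈ra A i + ra A j - ra B k⌉₊ : ℕ) : ℤ) = cl (A i + A j - B k) := fun i j k =>
    cl_ceil _ _ (by simp only [ra]; push_cast; ring)
  have c2 : ∀ {n : ℕ} (A : Fin n → ℤ) (i j), ((⌈ra A i - ra A j⌉₊ : ℕ) : ℤ) = cl (A i - A j) := fun A i j =>
    cl_ceil _ _ (by simp only [ra]; push_cast; ring)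
  have hE : (E1 : ℤ) - E2 = ex (A 0) (A 1) (A 2) (B 0) (B 1) := by
    obtain ⟨⟨sA, sA'⟩, sB, _⟩ := hr
    have i0 : ii 0 = 0 := rfl
    have j0 : jj 0 = 0 := rfl
    have i1 : ii 1 = 0 := rfl
    have j1 : jj 1 = 1 := rfl
    have i2 : ii 2 = 0 := rfl
    have j2 : jj 2 = 2 := rfl
    have i3 : ii 3 = 1 := rfl
    have j3 : jj 3 = 1 := rfl
    have i4 : ii 4 = 1 := rfl
    have j4 : jj 4 = 2 := rfl
    have i5 : ii 5 = 2 := rfl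
    have j5 : jj 5 = 2 := rfl
    rw [hE1, hE2]
    push_cast
    simp only [c3, c2, Fintype.sum_prod_type, Fin.sum_univ_two, Fin.sum_univ_three, Fin.sum_univ_six, i0, i1, i2, i3, i4, i5, j0, j1, j2, j3, j4, j5]
    simp only [sub_self]
    rw [cl_neg (x := A 0 - A 1) (by omega), cl_neg (x := A 0 - A 2) (by omega), cl_neg (x := A 1 - A 2) (by omega), cl_neg (x := B 0 - B 1) (by omega), cl_neg (x := 0) (by omega)]
    unfold ex
    ring
  rw [← hE, zpow_sub₀ (by exact_mod_cast hs0)]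
  have key' : (Mc F (ra A) (ra B) : ℚ) * CC (s + 2) = wp (s + 2) p A B * Pc F (ra A) (ra B) := by exact_mod_cast key
  push_cast at key' ⊢
  simp only [zpow_natCast]
  have e1 : ((s : ℚ) + 2) ^ E2 ≠ 0 := pow_ne_zero _ hs0
  field_simp
  linear_combination key'
end cnt
end QC

namespace QC
open Matrix Polynomial

/-- weights destabilising the residues that do not occur -/
def wts : List (ℤ × ℤ × ℤ × ℤ × ℤ) := [(-1, -1, 0, -2, 0), (-1, 0, -1, 0, -2), (0, -3, 3, 0, 0), (1, 0, -1, 0, 0), (-3, 3, 0, 0, 0), (-1, -1, 0, 0, -2), (-1, 0, -1, -2, 0), (0, -1, -1, -2, 0), (0, -1, -1, 0, -2)]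

instance (p A B) : Decidable (HasPat p A B) := inferInstanceAs (Decidable (_ ∧ _))

/-- certificate condition -/
def Cert (x y z : ℕ) (b : ℕ × ℕ) (w : ℤ × ℤ × ℤ × ℤ × ℤ) : Prop :=
      w.1 + w.2.1 + w.2.2.1 = w.2.2.2.1 + w.2.2.2.2 ∧ (w.1 < 0 ∨ w.2.1 < 0 ∨ w.2.2.1 < 0 ∨ w.2.2.2.1 < 0 ∨ w.2.2.2.2 < 0) ∧
      ((x + x) % 12 = b.1 → 0 ≤ w.1 + w.1 - w.2.2.2.1) ∧ ((x + x) % 12 = b.2 → 0 ≤ w.1 + w.1 - w.2.2.2.2) ∧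
      ((x + y) % 12 = b.1 → 0 ≤ w.1 + w.2.1 - w.2.2.2.1) ∧ ((x + y) % 12 = b.2 → 0 ≤ w.1 + w.2.1 - w.2.2.2.2) ∧
      ((x + z) % 12 = b.1 → 0 ≤ w.1 + w.2.2.1 - w.2.2.2.1) ∧ ((x + z) % 12 = b.2 → 0 ≤ w.1 + w.2.2.1 - w.2.2.2.2) ∧
      ((y + y) % 12 = b.1 → 0 ≤ w.2.1 + w.2.1 - w.2.2.2.1) ∧ ((y + y) % 12 = b.2 → 0 ≤ w.2.1 + w.2.1 - w.2.2.2.2) ∧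
      ((y + z) % 12 = b.1 → 0 ≤ w.2.1 + w.2.2.1 - w.2.2.2.1) ∧ ((y + z) % 12 = b.2 → 0 ≤ w.2.1 + w.2.2.1 - w.2.2.2.2) ∧
      ((z + z) % 12 = b.1 → 0 ≤ w.2.2.1 + w.2.2.1 - w.2.2.2.1) ∧ ((z + z) % 12 = b.2 → 0 ≤ w.2.2.1 + w.2.2.1 - w.2.2.2.2)

instance (x y z b w) : Decidable (Cert x y z b w) := by unfold Cert; infer_instance

theorem res_dec : ∀ b ∈ ([(0, 0), (0, 6), (6, 0), (4, 8), (8, 4)] : List (ℕ × ℕ)), ∀ x < 12, ∀ y < 12, ∀ z < 12,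
    (x + y + z) % 12 = (b.1 + b.2) % 12 →
    (∃ p ∈ pats, HasPat p ![(x : ℕ), (y : ℕ), (z : ℕ)] ![(b.1 : ℤ), (b.2 : ℤ)]) ∨
    ∃ w ∈ wts, Cert x y z b w := by
  decide +kernel

section cls
variable {F : Type} [Field F]

/-- being an integer -/
def isZ (r : ℝ) : Prop := ∃ z : ℤ, r = z

theorem isZ.add {r s : ℝ} : isZ r → isZ s → isZ (r + s) := by
  rintro ⟨x, rfl⟩ ⟨y, rfl⟩; exact ⟨x + y, by push_cast; rfl⟩
theorem isZ.sub {r s : ℝ} : isZ r → isZ s → isZ (r - s) := by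
  rintro ⟨x, rfl⟩ ⟨y, rfl⟩; exact ⟨x - y, by push_cast; rfl⟩
theorem isZ.mul {r : ℝ} (n : ℤ) : isZ r → isZ (n * r) := by
  rintro ⟨x, rfl⟩; exact ⟨n * x, by push_cast; rfl⟩

theorem cls_b (a : Fin 3 → ℝ) (b : Fin 2 → ℝ) (n : ℕ) (x : Fin 2 → M3 F) (hx : Hom a b x) (hD : D x ≠ 0)
    (hab : ∑ i, a i = ∑ k, b k) (hn : 2 * ∑ i, a i = n) :
    ∃ B : Fin 2 → ℤ, b = ra B ∧ ((B 0 % 12).toNat, (B 1 % 12).toNat) ∈ ([(0, 0), (0, 6), (6, 0), (4, 8), (8, 4)] : List (ℕ × ℕ)) := by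
  rw [D_eq] at hD
  have i0 := det_int a (b 0) (x 0) (hx 0)
  have i1 := mixc_int a (b 0) (b 1) (x 0) (x 1) (hx 0) (hx 1)
  have i2 := mixc_int a (b 1) (b 0) (x 1) (x 0) (hx 1) (hx 0)
  have i3 := det_int a (b 1) (x 1) (hx 1)
  rw [hn] at i0 i1 i2 i3
  rw [hab, Fin.sum_univ_two] at hn
  have fin : ∀ z0 z1 : ℤ, 12 * b 0 = z0 → 12 * b 1 = z1 → ((z0 % 12 = 0 ∧ z1 % 12 = 0) ∨ (z0 % 12 = 0 ∧ z1 % 12 = 6) ∨ (z0 % 12 = 6 ∧ z1 % 12 = 0) ∨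
      (z0 % 12 = 4 ∧ z1 % 12 = 8) ∨ (z0 % 12 = 8 ∧ z1 % 12 = 4)) →
      ∃ B : Fin 2 → ℤ, b = ra B ∧ ((B 0 % 12).toNat, (B 1 % 12).toNat) ∈ ([(0, 0), (0, 6), (6, 0), (4, 8), (8, 4)] : List (ℕ × ℕ)) := by
    intro z0 z1 h0 h1 h
    refine ⟨![z0, z1], ?_, ?_⟩
    · funext k; fin_cases k
      · simp [ra]; linarith
      · simp [ra]; linarith
    · simp
      omega
  by_cases A0 : (x 0).det = 0
  · have hb : mixc (x 0) (x 1) ≠ 0 := by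
      intro h; apply hD; rw [A0, h]; unfold disc3; ring
    obtain ⟨u, hu⟩ := i1 hb
    by_cases C0 : mixc (x 1) (x 0) = 0
    · have hd : (x 1).det ≠ 0 := by
        intro h; apply hD; rw [A0, h, C0]; unfold disc3; ring
      obtain ⟨v, hv⟩ := i3 hd
      refine fin (6 * n - 12 * u) (12 * u) ?_ ?_ ?_ <;> push_cast <;> first | linarith | skip
      have : (3 : ℝ) * u = n - v := by linarith
      have : 3 * u = (n : ℤ) - v := by exact_mod_cast this
      omega
    · obtain ⟨v, hv⟩ := i2 C0
      refine fin (12 * v) (12 * u) ?_ ?_ ?_ <;> push_cast <;> first | linarith | skip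
      omega
  · obtain ⟨u, hu⟩ := i0 A0
    by_cases C0 : mixc (x 1) (x 0) = 0
    · have hd : (x 1).det ≠ 0 := by
        intro h; apply hD; rw [h, C0]; unfold disc3; ring
      obtain ⟨v, hv⟩ := i3 hd
      refine fin (4 * n - 4 * u) (4 * n - 4 * v) ?_ ?_ ?_ <;> push_cast <;> first | linarith | skip
      have : (2 : ℝ) * (n - u + (n - v)) = 3 * n := by linarith
      have : 2 * ((n : ℤ) - u + (n - v)) = 3 * n := by exact_mod_cast this
      omega
    · obtain ⟨v, hv⟩ := i2 C0
      refine fin (12 * v) (6 * n - 12 * v) ?_ ?_ ?_ <;> push_cast <;> first | linarith | skip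
      omega

theorem cls_a (a : Fin 3 → ℝ) (B : Fin 2 → ℤ) (x : Fin 2 → M3 F) (hs : ∀ k, (x k).IsSymm) (hx : Hom a (ra B) x) (hD : D x ≠ 0)
    (hB : B 0 % 2 = 0 ∧ B 1 % 2 = 0) (i : Fin 3) : isZ (12 * a i) := by
  classical
  by_contra hi
  have sup : ∀ k l m, x k l m ≠ 0 → isZ (6 * (a l + a m)) := by
    intro k l m h
    obtain ⟨z, hz⟩ := hx k l m h
    have hb : isZ (6 * ra B k) := by
      refine ⟨B k / 2, ?_⟩
      have : B k = 2 * (B k / 2) := by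
        fin_cases k
        · change B 0 = 2 * (B 0 / 2); omega
        · change B 1 = 2 * (B 1 / 2); omega
      have : (B k : ℝ) = 2 * ((B k / 2 : ℤ) : ℝ) := by exact_mod_cast this
      simp only [ra]; linarith
    have h6 : isZ (6 * (z : ℝ)) := ⟨6 * z, by push_cast; ring⟩
    have := h6.add hb
    rw [← hz] at this
    convert this using 1
    ring
  let w : Fin 3 → ℝ := fun l => if isZ (6 * (a l - a i)) then 1 else if isZ (6 * (a l + a i)) then -1 else 0
  have nb : ∀ l, isZ (6 * (a l - a i)) → ¬ isZ (6 * (a l + a i)) := by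
    intro l h1 h2
    apply hi
    convert h2.sub h1 using 1
    ring
  have ww : ∀ k l m, x k l m ≠ 0 → w l + w m = 0 := by
    intro k l m h
    have hz := sup k l m h
    have e1 : isZ (6 * (a l - a i)) ↔ isZ (6 * (a m + a i)) := by
      constructor
      · intro h; convert hz.sub h using 1; ring
      · intro h; convert hz.sub h using 1; ring
    have e2 : isZ (6 * (a m - a i)) ↔ isZ (6 * (a l + a i)) := by
      constructor
      · intro h; convert hz.sub h using 1; ring
      · intro h; convert hz.sub h using 1; ring
    simp only [w, e1, e2]
    by_cases c1 : isZ (6 * (a m + a i))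
    · have c2 : ¬ isZ (6 * (a l + a i)) := fun h => nb m (e2.2 h) c1
      simp [c1, c2]
    · by_cases c2 : isZ (6 * (a l + a i))
      · simp [c1, c2]
      · simp [c1, c2]
  have v1 := VF x hs hD (fun l => w l + ∑ l, w l) (fun _ => 2 * ∑ l, w l) (by
    simp [Finset.sum_add_distrib]; ring) (by
    intro k l m h
    by_contra h0
    have := ww k l m h0
    linarith)
  have v2 := VF x hs hD (fun l => - (w l + ∑ l, w l)) (fun _ => - (2 * ∑ l, w l)) (by
    simp [Finset.sum_add_distrib]; ring) (by
    intro k l m h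
    by_contra h0
    have := ww k l m h0
    linarith)
  have s0 := v1.2 0
  have s1 := v2.2 0
  have t0 := v1.1 i
  have t1 := v2.1 i
  have hw : w i = 1 := by
    have : isZ (6 * (a i - a i)) := ⟨0, by simp⟩
    simp only [w, if_pos this]
  try dsimp only at s0
  try dsimp only at s1
  rw [hw] at t0 t1
  linarith

theorem res_lem (x y b : ℤ) (h : nd (x + y - b)) : ((x % 12).toNat + (y % 12).toNat) % 12 = (b % 12).toNat := by
  unfold nd at h; omega

theorem cls (n : ℕ) (t : TY) (ht : OKT n t) (hne : (RedS (F := F) t.1 t.2).Nonempty) :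
    ∃ (A : Fin 3 → ℤ) (B : Fin 2 → ℤ), t = (ra A, ra B) ∧ Reg A B ∧ (A 0 + A 1 + A 2 = B 0 + B 1 ∧ A 0 + A 1 + A 2 = 6 * n) ∧ ∃ p ∈ pats, HasPat p A B := by
  obtain ⟨a, b⟩ := t
  obtain ⟨ma, mb, hab, hn⟩ := ht
  obtain ⟨X, hXs, hBd, hD⟩ := hne
  try dsimp only at ma
  try dsimp only at mb
  try dsimp only at hab
  try dsimp only at hn
  try dsimp only at hD
  have hs : ∀ k, (lead a b X k).IsSymm := by
    intro k
    refine Matrix.ext fun i j => ?_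
    have : X k j i = X k i j := (hXs k).apply i j
    simp [lead, this, add_comm (a j)]
  have hx := lead_hom a b X
  generalize lead a b X = x at hD hs hx
  obtain ⟨B, rfl, hB⟩ := cls_b a b n x hx hD hab hn
  have hB' : (B 0 % 12 = 0 ∧ B 1 % 12 = 0) ∨ (B 0 % 12 = 0 ∧ B 1 % 12 = 6) ∨ (B 0 % 12 = 6 ∧ B 1 % 12 = 0) ∨
      (B 0 % 12 = 4 ∧ B 1 % 12 = 8) ∨ (B 0 % 12 = 8 ∧ B 1 % 12 = 4) := by
    simp at hB; omega
  choose A hA using cls_a a B x hs hx hD (by omega)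
  have ea : a = ra A := by
    funext i; simp only [ra]; rw [← hA i]; ring
  subst ea
  have cst : ∀ {m : ℕ} (C : Fin m → ℤ) (i j), ra C i ≤ ra C j → C i ≤ C j := by
    intro m C i j h
    simp only [ra] at h
    have : (C i : ℝ) ≤ C j := by linarith
    exact_mod_cast this
  have s1 := cst A 0 1 (ma (by decide))
  have s2 := cst A 1 2 (ma (by decide))
  have s3 := cst B 0 1 (mb (by decide))
  rw [Fin.sum_univ_three] at hn hab
  rw [Fin.sum_univ_two] at hab
  simp only [ra] at hab hn
  have e1 : A 0 + A 1 + A 2 = B 0 + B 1 := by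
    have : (A 0 : ℝ) + A 1 + A 2 = B 0 + B 1 := by linarith
    exact_mod_cast this
  have e2 : A 0 + A 1 + A 2 = 6 * n := by
    have : (A 0 : ℝ) + A 1 + A 2 = 6 * n := by linarith
    exact_mod_cast this
  have van : ∀ k i j, ¬ nd (A i + A j - B k) → x k i j = 0 := by
    intro k i j h
    by_contra h0
    exact h ((ex_nat3 A B i j k).1 (hx k i j h0))
  refine ⟨A, B, rfl, ⟨⟨s1, s2⟩, s3, ?_, ?_, ?_⟩, ⟨e1, e2⟩, ?_⟩
  · by_contra! hh
    exact hD (D_F1 x hs (van _ _ _ (by unfold nd; omega)) (van _ _ _ (by unfold nd; omega)) (van _ _ _ (by unfold nd; omega)) (van _ _ _ (by unfold nd; omega)))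
  · by_contra! hh
    exact hD (D_F2 x hs (van _ _ _ (by unfold nd; omega)) (van _ _ _ (by unfold nd; omega)) (van _ _ _ (by unfold nd; omega)) (van _ _ _ (by unfold nd; omega)) (van _ _ _ (by unfold nd; omega)))
  · by_contra! hh
    exact hD (D_F3 x hs (van _ _ _ (by unfold nd; omega)) (van _ _ _ (by unfold nd; omega)) (van _ _ _ (by unfold nd; omega)) (van _ _ _ (by unfold nd; omega)))
  · have hh := res_dec _ hB (A 0 % 12).toNat (by omega) (A 1 % 12).toNat (by omega) (A 2 % 12).toNat (by omega) (by dsimp only; omega)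
    have tn : ∀ z : ℤ, (((z % 12).toNat : ℕ) : ℤ) = z % 12 := fun z => by omega
    rcases hh with ⟨p, hp, hP⟩ | ⟨w, _, hw⟩
    · refine ⟨p, hp, ?_⟩
      have fA : ∀ i, (![(((A 0 % 12).toNat : ℕ) : ℤ), (((A 1 % 12).toNat : ℕ) : ℤ), (((A 2 % 12).toNat : ℕ) : ℤ)] : Fin 3 → ℤ) i % 12 = A i % 12 := by
        intro i; fin_cases i <;> simp [tn]
      have fB : ∀ i, (![(((B 0 % 12).toNat : ℕ) : ℤ), (((B 1 % 12).toNat : ℕ) : ℤ)] : Fin 2 → ℤ) i % 12 = B i % 12 := by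
        intro i; fin_cases i <;> simp [tn]
      unfold HasPat at hP ⊢
      simpa only [fA, fB] using hP
    · exfalso
      obtain ⟨wa, wb, wc, wd, we⟩ := w
      obtain ⟨w1, w2, q1, q2, q3, q4, q5, q6, q7, q8, q9, q10, q11, q12⟩ := hw
      have ax : ∀ i j k (u : ℤ) (r : ℝ), r = u → (nd (A i + A j - B k) → 0 ≤ u) → r < 0 → x k i j = 0 := by
        intro i j k u r hr hu hr0
        apply van
        intro h
        have h1 := hu h
        rw [hr] at hr0
        have h2 : u < 0 := by exact_mod_cast hr0
        exact absurd h1 (not_le.2 h2)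
      have v := VF x hs hD ![(wa : ℝ), wb, wc] ![(wd : ℝ), we] (by
        simp [Fin.sum_univ_three]; exact_mod_cast w1) (by
        intro k i j
        fin_cases k <;> fin_cases i <;> fin_cases j
        · exact ax 0 0 0 (wa + wa - wd) _ (by simp) (fun h => q1 (res_lem _ _ _ h))
        · exact ax 0 1 0 (wa + wb - wd) _ (by simp) (fun h => q3 (res_lem _ _ _ h))
        · exact ax 0 2 0 (wa + wc - wd) _ (by simp) (fun h => q5 (res_lem _ _ _ h))
        · exact ax 1 0 0 (wb + wa - wd) _ (by simp) (fun h => by rw [add_comm wb]; exact q3 (res_lem _ _ _ (by rw [add_comm (A 0)]; exact h)))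
        · exact ax 1 1 0 (wb + wb - wd) _ (by simp) (fun h => q7 (res_lem _ _ _ h))
        · exact ax 1 2 0 (wb + wc - wd) _ (by simp) (fun h => q9 (res_lem _ _ _ h))
        · exact ax 2 0 0 (wc + wa - wd) _ (by simp) (fun h => by rw [add_comm wc]; exact q5 (res_lem _ _ _ (by rw [add_comm (A 0)]; exact h)))
        · exact ax 2 1 0 (wc + wb - wd) _ (by simp) (fun h => by rw [add_comm wc]; exact q9 (res_lem _ _ _ (by rw [add_comm (A 1)]; exact h)))
        · exact ax 2 2 0 (wc + wc - wd) _ (by simp) (fun h => q11 (res_lem _ _ _ h))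
        · exact ax 0 0 1 (wa + wa - we) _ (by simp) (fun h => q2 (res_lem _ _ _ h))
        · exact ax 0 1 1 (wa + wb - we) _ (by simp) (fun h => q4 (res_lem _ _ _ h))
        · exact ax 0 2 1 (wa + wc - we) _ (by simp) (fun h => q6 (res_lem _ _ _ h))
        · exact ax 1 0 1 (wb + wa - we) _ (by simp) (fun h => by rw [add_comm wb]; exact q4 (res_lem _ _ _ (by rw [add_comm (A 0)]; exact h)))
        · exact ax 1 1 1 (wb + wb - we) _ (by simp) (fun h => q8 (res_lem _ _ _ h))
        · exact ax 1 2 1 (wb + wc - we) _ (by simp) (fun h => q10 (res_lem _ _ _ h))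
        · exact ax 2 0 1 (wc + wa - we) _ (by simp) (fun h => by rw [add_comm wc]; exact q6 (res_lem _ _ _ (by rw [add_comm (A 0)]; exact h)))
        · exact ax 2 1 1 (wc + wb - we) _ (by simp) (fun h => by rw [add_comm wc]; exact q10 (res_lem _ _ _ (by rw [add_comm (A 1)]; exact h)))
        · exact ax 2 2 1 (wc + wc - we) _ (by simp) (fun h => q12 (res_lem _ _ _ h)))
      have a0 := v.1 0; have a1 := v.1 1; have a2 := v.1 2; have b0 := v.2 0; have b1 := v.2 1
      have a0' : 0 ≤ wa := by simpa using a0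
      have a1' : 0 ≤ wb := by simpa using a1
      have a2' : 0 ≤ wc := by simpa using a2
      have b0' : 0 ≤ wd := by simpa using b0
      have b1' : 0 ≤ we := by simpa using b1
      have w2' : wa < 0 ∨ wb < 0 ∨ wc < 0 ∨ wd < 0 ∨ we < 0 := w2
      clear * - a0' a1' a2' b0' b1' w2'
      omega
end cls
end QC

namespace QC
open Matrix Polynomial

/-- rays of the fan, first part -/
def rayA : Fin 10 → Fin 3 → ℤ :=
  ![![0, 0, 1], ![0, 1, 2], ![0, 1, 1], ![0, 1, 1], ![1, 2, 3], ![1, 2, 2], ![1, 1, 2], ![2, 3, 3], ![1, 1, 1], ![2, 2, 2]]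
/-- rays of the fan, second part -/
def rayB : Fin 10 → Fin 2 → ℤ :=
  ![![0, 1], ![1, 2], ![0, 2], ![1, 1], ![2, 4], ![2, 3], ![2, 2], ![4, 4], ![1, 2], ![3, 3]]
/-- cones of the fan -/
def co : Fin 10 → Fin 4 → Fin 10 :=
  ![![6, 7, 8, 9], ![5, 6, 7, 8], ![4, 5, 6, 8], ![2, 4, 5, 8], ![0, 4, 6, 8], ![0, 2, 4, 8], ![3, 5, 6, 7], ![1, 3, 4, 6], ![3, 4, 5, 6], ![0, 1, 4, 6]]
/-- coordinates in a cone -/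
def kM : Fin 10 → Fin 4 → Fin 4 → ℤ :=
  ![![![0, -1, 1, 0], ![-1, 1, 0, 0], ![1, 1, 1, -2], ![1, -1, -1, 1]],
    ![![-1, 1, 1, -1], ![0, -1, 1, 0], ![0, 0, -1, 1], ![2, 0, 0, -1]],
    ![![0, 0, 1, -1], ![-1, 1, -1, 1], ![0, -1, 0, 1], ![2, 0, 0, -1]],
    ![![0, 1, 0, -1], ![0, -1, 1, 0], ![-1, 1, -1, 1], ![2, 0, 0, -1]],
    ![![1, -1, 1, -1], ![-1, 1, 0, 0], ![0, -1, 0, 1], ![2, 0, 0, -1]],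
    ![![1, -1, 1, -1], ![0, 1, 0, -1], ![-1, 0, 0, 1], ![2, 0, 0, -1]],
    ![![-2, 0, 0, 1], ![1, 1, 1, -2], ![0, -1, 1, 0], ![0, 0, -1, 1]],
    ![![-1, -1, 1, 0], ![-1, 1, -1, 1], ![1, 1, 0, -1], ![0, -1, 0, 1]],
    ![![-2, 0, 0, 1], ![0, 0, 1, -1], ![1, 1, -1, 0], ![0, -1, 0, 1]],
    ![![1, -1, 1, -1], ![-2, 0, 0, 1], ![1, 1, 0, -1], ![0, -1, 0, 1]]]

/-- combination of four numbers -/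
def lc4 (k r : Fin 4 → ℤ) : ℤ := k 0 * r 0 + k 1 * r 1 + k 2 * r 2 + k 3 * r 3

/-- point of a cone -/
def tA (c : Fin 10) (k : Fin 4 → ℤ) (j : Fin 3) : ℤ := lc4 k fun i => rayA (co c i) j
/-- point of a cone -/
def tB (c : Fin 10) (k : Fin 4 → ℤ) (j : Fin 2) : ℤ := lc4 k fun i => rayB (co c i) j
/-- coordinates in a cone -/
def kp (c : Fin 10) (A : Fin 3 → ℤ) (B : Fin 2 → ℤ) (i : Fin 4) : ℤ := A 0 * kM c i 0 + A 1 * kM c i 1 + A 2 * kM c i 2 + B 0 * kM c i 3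

/-- coarse zone -/
def zone0 (A : Fin 3 → ℤ) (B : Fin 2 → ℤ) : ℕ :=
  if B 1 ≤ A 0 + A 0 then 0
  else if B 0 ≤ A 0 + A 0 then
    if B 1 ≤ A 0 + A 1 then 1
    else if B 1 ≤ A 1 + A 1 then (if B 1 ≤ A 0 + A 2 then 2 else 3)
    else (if B 1 ≤ A 0 + A 2 then 4 else 5)
  else if B 1 ≤ A 0 + A 1 then 6
  else if B 1 ≤ A 1 + A 1 then 7 else 9

/-- zone of a cone -/
def inZ (c : Fin 10) (A : Fin 3 → ℤ) (B : Fin 2 → ℤ) : Prop :=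
  zone0 A B = (if c = 8 then 7 else (c : ℕ)) ∧ (c = 7 → 0 ≤ A 2 - A 1 - A 0) ∧ (c = 8 → A 2 - A 1 - A 0 < 0)

instance (c A B) : Decidable (inZ c A B) := inferInstanceAs (Decidable (_ ∧ _))

theorem kp_tab : ∀ c i l, rayA (co c l) 0 * kM c i 0 + rayA (co c l) 1 * kM c i 1 + rayA (co c l) 2 * kM c i 2 +
    rayB (co c l) 0 * kM c i 3 = if i = l then 1 else 0 := by
  decide +kernel

theorem kp_comb (c : Fin 10) (k : Fin 4 → ℤ) : kp c (tA c k) (tB c k) = k := by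
  funext i
  have h0 := kp_tab c i 0
  have h1 := kp_tab c i 1
  have h2 := kp_tab c i 2
  have h3 := kp_tab c i 3
  simp only [kp, tA, tB, lc4]
  have e : k i = k 0 * (if i = 0 then 1 else 0) + k 1 * (if i = 1 then 1 else 0) + k 2 * (if i = 2 then 1 else 0) + k 3 * (if i = 3 then 1 else 0) := by
    fin_cases i <;> simp
  rw [e]
  linear_combination k 0 * h0 + k 1 * h1 + k 2 * h2 + k 3 * h3

theorem comb_tab : (∀ c j l, lc4 (fun i => kM c i l) (fun i => rayA (co c i) j) = if (l : ℕ) = (j : ℕ) then 1 else 0) ∧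
    (∀ c l, lc4 (fun i => kM c i l) (fun i => rayB (co c i) 0) = if l = 3 then 1 else 0) ∧
    (∀ c l, lc4 (fun i => kM c i l) (fun i => rayB (co c i) 1) = if l = 3 then -1 else 1) := by
  decide +kernel

theorem lc4_kp (c A B r) : lc4 (kp c A B) r = A 0 * lc4 (fun i => kM c i 0) r + A 1 * lc4 (fun i => kM c i 1) r +
    A 2 * lc4 (fun i => kM c i 2) r + B 0 * lc4 (fun i => kM c i 3) r := by
  simp only [lc4, kp]; ring

theorem comb_kp (c : Fin 10) (A : Fin 3 → ℤ) (B : Fin 2 → ℤ) (h : A 0 + A 1 + A 2 = B 0 + B 1) :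
    tA c (kp c A B) = A ∧ tB c (kp c A B) = B := by
  constructor
  · funext j
    simp only [tA, lc4_kp, comb_tab.1]
    fin_cases j <;> simp
  · funext j
    simp only [tB, lc4_kp]
    fin_cases j
    · simp [comb_tab.2.1]
    · simp [comb_tab.2.2]; linarith

theorem inZ_uniq {c c' : Fin 10} {A : Fin 3 → ℤ} {B : Fin 2 → ℤ} (h : inZ c A B) (h' : inZ c' A B) : c = c' := by
  unfold inZ at h h'
  obtain ⟨h1, h2, h3⟩ := h
  obtain ⟨h1', h2', h3'⟩ := h'
  rw [h1] at h1'
  split_ifs at h1' with x y y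
  · rw [x, y]
  · have : c' = 7 := by ext; exact h1'.symm
    have := h3 x; have := h2' (by assumption); omega
  · have : c = 7 := by ext; exact h1'
    have := h3' y; have := h2 (by assumption); omega
  · ext; exact h1'

theorem reg_tab : ∀ c, (∀ i, 0 ≤ rayA (co c i) 1 - rayA (co c i) 0) ∧ (∀ i, 0 ≤ rayA (co c i) 2 - rayA (co c i) 1) ∧
    (∀ i, 0 ≤ rayB (co c i) 1 - rayB (co c i) 0) ∧ (∀ i, 0 ≤ rayA (co c i) 0 + rayA (co c i) 1 - rayB (co c i) 0) ∧
    (∀ i, 0 ≤ rayA (co c i) 1 + rayA (co c i) 2 - rayB (co c i) 1) ∧ ((∀ i, 0 ≤ rayA (co c i) 0 + rayA (co c i) 2 - rayB (co c i) 1) ∨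
    ∀ i, 0 ≤ 2 * rayA (co c i) 0 - rayB (co c i) 0) := by
  decide +kernel

theorem reg_comb (c : Fin 10) (k : Fin 4 → ℤ) (h : ∀ i, 0 ≤ k i) : Reg (tA c k) (tB c k) := by
  have nn : ∀ r : Fin 4 → ℤ, (∀ i, 0 ≤ r i) → 0 ≤ lc4 k r := by
    intro r hr
    have := mul_nonneg (h 0) (hr 0); have := mul_nonneg (h 1) (hr 1)
    have := mul_nonneg (h 2) (hr 2); have := mul_nonneg (h 3) (hr 3)
    unfold lc4; linarith
  have tab := reg_tab c
  have n1 := nn _ tab.1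
  have n2 := nn _ tab.2.1
  have n3 := nn _ tab.2.2.1
  have n4 := nn _ tab.2.2.2.1
  have n5 := nn _ tab.2.2.2.2.1
  have n6 := tab.2.2.2.2.2.imp (nn _) (nn _)
  unfold Reg
  simp only [tA, tB]
  unfold lc4 at *
  refine ⟨⟨by linarith, by linarith⟩, by linarith, by linarith, by linarith, n6.imp (fun h => by linarith) (fun h => by linarith)⟩

theorem cover (A : Fin 3 → ℤ) (B : Fin 2 → ℤ) (hr : Reg A B) (h : A 0 + A 1 + A 2 = B 0 + B 1) :
    ∃ c, inZ c A B ∧ ∀ i, 0 ≤ kp c A B i := by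
  obtain ⟨⟨h1, h2⟩, h3, h4, h5, h6⟩ := hr
  unfold inZ zone0
  by_cases c1 : B 1 ≤ A 0 + A 0
  · exact ⟨0, by simp [c1], by intro i; fin_cases i <;> simp [kp, kM] <;> omega⟩
  by_cases c2 : B 0 ≤ A 0 + A 0
  · by_cases c3 : B 1 ≤ A 0 + A 1
    · exact ⟨1, by simp [c1, c2, c3], by intro i; fin_cases i <;> simp [kp, kM] <;> omega⟩
    by_cases c4 : B 1 ≤ A 1 + A 1
    · by_cases c5 : B 1 ≤ A 0 + A 2
      · exact ⟨2, by simp [c1, c2, c3, c4, c5], by intro i; fin_cases i <;> simp [kp, kM] <;> omega⟩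
      · exact ⟨3, by simp [c1, c2, c3, c4, c5], by intro i; fin_cases i <;> simp [kp, kM] <;> omega⟩
    · by_cases c5 : B 1 ≤ A 0 + A 2
      · exact ⟨4, by simp [c1, c2, c3, c4, c5], by intro i; fin_cases i <;> simp [kp, kM] <;> omega⟩
      · exact ⟨5, by simp [c1, c2, c3, c4, c5], by intro i; fin_cases i <;> simp [kp, kM] <;> omega⟩
  · by_cases c3 : B 1 ≤ A 0 + A 1
    · exact ⟨6, by simp [c1, c2, c3], by intro i; fin_cases i <;> simp [kp, kM] <;> omega⟩
    by_cases c4 : B 1 ≤ A 1 + A 1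
    · by_cases c5 : 0 ≤ A 2 - A 1 - A 0
      · exact ⟨7, by simp [c1, c2, c3, c4]; omega, by intro i; fin_cases i <;> simp [kp, kM] <;> omega⟩
      · exact ⟨8, by simp [c1, c2, c3, c4]; omega, by intro i; fin_cases i <;> simp [kp, kM] <;> omega⟩
    · exact ⟨9, by simp [c1, c2, c3, c4], by intro i; fin_cases i <;> simp [kp, kM] <;> omega⟩
end QC

namespace QC
open Matrix Polynomial

theorem stp (v d : ℤ) (h : 0 < d → 0 < v) (h' : d < 0 → v < 0) :
    cl (v + 12 * d) = cl v + cl (12 * d) ∧ (0 ≤ v + 12 * d ↔ 0 ≤ v) ∧ (v + 12 * d = 0 ↔ v = 0) := by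
  unfold cl
  refine ⟨?_, ?_, ?_⟩
  · split_ifs <;> omega
  · omega
  · omega

/-- constant sign -/
def sdef (r : Fin 4 → ℤ) : Prop := (∀ i, 0 ≤ r i) ∨ (∀ i, r i ≤ 0)
instance (r) : Decidable (sdef r) := inferInstanceAs (Decidable (_ ∨ _))

theorem sd_tab : ∀ c, (∀ j l m, sdef fun i => rayA (co c i) j + rayA (co c i) l - rayB (co c i) m) ∧
    (∀ j l, sdef fun i => rayA (co c i) j - rayA (co c i) l) ∧ (∀ j l, sdef fun i => rayB (co c i) j - rayB (co c i) l) ∧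
    (c = 7 ∨ c = 8 → sdef fun i => rayA (co c i) 2 - rayA (co c i) 1 - rayA (co c i) 0) := by
  decide +kernel

theorem lc4_pos {k r : Fin 4 → ℤ} (hk : ∀ i, 0 ≤ k i) (hr : ∀ i, 0 ≤ r i) (i : Fin 4) (hi : 1 ≤ k i) (h : 0 < r i) : 0 < lc4 k r := by
  have h0 := mul_nonneg (hk 0) (hr 0); have h1 := mul_nonneg (hk 1) (hr 1)
  have h2 := mul_nonneg (hk 2) (hr 2); have h3 := mul_nonneg (hk 3) (hr 3)
  have : 0 < k i * r i := mul_pos (by omega) h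
  unfold lc4
  fin_cases i
  · change 0 < k 0 * r 0 at this; linarith
  · change 0 < k 1 * r 1 at this; linarith
  · change 0 < k 2 * r 2 at this; linarith
  · change 0 < k 3 * r 3 at this; linarith

theorem lc4_neg (k r : Fin 4 → ℤ) : lc4 k (fun i => - r i) = - lc4 k r := by
  simp only [lc4]; ring

theorem lc4_sd {k r : Fin 4 → ℤ} (hk : ∀ i, 0 ≤ k i) (hr : sdef r) (i : Fin 4) (hi : 1 ≤ k i) :
    (0 < r i → 0 < lc4 k r) ∧ (r i < 0 → lc4 k r < 0) := by
  rcases hr with hr | hr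
  · exact ⟨fun h => lc4_pos hk hr i hi h, fun h => absurd (hr i) (not_le.2 h)⟩
  · refine ⟨fun h => absurd (hr i) (not_le.2 h), fun h => ?_⟩
    have := lc4_pos (r := fun i => - r i) hk (fun i => by have := hr i; omega) i hi (by omega)
    rw [lc4_neg] at this
    omega

/-- shift of one coordinate -/
def sh (k : Fin 4 → ℤ) (i : Fin 4) : Fin 4 → ℤ := fun j => k j + if j = i then 12 else 0

theorem lc4_sh (k r i) : lc4 (sh k i) r = lc4 k r + 12 * r i := by
  unfold lc4 sh
  fin_cases i <;> simp <;> ring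

theorem mf_congr (A A' : Fin 3 → ℤ) (B B' : Fin 2 → ℤ) (hs : ∀ j l m, B' m ≤ A' j + A' l ↔ B m ≤ A j + A l) (f i j l k m) :
    mf f (A' i) (A' j) (A' l) (B' k) (B' m) = mf f (A i) (A j) (A l) (B k) (B m) := by
  match f with
  | 0 => simp only [mf, me, two_mul, hs]
  | 1 => simp only [mf, m12, two_mul, ← not_le, hs]
  | 2 => simp only [mf, m22, two_mul, ← not_le, hs]
  | 3 => simp only [mf, m123, two_mul, hs]
  | n + 4 => simp only [mf, m1234, two_mul, hs]

/-- exponent of a ray -/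
def re (r : Fin 10) : ℕ := (ex (12 * rayA r 0) (12 * rayA r 1) (12 * rayA r 2) (12 * rayB r 0) (12 * rayB r 1)).toNat

theorem re_eq : ∀ r, (re r : ℤ) = ex (12 * rayA r 0) (12 * rayA r 1) (12 * rayA r 2) (12 * rayB r 0) (12 * rayB r 1) := by
  decide +kernel

/-- weight restricted to a zone -/
def wtz (q : ℕ) (c : Fin 10) (p : Pt) (k : Fin 4 → ℤ) : ℚ :=
  if inZ c (tA c k) (tB c k) then wt q p (tA c k) (tB c k) else 0

theorem wtz_step (q : ℕ) (hq : q ≠ 0) (c : Fin 10) (p : Pt) (k : Fin 4 → ℤ) (hk : ∀ i, 0 ≤ k i) (i : Fin 4) (hi : 1 ≤ k i) :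
    wtz q c p (sh k i) = (q : ℚ) ^ re (co c i) * wtz q c p k := by
  obtain ⟨t1, t2, t3, t4⟩ := sd_tab c
  have eA : ∀ j, tA c (sh k i) j = tA c k j + 12 * rayA (co c i) j := fun j => lc4_sh _ _ _
  have eB : ∀ j, tB c (sh k i) j = tB c k j + 12 * rayB (co c i) j := fun j => lc4_sh _ _ _
  have f1 : ∀ j l m, lc4 k (fun i => rayA (co c i) j + rayA (co c i) l - rayB (co c i) m) = tA c k j + tA c k l - tB c k m := by
    intro j l m; simp only [tA, tB, lc4]; ring
  have f2 : ∀ j l, lc4 k (fun i => rayA (co c i) j - rayA (co c i) l) = tA c k j - tA c k l := by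
    intro j l; simp only [tA, lc4]; ring
  have f3 : ∀ j l, lc4 k (fun i => rayB (co c i) j - rayB (co c i) l) = tB c k j - tB c k l := by
    intro j l; simp only [tB, lc4]; ring
  have f4 : lc4 k (fun i => rayA (co c i) 2 - rayA (co c i) 1 - rayA (co c i) 0) = tA c k 2 - tA c k 1 - tA c k 0 := by
    simp only [tA, lc4]; ring
  have s1 := fun j l m => (f1 j l m) ▸ stp _ _ (lc4_sd hk (t1 j l m) i hi).1 (lc4_sd hk (t1 j l m) i hi).2
  have s2 := fun j l => (f2 j l) ▸ stp _ _ (lc4_sd hk (t2 j l) i hi).1 (lc4_sd hk (t2 j l) i hi).2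
  have s3 := fun j l => (f3 j l) ▸ stp _ _ (lc4_sd hk (t3 j l) i hi).1 (lc4_sd hk (t3 j l) i hi).2
  have s4 := fun h => f4 ▸ stp _ _ (lc4_sd hk (t4 h) i hi).1 (lc4_sd hk (t4 h) i hi).2
  clear f1 f2 f3 f4 t1 t2 t3 t4
  unfold wtz
  generalize tA c k = A at *
  generalize tB c k = B at *
  generalize tA c (sh k i) = A' at *
  generalize tB c (sh k i) = B' at *
  generalize co c i = r at *
  have c1 : ∀ j l m, cl (A' j + A' l - B' m) = cl (A j + A l - B m) + cl (12 * rayA r j + 12 * rayA r l - 12 * rayB r m) := by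
    intro j l m
    convert (s1 j l m).1 using 2
    · rw [eA, eA, eB]; ring
    · ring_nf
  have c2 : ∀ j l, cl (A' j - A' l) = cl (A j - A l) + cl (12 * rayA r j - 12 * rayA r l) := by
    intro j l
    convert (s2 j l).1 using 2
    · rw [eA, eA]; ring
    · ring_nf
  have c3 : ∀ j l, cl (B' j - B' l) = cl (B j - B l) + cl (12 * rayB r j - 12 * rayB r l) := by
    intro j l
    convert (s3 j l).1 using 2
    · rw [eB, eB]; ring
    · ring_nf
  have i1 : ∀ j l m, B' m ≤ A' j + A' l ↔ B m ≤ A j + A l := by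
    intro j l m
    have := (s1 j l m).2.1
    have := eA j; have := eA l; have := eB m
    omega
  have i2 : ∀ j l, A' j = A' l ↔ A j = A l := by
    intro j l
    have := (s2 j l).2.2
    have := eA j; have := eA l
    omega
  have i3 : ∀ j l, B' j = B' l ↔ B j = B l := by
    intro j l
    have := (s3 j l).2.2
    have := eB j; have := eB l
    omega
  have hz : inZ c A' B' ↔ inZ c A B := by
    have z0 : zone0 A' B' = zone0 A B := by simp only [zone0, i1]
    unfold inZ
    rw [z0]
    have e0 := eA 0; have e1 := eA 1; have e2 := eA 2
    by_cases h : c = 7 ∨ c = 8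
    · have := (s4 h).2.1
      clear s1 s2 s3 s4 c1 c2 c3 i1 i2 i3
      have e : A' 2 - A' 1 - A' 0 = A 2 - A 1 - A 0 + 12 * (rayA r 2 - rayA r 1 - rayA r 0) := by rw [e0, e1, e2]; ring
      rw [e, this, ← not_le, this, ← not_le]
    · push Not at h
      simp [h.1, h.2]
  simp only [hz]
  split_ifs
  · unfold wt wp
    rw [mf_congr A A' B B' i1]
    have d1 : da (A' 0) (A' 1) (A' 2) = da (A 0) (A 1) (A 2) := by simp only [da, i2]
    have d2 : db (B' 0) (B' 1) = db (B 0) (B 1) := by simp only [db, i3]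
    have he : ex (A' 0) (A' 1) (A' 2) (B' 0) (B' 1) = re r + ex (A 0) (A 1) (A 2) (B 0) (B 1) := by
      rw [re_eq]
      simp only [ex, c1, c2, c3]
      ring
    rw [d1, d2, he, zpow_add₀ (by exact_mod_cast hq), zpow_natCast, mul_assoc]
  · simp
end QC

namespace QC
open Matrix Polynomial

/-- residues of a pattern -/
def rhoA (p : Pt) (i : Fin 3) : ℤ := if i = p.2.1.1 then (rfA p.1).1 else if i = p.2.1.2.1 then (rfA p.1).2.1 else (rfA p.1).2.2
/-- residues of a pattern -/
def rhoB (p : Pt) (i : Fin 2) : ℤ := if i = p.2.2.1 then (rfB p.1).1 else (rfB p.1).2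
/-- base point of a pattern in a cone -/
def kz (c : Fin 10) (p : Pt) (i : Fin 4) : ℤ := kp c (rhoA p) (rhoB p) i % 12
/-- points of a pattern in a cone -/
def kn (c : Fin 10) (p : Pt) (m : Fin 4 → ℕ) (i : Fin 4) : ℤ := kz c p i + 12 * m i
/-- degree of the base point -/
def d0 (c : Fin 10) (p : Pt) : ℕ := ((tA c (kz c p) 0 + tA c (kz c p) 1 + tA c (kz c p) 2) / 6).toNat
/-- degree of a ray -/
def dg (r : Fin 10) : ℕ := (2 * (rayA r 0 + rayA r 1 + rayA r 2)).toNat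
/-- degree of a point -/
def dgk (c : Fin 10) (p : Pt) (m : Fin 4 → ℕ) : ℕ :=
  d0 c p + (m 0 * dg (co c 0) + m 1 * dg (co c 1) + m 2 * dg (co c 2) + m 3 * dg (co c 3))

theorem pat_dec1 : ∀ c : Fin 10, ∀ p ∈ pats, HasPat p (tA c (kz c p)) (tB c (kz c p)) ∧
    (tA c (kz c p) 0 + tA c (kz c p) 1 + tA c (kz c p) 2) = 6 * (d0 c p : ℤ) := by
  decide +kernel

theorem pat_dec2 : ∀ c : Fin 10, ∀ p ∈ pats, ∀ p' ∈ pats, kz c p = kz c p' → p = p' := by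
  decide +kernel

theorem pat_dec3 : ∀ p ∈ pats, (∀ i, i = p.2.1.1 ∨ (i ≠ p.2.1.1 ∧ i = p.2.1.2.1) ∨ (i ≠ p.2.1.1 ∧ i ≠ p.2.1.2.1 ∧ i = p.2.1.2.2)) ∧
    (∀ i, i = p.2.2.1 ∨ (i ≠ p.2.2.1 ∧ i = p.2.2.2)) := by
  decide +kernel

theorem dg_dec : ∀ r, ((dg r : ℕ) : ℤ) = 2 * (rayA r 0 + rayA r 1 + rayA r 2) ∧ 1 ≤ dg r := by
  decide +kernel

theorem sumB_dec : ∀ r, rayA r 0 + rayA r 1 + rayA r 2 = rayB r 0 + rayB r 1 := by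
  decide +kernel

theorem kn_nonneg (c p m i) : 0 ≤ kn c p m i := by
  unfold kn kz; omega

theorem lc4_kn (c p m r) : lc4 (kn c p m) r = lc4 (kz c p) r + 12 * lc4 (fun i => (m i : ℤ)) r := by
  simp only [lc4, kn]; ring

theorem kn_sumB (c k) : tA c k 0 + tA c k 1 + tA c k 2 = tB c k 0 + tB c k 1 := by
  simp only [tA, tB, lc4]
  linear_combination k 0 * sumB_dec (co c 0) + k 1 * sumB_dec (co c 1) + k 2 * sumB_dec (co c 2) + k 3 * sumB_dec (co c 3)

theorem kn_sum (c p) (hp : p ∈ pats) (m) : tA c (kn c p m) 0 + tA c (kn c p m) 1 + tA c (kn c p m) 2 = 6 * (dgk c p m : ℤ) := by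
  have h := (pat_dec1 c p hp).2
  have e0 := (dg_dec (co c 0)).1
  have e1 := (dg_dec (co c 1)).1
  have e2 := (dg_dec (co c 2)).1
  have e3 := (dg_dec (co c 3)).1
  simp only [tA, lc4_kn, dgk] at h ⊢
  push_cast
  rw [e0, e1, e2, e3]
  simp only [lc4] at h ⊢
  linear_combination h

theorem kn_pat (c p) (hp : p ∈ pats) (m) : HasPat p (tA c (kn c p m)) (tB c (kn c p m)) := by
  have h := (pat_dec1 c p hp).1
  have hA : ∀ j, tA c (kn c p m) j % 12 = tA c (kz c p) j % 12 := by
    intro j; simp only [tA, lc4_kn]; omega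
  have hB : ∀ j, tB c (kn c p m) j % 12 = tB c (kz c p) j % 12 := by
    intro j; simp only [tB, lc4_kn]; omega
  unfold HasPat at h ⊢
  simpa only [hA, hB] using h

theorem pat_kz (c p) (hp : p ∈ pats) (A B) (h : HasPat p A B) (i) : kp c A B i % 12 = kz c p i := by
  obtain ⟨h1, h2⟩ := pat_dec3 p hp
  obtain ⟨⟨a1, a2, a3⟩, b1, b2⟩ := h
  have hA : ∀ i, ∃ z, A i = rhoA p i + 12 * z := by
    intro i
    refine ⟨A i / 12, ?_⟩
    have : A i % 12 = rhoA p i := by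
      unfold rhoA
      rcases h1 i with h | ⟨h, h'⟩ | ⟨h, h', h''⟩
      · rw [if_pos h, h, a1]
      · rw [if_neg h, if_pos h', h', a2]
      · rw [if_neg h, if_neg h', h'', a3]
    omega
  have hB : ∀ i, ∃ z, B i = rhoB p i + 12 * z := by
    intro i
    refine ⟨B i / 12, ?_⟩
    have : B i % 12 = rhoB p i := by
      unfold rhoB
      rcases h2 i with h | ⟨h, h'⟩
      · rw [if_pos h, h, b1]
      · rw [if_neg h, h', b2]
    omega
  obtain ⟨x, hx⟩ := hA 0
  obtain ⟨y, hy⟩ := hA 1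
  obtain ⟨z, hz⟩ := hA 2
  obtain ⟨w, hw⟩ := hB 0
  unfold kz
  apply Int.emod_emod_of_dvd _ (dvd_refl 12) |>.symm.trans
  apply Int.ModEq.eq
  apply (Int.emod_emod_of_dvd _ (dvd_refl 12)).trans
  apply Int.emod_emod_of_dvd _ (dvd_refl 12) |>.symm.trans
  have : kp c A B i = kp c (rhoA p) (rhoB p) i + 12 * (x * kM c i 0 + y * kM c i 1 + z * kM c i 2 + w * kM c i 3) := by
    simp only [kp]; rw [hx, hy, hz, hw]; ring
  rw [this]; omega

/-- index set -/
abbrev IX := Fin 10 × Pt × ℕ × ℕ × ℕ × ℕ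
/-- multi-index -/
def mi (j : IX) : Fin 4 → ℕ := ![j.2.2.1, j.2.2.2.1, j.2.2.2.2.1, j.2.2.2.2.2]
/-- coordinates of an index -/
def kx (j : IX) : Fin 4 → ℤ := kn j.1 j.2.1 (mi j)
/-- box -/
def Bx (n : ℕ) : Finset IX := Finset.univ ×ˢ pats.toFinset ×ˢ Finset.range (n + 1) ×ˢ Finset.range (n + 1) ×ˢ Finset.range (n + 1) ×ˢ Finset.range (n + 1)
/-- indices of given degree -/
def Jx (n : ℕ) : Finset IX := (Bx n).filter fun j => dgk j.1 j.2.1 (mi j) = n ∧ inZ j.1 (tA j.1 (kx j)) (tB j.1 (kx j))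

theorem ra_inj {m : ℕ} {A A' : Fin m → ℤ} (h : ra A = ra A') : A = A' := by
  funext i
  have := congrFun h i
  simp only [ra] at this
  have : (A i : ℝ) = A' i := by linarith
  exact_mod_cast this

section cnt
variable {F : Type} [Field F] [Fintype F]
variable {s : ℕ} (hq : Fintype.card F = s + 2) (h2 : (2 : F) ≠ 0) (h3 : (3 : F) ≠ 0)
include hq h2 h3

theorem count_J (n : ℕ) (N : ℚ)
    (hN : IsWeightedG4OrbitCount {v : Matrix (Fin 3) (Fin 3) (Polynomial F) ×
                Matrix (Fin 3) (Fin 3) (Polynomial F) |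
              v.1.IsSymm ∧ v.2.IsSymm ∧ disc4 v.1 v.2 ≠ 0 ∧
                (disc4 v.1 v.2).natDegree = n} N) :
    N * CC (s + 2) = ∑ j ∈ Jx n, wt (s + 2) j.2.1 (tA j.1 (kx j)) (tB j.1 (kx j)) := by
  classical
  let φ : IX → TY := fun j => (ra (tA j.1 (kx j)), ra (tB j.1 (kx j)))
  have mem : ∀ j ∈ Jx n, j.2.1 ∈ pats ∧ dgk j.1 j.2.1 (mi j) = n ∧ inZ j.1 (tA j.1 (kx j)) (tB j.1 (kx j)) := by
    intro j hj
    simp only [Jx, Bx, Finset.mem_filter, Finset.mem_product, List.mem_toFinset] at hj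
    exact ⟨hj.1.2.1, hj.2⟩
  have inj : Set.InjOn φ (Jx n) := by
    intro j hj j' hj' h
    obtain ⟨m1, m2, m3⟩ := mem j hj
    obtain ⟨m1', m2', m3'⟩ := mem j' hj'
    simp only [φ, Prod.mk.injEq] at h
    have e1 := ra_inj h.1
    have e2 := ra_inj h.2
    rw [← e1, ← e2] at m3'
    have ec := inZ_uniq m3 m3'
    have ek : kx j = kx j' := by
      rw [← kp_comb j.1 (kx j), e1, e2, ec, kp_comb]
    have ek' : ∀ i, kz j.1 j.2.1 i + 12 * mi j i = kz j'.1 j'.2.1 i + 12 * mi j' i := fun i => congrFun ek i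
    have ez : kz j.1 j.2.1 = kz j.1 j'.2.1 := by
      funext i
      have := ek' i
      rw [← ec] at this
      have b1 : 0 ≤ kz j.1 j.2.1 i ∧ kz j.1 j.2.1 i < 12 := by unfold kz; omega
      have b2 : 0 ≤ kz j.1 j'.2.1 i ∧ kz j.1 j'.2.1 i < 12 := by unfold kz; omega
      omega
    have ep := pat_dec2 _ _ m1 _ m1' ez
    have em : ∀ i, mi j i = mi j' i := by
      intro i
      have := ek' i
      rw [← ec, ← ep] at this
      omega
    have g0 := em 0; have g1 := em 1; have g2 := em 2; have g3 := em 3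
    simp only [mi] at g0 g1 g2 g3
    simp at g0 g1 g2 g3
    ext1
    · exact ec
    · ext1
      · exact ep
      · simp only [Prod.ext_iff]
        exact ⟨g0, g1, g2, g3⟩
  have okt : ∀ j ∈ Jx n, Reg (tA j.1 (kx j)) (tB j.1 (kx j)) ∧ OKT n (φ j) := by
    intro j hj
    obtain ⟨m1, m2, m3⟩ := mem j hj
    have hr := reg_comb j.1 (kx j) (kn_nonneg _ _ _)
    refine ⟨hr, ?_⟩
    obtain ⟨⟨r1, r2⟩, r3, _⟩ := hr
    have sB := kn_sumB j.1 (kx j)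
    have sA := kn_sum j.1 j.2.1 m1 (mi j)
    rw [m2] at sA
    change tA j.1 (kx j) 0 + tA j.1 (kx j) 1 + tA j.1 (kx j) 2 = _ at sA
    simp only [φ]
    generalize tA j.1 (kx j) = A at *
    generalize tB j.1 (kx j) = B at *
    have r1' : (A 0 : ℝ) ≤ A 1 := by exact_mod_cast r1
    have r2' : (A 1 : ℝ) ≤ A 2 := by exact_mod_cast r2
    have r3' : (B 0 : ℝ) ≤ B 1 := by exact_mod_cast r3
    have sA' : (A 0 : ℝ) + A 1 + A 2 = 6 * n := by exact_mod_cast sA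
    have sB' : (A 0 : ℝ) + A 1 + A 2 = B 0 + B 1 := by exact_mod_cast sB
    refine ⟨?_, ?_, ?_, ?_⟩
    · rw [Fin.monotone_iff_le_succ]
      intro i; fin_cases i <;> simp [ra] <;> linarith
    · rw [Fin.monotone_iff_le_succ]
      intro i; fin_cases i; simp [ra]; linarith
    · simp only [Fin.sum_univ_three, Fin.sum_univ_two, ra]; linarith
    · simp only [Fin.sum_univ_three, ra]; linarith
  have mc := main_count h2 h3 n N hN ((Jx n).image φ) (by
      intro t ht
      obtain ⟨j, hj, rfl⟩ := Finset.mem_image.1 ht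
      exact (okt j hj).2) (by
      intro t ht hne
      obtain ⟨A, B, rfl, hr, ⟨s1, s2⟩, p, hp, hP⟩ := cls n t ht hne
      obtain ⟨c, hz, hk⟩ := cover A B hr s1
      obtain ⟨cA, cB⟩ := comb_kp c A B s1
      let m : Fin 4 → ℕ := fun i => (kp c A B i / 12).toNat
      let j : IX := (c, p, m 0, m 1, m 2, m 3)
      have hm : mi j = m := by
        funext i; fin_cases i <;> rfl
      have hkx : kx j = kp c A B := by
        funext i
        unfold kx; rw [hm]
        change kz c p i + 12 * ((kp c A B i / 12).toNat : ℤ) = _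
        rw [← pat_kz c p hp A B hP i]
        have := hk i
        omega
      have hd : dgk c p m = n := by
        have := kn_sum c p hp m
        have e : kn c p m = kp c A B := by rw [← hkx]; unfold kx; rw [hm]
        rw [e, cA, s2] at this
        omega
      refine Finset.mem_image.2 ⟨j, ?_, ?_⟩
      · simp only [Jx, Bx, Finset.mem_filter, Finset.mem_product, List.mem_toFinset, Finset.mem_range, Finset.mem_univ, true_and]
        refine ⟨⟨hp, ?_⟩, ?_, ?_⟩
        · have q0 := Nat.le_mul_of_pos_right (m 0) (dg_dec (co c 0)).2
          have q1 := Nat.le_mul_of_pos_right (m 1) (dg_dec (co c 1)).2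
          have q2 := Nat.le_mul_of_pos_right (m 2) (dg_dec (co c 2)).2
          have q3 := Nat.le_mul_of_pos_right (m 3) (dg_dec (co c 3)).2
          unfold dgk at hd
          change m 0 < n + 1 ∧ m 1 < n + 1 ∧ m 2 < n + 1 ∧ m 3 < n + 1
          omega
        · rw [hm]; exact hd
        · rw [hkx]; change inZ c (tA c _) (tB c _); rw [cA, cB]; exact hz
      · simp only [φ]
        rw [hkx]; change (ra (tA c _), ra (tB c _)) = _; rw [cA, cB])
    (fun t _ => (card_AutT _ _).2) (fun t _ => (card_RedS _ _).2)
  rw [mc, Finset.sum_image inj, Finset.sum_mul]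
  refine Finset.sum_congr rfl fun j hj => ?_
  obtain ⟨m1, m2, m3⟩ := mem j hj
  exact W_thm hq h2 h3 j.2.1 m1 _ _ (okt j hj).1 (kn_pat _ _ m1 _)

theorem count_sum (n : ℕ) (N : ℚ)
    (hN : IsWeightedG4OrbitCount {v : Matrix (Fin 3) (Fin 3) (Polynomial F) ×
                Matrix (Fin 3) (Fin 3) (Polynomial F) |
              v.1.IsSymm ∧ v.2.IsSymm ∧ disc4 v.1 v.2 ≠ 0 ∧
                (disc4 v.1 v.2).natDegree = n} N) :
    N * CC (s + 2) = ∑ c : Fin 10, ∑ p ∈ pats.toFinset, ∑ m0 ∈ Finset.range (n + 1), ∑ m1 ∈ Finset.range (n + 1),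
      ∑ m2 ∈ Finset.range (n + 1), ∑ m3 ∈ Finset.range (n + 1),
      if n = dgk c p ![m0, m1, m2, m3] then wtz (s + 2) c p (kn c p ![m0, m1, m2, m3]) else 0 := by
  rw [count_J hq h2 h3 n N hN]
  simp only [← Finset.sum_product']
  rw [Jx, Finset.sum_filter]
  refine Finset.sum_congr rfl fun j _ => ?_
  rw [ite_and]
  simp only [wtz]
  simp only [eq_comm (a := n)]
  rfl
end cnt
end QC

namespace QC
open PowerSeries

/-- vanishing to order `k` -/
def lo (k : ℕ) (g : ℚ⟦X⟧) : Prop := ∀ n < k, coeff n g = 0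
/-- locally finite sums of power series -/
noncomputable def PSs (f : ℕ → ℚ⟦X⟧) : ℚ⟦X⟧ := PowerSeries.mk fun n => ∑ k ∈ Finset.range (n + 1), coeff n (f k)

theorem PSs_lo {K : ℕ} {f : ℕ → ℚ⟦X⟧} (h : ∀ k, lo K (f k)) : lo K (PSs f) := by
  intro n hn
  simp only [PSs, coeff_mk]
  exact Finset.sum_eq_zero fun k _ => h k n hn

theorem PSs_coeff {f : ℕ → ℚ⟦X⟧} (h : ∀ k, lo k (f k)) (n M : ℕ) (hM : n < M) :
    coeff n (PSs f) = ∑ k ∈ Finset.range M, coeff n (f k) := by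
  simp only [PSs, coeff_mk]
  refine Finset.sum_subset (by intro k hk; simp at *; omega) ?_
  intro k _ hk
  exact h k n (by simp at hk; omega)

theorem PSs_mul (x : ℚ⟦X⟧) {f : ℕ → ℚ⟦X⟧} (h : ∀ k, lo k (f k)) : PSs (fun k => x * f k) = x * PSs f := by
  ext n
  simp only [PSs, coeff_mk, coeff_mul]
  rw [Finset.sum_comm]
  refine Finset.sum_congr rfl fun p hp => ?_
  rw [← Finset.mul_sum]
  congr 1
  have : p.2 ≤ n := by have := Finset.HasAntidiagonal.mem_antidiagonal.1 hp; omega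
  exact (PSs_coeff h p.2 (n + 1) (by omega)).symm.trans (by simp only [PSs, coeff_mk])

theorem lo_mul {k : ℕ} {f : ℚ⟦X⟧} (x : ℚ⟦X⟧) (h : lo k f) : lo k (x * f) := by
  intro n hn
  rw [coeff_mul]
  refine Finset.sum_eq_zero fun p hp => ?_
  have : p.2 ≤ n := by have := Finset.HasAntidiagonal.mem_antidiagonal.1 hp; omega
  rw [h p.2 (by omega), mul_zero]

theorem PSs_succ {f : ℕ → ℚ⟦X⟧} (h : ∀ k, lo k (f k)) : PSs f = f 0 + PSs (fun k => f (k + 1)) := by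
  ext n
  rw [PSs_coeff h n (n + 2) (by omega), Finset.sum_range_succ', map_add, add_comm]
  simp only [PSs, coeff_mk]

theorem lo_mono {k l : ℕ} (h : l ≤ k) {f} (hf : lo k f) : lo l f := fun n hn => hf n (by omega)

theorem PSs_geo0 {f : ℕ → ℚ⟦X⟧} (h : ∀ k, lo k (f k)) (x : ℚ⟦X⟧) (hx : ∀ k, f (k + 1) = x * f k) :
    (1 - x) * PSs f = f 0 := by
  have h1 := PSs_succ h
  have h2 : PSs (fun k => f (k + 1)) = x * PSs f := by
    rw [← PSs_mul x h]; congr 1; funext k; exact hx k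
  rw [h2] at h1
  linear_combination h1

theorem PSs_geo1 {f : ℕ → ℚ⟦X⟧} (h : ∀ k, lo k (f k)) (x : ℚ⟦X⟧) (hx : ∀ k, 1 ≤ k → f (k + 1) = x * f k) :
    (1 - x) * PSs f = (1 - x) * f 0 + f 1 := by
  have h1 := PSs_succ h
  have h2 := PSs_geo0 (f := fun k => f (k + 1)) (fun k => lo_mono (by omega) (h (k + 1))) x (fun k => hx (k + 1) (by omega))
  rw [h1, mul_add, h2]

/-- sparse polynomials in two variables -/
abbrev Tm := List (ℤ × ℕ × ℕ)
/-- evaluation of the first variable -/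
noncomputable def ev (q : ℕ) (l : Tm) : ℚ⟦X⟧ := (l.map fun t => PowerSeries.monomial t.2.2 ((t.1 : ℚ) * (q : ℚ) ^ t.2.1)).sum
/-- merging -/
def mrg : ℕ → Tm → Tm → Tm
  | 0, a, b => a ++ b
  | _ + 1, [], b => b
  | _ + 1, x :: a, [] => x :: a
  | n + 1, x :: a, y :: b =>
    if x.2.2 = y.2.2 ∧ x.2.1 = y.2.1 then
      if x.1 + y.1 = 0 then mrg n a b else (x.1 + y.1, x.2) :: mrg n a b
    else if x.2.2 * 256 + x.2.1 < y.2.2 * 256 + y.2.1 then x :: mrg n a (y :: b) else y :: mrg n (x :: a) b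
/-- multiplication by a binomial -/
def bin (x : ℕ × ℕ) (l : Tm) : Tm := mrg 4000 l (l.map fun t => (-t.1, t.2.1 + x.1, t.2.2 + x.2))
/-- one coordinate -/
def nst (fl : Bool) (x : ℕ × ℕ) (e : ℕ → Tm) : Tm := if fl then e 0 else mrg 4000 (bin x (e 0)) (e 1)

/-- needed base values -/
def rg (fl : Bool) : List ℕ := if fl then [0] else [0, 1]

variable (q : ℕ)

/-- a monomial -/
noncomputable def mon (x : ℕ × ℕ) : ℚ⟦X⟧ := PowerSeries.monomial x.2 ((q : ℚ) ^ x.1)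

theorem ev_nil : ev q [] = 0 := rfl
theorem ev_cons (t l) : ev q (t :: l) = PowerSeries.monomial t.2.2 ((t.1 : ℚ) * (q : ℚ) ^ t.2.1) + ev q l := by
  simp [ev]
theorem ev_append (a b) : ev q (a ++ b) = ev q a + ev q b := by
  simp [ev]

theorem ev_mrg (n a b) : ev q (mrg n a b) = ev q a + ev q b := by
  induction n generalizing a b with
  | zero => simp only [mrg, ev_append]
  | succ n ih =>
    match a, b with
    | [], b => simp only [mrg, ev_nil, zero_add]
    | x :: a, [] => simp only [mrg, ev_nil, add_zero]
    | x :: a, y :: b =>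
      have key : x.2.2 = y.2.2 ∧ x.2.1 = y.2.1 → PowerSeries.monomial x.2.2 ((x.1 : ℚ) * (q : ℚ) ^ x.2.1) + PowerSeries.monomial y.2.2 ((y.1 : ℚ) * (q : ℚ) ^ y.2.1)
          = PowerSeries.monomial x.2.2 (((x.1 + y.1 : ℤ) : ℚ) * (q : ℚ) ^ x.2.1) := by
        rintro ⟨h1, h2⟩
        rw [← h1, ← h2, ← map_add]; push_cast; rw [add_mul]
      simp only [mrg]
      split_ifs with h1 h2 h3
      · have := key h1
        rw [h2] at this
        simp only [ih, ev_cons]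
        simp only [Int.cast_zero, zero_mul, map_zero] at this
        linear_combination - this
      · simp only [ih, ev_cons]
        linear_combination - key h1
      · simp only [ih, ev_cons]; ring
      · simp only [ih, ev_cons]; ring

theorem ev_bin (x l) : ev q (bin x l) = (1 - mon q x) * ev q l := by
  rw [bin, ev_mrg, sub_mul, one_mul, sub_eq_add_neg]
  congr 1
  induction l with
  | nil => simp [ev_nil]
  | cons t l ih =>
    rw [List.map_cons, ev_cons, ev_cons, ih, mul_add, neg_add]
    congr 1
    simp only [mon, PowerSeries.monomial_mul_monomial, ← map_neg]
    rw [add_comm x.2]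
    congr 1
    push_cast
    rw [pow_add]; ring

theorem nst_spec (fl : Bool) (x : ℕ × ℕ) (y : ℚ⟦X⟧) (f : ℕ → ℚ⟦X⟧) (e : ℕ → Tm) (h : ∀ k, lo k (f k))
    (hx : ∀ k, (fl = true ∨ 1 ≤ k) → f (k + 1) = mon q x * f k) (he : ∀ k ∈ rg fl, y * f k = ev q (e k)) :
    (y * (1 - mon q x)) * PSs f = ev q (nst fl x e) := by
  rw [mul_assoc]
  cases fl
  · rw [PSs_geo1 h _ (fun k hk => hx k (Or.inr hk))]
    simp only [nst, Bool.false_eq_true, if_false, ev_mrg, ev_bin]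
    rw [← he 0 (by decide), ← he 1 (by decide)]; ring
  · rw [PSs_geo0 h _ (fun k => hx k (Or.inl rfl))]
    simp only [nst, if_true]
    exact he 0 (by decide)

/-- product of polynomials in one variable -/
def padd : List ℕ → List ℕ → List ℕ
  | [], b => b
  | x :: a, [] => x :: a
  | x :: a, y :: b => (x + y) :: padd a b
/-- product of polynomials in one variable -/
def pmul : List ℕ → List ℕ → List ℕ
  | [], _ => []
  | x :: a, b => padd (b.map (x * ·)) (0 :: pmul a b)

theorem evl_padd (a b) : evl q (padd a b) = evl q a + evl q b := by
  induction a generalizing b with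
  | nil => simp [padd, evl]
  | cons x a ih =>
    cases b with
    | nil => simp [padd, evl]
    | cons y b => simp only [padd, evl, ih]; ring

theorem evl_smul (x b) : evl q (b.map (x * ·)) = x * evl q b := by
  induction b with
  | nil => simp [evl]
  | cons y b ih => simp only [List.map_cons, evl, ih]; ring

theorem evl_pmul (a b) : evl q (pmul a b) = evl q a * evl q b := by
  induction a with
  | nil => simp [pmul, evl]
  | cons x a ih => simp only [pmul, evl_padd, evl_smul, evl, ih]; ring

/-- sparse version of a polynomial -/
def toT (d : ℕ) : ℕ → List ℕ → Tm
  | _, [] => []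
  | e, x :: l => if x = 0 then toT d (e + 1) l else ((x : ℤ), e, d) :: toT d (e + 1) l

theorem ev_toT (d e l) : ev q (toT d e l) = PowerSeries.monomial d ((q : ℚ) ^ e * (evl q l : ℚ)) := by
  induction l generalizing e with
  | nil => simp [toT, evl, ev_nil]
  | cons x l ih =>
    simp only [toT, evl]
    split_ifs with h
    · subst h
      rw [ih]; congr 1; push_cast; ring
    · rw [ev_cons, ih]
      simp only
      rw [← map_add]; congr 1; push_cast; ring

/-- term of a base point -/
def bs (c : Fin 10) (p : Pt) (d : ℕ) (A : Fin 3 → ℤ) (B : Fin 2 → ℤ) : Tm :=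
  if inZ c A B then toT d (ex (A 0) (A 1) (A 2) (B 0) (B 1)).toNat
    (pmul (mf p.1 (A p.2.1.1) (A p.2.1.2.1) (A p.2.1.2.2) (B p.2.2.1) (B p.2.2.2)) (pmul (da (A 0) (A 1) (A 2)) (db (B 0) (B 1)))) else []

/-- term of a base point -/
def base (c : Fin 10) (p : Pt) (m : Fin 4 → ℕ) : Tm := bs c p (dgk c p m) (tA c (kn c p m)) (tB c (kn c p m))

/-- nonnegative exponent -/
def exok (c : Fin 10) (A : Fin 3 → ℤ) (B : Fin 2 → ℤ) : Prop := inZ c A B → 0 ≤ ex (A 0) (A 1) (A 2) (B 0) (B 1)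
instance (c A B) : Decidable (exok c A B) := inferInstanceAs (Decidable (_ → _))

/-- flags -/
def fg (c : Fin 10) (p : Pt) (i : Fin 4) : Bool := decide (0 < kz c p i)

theorem exok_dec : ∀ c, ∀ p ∈ pats, ∀ m0 ∈ rg (fg c p 0), ∀ m1 ∈ rg (fg c p 1), ∀ m2 ∈ rg (fg c p 2), ∀ m3 ∈ rg (fg c p 3),
    exok c (tA c (kn c p ![m0, m1, m2, m3])) (tB c (kn c p ![m0, m1, m2, m3])) := by
  decide +kernel

end QC

namespace QC
open PowerSeries

/-- exponents of a ray of a cone -/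
def xr (c : Fin 10) (i : Fin 4) : ℕ × ℕ := (re (co c i), dg (co c i))
/-- numerator of a cone and a pattern -/
def tms (c : Fin 10) (p : Pt) : Tm :=
  nst (fg c p 0) (xr c 0) fun m0 => nst (fg c p 1) (xr c 1) fun m1 => nst (fg c p 2) (xr c 2) fun m2 =>
    nst (fg c p 3) (xr c 3) fun m3 => base c p ![m0, m1, m2, m3]
/-- numerator of a cone -/
def num (c : Fin 10) : Tm := pats.foldr (fun p acc => mrg 4000 (tms c p) acc) []
/-- several binomials -/
def bins (l : List (ℕ × ℕ)) (t : Tm) : Tm := l.foldr bin t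
/-- complementary factors -/
def comp : Fin 10 → List (ℕ × ℕ) :=
  ![[(2, 2), (4, 4), (8, 10), (9, 12)], [(2, 2), (4, 4), (9, 12), (12, 12)], [(2, 2), (4, 4), (12, 12), (14, 16)], [(2, 2), (6, 8), (12, 12), (14, 16)], [(4, 4), (8, 10), (12, 12), (14, 16)], [(6, 8), (8, 10), (12, 12), (14, 16)], [(2, 2), (5, 6), (9, 12), (12, 12)], [(2, 2), (8, 10), (12, 12), (14, 16)], [(2, 2), (5, 6), (12, 12), (14, 16)], [(4, 4), (8, 10), (12, 12), (14, 16)]]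
/-- total numerator -/
def ntot : Tm := (List.finRange 10).foldr (fun c acc => mrg 4000 (bins (comp c) (num c)) acc) []
/-- reduced numerator -/
def QT : Tm :=
  [(1, 0, 0), (3, 1, 0), (4, 2, 0), (3, 3, 0), (1, 4, 0), (1, 1, 1), (3, 2, 1), (4, 3, 1), (3, 4, 1), (1, 5, 1), (2, 2, 2), (6, 3, 2), (8, 4, 2),
   (6, 5, 2), (2, 6, 2), (3, 3, 3), (9, 4, 3), (12, 5, 3), (9, 6, 3), (3, 7, 3), (4, 4, 4), (12, 5, 4), (16, 6, 4), (12, 7, 4), (4, 8, 4), (2, 5, 5),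
   (6, 6, 5), (8, 7, 5), (6, 8, 5), (2, 9, 5), (2, 5, 6), (8, 6, 6), (14, 7, 6), (14, 8, 6), (8, 9, 6), (2, 10, 6), (3, 6, 7), (10, 7, 7), (15, 8, 7),
   (13, 9, 7), (6, 10, 7), (1, 11, 7), (4, 7, 8), (13, 8, 8), (19, 9, 8), (16, 10, 8), (7, 11, 8), (1, 12, 8), (3, 8, 9), (10, 9, 9), (15, 10, 9),
   (13, 11, 9), (6, 12, 9), (1, 13, 9), (1, 8, 10), (5, 9, 10), (11, 10, 10), (14, 11, 10), (11, 12, 10), (5, 13, 10), (1, 14, 10), (1, 9, 11),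
   (3, 10, 11), (5, 11, 11), (6, 12, 11), (5, 13, 11), (3, 14, 11), (1, 15, 11), (3, 10, 12), (9, 11, 12), (12, 12, 12), (9, 13, 12), (3, 14, 12),
   (2, 11, 13), (6, 12, 13), (8, 13, 13), (6, 14, 13), (2, 15, 13), (1, 12, 14), (3, 13, 14), (3, 14, 14), (-3, 16, 14), (-3, 17, 14), (-1, 18, 14),
   (-2, 15, 15), (-6, 16, 15), (-8, 17, 15), (-6, 18, 15), (-2, 19, 15), (-3, 16, 16), (-9, 17, 16), (-12, 18, 16), (-9, 19, 16), (-3, 20, 16),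
   (-1, 15, 17), (-3, 16, 17), (-5, 17, 17), (-6, 18, 17), (-5, 19, 17), (-3, 20, 17), (-1, 21, 17), (-1, 16, 18), (-5, 17, 18), (-11, 18, 18),
   (-14, 19, 18), (-11, 20, 18), (-5, 21, 18), (-1, 22, 18), (-1, 17, 19), (-6, 18, 19), (-13, 19, 19), (-15, 20, 19), (-10, 21, 19), (-3, 22, 19),
   (-1, 18, 20), (-7, 19, 20), (-16, 20, 20), (-19, 21, 20), (-13, 22, 20), (-4, 23, 20), (-1, 19, 21), (-6, 20, 21), (-13, 21, 21), (-15, 22, 21),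
   (-10, 23, 21), (-3, 24, 21), (-2, 20, 22), (-8, 21, 22), (-14, 22, 22), (-14, 23, 22), (-8, 24, 22), (-2, 25, 22), (-2, 21, 23), (-6, 22, 23),
   (-8, 23, 23), (-6, 24, 23), (-2, 25, 23), (-4, 22, 24), (-12, 23, 24), (-16, 24, 24), (-12, 25, 24), (-4, 26, 24), (-3, 23, 25), (-9, 24, 25),
   (-12, 25, 25), (-9, 26, 25), (-3, 27, 25), (-2, 24, 26), (-6, 25, 26), (-8, 26, 26), (-6, 27, 26), (-2, 28, 26), (-1, 25, 27), (-3, 26, 27),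
   (-4, 27, 27), (-3, 28, 27), (-1, 29, 27), (-1, 26, 28), (-3, 27, 28), (-4, 28, 28), (-3, 29, 28), (-1, 30, 28)]

theorem num_check : mrg 4000 ntot (bins [(4, 4), (8, 10), (14, 16)] (QT.map fun t => (-t.1, t.2))) = [] := by decide +kernel
end QC

namespace QC
open PowerSeries

theorem ev_bins (q : ℕ) (l t) : ev q (bins l t) = (l.map fun x => 1 - mon q x).prod * ev q t := by
  induction l with
  | nil => simp [bins]
  | cons x l ih =>
    have : bins (x :: l) t = bin x (bins l t) := rfl
    rw [this, ev_bin, ih, List.map_cons, List.prod_cons, mul_assoc]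

theorem ev_neg (q : ℕ) (t : Tm) : ev q (t.map fun t => (-t.1, t.2)) = - ev q t := by
  induction t with
  | nil => simp [ev_nil]
  | cons x l ih =>
    rw [List.map_cons, ev_cons, ev_cons, ih, neg_add]
    simp only [Int.cast_neg, neg_mul, map_neg]

theorem ev_ntot (q : ℕ) : ev q ntot = ((1 - mon q (4, 4)) * ((1 - mon q (8, 10)) * (1 - mon q (14, 16)))) * ev q QT := by
  have h := congrArg (ev q) num_check
  rw [ev_mrg, ev_bins, ev_neg, ev_nil] at h
  simp only [List.map_cons, List.map_nil, List.prod_cons, List.prod_nil, mul_one] at h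
  linear_combination h

/-- term of a point -/
noncomputable def Ft (q : ℕ) (c : Fin 10) (p : Pt) (m0 m1 m2 m3 : ℕ) : ℚ⟦X⟧ :=
  PowerSeries.monomial (dgk c p ![m0, m1, m2, m3]) (wtz q c p (kn c p ![m0, m1, m2, m3]))

theorem dgk_eq (c p m0 m1 m2 m3) : dgk c p ![m0, m1, m2, m3] =
    d0 c p + (m0 * dg (co c 0) + m1 * dg (co c 1) + m2 * dg (co c 2) + m3 * dg (co c 3)) := rfl

theorem lo_mono' {k l : ℕ} (h : l ≤ k) (a : ℚ) : lo l (PowerSeries.monomial k a) := by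
  intro n hn
  rw [coeff_monomial, if_neg (by omega)]

theorem Ft_step (q : ℕ) (hq : q ≠ 0) (c p) (m m' : Fin 4 → ℕ) (i : Fin 4) (hm : ∀ j, m' j = m j + if j = i then 1 else 0)
    (hi : fg c p i = true ∨ 1 ≤ m i) :
    PowerSeries.monomial (dgk c p m') (wtz q c p (kn c p m')) = mon q (xr c i) * PowerSeries.monomial (dgk c p m) (wtz q c p (kn c p m)) := by
  have h1 : kn c p m' = sh (kn c p m) i := by
    funext j
    simp only [kn, sh, hm]
    push_cast
    split_ifs <;> ring
  have h2 : dgk c p m' = dg (co c i) + dgk c p m := by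
    simp only [dgk, hm]
    fin_cases i <;> simp <;> ring
  have h3 : 1 ≤ kn c p m i := by
    have h0 : 0 ≤ kz c p i := by unfold kz; omega
    unfold kn
    rcases hi with h | h
    · have : 0 < kz c p i := by simpa [fg] using h
      omega
    · omega
  rw [h1, wtz_step q hq c p _ (kn_nonneg c p m) i h3, h2, mon, PowerSeries.monomial_mul_monomial]
  rfl

theorem ev_base (q : ℕ) (hq : q ≠ 0) (c p m) (h : exok c (tA c (kn c p m)) (tB c (kn c p m))) :
    PowerSeries.monomial (dgk c p m) (wtz q c p (kn c p m)) = ev q (base c p m) := by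
  unfold base bs wtz
  split_ifs with hz
  · have h0 := h hz
    rw [ev_toT, evl_pmul, evl_pmul]
    congr 1
    simp only [wt, wp]
    rw [← zpow_natCast, Int.toNat_of_nonneg h0]
  · rw [ev_nil, map_zero]

/-- generating function of a cone -/
noncomputable def Hs (q : ℕ) (c : Fin 10) (p : Pt) : ℚ⟦X⟧ :=
  PSs fun m0 => PSs fun m1 => PSs fun m2 => PSs fun m3 => Ft q c p m0 m1 m2 m3

theorem Ft_lo (q c p m0 m1 m2 m3 k) (h : k ≤ m0 ∨ k ≤ m1 ∨ k ≤ m2 ∨ k ≤ m3) : lo k (Ft q c p m0 m1 m2 m3) := by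
  refine lo_mono' ?_ _
  rw [dgk_eq]
  have h0 := Nat.le_mul_of_pos_right m0 (dg_dec (co c 0)).2
  have h1 := Nat.le_mul_of_pos_right m1 (dg_dec (co c 1)).2
  have h2 := Nat.le_mul_of_pos_right m2 (dg_dec (co c 2)).2
  have h3 := Nat.le_mul_of_pos_right m3 (dg_dec (co c 3)).2
  omega

theorem Hs_coeff (q c p n) : coeff n (Hs q c p) = ∑ m0 ∈ Finset.range (n + 1), ∑ m1 ∈ Finset.range (n + 1),
      ∑ m2 ∈ Finset.range (n + 1), ∑ m3 ∈ Finset.range (n + 1),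
      if n = dgk c p ![m0, m1, m2, m3] then wtz q c p (kn c p ![m0, m1, m2, m3]) else 0 := by
  simp only [Hs, PSs, coeff_mk, Ft, coeff_monomial]

theorem Hs_spec (q : ℕ) (hq : q ≠ 0) (c p) (hp : p ∈ pats) :
    ((((1 - mon q (xr c 3)) * (1 - mon q (xr c 2))) * (1 - mon q (xr c 1))) * (1 - mon q (xr c 0))) * Hs q c p = ev q (tms c p) := by
  unfold Hs tms
  refine nst_spec q _ _ _ _ _ (fun k => PSs_lo fun _ => PSs_lo fun _ => PSs_lo fun _ => Ft_lo _ _ _ _ _ _ _ _ (by omega)) ?_ fun m0 h0 => ?_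
  · intro k hk
    rw [← PSs_mul _ (fun k => PSs_lo fun _ => PSs_lo fun _ => Ft_lo _ _ _ _ _ _ _ _ (by omega))]
    congr 1; funext m1
    rw [← PSs_mul _ (fun k => PSs_lo fun _ => Ft_lo _ _ _ _ _ _ _ _ (by omega))]
    congr 1; funext m2
    rw [← PSs_mul _ (fun k => Ft_lo _ _ _ _ _ _ _ _ (by omega))]
    congr 1; funext m3
    refine Ft_step q hq c p ![k, m1, m2, m3] ![k + 1, m1, m2, m3] 0 ?_ hk
    intro j; fin_cases j <;> rfl
  refine nst_spec q _ _ _ _ _ (fun k => PSs_lo fun _ => PSs_lo fun _ => Ft_lo _ _ _ _ _ _ _ _ (by omega)) ?_ fun m1 h1 => ?_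
  · intro k hk
    rw [← PSs_mul _ (fun k => PSs_lo fun _ => Ft_lo _ _ _ _ _ _ _ _ (by omega))]
    congr 1; funext m2
    rw [← PSs_mul _ (fun k => Ft_lo _ _ _ _ _ _ _ _ (by omega))]
    congr 1; funext m3
    refine Ft_step q hq c p ![m0, k, m2, m3] ![m0, k + 1, m2, m3] 1 ?_ hk
    intro j; fin_cases j <;> rfl
  refine nst_spec q _ _ _ _ _ (fun k => PSs_lo fun _ => Ft_lo _ _ _ _ _ _ _ _ (by omega)) ?_ fun m2 h2 => ?_
  · intro k hk
    rw [← PSs_mul _ (fun k => Ft_lo _ _ _ _ _ _ _ _ (by omega))]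
    congr 1; funext m3
    refine Ft_step q hq c p ![m0, m1, k, m3] ![m0, m1, k + 1, m3] 2 ?_ hk
    intro j; fin_cases j <;> rfl
  rw [← one_mul (1 - mon q (xr c 3))]
  refine nst_spec q _ _ _ _ _ (fun k => Ft_lo _ _ _ _ _ _ _ _ (by omega)) ?_ fun m3 h3 => ?_
  · intro k hk
    refine Ft_step q hq c p ![m0, m1, m2, k] ![m0, m1, m2, k + 1] 3 ?_ hk
    intro j; fin_cases j <;> rfl
  rw [one_mul]
  exact ev_base q hq c p _ (exok_dec c p hp m0 h0 m1 h1 m2 h2 m3 h3)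

theorem pats_nodup : pats.Nodup := by decide +kernel

theorem perm_dec : ∀ c, (comp c ++ [xr c 3, xr c 2, xr c 1, xr c 0]).Perm
    [(2, 2), (4, 4), (5, 6), (6, 8), (8, 10), (9, 12), (12, 12), (14, 16)] := by decide +kernel

/-- total generating function -/
noncomputable def Gs (q : ℕ) : ℚ⟦X⟧ := ∑ c : Fin 10, ∑ p ∈ pats.toFinset, Hs q c p

theorem ev_num (q : ℕ) (hq : q ≠ 0) (c) :
    ((((1 - mon q (xr c 3)) * (1 - mon q (xr c 2))) * (1 - mon q (xr c 1))) * (1 - mon q (xr c 0))) * ∑ p ∈ pats.toFinset, Hs q c p = ev q (num c) := by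
  rw [List.sum_toFinset _ pats_nodup]
  unfold num
  have : ∀ l : List Pt, (∀ p ∈ l, p ∈ pats) →
    ((((1 - mon q (xr c 3)) * (1 - mon q (xr c 2))) * (1 - mon q (xr c 1))) * (1 - mon q (xr c 0))) * (l.map (Hs q c)).sum =
      ev q (l.foldr (fun p acc => mrg 4000 (tms c p) acc) []) := by
    intro l hl
    induction l with
    | nil => simp [ev_nil]
    | cons p l ih =>
      rw [List.map_cons, List.sum_cons, List.foldr_cons, ev_mrg, mul_add, Hs_spec q hq c p (hl p (by simp)), ih fun p hp => hl p (by simp [hp])]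
  exact this _ fun _ h => h

theorem Gs_all (q : ℕ) (hq : q ≠ 0) :
    (([(2, 2), (4, 4), (5, 6), (6, 8), (8, 10), (9, 12), (12, 12), (14, 16)] : List (ℕ × ℕ)).map fun x => 1 - mon q x).prod * Gs q = ev q ntot := by
  unfold Gs ntot
  have : ∀ l : List (Fin 10),
    (([(2, 2), (4, 4), (5, 6), (6, 8), (8, 10), (9, 12), (12, 12), (14, 16)] : List (ℕ × ℕ)).map fun x => 1 - mon q x).prod *
      (l.map fun c => ∑ p ∈ pats.toFinset, Hs q c p).sum = ev q (l.foldr (fun c acc => mrg 4000 (bins (comp c) (num c)) acc) []) := by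
    intro l
    induction l with
    | nil => simp [ev_nil]
    | cons c l ih =>
      rw [List.map_cons (l := l), List.sum_cons, List.foldr_cons, ev_mrg, mul_add, ih, ev_bins, ← ev_num q hq c,
        ← ((perm_dec c).map _).prod_eq, List.map_append, List.prod_append]
      simp only [List.map_cons, List.map_nil, List.prod_cons, List.prod_nil]
      ring
  rw [← this, ← Fin.sum_univ_def]

theorem mon_ne (q : ℕ) (x : ℕ × ℕ) (h : x.2 ≠ 0) : 1 - mon q x ≠ 0 := by
  intro h0
  have := congrArg (coeff 0) h0
  rw [map_sub, mon, coeff_monomial, if_neg (by omega)] at this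
  simp at this

theorem Gs_main (q : ℕ) (hq : q ≠ 0) :
    ((1 - mon q (2, 2)) * (1 - mon q (5, 6)) * (1 - mon q (6, 8)) * (1 - mon q (9, 12)) * (1 - mon q (12, 12))) * Gs q = ev q QT := by
  have h := Gs_all q hq
  rw [ev_ntot] at h
  simp only [List.map_cons, List.map_nil, List.prod_cons, List.prod_nil] at h
  refine mul_left_cancel₀ (mul_ne_zero (mon_ne q (4, 4) (by decide)) (mul_ne_zero (mon_ne q (8, 10) (by decide)) (mon_ne q (14, 16) (by decide)))) ?_
  rw [← h]; ring

end QC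

namespace QC
open Polynomial

/-- functions on `w > 1` given by rational functions without poles there -/
def Rt (g : ℝ → ℝ) : Prop := ∃ p r : ℚ[X], ∀ w : ℝ, 1 < w → aeval w r ≠ 0 ∧ g w = aeval w p / aeval w r

theorem Rt.of_poly {g : ℝ → ℝ} (p : ℚ[X]) (h : ∀ w : ℝ, 1 < w → g w = aeval w p) : Rt g :=
  ⟨p, 1, fun w hw => by simp [h w hw]⟩

theorem Rt.add {f g : ℝ → ℝ} (hf : Rt f) (hg : Rt g) : Rt (fun w => f w + g w) := by
  obtain ⟨p, r, h⟩ := hf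
  obtain ⟨p', r', h'⟩ := hg
  refine ⟨p * r' + r * p', r * r', fun w hw => ?_⟩
  obtain ⟨h1, h2⟩ := h w hw
  obtain ⟨h3, h4⟩ := h' w hw
  beta_reduce
  rw [map_mul, map_add, map_mul, map_mul, h2, h4]
  exact ⟨mul_ne_zero h1 h3, div_add_div _ _ h1 h3⟩

theorem Rt.mul {f g : ℝ → ℝ} (hf : Rt f) (hg : Rt g) : Rt (fun w => f w * g w) := by
  obtain ⟨p, r, h⟩ := hf
  obtain ⟨p', r', h'⟩ := hg
  refine ⟨p * p', r * r', fun w hw => ?_⟩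
  obtain ⟨h1, h2⟩ := h w hw
  obtain ⟨h3, h4⟩ := h' w hw
  beta_reduce
  rw [map_mul, map_mul, h2, h4]
  exact ⟨mul_ne_zero h1 h3, div_mul_div_comm _ _ _ _⟩

theorem Rt.const (c : ℚ) : Rt (fun _ => (c : ℝ)) := Rt.of_poly (C c) (by simp)
theorem Rt.nat (c : ℕ) : Rt (fun _ => (c : ℝ)) := Rt.of_poly (c : ℚ[X]) (by simp)
theorem Rt.pw (n : ℕ) : Rt (fun w => w ^ n) := Rt.of_poly (X ^ n) (by simp)

theorem Rt.sub {f g : ℝ → ℝ} (hf : Rt f) (hg : Rt g) : Rt (fun w => f w - g w) := by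
  have := hf.add ((Rt.const (-1)).mul hg)
  convert this using 2
  push_cast; ring

theorem Rt.div {f g : ℝ → ℝ} (hf : Rt f) (hg : Rt g) (h0 : ∀ w, 1 < w → g w ≠ 0) : Rt (fun w => f w / g w) := by
  obtain ⟨p, r, h⟩ := hf
  obtain ⟨p', r', h'⟩ := hg
  refine ⟨p * r', r * p', fun w hw => ?_⟩
  obtain ⟨h1, h2⟩ := h w hw
  obtain ⟨h3, h4⟩ := h' w hw
  have h5 : aeval w p' ≠ 0 := by
    intro h
    exact h0 w hw (by rw [h4, h, zero_div])
  beta_reduce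
  rw [map_mul, map_mul, h2, h4]
  exact ⟨mul_ne_zero h1 h5, div_div_div_eq _ _ _ _⟩

theorem Rt.npow {f : ℝ → ℝ} (hf : Rt f) (n : ℕ) : Rt (fun w => f w ^ n) := by
  induction n with
  | zero => exact Rt.of_poly 1 (by simp)
  | succ n ih => simp only [pow_succ]; exact ih.mul hf

theorem Rt.toRat {g : ℝ → ℝ} (hg : Rt g) : ∃ f : RatFunc ℚ, ∀ w : ℝ, 1 < w →
    (RatFunc.denom f).eval₂ (algebraMap ℚ ℝ) w ≠ 0 ∧ RatFunc.eval (algebraMap ℚ ℝ) w f = g w := by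
  obtain ⟨p, r, h⟩ := hg
  have hr : r ≠ 0 := by
    rintro rfl
    exact (h 2 (by norm_num)).1 (by simp)
  refine ⟨algebraMap _ _ p / algebraMap _ _ r, fun w hw => ?_⟩
  obtain ⟨h1, h2⟩ := h w hw
  have hd : (RatFunc.denom (algebraMap ℚ[X] (RatFunc ℚ) p / algebraMap _ _ r)).eval₂ (algebraMap ℚ ℝ) w ≠ 0 := by
    obtain ⟨z, hz⟩ := RatFunc.denom_div_dvd p r
    intro h0
    apply h1
    rw [hz, aeval_def, eval₂_mul, h0, zero_mul]
  refine ⟨hd, ?_⟩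
  have key := (RatFunc.num_mul_eq_mul_denom_iff (x := algebraMap ℚ[X] (RatFunc ℚ) p / algebraMap _ _ r) (p := p) hr).2 rfl
  have key2 := congrArg (eval₂ (algebraMap ℚ ℝ) w) key
  rw [eval₂_mul, eval₂_mul] at key2
  rw [RatFunc.eval, h2, div_eq_div_iff hd h1]
  exact key2

theorem seq2 (r : ℝ) (hr : r ≠ 0) (u : ℕ → ℝ) (h : ∀ k, u (k + 2) - 2 * r * u (k + 1) + r ^ 2 * u k = 0) (k : ℕ) :
    u k = ((u 1 / r - u 0) * k + u 0) * r ^ k := by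
  have : u k = ((u 1 / r - u 0) * k + u 0) * r ^ k ∧ u (k + 1) = ((u 1 / r - u 0) * ((k + 1 : ℕ) : ℝ) + u 0) * r ^ (k + 1) := by
    induction k with
    | zero => constructor
              · simp
              · simp; field_simp; 
    | succ k ih =>
      refine ⟨ih.2, ?_⟩
      have h1 := h k
      rw [ih.1, ih.2] at h1
      have h2 : u (k + 1 + 1) = u (k + 2) := rfl
      rw [h2]
      push_cast at h1 ⊢
      have e1 : r ^ (k + 1) = r ^ k * r := pow_succ r k
      have e2 : r ^ (k + 1 + 1) = r ^ k * r * r := by rw [pow_succ, pow_succ]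
      rw [e1] at h1; rw [e2]
      linear_combination h1
  exact this.1

theorem seq1 (r : ℝ) (u : ℕ → ℝ) (h : ∀ k, u (k + 1) - r * u k = 0) (k : ℕ) : u k = u 0 * r ^ k := by
  induction k with
  | zero => simp
  | succ k ih => rw [pow_succ]; linear_combination h k + r * ih

theorem solve5 (r1 r2 r3 : ℝ → ℝ) (h1 : Rt r1) (h2 : Rt r2) (h3 : Rt r3)
    (n1 : ∀ w, 1 < w → r1 w ≠ 0) (n2 : ∀ w, 1 < w → r3 w ≠ 0)
    (d12 : ∀ w, 1 < w → r2 w - r1 w ≠ 0) (d13 : ∀ w, 1 < w → r3 w - r1 w ≠ 0) (d23 : ∀ w, 1 < w → r3 w - r2 w ≠ 0)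
    (a : ℕ → ℝ → ℝ) (ha : ∀ k, Rt (a k)) :
    ∃ α β γ δ ε : ℝ → ℝ, (Rt α ∧ Rt β ∧ Rt γ ∧ Rt δ ∧ Rt ε) ∧ ∀ w, 1 < w →
      (∀ k, a (k + 5) w - (2 * r1 w + r2 w + 2 * r3 w) * a (k + 4) w
        + (r1 w ^ 2 + r3 w ^ 2 + 2 * r1 w * r2 w + 4 * r1 w * r3 w + 2 * r2 w * r3 w) * a (k + 3) w
        - (r1 w ^ 2 * r2 w + 2 * r1 w ^ 2 * r3 w + 4 * r1 w * r2 w * r3 w + 2 * r1 w * r3 w ^ 2 + r2 w * r3 w ^ 2) * a (k + 2) w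
        + (2 * r1 w ^ 2 * r2 w * r3 w + 2 * r1 w * r2 w * r3 w ^ 2 + r1 w ^ 2 * r3 w ^ 2) * a (k + 1) w
        - r1 w ^ 2 * r2 w * r3 w ^ 2 * a k w = 0) →
      ∀ k, a k w = (α w * k + β w) * r1 w ^ k + γ w * r2 w ^ k + (δ w * k + ε w) * r3 w ^ k := by
  have c2 : Rt (fun _ => (2 : ℝ)) := by simpa using Rt.nat 2
  -- first peel
  obtain ⟨u, hu⟩ : ∃ u : ℕ → ℝ → ℝ, u = fun k w => a (k + 3) w - (2 * r1 w + r2 w) * a (k + 2) w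
      + (r1 w ^ 2 + 2 * r1 w * r2 w) * a (k + 1) w - r1 w ^ 2 * r2 w * a k w := ⟨_, rfl⟩
  have ru : ∀ k, Rt (u k) := by
    intro k
    rw [hu]
    exact (((ha _).sub (((c2.mul h1).add h2).mul (ha _))).add (((h1.npow 2).add ((c2.mul h1).mul h2)).mul (ha _))).sub
      (((h1.npow 2).mul h2).mul (ha _))
  obtain ⟨P, hP⟩ : ∃ P : ℝ → ℝ, P = fun w => (r3 w - r1 w) ^ 2 * (r3 w - r2 w) := ⟨_, rfl⟩
  obtain ⟨Q, hQ⟩ : ∃ Q : ℝ → ℝ, Q = fun w => 2 * (r3 w - r1 w) * (r3 w - r2 w) + (r3 w - r1 w) ^ 2 := ⟨_, rfl⟩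
  have rP : Rt P := by rw [hP]; exact ((h3.sub h1).npow 2).mul (h3.sub h2)
  have rQ : Rt Q := by rw [hQ]; exact ((c2.mul (h3.sub h1)).mul (h3.sub h2)).add ((h3.sub h1).npow 2)
  have P0 : ∀ w, 1 < w → P w ≠ 0 := by
    intro w hw; rw [hP]; exact mul_ne_zero (pow_ne_zero 2 (d13 w hw)) (d23 w hw)
  obtain ⟨δ, hδ⟩ : ∃ δ : ℝ → ℝ, δ = fun w => (u 1 w / r3 w - u 0 w) / P w := ⟨_, rfl⟩
  have rδ : Rt δ := by rw [hδ]; exact (((ru 1).div h3 n2).sub (ru 0)).div rP P0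
  obtain ⟨ε, hε⟩ : ∃ ε : ℝ → ℝ, ε = fun w => (u 0 w - Q w * r3 w * δ w) / P w := ⟨_, rfl⟩
  have rε : Rt ε := by rw [hε]; exact ((ru 0).sub ((rQ.mul h3).mul rδ)).div rP P0
  obtain ⟨b, hb⟩ : ∃ b : ℕ → ℝ → ℝ, b = fun k w => a k w - (δ w * (k : ℝ) + ε w) * r3 w ^ k := ⟨_, rfl⟩
  have rb : ∀ k, Rt (b k) := by
    intro k; rw [hb]
    exact (ha k).sub (((rδ.mul (Rt.nat k)).add rε).mul (h3.npow k))
  obtain ⟨v, hv⟩ : ∃ v : ℕ → ℝ → ℝ, v = fun k w => b (k + 2) w - 2 * r1 w * b (k + 1) w + r1 w ^ 2 * b k w := ⟨_, rfl⟩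
  have rv : ∀ k, Rt (v k) := by
    intro k; rw [hv]
    exact ((rb _).sub ((c2.mul h1).mul (rb _))).add ((h1.npow 2).mul (rb _))
  obtain ⟨γ, hγ⟩ : ∃ γ : ℝ → ℝ, γ = fun w => v 0 w / (r2 w - r1 w) ^ 2 := ⟨_, rfl⟩
  have rγ : Rt γ := by
    rw [hγ]; exact (rv 0).div ((h2.sub h1).npow 2) fun w hw => pow_ne_zero 2 (d12 w hw)
  obtain ⟨c, hc⟩ : ∃ c : ℕ → ℝ → ℝ, c = fun k w => b k w - γ w * r2 w ^ k := ⟨_, rfl⟩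
  have rc : ∀ k, Rt (c k) := by
    intro k; rw [hc]; exact (rb k).sub (rγ.mul (h2.npow k))
  refine ⟨fun w => c 1 w / r1 w - c 0 w, c 0, γ, δ, ε, ⟨((rc 1).div h1 n1).sub (rc 0), rc 0, rγ, rδ, rε⟩, ?_⟩
  intro w hw hrec k
  have su := seq2 (r3 w) (n2 w hw) (fun k => u k w) (by
    intro k
    simp only [hu]
    linear_combination hrec k)
  have eδ : δ w * P w = u 1 w / r3 w - u 0 w := by rw [hδ]; exact div_mul_cancel₀ _ (P0 w hw)
  have eε : ε w * P w = u 0 w - Q w * r3 w * δ w := by rw [hε]; exact div_mul_cancel₀ _ (P0 w hw)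
  have sv := seq1 (r2 w) (fun k => v k w) (by
    intro k
    have h := su k
    simp only [← eδ] at h
    have e : u 0 w = ε w * P w + Q w * r3 w * δ w := by linear_combination -eε
    rw [e] at h
    simp only [hP, hQ, hu] at h
    simp only [hv, hb]
    push_cast
    have e1 : r3 w ^ (k + 1) = r3 w ^ k * r3 w := pow_succ _ k
    have e2 : r3 w ^ (k + 2) = r3 w ^ k * r3 w ^ 2 := pow_add _ k 2
    have e3 : r3 w ^ (k + 3) = r3 w ^ k * r3 w ^ 3 := pow_add _ k 3
    have e3' : r3 w ^ (k + 1 + 2) = r3 w ^ k * r3 w ^ 3 := e3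
    have e2' : r3 w ^ (k + 1 + 1) = r3 w ^ k * r3 w ^ 2 := e2
    have i1 : k + 1 + 2 = k + 3 := rfl
    have i2 : k + 1 + 1 = k + 2 := rfl
    simp only [e1, e2', e3', i1, i2]
    linear_combination h)
  have eγ : γ w * (r2 w - r1 w) ^ 2 = v 0 w := by rw [hγ]; exact div_mul_cancel₀ _ (pow_ne_zero 2 (d12 w hw))
  have sc := seq2 (r1 w) (n1 w hw) (fun k => c k w) (by
    intro k
    have h := sv k
    simp only [← eγ] at h
    simp only [hv] at h
    simp only [hc]
    have e1 : r2 w ^ (k + 1) = r2 w ^ k * r2 w := pow_succ _ k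
    have e2 : r2 w ^ (k + 2) = r2 w ^ k * r2 w ^ 2 := pow_add _ k 2
    rw [e1, e2]
    linear_combination h)
  have h := sc k
  have h' : c k w = a k w - (δ w * (k : ℝ) + ε w) * r3 w ^ k - γ w * r2 w ^ k := by simp only [hc, hb]
  rw [h'] at h
  linear_combination h
end QC

namespace QC
open PowerSeries

/-- polynomial coefficients -/
def PC (g : ℕ → ℚ⟦X⟧) : Prop := ∀ n, ∃ f : Polynomial ℚ, ∀ q : ℕ, q ≠ 0 → coeff n (g q) = f.eval (q : ℚ)

theorem PC_ev (t : Tm) : PC (fun q => ev q t) := by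
  intro n
  induction t with
  | nil => exact ⟨0, fun q _ => by simp [ev_nil]⟩
  | cons x t ih =>
    obtain ⟨f, hf⟩ := ih
    refine ⟨(if n = x.2.2 then Polynomial.C (x.1 : ℚ) * Polynomial.X ^ x.2.1 else 0) + f, fun q hq => ?_⟩
    beta_reduce
    rw [ev_cons, map_add, hf q hq, coeff_monomial, Polynomial.eval_add]
    congr 1
    split_ifs <;> simp

theorem mon_CX (q : ℕ) (x : ℕ × ℕ) : mon q x = C ((q : ℚ) ^ x.1) * X ^ x.2 := by
  ext n
  rw [mon, coeff_monomial, coeff_C_mul, coeff_X_pow, mul_ite, mul_one, mul_zero]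

theorem coeff5 (G : ℚ⟦X⟧) (c1 c2 c3 c4 c5 : ℚ) (n : ℕ) :
    coeff (n + 120) (G - C c1 * (X ^ 24 * G) + C c2 * (X ^ 48 * G) - C c3 * (X ^ 72 * G) + C c4 * (X ^ 96 * G) - C c5 * (X ^ 120 * G)) =
    coeff (n + 120) G - c1 * coeff (n + 96) G + c2 * coeff (n + 72) G - c3 * coeff (n + 48) G + c4 * coeff (n + 24) G - c5 * coeff n G := by
  simp only [map_add, map_sub, coeff_C_mul]
  have e (a b : ℕ) : coeff (a + b) (X ^ b * G) = coeff a G := coeff_X_pow_mul _ _ _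
  rw [← e (n + 96) 24, ← e (n + 72) 48, ← e (n + 48) 72, ← e (n + 24) 96, ← e n 120]

theorem PC_div (x : ℕ × ℕ) (hx : x.2 ≠ 0) (g : ℕ → ℚ⟦X⟧) (h : PC fun q => (1 - mon q x) * g q) : PC g := by
  intro n
  induction n using Nat.strong_induction_on with
  | _ n ih =>
    obtain ⟨f, hf⟩ := h n
    have e : ∀ q, coeff n (mon q x * g q) = if x.2 ≤ n then (q : ℚ) ^ x.1 * coeff (n - x.2) (g q) else 0 := by
      intro q
      rw [mon_CX, mul_assoc, coeff_C_mul, coeff_X_pow_mul']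
      split_ifs <;> simp
    by_cases hn : x.2 ≤ n
    · obtain ⟨f', hf'⟩ := ih (n - x.2) (by omega)
      refine ⟨f + Polynomial.X ^ x.1 * f', fun q hq => ?_⟩
      have h1 := hf q hq
      beta_reduce at h1
      rw [sub_mul, one_mul, map_sub, e, if_pos hn, hf' q hq] at h1
      simp only [Polynomial.eval_add, Polynomial.eval_mul, Polynomial.eval_pow, Polynomial.eval_X]
      linear_combination h1
    · refine ⟨f, fun q hq => ?_⟩
      have h1 := hf q hq
      beta_reduce at h1
      rw [sub_mul, one_mul, map_sub, e, if_neg hn] at h1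
      linear_combination h1

theorem PC_congr {g g' : ℕ → ℚ⟦X⟧} (h : PC g) (e : ∀ q, q ≠ 0 → g' q = g q) : PC g' := fun n => by
  obtain ⟨f, hf⟩ := h n
  exact ⟨f, fun q hq => by rw [e q hq, hf q hq]⟩

theorem PC_Gs : PC Gs := by
  refine PC_div (12, 12) (by decide) _ (PC_div (9, 12) (by decide) _ (PC_div (6, 8) (by decide) _
    (PC_div (5, 6) (by decide) _ (PC_div (2, 2) (by decide) _ ?_))))
  refine PC_congr (PC_ev QT) fun q hq => ?_
  rw [← Gs_main q hq]; ring

/-- degree bound -/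
def pd (d : ℕ) (g : ℚ⟦X⟧) : Prop := ∀ n, d < n → coeff n g = 0

theorem pd_mul {a b : ℕ} {f g : ℚ⟦X⟧} (hf : pd a f) (hg : pd b g) : pd (a + b) (f * g) := by
  intro n hn
  rw [coeff_mul]
  refine Finset.sum_eq_zero fun p hp => ?_
  have : p.1 + p.2 = n := Finset.HasAntidiagonal.mem_antidiagonal.1 hp
  by_cases h : a < p.1
  · rw [hf _ h, zero_mul]
  · rw [hg _ (by omega), mul_zero]

theorem pd_ev (q d : ℕ) (t : Tm) (h : ∀ x ∈ t, x.2.2 ≤ d) : pd d (ev q t) := by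
  intro n hn
  induction t with
  | nil => simp [ev_nil]
  | cons x t ih =>
    have := h x (by simp)
    rw [ev_cons, map_add, ih fun y hy => h y (by simp [hy]), coeff_monomial, if_neg (by omega), add_zero]

theorem mon_pow (q : ℕ) (x : ℕ × ℕ) (n : ℕ) : mon q x ^ n = mon q (n * x.1, n * x.2) := by
  induction n with
  | zero => simp [mon]
  | succ n ih =>
    rw [pow_succ, ih]
    simp only [mon, PowerSeries.monomial_mul_monomial]
    rw [← pow_add, add_mul, add_mul, one_mul, one_mul]

/-- cofactor -/
noncomputable def cf (q : ℕ) (x : ℕ × ℕ) (n : ℕ) : ℚ⟦X⟧ := ∑ i ∈ Finset.range n, mon q x ^ i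

theorem cf_mul (q x n) : (1 - mon q x) * cf q x n = 1 - mon q (n * x.1, n * x.2) := by
  rw [cf, mul_neg_geom_sum, mon_pow]

theorem pd_cf (q x n) : pd (n * x.2) (cf q x (n + 1)) := by
  intro m hm
  rw [cf, map_sum]
  refine Finset.sum_eq_zero fun i hi => ?_
  rw [mon_pow, mon, coeff_monomial, if_neg]
  have : i ≤ n := by have := Finset.mem_range.1 hi; omega
  have := Nat.mul_le_mul_right x.2 this
  simp only
  omega

theorem Gs_D (q : ℕ) (hq : q ≠ 0) : pd 108 ((1 - mon q (24, 24)) ^ 2 * (1 - mon q (20, 24)) * (1 - mon q (18, 24)) ^ 2 * Gs q) := by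
  have e1 := cf_mul q (2, 2) 12
  have e2 := cf_mul q (12, 12) 2
  have e3 := cf_mul q (5, 6) 4
  have e4 := cf_mul q (6, 8) 3
  have e5 := cf_mul q (9, 12) 2
  norm_num at e1 e2 e3 e4 e5
  have e : (1 - mon q (24, 24)) ^ 2 * (1 - mon q (20, 24)) * (1 - mon q (18, 24)) ^ 2 * Gs q =
      ev q QT * (cf q (2, 2) 12 * cf q (12, 12) 2 * cf q (5, 6) 4 * cf q (6, 8) 3 * cf q (9, 12) 2) := by
    rw [← Gs_main q hq]
    calc _ = (1 - mon q (24, 24)) * (1 - mon q (24, 24)) * (1 - mon q (20, 24)) * (1 - mon q (18, 24)) * (1 - mon q (18, 24)) * Gs q := by ring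
      _ = ((1 - mon q (2, 2)) * cf q (2, 2) 12) * ((1 - mon q (12, 12)) * cf q (12, 12) 2) * ((1 - mon q (5, 6)) * cf q (5, 6) 4) *
          ((1 - mon q (6, 8)) * cf q (6, 8) 3) * ((1 - mon q (9, 12)) * cf q (9, 12) 2) * Gs q := by rw [e1, e2, e3, e4, e5]
      _ = _ := by ring
  rw [e]
  exact pd_mul (pd_ev q 28 QT (by decide +kernel)) (pd_mul (pd_mul (pd_mul (pd_mul (pd_cf q (2, 2) 11) (pd_cf q (12, 12) 1)) (pd_cf q (5, 6) 3)) (pd_cf q (6, 8) 2)) (pd_cf q (9, 12) 1))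

theorem Gs_rec (q : ℕ) (hq : q ≠ 0) (r1 r2 r3 : ℚ) (h1 : r1 = (q : ℚ) ^ 24) (h2 : r2 = (q : ℚ) ^ 20) (h3 : r3 = (q : ℚ) ^ 18) (n : ℕ) :
    coeff (n + 120) (Gs q) - (2 * r1 + r2 + 2 * r3) * coeff (n + 96) (Gs q)
        + (r1 ^ 2 + r3 ^ 2 + 2 * r1 * r2 + 4 * r1 * r3 + 2 * r2 * r3) * coeff (n + 72) (Gs q)
        - (r1 ^ 2 * r2 + 2 * r1 ^ 2 * r3 + 4 * r1 * r2 * r3 + 2 * r1 * r3 ^ 2 + r2 * r3 ^ 2) * coeff (n + 48) (Gs q)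
        + (2 * r1 ^ 2 * r2 * r3 + 2 * r1 * r2 * r3 ^ 2 + r1 ^ 2 * r3 ^ 2) * coeff (n + 24) (Gs q)
        - r1 ^ 2 * r2 * r3 ^ 2 * coeff n (Gs q) = 0 := by
  have h := Gs_D q hq (n + 120) (by omega)
  have m1 : mon q (24, 24) = C r1 * X ^ 24 := by rw [mon_CX, h1]
  have m2 : mon q (20, 24) = C r2 * X ^ 24 := by rw [mon_CX, h2]
  have m3 : mon q (18, 24) = C r3 * X ^ 24 := by rw [mon_CX, h3]
  have e : (1 - mon q (24, 24)) ^ 2 * (1 - mon q (20, 24)) * (1 - mon q (18, 24)) ^ 2 * Gs q =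
      Gs q - C (2 * r1 + r2 + 2 * r3) * (X ^ 24 * Gs q)
        + C (r1 ^ 2 + r3 ^ 2 + 2 * r1 * r2 + 4 * r1 * r3 + 2 * r2 * r3) * (X ^ 48 * Gs q)
        - C (r1 ^ 2 * r2 + 2 * r1 ^ 2 * r3 + 4 * r1 * r2 * r3 + 2 * r1 * r3 ^ 2 + r2 * r3 ^ 2) * (X ^ 72 * Gs q)
        + C (2 * r1 ^ 2 * r2 * r3 + 2 * r1 * r2 * r3 ^ 2 + r1 ^ 2 * r3 ^ 2) * (X ^ 96 * Gs q)
        - C (r1 ^ 2 * r2 * r3 ^ 2) * (X ^ 120 * Gs q) := by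
    rw [m1, m2, m3]
    simp only [map_add, map_mul, map_pow, map_ofNat]
    ring
  rw [e, coeff5] at h
  exact h

end QC

namespace QC
open Polynomial

theorem count_Gs {F : Type} [Field F] [Fintype F] (q : ℕ) (hq : Fintype.card F = q) (hc : Nat.Coprime q 6) (b : ℕ) (N : ℚ)
    (hN : IsWeightedG4OrbitCount {v : Matrix (Fin 3) (Fin 3) (Polynomial F) ×
                Matrix (Fin 3) (Fin 3) (Polynomial F) |
              v.1.IsSymm ∧ v.2.IsSymm ∧ disc4 v.1 v.2 ≠ 0 ∧
                (disc4 v.1 v.2).natDegree = b} N) : N * CC q = PowerSeries.coeff b (Gs q) := by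
  have hq2 : 2 ≤ q := by rw [← hq]; exact Fintype.one_lt_card
  obtain ⟨s, rfl⟩ : ∃ s, q = s + 2 := ⟨q - 2, by omega⟩
  have hz : ((s + 2 : ℕ) : F) = 0 := by rw [← hq]; exact Nat.cast_card_eq_zero F
  have h6 : (6 : F) ≠ 0 := by
    intro h
    have h1 : ringChar F ∣ s + 2 := ringChar.dvd hz
    have h2 : ringChar F ∣ 6 := ringChar.dvd (by exact_mod_cast h)
    have h3 := Nat.dvd_gcd h1 h2
    rw [hc.gcd_eq_one] at h3
    have h4 := ringChar.spec F 1
    have := h4.2 h3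
    simp at this
  have h2 : (2 : F) ≠ 0 := by
    intro h; apply h6; linear_combination 3 * h
  have h3 : (3 : F) ≠ 0 := by
    intro h; apply h6; linear_combination 2 * h
  rw [count_sum hq h2 h3 b N hN, Gs, map_sum]
  refine Finset.sum_congr rfl fun c _ => ?_
  rw [map_sum]
  refine Finset.sum_congr rfl fun p _ => ?_
  rw [Hs_coeff]

theorem pow_ne_of_gt {w : ℝ} (hw : 1 < w) {a b : ℕ} (h : a < b) : w ^ a - w ^ b ≠ 0 := by
  have := pow_lt_pow_right₀ hw h
  intro h; linarith

theorem main_fun (j : ℕ) : ∃ A B C D E : ℝ → ℝ, (Rt A ∧ Rt B ∧ Rt C ∧ Rt D ∧ Rt E) ∧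
    ∀ (q : ℕ), q ≠ 0 → ∀ w : ℝ, 1 < w → w ^ 12 = q → ∀ k : ℕ, ∀ N : ℚ, N * CC q = PowerSeries.coeff (j + 24 * k) (Gs q) →
      (N : ℝ) = (A w * ((j + 24 * k : ℕ) : ℝ) + B w) * (w ^ 12) ^ (j + 24 * k) + C w * (w ^ 10) ^ (j + 24 * k) +
        (D w * ((j + 24 * k : ℕ) : ℝ) + E w) * (w ^ 9) ^ (j + 24 * k) := by
  choose f hf using PC_Gs
  have c24 : Rt (fun _ => (24 : ℝ)) := by simpa using Rt.nat 24
  have cj : Rt (fun _ => (j : ℝ)) := Rt.nat j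
  obtain ⟨α, β, γ, δ, ε, ⟨rα, rβ, rγ, rδ, rε⟩, h⟩ := solve5 (fun w => w ^ 288) (fun w => w ^ 240) (fun w => w ^ 216)
    (Rt.pw _) (Rt.pw _) (Rt.pw _) (fun w hw => by positivity) (fun w hw => by positivity)
    (fun w hw => pow_ne_of_gt hw (by norm_num)) (fun w hw => pow_ne_of_gt hw (by norm_num)) (fun w hw => pow_ne_of_gt hw (by norm_num))
    (fun k w => aeval (w ^ 12) (f (j + 24 * k)))
    (fun k => Rt.of_poly ((f (j + 24 * k)).comp (X ^ 12)) (fun w _ => by rw [aeval_comp]; simp))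
  obtain ⟨c, hc⟩ : ∃ c : ℝ → ℝ, c = fun w => (1 + w ^ 12) ^ 2 * (1 + w ^ 12 + w ^ 24) := ⟨_, rfl⟩
  have c1 : Rt (fun _ => (1 : ℝ)) := by simpa using Rt.nat 1
  have rc : Rt c := by
    rw [hc]; exact ((c1.add (Rt.pw 12)).npow 2).mul ((c1.add (Rt.pw 12)).add (Rt.pw 24))
  have c0 : ∀ w, 1 < w → c w ≠ 0 := by
    intro w hw; rw [hc]; positivity
  have rd : ∀ n, Rt (fun w => w ^ n * c w) := fun n => (Rt.pw n).mul rc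
  have d0 : ∀ n : ℕ, ∀ w, 1 < w → w ^ n * c w ≠ 0 := fun n w hw => mul_ne_zero (by positivity) (c0 w hw)
  have n24 : ∀ w : ℝ, 1 < w → (24 : ℝ) ≠ 0 := fun _ _ => by norm_num
  refine ⟨fun w => α w / 24 / (w ^ (12 * j) * c w), fun w => (β w - α w * j / 24) / (w ^ (12 * j) * c w), fun w => γ w / (w ^ (10 * j) * c w),
    fun w => δ w / 24 / (w ^ (9 * j) * c w), fun w => (ε w - δ w * j / 24) / (w ^ (9 * j) * c w),
    ⟨(rα.div c24 n24).div (rd _) (d0 _), (rβ.sub ((rα.mul cj).div c24 n24)).div (rd _) (d0 _), rγ.div (rd _) (d0 _),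
      (rδ.div c24 n24).div (rd _) (d0 _), (rε.sub ((rδ.mul cj).div c24 n24)).div (rd _) (d0 _)⟩, ?_⟩
  intro q hq w hw hwq k N hN
  have ea : ∀ n, aeval (w ^ 12) (f n) = ((PowerSeries.coeff n (Gs q) : ℚ) : ℝ) := by
    intro n
    rw [hf n q hq, hwq]
    have : ((q : ℕ) : ℝ) = algebraMap ℚ ℝ (q : ℚ) := by simp
    rw [this, aeval_algebraMap_apply]
    simp
  have key := h w hw (by
    intro k
    simp only [ea]
    have hr := Gs_rec q hq _ _ _ rfl rfl rfl (j + 24 * k)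
    have hr' := congrArg (fun x : ℚ => (x : ℝ)) hr
    push_cast at hr'
    rw [← hwq] at hr'
    simp only [← pow_mul] at hr'
    norm_num at hr'
    convert hr' using 2 <;> ring_nf) k
  simp only [ea] at key
  rw [← hN] at key
  push_cast at key
  have hcc : ((CC q : ℕ) : ℝ) = c w := by
    rw [hc]; simp only [CC]; push_cast; rw [← hwq]; ring
  rw [hcc] at key
  have w0 : w ≠ 0 := by positivity
  have hcw := c0 w hw
  have p1 : (w ^ 12) ^ (j + 24 * k) = w ^ (12 * j) * (w ^ 288) ^ k := by
    rw [← pow_mul, ← pow_mul, ← pow_add]; congr 1; ring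
  have p2 : (w ^ 10) ^ (j + 24 * k) = w ^ (10 * j) * (w ^ 240) ^ k := by
    rw [← pow_mul, ← pow_mul, ← pow_add]; congr 1; ring
  have p3 : (w ^ 9) ^ (j + 24 * k) = w ^ (9 * j) * (w ^ 216) ^ k := by
    rw [← pow_mul, ← pow_mul, ← pow_add]; congr 1; ring
  rw [p1, p2, p3]
  have g (n : ℕ) (x y : ℝ) : x / (w ^ n * c w) * (w ^ n * y) = x * y / c w := by
    have : w ^ n ≠ 0 := pow_ne_zero _ w0
    field_simp
  push_cast
  rw [g, show α w / 24 / (w ^ (12 * j) * c w) * ((j : ℝ) + 24 * k) + (β w - α w * j / 24) / (w ^ (12 * j) * c w) =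
      (α w * k + β w) / (w ^ (12 * j) * c w) by ring, show δ w / 24 / (w ^ (9 * j) * c w) * ((j : ℝ) + 24 * k) + (ε w - δ w * j / 24) / (w ^ (9 * j) * c w) =
      (δ w * k + ε w) / (w ^ (9 * j) * c w) by ring, g, g, ← add_div, ← add_div, eq_div_iff hcw]
  linear_combination key

end QC

/-- **Shape of the count of quartic `F_q[T]`-algebras with cubic resolvent.**  There are
rational functions `A, B, C, D, E : ℤ/24ℤ → ℚ(w)` such that for every finite field of
cardinality `q` coprime to `6` and every `b : ℕ`, the denominators of `A, …, E` at
`b mod 24` do not vanish at `q^{1/12}` and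
`N_{4,q,b} = (A(b)(q^{1/12})·b + B(b)(q^{1/12}))·q^b + C(b)(q^{1/12})·q^{5b/6}
  + (D(b)(q^{1/12})·b + E(b)(q^{1/12}))·q^{3b/4}` (all evaluations at `b mod 24`). -/
theorem quartic_count_secondary_terms :
    ∃ A B C D E : ZMod 24 → RatFunc ℚ,
      ∀ (𝔽 : Type) [Field 𝔽] [Fintype 𝔽] (q : ℕ), Fintype.card 𝔽 = q → Nat.Coprime q 6 →
        ∀ (b : ℕ) (N : ℚ),
          IsWeightedG4OrbitCount
            {v : Matrix (Fin 3) (Fin 3) (Polynomial 𝔽) ×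
                Matrix (Fin 3) (Fin 3) (Polynomial 𝔽) |
              v.1.IsSymm ∧ v.2.IsSymm ∧ disc4 v.1 v.2 ≠ 0 ∧
                (disc4 v.1 v.2).natDegree = b} N →
          ((RatFunc.denom (A (b : ZMod 24))).eval₂ (algebraMap ℚ ℝ)
              ((q : ℝ) ^ ((1 : ℝ) / 12)) ≠ 0 ∧
            (RatFunc.denom (B (b : ZMod 24))).eval₂ (algebraMap ℚ ℝ)
              ((q : ℝ) ^ ((1 : ℝ) / 12)) ≠ 0 ∧
            (RatFunc.denom (C (b : ZMod 24))).eval₂ (algebraMap ℚ ℝ)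
              ((q : ℝ) ^ ((1 : ℝ) / 12)) ≠ 0 ∧
            (RatFunc.denom (D (b : ZMod 24))).eval₂ (algebraMap ℚ ℝ)
              ((q : ℝ) ^ ((1 : ℝ) / 12)) ≠ 0 ∧
            (RatFunc.denom (E (b : ZMod 24))).eval₂ (algebraMap ℚ ℝ)
              ((q : ℝ) ^ ((1 : ℝ) / 12)) ≠ 0) ∧
          (N : ℝ) =
            (RatFunc.eval (algebraMap ℚ ℝ) ((q : ℝ) ^ ((1 : ℝ) / 12)) (A (b : ZMod 24)) *
                (b : ℝ) +
              RatFunc.eval (algebraMap ℚ ℝ) ((q : ℝ) ^ ((1 : ℝ) / 12)) (B (b : ZMod 24))) *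
                (q : ℝ) ^ (b : ℕ) +
            RatFunc.eval (algebraMap ℚ ℝ) ((q : ℝ) ^ ((1 : ℝ) / 12)) (C (b : ZMod 24)) *
                (q : ℝ) ^ ((5 * (b : ℝ)) / 6) +
            (RatFunc.eval (algebraMap ℚ ℝ) ((q : ℝ) ^ ((1 : ℝ) / 12)) (D (b : ZMod 24)) *
                (b : ℝ) +
              RatFunc.eval (algebraMap ℚ ℝ) ((q : ℝ) ^ ((1 : ℝ) / 12)) (E (b : ZMod 24))) *
                (q : ℝ) ^ ((3 * (b : ℝ)) / 4) := by
  choose A B C D E hR hS using QC.main_fun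
  choose A' hA using fun j => (hR j).1.toRat
  choose B' hB using fun j => (hR j).2.1.toRat
  choose C' hC using fun j => (hR j).2.2.1.toRat
  choose D' hD using fun j => (hR j).2.2.2.1.toRat
  choose E' hE using fun j => (hR j).2.2.2.2.toRat
  refine ⟨fun j => A' j.val, fun j => B' j.val, fun j => C' j.val, fun j => D' j.val, fun j => E' j.val, ?_⟩
  intro F _ _ q hq hc b N hN
  have hq2 : 2 ≤ q := by rw [← hq]; exact Fintype.one_lt_card
  have hq0 : (0 : ℝ) ≤ (q : ℝ) := Nat.cast_nonneg q
  have hq1 : (1 : ℝ) < (q : ℝ) := by exact_mod_cast hq2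
  obtain ⟨w, hw⟩ : ∃ w : ℝ, w = (q : ℝ) ^ ((1 : ℝ) / 12) := ⟨_, rfl⟩
  have w1 : 1 < w := by rw [hw]; exact Real.one_lt_rpow hq1 (by norm_num)
  have wp (n : ℕ) : w ^ n = (q : ℝ) ^ ((n : ℝ) / 12) := by
    rw [hw, ← Real.rpow_natCast, ← Real.rpow_mul hq0]; congr 1; ring
  have w12 : w ^ 12 = q := by rw [wp]; norm_num
  have hv : ((b : ZMod 24)).val = b % 24 := ZMod.val_natCast 24 b
  rw [← hw]
  simp only [hv]
  refine ⟨⟨(hA _ w w1).1, (hB _ w w1).1, (hC _ w w1).1, (hD _ w w1).1, (hE _ w w1).1⟩, ?_⟩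
  rw [(hA _ w w1).2, (hB _ w w1).2, (hC _ w w1).2, (hD _ w w1).2, (hE _ w w1).2]
  have hG := QC.count_Gs q hq hc b N hN
  have hb : b % 24 + 24 * (b / 24) = b := Nat.mod_add_div b 24
  have h := hS (b % 24) q (by omega) w w1 w12 (b / 24) N (by rw [hb]; exact hG)
  rw [hb, w12] at h
  have e1 : (q : ℝ) ^ ((5 * (b : ℝ)) / 6) = (w ^ 10) ^ b := by
    rw [← pow_mul, wp]; congr 1; push_cast; ring
  have e2 : (q : ℝ) ^ ((3 * (b : ℝ)) / 4) = (w ^ 9) ^ b := by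
    rw [← pow_mul, wp]; congr 1; push_cast; ring
  rw [e1, e2]
  exact h
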